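/- Let A^{αβ}, for |α| = |β| = m, be simple coefficients (depending only on t), measurable, bounded by K, satisfying the Legendre–Hadamard condition with constant λ > 0, and let γ ∈ (0,1), R > 0. Let X₀ = (t₀,x₀) with (x₀)_d = 0, and let u ∈ C^∞(ℝ^{d+1}; ℝⁿ) satisfy ∂_t u + (−1)^m Σ_{|α|=|β|=m} A^{αβ}(t) D^{α+β} u = 0 for almost every (t,x) ∈ Q_{2R}⁺(X₀), with u = D_d u = ⋯ = D_d^{m−1} u = 0 on {x_d = 0} ∩ Q_{2R}(X₀). Then there exists a constant C depending only on d, n, m, λ, K, γ such that for all 0 < r ≤ R: ∫_{Q_r⁺(X₀)} |D^{2m−1} u − (D^{2m−1} u)_{Q_r⁺(X₀)}|² dx dt ≤ C (r/R)^{2γ+d+2m} ∫_{Q_R⁺(X₀)} |D^{2m−1} u − (D^{2m−1} u)_{Q_R⁺(X₀)}|² dx dt. -/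

import Mathlib

open MeasureTheory Metric Set Topology

noncomputable section

/-- The parabolic cylinder `Q_r(t₀,x₀) = (t₀ - r^{2m}, t₀) × B_r(x₀)`. -/
def QCyl (d m : ℕ) (r : ℝ) (X : ℝ × EuclideanSpace ℝ (Fin d)) :
    Set (ℝ × EuclideanSpace ℝ (Fin d)) :=
  Set.Ioo (X.1 - r ^ (2 * m)) X.1 ×ˢ Metric.ball X.2 r

/-- The upper-half parabolic cylinder, `i` being the index of the normal direction. -/
def QCylP (d m : ℕ) (i : Fin d) (r : ℝ) (X : ℝ × EuclideanSpace ℝ (Fin d)) :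
    Set (ℝ × EuclideanSpace ℝ (Fin d)) :=
  {p ∈ QCyl d m r X | 0 < p.2 i}

/-- Multi-indices of order exactly `k`. -/
def MIdx (d k : ℕ) : Finset (Fin d → ℕ) :=
  (Fintype.piFinset fun _ : Fin d => Finset.range (k + 1)).filter fun γ => ∑ i, γ i = k

/-- Multi-indices of order at most `k`. -/
def MIdxLe (d k : ℕ) : Finset (Fin d → ℕ) :=
  (Fintype.piFinset fun _ : Fin d => Finset.range (k + 1)).filter fun γ => ∑ i, γ i ≤ k

/-- Multi-indices of order strictly less than `k`. -/
def MIdxLt (d k : ℕ) : Finset (Fin d → ℕ) :=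
  (Fintype.piFinset fun _ : Fin d => Finset.range (k + 1)).filter fun γ => ∑ i, γ i < k

variable {d n : ℕ} {F : Type*} [NormedAddCommGroup F] [NormedSpace ℝ F]

/-- Spatial partial derivative in the `i`-th coordinate direction. -/
def pder (i : Fin d) (u : ℝ × EuclideanSpace ℝ (Fin d) → F) :
    ℝ × EuclideanSpace ℝ (Fin d) → F :=
  fun p => fderiv ℝ (fun y => u (p.1, y)) p.2 (EuclideanSpace.single i 1)

/-- Multi-index spatial derivative `D^γ`. -/
def Dmul (γ : Fin d → ℕ) (u : ℝ × EuclideanSpace ℝ (Fin d) → F) :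
    ℝ × EuclideanSpace ℝ (Fin d) → F :=
  (List.finRange d).foldr (fun i v => (pder i)^[γ i] v) u

/-- Time derivative `∂_t`. -/
def tder (u : ℝ × EuclideanSpace ℝ (Fin d) → F) : ℝ × EuclideanSpace ℝ (Fin d) → F :=
  fun p => deriv (fun s => u (s, p.2)) p.1

/-- The set of difference quotients entering the spatial Hölder seminorm `[f]*_{a,D}`. -/
def sHolderSet (a : ℝ) (D : Set (ℝ × EuclideanSpace ℝ (Fin d)))
    (f : ℝ × EuclideanSpace ℝ (Fin d) → F) : Set ℝ :=
  {c | ∃ p ∈ D, ∃ q ∈ D, p.1 = q.1 ∧ p.2 ≠ q.2 ∧ c = ‖f p - f q‖ / dist p.2 q.2 ^ a}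

/-- The spatial Hölder seminorm `[f]*_{a,D}`. -/
def sHolder (a : ℝ) (D : Set (ℝ × EuclideanSpace ℝ (Fin d)))
    (f : ℝ × EuclideanSpace ℝ (Fin d) → F) : ℝ :=
  sSup (sHolderSet a D f)

/-- The set of difference quotients entering the parabolic Hölder seminorm `[f]_{σ,a,D}`. -/
def pHolderSet (σ a : ℝ) (D : Set (ℝ × EuclideanSpace ℝ (Fin d)))
    (f : ℝ × EuclideanSpace ℝ (Fin d) → F) : Set ℝ :=
  {c | ∃ p ∈ D, ∃ q ∈ D, p ≠ q ∧ c = ‖f p - f q‖ / (|p.1 - q.1| ^ σ + dist p.2 q.2 ^ a)}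

/-- The parabolic Hölder seminorm `[f]_{σ,a,D}`. -/
def pHolder (σ a : ℝ) (D : Set (ℝ × EuclideanSpace ℝ (Fin d)))
    (f : ℝ × EuclideanSpace ℝ (Fin d) → F) : ℝ :=
  sSup (pHolderSet σ a D f)

/-- The set of difference quotients entering the time Hölder seminorm `⟨f⟩_{σ,D}`. -/
def tHolderSet (σ : ℝ) (D : Set (ℝ × EuclideanSpace ℝ (Fin d)))
    (f : ℝ × EuclideanSpace ℝ (Fin d) → F) : Set ℝ :=
  {c | ∃ p ∈ D, ∃ q ∈ D, p.2 = q.2 ∧ p.1 ≠ q.1 ∧ c = ‖f p - f q‖ / |p.1 - q.1| ^ σ}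

/-- The time Hölder seminorm `⟨f⟩_{σ,D}`. -/
def tHolder (σ : ℝ) (D : Set (ℝ × EuclideanSpace ℝ (Fin d)))
    (f : ℝ × EuclideanSpace ℝ (Fin d) → F) : ℝ :=
  sSup (tHolderSet σ D f)

/-- The `L^∞` norm over a set. -/
def LpInf (D : Set (ℝ × EuclideanSpace ℝ (Fin d)))
    (f : ℝ × EuclideanSpace ℝ (Fin d) → F) : ℝ :=
  (eLpNorm f ⊤ (volume.restrict D)).toReal

/-- The `L²` norm over a set. -/
def L2Norm (D : Set (ℝ × EuclideanSpace ℝ (Fin d)))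
    (f : ℝ × EuclideanSpace ℝ (Fin d) → F) : ℝ :=
  (eLpNorm f 2 (volume.restrict D)).toReal

/-- The Legendre–Hadamard ellipticity condition with constant `lam`. -/
def LegHad (d n m : ℕ) (lam : ℝ)
    (B : (Fin d → ℕ) → (Fin d → ℕ) → Fin n → Fin n → ℝ) : Prop :=
  ∀ (ξ : Fin n → ℝ) (η : Fin d → ℝ),
    lam * (∑ i, ξ i ^ 2) * (∑ k, η k ^ 2) ^ m ≤
      ∑ α ∈ MIdx d m, ∑ β ∈ MIdx d m, ∑ i, ∑ j,
        B α β i j * ξ i * ξ j * ((∏ k, η k ^ α k) * ∏ k, η k ^ β k)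

end

noncomputable section

open scoped ContDiff Real
open Filter
open Filter.Eventually (of_forall)
open Finset (sum_congr mul_sum sum_nonneg sum_le_sum sum_add_distrib single_le_sum sum_eq_zero
  sum_le_card_nsmul abs_sum_le_sum_abs sum_mul sum_neg_distrib sum_comm sum_sub_distrib
  sum_insert)
open Real (sqrt sq_sqrt sqrt_nonneg exp cos sin norm_eq_abs rpow_natCast rpow_nonneg rpow_mul
  exp_pos sqrt_zero rpow_lt_rpow_of_exponent_lt rpow_le_rpow mul_self_sqrt sqrt_sq_eq_abs
  exp_zero)
open PiLp (norm_apply_le)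
open List (finRange foldr_cons)
open intervalIntegral (integral_of_le integral_mono_on integral_mul_deriv_eq_deriv_mul
  integral_eq_sub_of_hasDerivAt integral_mono_interval integral_mono_on_of_le_Ioo)
open WithLp (toLp)
open Nat (cast_nonneg)
open ENNReal (ofReal ofReal_mul ofReal_le_ofReal ofReal_add)
open EuclideanSpace (single proj)
open Function (update iterate_succ_apply' comp_apply)

/-- Partial derivative of a function on Euclidean space. -/
def pd {d : ℕ} {F : Type*} [NormedAddCommGroup F] [NormedSpace ℝ F] (i : Fin d)
    (f : EuclideanSpace ℝ (Fin d) → F) : EuclideanSpace ℝ (Fin d) → F :=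
  fun x => fderiv ℝ f x (single i 1)

/-- Multi-index derivative of a function on Euclidean space. -/
def DD {d : ℕ} {F : Type*} [NormedAddCommGroup F] [NormedSpace ℝ F] (γ : Fin d → ℕ)
    (f : EuclideanSpace ℝ (Fin d) → F) : EuclideanSpace ℝ (Fin d) → F :=
  (finRange d).foldr (fun i v => (pd i)^[γ i] v) f

theorem two_le_infty : (2 : WithTop ℕ∞) ≤ ∞ := by
  have : ((2 : ℕ∞) : WithTop ℕ∞) ≤ ∞ := WithTop.coe_le_coe.2 le_top
  exact this

/-- Induction on multi-indices, one differentiation at a time. -/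
theorem multiIndex_induction {d : ℕ} {P : (Fin d → ℕ) → Prop} (h0 : P 0)
    (hs : ∀ γ j, P γ → P (γ + Pi.single j 1)) (γ : Fin d → ℕ) : P γ := by
  induction h : ∑ i, γ i generalizing γ with
  | zero =>
    have : γ = 0 := by
      funext i
      exact (Finset.sum_eq_zero_iff.1 h) i (Finset.mem_univ i)
    rw [this]; exact h0
  | succ k ih =>
    obtain ⟨j, -, hj⟩ : ∃ j ∈ Finset.univ, γ j ≠ 0 := by
      by_contra! hc
      rw [sum_eq_zero hc] at h
      omega
    have e : γ = update γ j (γ j - 1) + Pi.single j 1 := by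
      funext i
      by_cases hij : i = j
      · subst hij; simp; omega
      · simp [hij]
    rw [e]
    refine hs _ _ (ih _ ?_)
    have h2 : ∑ i, γ i = ∑ i, (update γ j (γ j - 1) + Pi.single j 1 : Fin d → ℕ) i := by
      rw [← e]
    simp only [Pi.add_apply, sum_add_distrib] at h2
    simp only [Finset.sum_pi_single', Finset.mem_univ, if_true] at h2
    omega

section derivatives
variable {d : ℕ} {F : Type*} [NormedAddCommGroup F] [NormedSpace ℝ F]
local notation "E" => EuclideanSpace ℝ (Fin d)
variable {f g : EuclideanSpace ℝ (Fin d) → F}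

theorem contDiff_pd (hf : ContDiff ℝ ∞ f) (i : Fin d) : ContDiff ℝ ∞ (pd i f) := by
  unfold pd
  exact (hf.fderiv_right (m := ∞) (by simp)).clm_apply contDiff_const

theorem contDiff_pd_iter (hf : ContDiff ℝ ∞ f) (i : Fin d) (k : ℕ) :
    ContDiff ℝ ∞ ((pd i)^[k] f) := by
  induction k with
  | zero => exact hf
  | succ k ih => rw [iterate_succ_apply']; exact contDiff_pd ih i

theorem pd_comm (hf : ContDiff ℝ ∞ f) (i j : Fin d) : pd i (pd j f) = pd j (pd i f) := by
  have key : ∀ (x v w : E),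
      fderiv ℝ (fun y => fderiv ℝ f y w) x v = fderiv ℝ (fderiv ℝ f) x v w := by
    intro x v w
    have h : DifferentiableAt ℝ (fderiv ℝ f) x :=
      (hf.fderiv_right (m := ∞) (by simp)).differentiable (by simp) x
    rw [fderiv_clm_apply h (differentiableAt_const _)]
    simp
  funext x
  unfold pd
  rw [key, key]
  exact (hf.contDiffAt.isSymmSndFDerivAt (by simpa using two_le_infty)) _ _

theorem pd_iter_comm (hf : ContDiff ℝ ∞ f) (i j : Fin d) (k : ℕ) :
    pd i ((pd j)^[k] f) = (pd j)^[k] (pd i f) := by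
  induction k with
  | zero => rfl
  | succ k ih =>
    rw [iterate_succ_apply', iterate_succ_apply',
      pd_comm (contDiff_pd_iter hf j k), ih]

theorem contDiff_foldr_pd (hf : ContDiff ℝ ∞ f) (γ : Fin d → ℕ) (l : List (Fin d)) :
    ContDiff ℝ ∞ (l.foldr (fun i v => (pd i)^[γ i] v) f) := by
  induction l with
  | nil => exact hf
  | cons a l ih => exact contDiff_pd_iter ih a _

theorem contDiff_DD (hf : ContDiff ℝ ∞ f) (γ : Fin d → ℕ) : ContDiff ℝ ∞ (DD γ f) :=
  contDiff_foldr_pd hf γ _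

theorem pd_foldr (hf : ContDiff ℝ ∞ f) (γ : Fin d → ℕ) (j : Fin d) (l : List (Fin d)) :
    pd j (l.foldr (fun i v => (pd i)^[γ i] v) f) =
      l.foldr (fun i v => (pd i)^[γ i] v) (pd j f) := by
  induction l with
  | nil => rfl
  | cons a l ih =>
    simp only [foldr_cons]
    rw [pd_iter_comm (contDiff_foldr_pd hf γ l), ih]

theorem pd_DD (hf : ContDiff ℝ ∞ f) (γ : Fin d → ℕ) (j : Fin d) :
    pd j (DD γ f) = DD γ (pd j f) :=
  pd_foldr hf γ j _

theorem foldr_pd_congr (γ δ : Fin d → ℕ) (l : List (Fin d)) (h : ∀ i ∈ l, γ i = δ i) :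
    l.foldr (fun i v => (pd i)^[γ i] v) f = l.foldr (fun i v => (pd i)^[δ i] v) f := by
  induction l with
  | nil => rfl
  | cons a l ih =>
    simp only [foldr_cons]
    rw [ih fun i hi => h i (List.mem_cons_of_mem _ hi), h a List.mem_cons_self]

theorem foldr_pd_add_single (hf : ContDiff ℝ ∞ f) (γ : Fin d → ℕ) (j : Fin d)
    (l : List (Fin d)) (hl : l.Nodup) (hj : j ∈ l) :
    l.foldr (fun i v => (pd i)^[(γ + Pi.single j 1 : Fin d → ℕ) i] v) f =
      pd j (l.foldr (fun i v => (pd i)^[γ i] v) f) := by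
  induction l with
  | nil => simp at hj
  | cons a l ih =>
    simp only [foldr_cons]
    obtain ⟨ha, hl⟩ := List.nodup_cons.1 hl
    by_cases haj : a = j
    · subst haj
      rw [foldr_pd_congr (γ + Pi.single a 1 : Fin d → ℕ) γ l (fun i hi => by
        have : i ≠ a := fun h => ha (h ▸ hi)
        simp [this])]
      simp [iterate_succ_apply']
    · have hj' : j ∈ l := by
        rcases List.mem_cons.1 hj with h | h
        · exact absurd h.symm haj
        · exact h
      rw [ih hl hj', ← pd_iter_comm (contDiff_foldr_pd hf γ l)]
      simp [haj]

theorem DD_add_single (hf : ContDiff ℝ ∞ f) (γ : Fin d → ℕ) (j : Fin d) :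
    DD (γ + Pi.single j 1) f = pd j (DD γ f) :=
  foldr_pd_add_single hf γ j _ (List.nodup_finRange d) (List.mem_finRange j)

theorem DD_zero : DD (0 : Fin d → ℕ) f = f := by
  unfold DD
  induction finRange d with
  | nil => rfl
  | cons a l ih => simp

theorem DD_single (hf : ContDiff ℝ ∞ f) (j : Fin d) : DD (Pi.single j 1) f = pd j f := by
  rw [← zero_add (Pi.single j 1 : Fin d → ℕ), DD_add_single hf, DD_zero]

theorem DD_smul_single (hf : ContDiff ℝ ∞ f) (j : Fin d) (k : ℕ) :
    DD (k • Pi.single j 1) f = (pd j)^[k] f := by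
  induction k with
  | zero => rw [zero_smul, DD_zero]; rfl
  | succ k ih => rw [succ_nsmul, DD_add_single hf, ih, iterate_succ_apply']

theorem DD_add_index (hf : ContDiff ℝ ∞ f) (γ δ : Fin d → ℕ) :
    DD (γ + δ) f = DD γ (DD δ f) := by
  induction γ using multiIndex_induction with
  | h0 => rw [zero_add, DD_zero]
  | hs γ j ih =>
    rw [add_right_comm, DD_add_single hf, ih, DD_add_single (contDiff_DD hf δ)]

theorem pd_add (hf : ContDiff ℝ ∞ f) (hg : ContDiff ℝ ∞ g) (i : Fin d) :
    pd i (f + g) = pd i f + pd i g := by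
  funext x
  simp only [pd, Pi.add_apply]
  rw [fderiv_add (hf.differentiable (by simp) x) (hg.differentiable (by simp) x)]
  rfl

theorem pd_const_smul (hf : ContDiff ℝ ∞ f) (c : ℝ) (i : Fin d) :
    pd i (c • f) = c • pd i f := by
  funext x
  simp only [pd, Pi.smul_apply]
  rw [fderiv_const_smul (hf.differentiable (by simp) x)]
  rfl

theorem DD_add (hf : ContDiff ℝ ∞ f) (hg : ContDiff ℝ ∞ g) (γ : Fin d → ℕ) :
    DD γ (f + g) = DD γ f + DD γ g := by
  induction γ using multiIndex_induction with
  | h0 => simp only [DD_zero]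
  | hs γ j ih =>
    rw [DD_add_single (f := f + g) (hf.add hg), ih, pd_add (contDiff_DD hf γ) (contDiff_DD hg γ),
      DD_add_single hf, DD_add_single hg]

theorem DD_const_smul (hf : ContDiff ℝ ∞ f) (c : ℝ) (γ : Fin d → ℕ) :
    DD γ (c • f) = c • DD γ f := by
  induction γ using multiIndex_induction with
  | h0 => simp only [DD_zero]
  | hs γ j ih =>
    rw [DD_add_single (f := c • f) (hf.const_smul c), ih, pd_const_smul (contDiff_DD hf γ), DD_add_single hf]

theorem DD_sub (hf : ContDiff ℝ ∞ f) (hg : ContDiff ℝ ∞ g) (γ : Fin d → ℕ) :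
    DD γ (f - g) = DD γ f - DD γ g := by
  have : f - g = f + (-1 : ℝ) • g := by simp [sub_eq_add_neg]
  rw [this, DD_add (g := (-1 : ℝ) • g) hf (hg.const_smul _), DD_const_smul hg]
  simp [sub_eq_add_neg]

theorem DD_zero_fun (γ : Fin d → ℕ) : DD γ (0 : E → F) = 0 := by
  have h : ContDiff ℝ ∞ (0 : E → F) := contDiff_const
  simpa using DD_const_smul h 0 γ

theorem DD_sum {ι : Type*} (s : Finset ι) (h : ι → E → F)
    (hh : ∀ i ∈ s, ContDiff ℝ ∞ (h i)) (γ : Fin d → ℕ) :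
    DD γ (∑ i ∈ s, h i) = ∑ i ∈ s, DD γ (h i) := by
  classical
  induction s using Finset.induction_on with
  | empty => simpa using DD_zero_fun γ
  | insert a s ha ih =>
    have h1 : ∀ i ∈ s, ContDiff ℝ ∞ (h i) := fun i hi => hh i (Finset.mem_insert_of_mem hi)
    have h2 : ContDiff ℝ ∞ (∑ i ∈ s, h i) := by
      have := ContDiff.sum (s := s) (f := h) h1
      convert this using 1
      funext x; simp
    rw [sum_insert ha, sum_insert ha, DD_add (hh a (Finset.mem_insert_self a s)) h2,
      ih h1]

theorem pd_mul {f g : E → ℝ} (hf : ContDiff ℝ ∞ f)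
    (hg : ContDiff ℝ ∞ g) (i : Fin d) : pd i (f * g) = pd i f * g + f * pd i g := by
  funext x
  simp only [pd, Pi.mul_apply, Pi.add_apply]
  rw [fderiv_mul (hf.differentiable (by simp) x) (hg.differentiable (by simp) x)]
  simp
  ring

theorem pd_eventuallyEq {x : E} (h : f =ᶠ[𝓝 x] g) (i : Fin d) :
    pd i f =ᶠ[𝓝 x] pd i g := by
  filter_upwards [h.fderiv (𝕜 := ℝ)] with y hy
  simp only [pd, hy]

theorem DD_eventuallyEq {x : E} (h : f =ᶠ[𝓝 x] g) (γ : Fin d → ℕ) :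
    DD γ f =ᶠ[𝓝 x] DD γ g := by
  unfold DD
  induction finRange d with
  | nil => exact h
  | cons a l ih =>
    simp only [foldr_cons]
    generalize γ a = k
    induction k with
    | zero => exact ih
    | succ k ihk =>
      rw [iterate_succ_apply', iterate_succ_apply']
      exact pd_eventuallyEq ihk a

theorem tsupport_DD_subset (f : E → F) (γ : Fin d → ℕ) :
    tsupport (DD γ f) ⊆ tsupport f := by
  intro x hx
  by_contra hc
  have h0 : f =ᶠ[𝓝 x] 0 := notMem_tsupport_iff_eventuallyEq.1 hc
  have h1 := DD_eventuallyEq h0 γ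
  rw [DD_zero_fun] at h1
  exact (notMem_tsupport_iff_eventuallyEq.2 h1) hx

theorem hasCompactSupport_DD (hf : HasCompactSupport f) (γ : Fin d → ℕ) :
    HasCompactSupport (DD γ f) :=
  hf.mono' ((subset_tsupport _).trans (tsupport_DD_subset f γ))

theorem pd_comp_affine (hf : ContDiff ℝ ∞ f) (a : E) (r : ℝ) (i : Fin d) :
    pd i (fun x => f (a + r • x)) = r • fun x => pd i f (a + r • x) := by
  funext x
  have h1 : HasFDerivAt (fun x : E => a + r • x)
      (r • ContinuousLinearMap.id ℝ _) x :=
    ((hasFDerivAt_id x).const_smul r).const_add a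
  have h2 := ((hf.differentiable (by simp) (a + r • x)).hasFDerivAt.comp x h1).fderiv
  simp only [pd, Pi.smul_apply]
  rw [show (fun x => f (a + r • x)) = f ∘ fun x => a + r • x from rfl, h2]
  simp

theorem DD_comp_affine (hf : ContDiff ℝ ∞ f) (a : E) (r : ℝ)
    (γ : Fin d → ℕ) :
    DD γ (fun x => f (a + r • x)) = (r ^ ∑ i, γ i) • fun x => DD γ f (a + r • x) := by
  have hc : ∀ {g : E → F}, ContDiff ℝ ∞ g →
      ContDiff ℝ ∞ fun x => g (a + r • x) := fun hg =>
    hg.comp (contDiff_const.add (contDiff_id.const_smul r))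
  induction γ using multiIndex_induction with
  | h0 => simp [DD_zero]
  | hs γ j ih =>
    rw [DD_add_single (hc hf), ih, pd_const_smul (hc (contDiff_DD hf γ)),
      pd_comp_affine (contDiff_DD hf γ), DD_add_single hf, smul_smul, ← pow_succ]
    congr 2
    simp [sum_add_distrib]

theorem pd_clm_comp {G : Type*} [NormedAddCommGroup G] [NormedSpace ℝ G] (L : F →L[ℝ] G)
    (hf : ContDiff ℝ ∞ f) (i : Fin d) : pd i (fun x => L (f x)) = fun x => L (pd i f x) := by
  funext x
  have := (L.hasFDerivAt.comp x (hf.differentiable (by simp) x).hasFDerivAt).fderiv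
  simp only [pd]
  rw [show (fun x => L (f x)) = L ∘ f from rfl, this]
  rfl

theorem DD_clm_comp {G : Type*} [NormedAddCommGroup G] [NormedSpace ℝ G] (L : F →L[ℝ] G)
    (hf : ContDiff ℝ ∞ f) (γ : Fin d → ℕ) : DD γ (fun x => L (f x)) = fun x => L (DD γ f x) := by
  induction γ using multiIndex_induction with
  | h0 => simp only [DD_zero]
  | hs γ j ih =>
    rw [DD_add_single (f := fun x => L (f x)) (L.contDiff.comp hf), ih, pd_clm_comp L (contDiff_DD hf γ),
      DD_add_single hf]

variable {u : ℝ × EuclideanSpace ℝ (Fin d) → F}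

theorem pder_iter_slice (i : Fin d) (k : ℕ) (u : ℝ × E → F)
    (t : ℝ) : (fun x => (pder i)^[k] u (t, x)) = (pd i)^[k] fun x => u (t, x) := by
  induction k with
  | zero => rfl
  | succ k ih =>
    rw [iterate_succ_apply', iterate_succ_apply', ← ih]
    rfl

theorem Dmul_slice (γ : Fin d → ℕ) (u : ℝ × E → F) (t : ℝ) :
    (fun x => Dmul γ u (t, x)) = DD γ fun x => u (t, x) := by
  unfold Dmul DD
  induction finRange d with
  | nil => rfl
  | cons a l ih =>
    simp only [foldr_cons]
    rw [pder_iter_slice, ih]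

theorem Dmul_apply (γ : Fin d → ℕ) (u : ℝ × E → F) (t : ℝ)
    (x : E) : Dmul γ u (t, x) = DD γ (fun x => u (t, x)) x :=
  congrFun (Dmul_slice γ u t) x

theorem contDiff_slice (hu : ContDiff ℝ ∞ u) (t : ℝ) : ContDiff ℝ ∞ fun x => u (t, x) :=
  hu.comp (contDiff_const.prodMk contDiff_id)

theorem pder_eq_fderiv (hu : ContDiff ℝ ∞ u) (i : Fin d) :
    pder i u = fun p => fderiv ℝ u p (0, single i 1) := by
  funext p
  have h1 : HasFDerivAt (fun y : E => (p.1, y))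
      (ContinuousLinearMap.inr ℝ ℝ _) p.2 := hasFDerivAt_prodMk_right p.1 p.2
  have h2 := ((hu.differentiable (by simp) (p.1, p.2)).hasFDerivAt.comp p.2 h1).fderiv
  simp only [pder]
  rw [show (fun y => u (p.1, y)) = u ∘ fun y => (p.1, y) from rfl, h2]
  simp

theorem tder_eq_fderiv (hu : ContDiff ℝ ∞ u) : tder u = fun p => fderiv ℝ u p (1, 0) := by
  funext p
  have h1 : HasDerivAt (fun s : ℝ => (s, p.2)) ((1 : ℝ), (0 : E)) p.1 :=
    (hasDerivAt_id p.1).prodMk (hasDerivAt_const _ _)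
  exact ((hu.differentiable (by simp) (p.1, p.2)).hasFDerivAt.comp_hasDerivAt p.1 h1).deriv

theorem hasDerivAt_tder (hu : ContDiff ℝ ∞ u) (t : ℝ) (x : E) :
    HasDerivAt (fun s => u (s, x)) (tder u (t, x)) t := by
  have h : ContDiff ℝ ∞ fun s => u (s, x) := hu.comp (contDiff_id.prodMk contDiff_const)
  exact (h.differentiable (by simp) t).hasDerivAt

theorem contDiff_fderiv_const (hu : ContDiff ℝ ∞ u) (v : ℝ × E) :
    ContDiff ℝ ∞ fun p => fderiv ℝ u p v :=
  (hu.fderiv_right (m := ∞) (by simp)).clm_apply contDiff_const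

theorem contDiff_pder (hu : ContDiff ℝ ∞ u) (i : Fin d) : ContDiff ℝ ∞ (pder i u) := by
  rw [pder_eq_fderiv hu]; exact contDiff_fderiv_const hu _

theorem contDiff_tder (hu : ContDiff ℝ ∞ u) : ContDiff ℝ ∞ (tder u) := by
  rw [tder_eq_fderiv hu]; exact contDiff_fderiv_const hu _

theorem tder_pder (hu : ContDiff ℝ ∞ u) (i : Fin d) : tder (pder i u) = pder i (tder u) := by
  have key : ∀ (x v w : ℝ × E),
      fderiv ℝ (fun y => fderiv ℝ u y w) x v = fderiv ℝ (fderiv ℝ u) x v w := by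
    intro x v w
    have h : DifferentiableAt ℝ (fderiv ℝ u) x :=
      (hu.fderiv_right (m := ∞) (by simp)).differentiable (by simp) x
    rw [fderiv_clm_apply h (differentiableAt_const _)]
    simp
  rw [tder_eq_fderiv (contDiff_pder hu i), pder_eq_fderiv (contDiff_tder hu),
    tder_eq_fderiv hu, pder_eq_fderiv hu]
  funext x
  rw [key, key]
  exact (hu.contDiffAt.isSymmSndFDerivAt (by simpa using two_le_infty)) _ _

theorem contDiff_tder_pder_iter (hu : ContDiff ℝ ∞ u) (i : Fin d) (k : ℕ) :
    ContDiff ℝ ∞ ((pder i)^[k] u) ∧ tder ((pder i)^[k] u) = (pder i)^[k] (tder u) := by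
  induction k with
  | zero => exact ⟨hu, rfl⟩
  | succ k ih =>
    simp only [iterate_succ_apply']
    exact ⟨contDiff_pder ih.1 i, by rw [tder_pder ih.1, ih.2]⟩

theorem contDiff_tder_Dmul (hu : ContDiff ℝ ∞ u) (γ : Fin d → ℕ) :
    ContDiff ℝ ∞ (Dmul γ u) ∧ tder (Dmul γ u) = Dmul γ (tder u) := by
  unfold Dmul
  induction finRange d with
  | nil => exact ⟨hu, rfl⟩
  | cons a l ih =>
    simp only [foldr_cons]
    have h := contDiff_tder_pder_iter ih.1 a (γ a)
    exact ⟨h.1, by rw [h.2, ih.2]⟩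

theorem contDiff_Dmul (hu : ContDiff ℝ ∞ u) (γ : Fin d → ℕ) : ContDiff ℝ ∞ (Dmul γ u) :=
  (contDiff_tder_Dmul hu γ).1

theorem tder_Dmul (hu : ContDiff ℝ ∞ u) (γ : Fin d → ℕ) : tder (Dmul γ u) = Dmul γ (tder u) :=
  (contDiff_tder_Dmul hu γ).2

theorem Dmul_add_index (hu : ContDiff ℝ ∞ u) (γ δ : Fin d → ℕ) :
    Dmul (γ + δ) u = Dmul γ (Dmul δ u) := by
  funext ⟨t, x⟩
  rw [Dmul_apply, Dmul_apply, DD_add_index (contDiff_slice hu t), Dmul_slice]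

end derivatives

section halfSpace
variable {d : ℕ} {N : Fin d}
local notation "E" => EuclideanSpace ℝ (Fin d)

/-- The open half space `{x_N > 0}`. -/
def HalfSp (N : Fin d) : Set (E) := {x | 0 < x N}

theorem continuous_coord (i : Fin d) : Continuous fun x : E => x i :=
  (proj (𝕜 := ℝ) i).continuous

theorem isOpen_halfSp : IsOpen (HalfSp N) := isOpen_lt continuous_const (continuous_coord N)

theorem volume_hyperplane : volume {x : E | x N = 0} = 0 := by
  have h := Measure.addHaar_submodule (volume : Measure (E))
    (LinearMap.ker (proj (𝕜 := ℝ) N).toLinearMap) ?_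
  · convert h using 2
    ext x; simp
  · intro h
    have : (single N (1 : ℝ)) ∈
        LinearMap.ker (proj (𝕜 := ℝ) N).toLinearMap := by rw [h]; trivial
    simp at this

theorem hasLineDerivAt_pd {f : E → ℝ} (hf : ContDiff ℝ ∞ f) (i : Fin d)
    (x : E) :
    HasLineDerivAt ℝ f (pd i f x) x (single i 1) :=
  (hf.differentiable (by simp) x).hasFDerivAt.hasLineDerivAt _

theorem integrable_of_contDiff {f : E → ℝ} (hf : ContDiff ℝ ∞ f)
    (hc : HasCompactSupport f) : Integrable f :=
  hf.continuous.integrable_of_hasCompactSupport hc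

theorem hasCompactSupport_pd {F : Type*} [NormedAddCommGroup F] [NormedSpace ℝ F]
    {f : E → F} (hf : ContDiff ℝ ∞ f)
    (hc : HasCompactSupport f) (i : Fin d) : HasCompactSupport (pd i f) := by
  rw [← DD_single hf]; exact hasCompactSupport_DD hc _

theorem integral_halfSp_pd_tangential {h : E → ℝ}
    (hh : ContDiff ℝ ∞ h) (hc : HasCompactSupport h) {i : Fin d} (hi : i ≠ N) :
    ∫ x in HalfSp N, pd i h x = 0 := by
  have hm : MeasurableSet (HalfSp N) := isOpen_halfSp.measurableSet
  rw [← integral_indicator hm]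
  have key := integral_bilinear_hasLineDerivAt_right_eq_neg_left_of_integrable
    (μ := (volume : Measure (E))) (f := fun _ => (1 : ℝ)) (f' := fun _ => 0)
    (g := (HalfSp N).indicator h) (g' := (HalfSp N).indicator (pd i h))
    (v := single i 1) (B := ContinuousLinearMap.mul ℝ ℝ) ?_ ?_ ?_ ?_ ?_
  · simpa using key
  · simp
  · simpa using (integrable_of_contDiff (contDiff_pd hh i) (hasCompactSupport_pd hh hc i)).indicator hm
  · simpa using (integrable_of_contDiff hh hc).indicator hm
  · intro x _
    exact (hasFDerivAt_const (1 : ℝ) x).hasLineDerivAt (single i 1)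
  · intro x _
    have hco : ∀ t : ℝ, x + t • single i (1 : ℝ) ∈ HalfSp N ↔ x ∈ HalfSp N := by
      intro t
      simp [HalfSp, Ne.symm hi]
    by_cases hx : x ∈ HalfSp N
    · have h1 := hasLineDerivAt_pd hh i x
      unfold HasLineDerivAt at h1 ⊢
      simp only [indicator_of_mem hx]
      convert h1 using 1
      funext t
      exact indicator_of_mem ((hco t).2 hx) _
    · unfold HasLineDerivAt
      simp only [indicator_of_notMem hx]
      convert hasDerivAt_const (0 : ℝ) (0 : ℝ) using 1
      funext t
      exact indicator_of_notMem (fun hc => hx ((hco t).1 hc)) _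

theorem integral_halfSp_pd_normal {h : E → ℝ}
    (hh : ContDiff ℝ ∞ h) (hc : HasCompactSupport h) (h0 : ∀ x, x N = 0 → h x = 0) :
    ∫ x in HalfSp N, pd N h x = 0 := by
  have hm : MeasurableSet (HalfSp N) := isOpen_halfSp.measurableSet
  obtain ⟨C, hC⟩ := (hh.of_le (by simp : (1 : WithTop ℕ∞) ≤ ∞)).lipschitzWith_of_hasCompactSupport hc
    (by simp)
  set g := (HalfSp N).indicator h with hg
  have hco : LipschitzWith 1 fun x : E => x N := by
    refine LipschitzWith.of_dist_le_mul fun x y => ?_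
    simpa [dist_eq_norm] using norm_apply_le (x - y) N
  obtain ⟨D, hD⟩ : ∃ D, LipschitzWith D g := by
    have h1 : LipschitzWith (1 + 1 * (1 + 1)) fun x : E =>
        x + (max (x N) 0 - x N) • single N (1 : ℝ) := by
      refine LipschitzWith.id.add ?_
      have h2 : LipschitzWith (1 + 1) fun x : E => max (x N) 0 - x N :=
        (hco.max_const 0).sub hco
      have h3 : LipschitzWith 1 fun c : ℝ => c • single N (1 : ℝ) := by
        refine LipschitzWith.of_dist_le_mul fun a b => ?_
        rw [dist_eq_norm, dist_eq_norm, ← sub_smul, norm_smul]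
        simp
      exact h3.comp h2
    refine ⟨C * (1 + 1 * (1 + 1)), ?_⟩
    · convert hC.comp h1 using 1
      funext x
      by_cases hx : x ∈ HalfSp N
      · have hx' : 0 < x N := hx
        simp [hg, indicator_of_mem hx, max_eq_left hx'.le]
      · have hx' : x N ≤ 0 := not_lt.1 hx
        simp only [hg, indicator_of_notMem hx, max_eq_right hx', comp_apply]
        refine (h0 _ ?_).symm
        simp
  have hgc : HasCompactSupport g := hc.mono (by
    intro x hx
    rw [Function.mem_support] at hx ⊢
    intro h
    exact hx (by simp [hg, indicator, h]))
  have key := LipschitzWith.integral_lineDeriv_mul_eq (μ := (volume : Measure (E)))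
    (LipschitzWith.const (1 : ℝ)) hD hgc (-single N 1)
  have hz : ∀ x, lineDeriv ℝ (fun _ : E => (1 : ℝ)) x
      (-single N 1) = 0 := fun x => by simp [lineDeriv]
  simp only [hz, zero_mul, integral_zero, neg_neg, mul_one] at key
  rw [← integral_indicator hm]
  rw [key]
  refine integral_congr_ae ?_
  have hae : ∀ᵐ x : E, x N ≠ 0 := by
    rw [ae_iff]; simpa using volume_hyperplane
  filter_upwards [hae] with x hx
  symm
  rcases lt_or_gt_of_ne hx with hlt | hgt
  · have : x ∉ HalfSp N := not_lt.2 hlt.le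
    rw [indicator_of_notMem this (pd N h)]
    have e : g =ᶠ[𝓝 x] fun _ => 0 := by
      filter_upwards [(isOpen_lt (continuous_coord N) continuous_const).mem_nhds hlt] with y hy
      exact indicator_of_notMem (s := HalfSp N) (not_lt.2 (le_of_lt hy)) h
    rw [e.lineDeriv_eq]
    simp [lineDeriv]
  · have hx' : x ∈ HalfSp N := hgt
    rw [indicator_of_mem hx']
    have e : g =ᶠ[𝓝 x] h := by
      filter_upwards [isOpen_halfSp.mem_nhds hx'] with y hy
      exact indicator_of_mem hy _
    rw [e.lineDeriv_eq]
    exact (hasLineDerivAt_pd hh N x).lineDeriv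

theorem integral_halfSp_pd {h : E → ℝ}
    (hh : ContDiff ℝ ∞ h) (hc : HasCompactSupport h) (i : Fin d)
    (h0 : i = N → ∀ x, x N = 0 → h x = 0) :
    ∫ x in HalfSp N, pd i h x = 0 := by
  by_cases hi : i = N
  · subst hi; exact integral_halfSp_pd_normal hh hc (h0 rfl)
  · exact integral_halfSp_pd_tangential hh hc hi

/-- Integration by parts on the half space. -/
theorem integral_halfSp_pd_mul {f g : E → ℝ}
    (hf : ContDiff ℝ ∞ f) (hg : ContDiff ℝ ∞ g) (hc : HasCompactSupport f) (i : Fin d)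
    (h0 : i = N → ∀ x, x N = 0 → f x = 0) :
    ∫ x in HalfSp N, pd i f x * g x = -∫ x in HalfSp N, f x * pd i g x := by
  have h := integral_halfSp_pd (N := N) (hf.mul hg) (h := f * g) hc.mul_right i
    (fun hi x hx => by simp [h0 hi x hx])
  rw [pd_mul hf hg] at h
  have i1 : Integrable (pd i f * g) := by
    refine ((contDiff_pd hf i).continuous.mul hg.continuous).integrable_of_hasCompactSupport ?_
    exact (hasCompactSupport_pd hf hc i).mul_right
  have i2 : Integrable (f * pd i g) := by
    refine (hf.continuous.mul (contDiff_pd hg i).continuous).integrable_of_hasCompactSupport ?_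
    exact hc.mul_right
  simp only [Pi.add_apply] at h
  rw [integral_add i1.integrableOn i2.integrableOn] at h
  simp only [Pi.mul_apply] at h
  linarith

/-- `f` vanishes to order `m` on the part of `{x_N = 0}` inside `S`. -/
def VanishOn (N : Fin d) (m : ℕ) (S : Set (E))
    (f : E → ℝ) : Prop :=
  ∀ γ : Fin d → ℕ, γ N < m → ∀ x ∈ S, x N = 0 → DD γ f x = 0

theorem VanishOn.mono_set {m : ℕ} {S T : Set (E)}
    {f : E → ℝ} (h : VanishOn N m S f) (hT : T ⊆ S) : VanishOn N m T f :=
  fun γ hγ x hx => h γ hγ x (hT hx)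

theorem VanishOn.DD {m k : ℕ} {S : Set (E)}
    {f : E → ℝ} (hf : ContDiff ℝ ∞ f) (h : VanishOn N m S f)
    (δ : Fin d → ℕ) (hδ : k + δ N ≤ m) : VanishOn N k S (DD δ f) := by
  intro γ hγ x hx hx0
  rw [← DD_add_index hf]
  exact h _ (by simp; omega) x hx hx0

theorem pd_eq_zero_of_tangential {O : Set (E)} (hO : IsOpen O)
    {f : E → ℝ} (hf : ContDiff ℝ ∞ f) (h : ∀ x ∈ O, x N = 0 → f x = 0)
    {i : Fin d} (hi : i ≠ N) : ∀ x ∈ O, x N = 0 → pd i f x = 0 := by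
  intro x hx hx0
  have h1 := hasLineDerivAt_pd hf i x
  unfold HasLineDerivAt at h1
  have h2 : (fun t : ℝ => f (x + t • single i 1)) =ᶠ[𝓝 0] fun _ => 0 := by
    have hc : Continuous fun t : ℝ => x + t • single i (1 : ℝ) := by fun_prop
    filter_upwards [(hO.preimage hc).mem_nhds (by simpa using hx)] with t ht
    exact h _ ht (by simp [hx0, Ne.symm hi])
  exact h1.unique ((hasDerivAt_const (0 : ℝ) (0 : ℝ)).congr_of_eventuallyEq h2)

theorem vanishOn_of_normal {m : ℕ} {O : Set (E)} (hO : IsOpen O)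
    {f : E → ℝ} (hf : ContDiff ℝ ∞ f)
    (h : ∀ k < m, ∀ x ∈ O, x N = 0 → (pd N)^[k] f x = 0) : VanishOn N m O f := by
  have key : ∀ γ : Fin d → ℕ, γ N = 0 → ∀ g : E → ℝ, ContDiff ℝ ∞ g →
      (∀ x ∈ O, x N = 0 → g x = 0) → ∀ x ∈ O, x N = 0 → DD γ g x = 0 := by
    intro γ
    induction γ using multiIndex_induction with
    | h0 => intro _ g _ hg0; simpa [DD_zero] using hg0
    | hs γ j ih =>
      intro hγ g hg hg0
      have hj : j ≠ N := by rintro rfl; simp at hγ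
      rw [DD_add_single hg]
      refine pd_eq_zero_of_tangential hO (contDiff_DD hg γ) (ih ?_ g hg hg0) hj
      simpa using (Nat.add_eq_zero_iff.1 hγ).1
  intro γ hγ
  have e : γ = update γ N 0 + (γ N) • Pi.single N 1 := by
    funext i
    by_cases hi : i = N
    · subst hi; simp
    · simp [hi]
  rw [e, DD_add_index hf, DD_smul_single hf]
  exact key _ (by simp) _ (contDiff_pd_iter hf N _) (h _ hγ)

theorem vanishOn_mul {m : ℕ} {S : Set (E)}
    {φ f : E → ℝ} (hφ : ContDiff ℝ ∞ φ) (hf : ContDiff ℝ ∞ f)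
    (h : VanishOn N m S f) : VanishOn N m S (φ * f) := by
  intro γ
  induction γ using multiIndex_induction generalizing m φ f with
  | h0 =>
    intro hm x hx hx0
    have := h 0 hm x hx hx0
    rw [DD_zero] at this
    simp [DD_zero, this]
  | hs γ j ih =>
    intro hγ x hx hx0
    have hg : ContDiff ℝ ∞ (φ * f) := hφ.mul hf
    rw [DD_add_single hg, pd_DD hg, pd_mul hφ hf,
      DD_add (f := pd j φ * f) (g := φ * pd j f) ((contDiff_pd hφ j).mul hf)
        (hφ.mul (contDiff_pd hf j))]
    have hγ1 : γ N ≤ (γ + Pi.single j 1 : Fin d → ℕ) N := by simp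
    rw [Pi.add_apply, ih (contDiff_pd hφ j) hf h (hγ1.trans_lt hγ) x hx hx0, zero_add]
    refine ih (m := γ N + 1) hφ (contDiff_pd hf j) ?_ (Nat.lt_succ_self _) x hx hx0
    rw [← DD_single hf]
    refine h.DD hf _ ?_
    have : (γ + Pi.single j 1 : Fin d → ℕ) N = γ N + (Pi.single j 1 : Fin d → ℕ) N := rfl
    omega

end halfSpace

section plancherel
open FourierTransform SchwartzMap
variable {d : ℕ}
local notation "E" => EuclideanSpace ℝ (Fin d)

theorem fourier_toLp_ae {f : E → ℂ} (h1 : Integrable f) (h2 : MemLp f 2) :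
    (𝓕 (h2.toLp f) : Lp ℂ 2 (volume : Measure E)) =ᵐ[volume] 𝓕 f := by
  have hcont : Continuous (𝓕 f) := VectorFourier.fourierIntegral_continuous
    Real.continuous_fourierChar (L := innerₗ E) (by simpa using continuous_inner) h1
  refine ae_eq_of_integral_contDiff_smul_eq
    ((Lp.memLp _).locallyIntegrable (by norm_num)) hcont.locallyIntegrable fun g hg hgc => ?_
  have hg' : ContDiff ℝ ∞ fun x => (g x : ℂ) := Complex.ofRealCLM.contDiff.comp hg
  have hgc' : HasCompactSupport fun x => (g x : ℂ) := hgc.comp_left (g := fun r : ℝ => (r : ℂ)) rfl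
  set G : 𝓢(E, ℂ) := hgc'.toSchwartzMap hg' with hG
  have hGx : ∀ x, G x = (g x : ℂ) := fun x => rfl
  have e1 := congrArg (fun T : TemperedDistribution E ℂ => T G)
    (Lp.fourier_toTemperedDistribution_eq (h2.toLp f))
  simp only [TemperedDistribution.fourier_apply, Lp.toTemperedDistribution_apply] at e1
  have e2 := VectorFourier.integral_fourierIntegral_smul_eq_flip (L := innerₗ E)
    (μ := (volume : Measure E)) (ν := (volume : Measure E)) (f := (G : E → ℂ)) (g := f)
    Real.continuous_fourierChar (by simpa using continuous_inner) G.integrable h1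
  rw [flip_innerₗ] at e2
  have l1 : ∀ x, g x • (𝓕 (h2.toLp f) : Lp ℂ 2 (volume : Measure E)) x
      = G x • (𝓕 (h2.toLp f) : Lp ℂ 2 (volume : Measure E)) x := fun x => by
    rw [hGx]; simp
  have l2 : ∀ x, g x • 𝓕 f x = G x • 𝓕 f x := fun x => by rw [hGx]; simp
  simp only [l1, l2]
  rw [← e1]
  refine Eq.trans ?_ e2
  refine integral_congr_ae ?_
  filter_upwards [h2.coeFn_toLp] with x hx
  rw [hx]
  rfl

theorem integrable_fourier_mul {f g : E → ℂ} (h1 : Integrable f) (h2 : MemLp f 2)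
    (k1 : Integrable g) (k2 : MemLp g 2) :
    Integrable fun ξ => starRingEnd ℂ (𝓕 f ξ) * 𝓕 g ξ := by
  have h := L2.integrable_inner (𝕜 := ℂ) (𝓕 (h2.toLp f) : Lp ℂ 2 (volume : Measure E))
    (𝓕 (k2.toLp g) : Lp ℂ 2 (volume : Measure E))
  refine h.congr ?_
  filter_upwards [fourier_toLp_ae h1 h2, fourier_toLp_ae k1 k2] with x hx hy
  rw [hx, hy]; simp [mul_comm]

theorem integral_fourier_mul {f g : E → ℂ} (h1 : Integrable f) (h2 : MemLp f 2)
    (k1 : Integrable g) (k2 : MemLp g 2) :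
    ∫ ξ, starRingEnd ℂ (𝓕 f ξ) * 𝓕 g ξ = ∫ x, starRingEnd ℂ (f x) * g x := by
  have h := Lp.inner_fourier_eq (h2.toLp f) (k2.toLp g)
  rw [L2.inner_def, L2.inner_def] at h
  calc _ = _ := integral_congr_ae ?_
    _ = _ := h
    _ = _ := integral_congr_ae ?_
  · filter_upwards [fourier_toLp_ae h1 h2, fourier_toLp_ae k1 k2] with x hx hy
    rw [hx, hy]; simp [mul_comm]
  · filter_upwards [h2.coeFn_toLp, k2.coeFn_toLp] with x hx hy
    rw [hx, hy]; simp [mul_comm]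

end plancherel

section garding
open FourierTransform
variable {d n m : ℕ} {N : Fin d}
local notation "E" => EuclideanSpace ℝ (Fin d)

/-- Complexified extension by zero from the half space. -/
def halfExt (N : Fin d) (f : E → ℝ) : E → ℂ := (HalfSp N).indicator fun x => (f x : ℂ)

theorem integrable_halfExt {f : E → ℝ} (hf : Continuous f) (hc : HasCompactSupport f) :
    Integrable (halfExt N f) :=
  (hf.integrable_of_hasCompactSupport hc).ofReal.indicator isOpen_halfSp.measurableSet

theorem memLp_halfExt {f : E → ℝ} (hf : Continuous f) (hc : HasCompactSupport f) :
    MemLp (halfExt N f) 2 :=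
  ((hf.memLp_of_hasCompactSupport hc).ofReal).indicator isOpen_halfSp.measurableSet

/-- The phase `2π⟨x,ξ⟩`. -/
def phase (ξ : E) (x : E) : ℝ := 2 * π * inner ℝ x ξ

theorem hasFDerivAt_phase (ξ x : E) :
    HasFDerivAt (phase ξ) ((2 * π) • (innerSL ℝ ξ)) x := by
  have : phase ξ = fun x => ((2 * π) • (innerSL ℝ ξ)) x := by
    funext y; simp [phase, real_inner_comm]
  rw [this]
  exact ContinuousLinearMap.hasFDerivAt _

theorem contDiff_phase (ξ : E) : ContDiff ℝ ∞ (phase ξ) :=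
  contDiff_const.mul (contDiff_id.inner ℝ contDiff_const)

theorem pd_cos_phase (ξ : E) (i : Fin d) :
    pd i (fun x => cos (phase ξ x)) = fun x => -(2 * π * ξ i) * sin (phase ξ x) := by
  funext x
  unfold pd
  rw [((hasFDerivAt_phase ξ x).cos).fderiv]
  simp [EuclideanSpace.inner_single_right]; ring

theorem pd_sin_phase (ξ : E) (i : Fin d) :
    pd i (fun x => sin (phase ξ x)) = fun x => (2 * π * ξ i) * cos (phase ξ x) := by
  funext x
  unfold pd
  rw [((hasFDerivAt_phase ξ x).sin).fderiv]
  simp [EuclideanSpace.inner_single_right]; ring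

theorem fourier_halfExt {f : E → ℝ} (hf : Continuous f) (hc : HasCompactSupport f) (ξ : E) :
    𝓕 (halfExt N f) ξ = ((∫ x in HalfSp N, f x * cos (phase ξ x) : ℝ) : ℂ)
      - Complex.I * ((∫ x in HalfSp N, f x * sin (phase ξ x) : ℝ) : ℂ) := by
  have hp : Continuous (phase ξ) := (contDiff_phase ξ).continuous
  have i1 : Integrable fun x => f x * cos (phase ξ x) :=
    (hf.mul (Real.continuous_cos.comp hp)).integrable_of_hasCompactSupport hc.mul_right
  have i2 : Integrable fun x => f x * sin (phase ξ x) :=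
    (hf.mul (Real.continuous_sin.comp hp)).integrable_of_hasCompactSupport hc.mul_right
  rw [Real.fourier_eq', ← integral_complex_ofReal, ← integral_complex_ofReal,
    ← integral_const_mul, ← integral_sub (i1.ofReal.restrict (s := HalfSp N))
      ((i2.ofReal.restrict (s := HalfSp N)).const_mul _), ← integral_indicator isOpen_halfSp.measurableSet]
  congr 1
  funext x
  by_cases hx : x ∈ HalfSp N
  · simp only [halfExt, indicator_of_mem hx, smul_eq_mul]
    have : ((-2 * π * inner ℝ x ξ : ℝ) : ℂ) * Complex.I = -((phase ξ x : ℝ) : ℂ) * Complex.I := by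
      simp [phase]
    rw [this, Complex.exp_mul_I, Complex.cos_neg, Complex.sin_neg]
    push_cast
    ring
  · simp only [halfExt, indicator_of_notMem hx, smul_zero]

theorem fourier_halfExt_pd {f : E → ℝ} (hf : ContDiff ℝ ∞ f) (hc : HasCompactSupport f)
    (i : Fin d) (h0 : i = N → ∀ x, x N = 0 → f x = 0) (ξ : E) :
    𝓕 (halfExt N (pd i f)) ξ = (2 * π * Complex.I * ξ i) * 𝓕 (halfExt N f) ξ := by
  rw [fourier_halfExt (contDiff_pd hf i).continuous (hasCompactSupport_pd hf hc i),
    fourier_halfExt hf.continuous hc]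
  have c1 := integral_halfSp_pd_mul hf (Real.contDiff_cos.comp (contDiff_phase ξ)) hc i h0
  have c2 := integral_halfSp_pd_mul hf (Real.contDiff_sin.comp (contDiff_phase ξ)) hc i h0
  have e1 := pd_cos_phase ξ i
  have e2 := pd_sin_phase ξ i
  have a1 : ∫ x in HalfSp N, f x * pd i (cos ∘ phase ξ) x
      = -(2 * π * ξ i) * ∫ x in HalfSp N, f x * sin (phase ξ x) := by
    rw [← integral_const_mul]
    congr 1; funext x
    have := congrFun e1 x
    rw [show (cos ∘ phase ξ) = fun x => cos (phase ξ x) from rfl, this]; ring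
  have a2 : ∫ x in HalfSp N, f x * pd i (sin ∘ phase ξ) x
      = (2 * π * ξ i) * ∫ x in HalfSp N, f x * cos (phase ξ x) := by
    rw [← integral_const_mul]
    congr 1; funext x
    have := congrFun e2 x
    rw [show (sin ∘ phase ξ) = fun x => sin (phase ξ x) from rfl, this]; ring
  rw [a1] at c1
  rw [a2] at c2
  simp only [comp_apply] at c1 c2
  rw [c1, c2]
  push_cast
  ring_nf
  rw [Complex.I_sq]
  ring

theorem fourier_halfExt_DD {f : E → ℝ} (hf : ContDiff ℝ ∞ f) (hc : HasCompactSupport f)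
    (hv : VanishOn N m univ f) (ξ : E) (α : Fin d → ℕ) : α N ≤ m →
    𝓕 (halfExt N (DD α f)) ξ = (∏ k, (2 * π * Complex.I * ξ k) ^ α k) * 𝓕 (halfExt N f) ξ := by
  induction α using multiIndex_induction with
  | h0 => intro _; simp [DD_zero]
  | hs α j ih =>
    intro hα
    have hα1 : α N ≤ (α + Pi.single j 1 : Fin d → ℕ) N := by simp
    rw [DD_add_single hf, fourier_halfExt_pd (contDiff_DD hf α) (hasCompactSupport_DD hc α) j ?_,
      ih (hα1.trans hα)]
    · have : ∏ k, (2 * π * Complex.I * ξ k) ^ (α + Pi.single j 1 : Fin d → ℕ) k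
          = (2 * π * Complex.I * ξ j) * ∏ k, (2 * π * Complex.I * ξ k) ^ α k := by
        simp only [Pi.add_apply, pow_add, Finset.prod_mul_distrib]
        rw [mul_comm]
        congr 1
        rw [Finset.prod_eq_single j]
        · simp
        · intro b _ hb; simp [hb]
        · simp
      rw [this]; ring
    · rintro rfl x hx
      exact hv α (by simp at hα; omega) x trivial hx

theorem mem_MIdx {d k : ℕ} {γ : Fin d → ℕ} : γ ∈ MIdx d k ↔ ∑ i, γ i = k := by
  unfold MIdx
  simp only [Finset.mem_filter, Fintype.mem_piFinset, Finset.mem_range, and_iff_right_iff_imp]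
  intro h i
  have := single_le_sum (f := γ) (fun _ _ => Nat.zero_le _) (Finset.mem_univ i)
  omega

theorem mem_MIdxLt {d k : ℕ} {γ : Fin d → ℕ} : γ ∈ MIdxLt d k ↔ ∑ i, γ i < k := by
  unfold MIdxLt
  simp only [Finset.mem_filter, Fintype.mem_piFinset, Finset.mem_range, and_iff_right_iff_imp]
  intro h i
  have := single_le_sum (f := γ) (fun _ _ => Nat.zero_le _) (Finset.mem_univ i)
  omega

/-- Bilinear Plancherel identity for top order derivatives on the half space. -/
theorem integral_DD_mul_eq_fourier {f g : E → ℝ} (hf : ContDiff ℝ ∞ f) (hcf : HasCompactSupport f)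
    (hvf : VanishOn N m univ f) (hg : ContDiff ℝ ∞ g) (hcg : HasCompactSupport g)
    (hvg : VanishOn N m univ g) {α β : Fin d → ℕ} (hα : α ∈ MIdx d m) (hβ : β ∈ MIdx d m) :
    Integrable (fun ξ : E => (∏ k, (2 * π * ξ k) ^ α k) * (∏ k, (2 * π * ξ k) ^ β k) *
      ((𝓕 (halfExt N f) ξ).re * (𝓕 (halfExt N g) ξ).re
        + (𝓕 (halfExt N f) ξ).im * (𝓕 (halfExt N g) ξ).im)) ∧
    ∫ x in HalfSp N, DD α f x * DD β g x =
      ∫ ξ : E, (∏ k, (2 * π * ξ k) ^ α k) * (∏ k, (2 * π * ξ k) ^ β k) *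
      ((𝓕 (halfExt N f) ξ).re * (𝓕 (halfExt N g) ξ).re
        + (𝓕 (halfExt N f) ξ).im * (𝓕 (halfExt N g) ξ).im) := by
  rw [mem_MIdx] at hα hβ
  have hαN : α N ≤ m := hα ▸ single_le_sum (f := α) (fun _ _ => Nat.zero_le _)
    (Finset.mem_univ N)
  have hβN : β N ≤ m := hβ ▸ single_le_sum (f := β) (fun _ _ => Nat.zero_le _)
    (Finset.mem_univ N)
  have cf := (contDiff_DD hf α).continuous
  have cg := (contDiff_DD hg β).continuous
  have sf := hasCompactSupport_DD hcf α
  have sg := hasCompactSupport_DD hcg β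
  have key : ∀ ξ : E, (starRingEnd ℂ (𝓕 (halfExt N (DD α f)) ξ) * 𝓕 (halfExt N (DD β g)) ξ).re
      = (∏ k, (2 * π * ξ k) ^ α k) * (∏ k, (2 * π * ξ k) ^ β k) *
      ((𝓕 (halfExt N f) ξ).re * (𝓕 (halfExt N g) ξ).re
        + (𝓕 (halfExt N f) ξ).im * (𝓕 (halfExt N g) ξ).im) := by
    intro ξ
    rw [fourier_halfExt_DD hf hcf hvf ξ α hαN, fourier_halfExt_DD hg hcg hvg ξ β hβN]
    have pr : ∀ γ : Fin d → ℕ, ∑ k, γ k = m → ∏ k, (2 * (π : ℂ) * Complex.I * (ξ k : ℂ)) ^ γ k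
        = Complex.I ^ m * ((∏ k, (2 * π * ξ k) ^ γ k : ℝ) : ℂ) := by
      intro γ hγ
      rw [← hγ, ← Finset.prod_pow_eq_pow_sum]
      push_cast
      rw [← Finset.prod_mul_distrib]
      refine Finset.prod_congr rfl fun k _ => ?_
      rw [← mul_pow]; congr 1; ring
    rw [pr α hα, pr β hβ]
    generalize (∏ k, (2 * π * ξ k) ^ α k) = a
    generalize (∏ k, (2 * π * ξ k) ^ β k) = b
    generalize 𝓕 (halfExt N f) ξ = z
    generalize 𝓕 (halfExt N g) ξ = w
    have hI : (starRingEnd ℂ (Complex.I)) ^ m * Complex.I ^ m = 1 := by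
      rw [← mul_pow]; simp
    have : starRingEnd ℂ (Complex.I ^ m * (a : ℂ) * z) * (Complex.I ^ m * (b : ℂ) * w)
        = ((a * b : ℝ) : ℂ) * (starRingEnd ℂ z * w) := by
      simp only [map_mul, map_pow, Complex.conj_ofReal]
      push_cast
      linear_combination (a * b * starRingEnd ℂ z * w : ℂ) * hI
    rw [this, Complex.re_ofReal_mul]
    simp
  have hi := integrable_fourier_mul (integrable_halfExt (N := N) cf sf) (memLp_halfExt cf sf)
    (integrable_halfExt (N := N) cg sg) (memLp_halfExt cg sg)
  have hI := integral_fourier_mul (integrable_halfExt (N := N) cf sf) (memLp_halfExt cf sf)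
    (integrable_halfExt (N := N) cg sg) (memLp_halfExt cg sg)
  simp only [← key]
  refine ⟨hi.re, ?_⟩
  have e := congrArg Complex.re hI
  have e3 : (∫ ξ : E, starRingEnd ℂ (𝓕 (halfExt N (DD α f)) ξ) * 𝓕 (halfExt N (DD β g)) ξ).re
      = ∫ ξ : E, (starRingEnd ℂ (𝓕 (halfExt N (DD α f)) ξ) * 𝓕 (halfExt N (DD β g)) ξ).re :=
    (integral_re hi).symm
  rw [← e3, e]
  have : ∫ x : E, starRingEnd ℂ (halfExt N (DD α f) x) * halfExt N (DD β g) x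
      = ((∫ x in HalfSp N, DD α f x * DD β g x : ℝ) : ℂ) := by
    rw [← integral_complex_ofReal, ← integral_indicator isOpen_halfSp.measurableSet]
    congr 1; funext x
    by_cases hx : x ∈ HalfSp N
    · simp [halfExt, indicator_of_mem hx]
    · simp [halfExt, indicator_of_notMem hx]
  rw [this, Complex.ofReal_re]

/-- Gårding's inequality on the half space. -/
theorem garding {lam : ℝ} (hlam : 0 ≤ lam) {B : (Fin d → ℕ) → (Fin d → ℕ) → Fin n → Fin n → ℝ}
    (hB : LegHad d n m lam B) {w : Fin n → E → ℝ} (hw : ∀ i, ContDiff ℝ ∞ (w i))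
    (hc : ∀ i, HasCompactSupport (w i)) (hv : ∀ i, VanishOn N m univ (w i)) :
    lam * ∑ α ∈ MIdx d m, ∑ i, ∫ x in HalfSp N, DD α (w i) x ^ 2 ≤
      (MIdx d m).card * ∑ α ∈ MIdx d m, ∑ β ∈ MIdx d m, ∑ i, ∑ j,
        B α β i j * ∫ x in HalfSp N, DD α (w i) x * DD β (w j) x := by
  set W : Fin n → E → ℂ := fun i => 𝓕 (halfExt N (w i)) with hW
  set P : (Fin d → ℕ) → E → ℝ := fun α ξ => ∏ k, (2 * π * ξ k) ^ α k with hP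
  have key : ∀ α ∈ MIdx d m, ∀ β ∈ MIdx d m, ∀ i j, Integrable (fun ξ : E => P α ξ * P β ξ *
      ((W i ξ).re * (W j ξ).re + (W i ξ).im * (W j ξ).im)) ∧
      ∫ x in HalfSp N, DD α (w i) x * DD β (w j) x = ∫ ξ : E, P α ξ * P β ξ *
      ((W i ξ).re * (W j ξ).re + (W i ξ).im * (W j ξ).im) := fun α hα β hβ i j =>
    integral_DD_mul_eq_fourier (hw i) (hc i) (hv i) (hw j) (hc j) (hv j) hα hβ
  have lhs : lam * ∑ α ∈ MIdx d m, ∑ i, ∫ x in HalfSp N, DD α (w i) x ^ 2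
      = ∫ ξ : E, ∑ α ∈ MIdx d m, ∑ i, lam * (P α ξ * P α ξ *
      ((W i ξ).re * (W i ξ).re + (W i ξ).im * (W i ξ).im)) := by
    rw [integral_finsetSum _ fun α hα => integrable_finsetSum _ fun i _ =>
      ((key α hα α hα i i).1.const_mul lam), mul_sum]
    refine sum_congr rfl fun α hα => ?_
    rw [integral_finsetSum _ fun i _ => ((key α hα α hα i i).1.const_mul lam), mul_sum]
    refine sum_congr rfl fun i _ => ?_
    rw [integral_const_mul, ← (key α hα α hα i i).2]
    simp only [sq]
  have rhs : (MIdx d m).card * ∑ α ∈ MIdx d m, ∑ β ∈ MIdx d m, ∑ i, ∑ j,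
        B α β i j * ∫ x in HalfSp N, DD α (w i) x * DD β (w j) x
      = ∫ ξ : E, (MIdx d m).card * ∑ α ∈ MIdx d m, ∑ β ∈ MIdx d m, ∑ i, ∑ j,
        B α β i j * (P α ξ * P β ξ *
      ((W i ξ).re * (W j ξ).re + (W i ξ).im * (W j ξ).im)) := by
    rw [integral_const_mul]
    congr 1
    rw [integral_finsetSum _ fun α hα => integrable_finsetSum _ fun β hβ =>
      integrable_finsetSum _ fun i _ => integrable_finsetSum _ fun j _ =>
      ((key α hα β hβ i j).1.const_mul _)]
    refine sum_congr rfl fun α hα => ?_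
    rw [integral_finsetSum _ fun β hβ =>
      integrable_finsetSum _ fun i _ => integrable_finsetSum _ fun j _ =>
      ((key α hα β hβ i j).1.const_mul _)]
    refine sum_congr rfl fun β hβ => ?_
    rw [integral_finsetSum _ fun i _ => integrable_finsetSum _ fun j _ =>
      ((key α hα β hβ i j).1.const_mul _)]
    refine sum_congr rfl fun i _ => ?_
    rw [integral_finsetSum _ fun j _ =>
      ((key α hα β hβ i j).1.const_mul _)]
    refine sum_congr rfl fun j _ => ?_
    rw [integral_const_mul, ← (key α hα β hβ i j).2]
  rw [lhs, rhs]
  refine integral_mono (integrable_finsetSum _ fun α hα => integrable_finsetSum _ fun i _ =>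
      ((key α hα α hα i i).1.const_mul lam)) ((integrable_finsetSum _ fun α hα =>
      integrable_finsetSum _ fun β hβ =>
      integrable_finsetSum _ fun i _ => integrable_finsetSum _ fun j _ =>
      ((key α hα β hβ i j).1.const_mul _)).const_mul _) fun ξ => ?_
  set η : Fin d → ℝ := fun k => 2 * π * ξ k with hη
  have b1 := hB (fun i => (W i ξ).re) η
  have b2 := hB (fun i => (W i ξ).im) η
  have hs : ∀ α ∈ MIdx d m, P α ξ * P α ξ ≤ (∑ k, η k ^ 2) ^ m := by
    intro α hα
    rw [mem_MIdx] at hα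
    rw [← hα, ← Finset.prod_pow_eq_pow_sum, hP]
    simp only
    rw [← Finset.prod_mul_distrib]
    refine Finset.prod_le_prod (fun k _ => by rw [← sq]; positivity) fun k _ => ?_
    rw [← mul_pow, ← sq]
    refine pow_le_pow_left₀ (sq_nonneg _) ?_ _
    exact single_le_sum (f := fun k => η k ^ 2) (fun _ _ => sq_nonneg _) (Finset.mem_univ k)
  set Wn : ℝ := ∑ i, ((W i ξ).re * (W i ξ).re + (W i ξ).im * (W i ξ).im) with hWn
  have hWn0 : 0 ≤ Wn := sum_nonneg fun i _ => by
    nlinarith [sq_nonneg (W i ξ).re, sq_nonneg (W i ξ).im]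
  have hl : ∑ α ∈ MIdx d m, ∑ i, lam * (P α ξ * P α ξ *
      ((W i ξ).re * (W i ξ).re + (W i ξ).im * (W i ξ).im))
      ≤ (MIdx d m).card * (lam * Wn * (∑ k, η k ^ 2) ^ m) := by
    rw [← nsmul_eq_mul]
    refine sum_le_card_nsmul _ _ _ fun α hα => ?_
    rw [← mul_sum, ← mul_sum, mul_assoc lam]
    refine mul_le_mul_of_nonneg_left ?_ hlam
    rw [mul_comm]
    exact mul_le_mul_of_nonneg_left (hs α hα) hWn0
  refine hl.trans (mul_le_mul_of_nonneg_left ?_ (cast_nonneg _))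
  have hsum : lam * Wn * (∑ k, η k ^ 2) ^ m = lam * (∑ i, (W i ξ).re ^ 2) * (∑ k, η k ^ 2) ^ m
      + lam * (∑ i, (W i ξ).im ^ 2) * (∑ k, η k ^ 2) ^ m := by
    rw [hWn, sum_add_distrib]
    simp only [sq]; ring
  rw [hsum]
  refine (add_le_add b1 b2).trans (le_of_eq ?_)
  simp only [← sum_add_distrib]
  refine sum_congr rfl fun α _ => sum_congr rfl fun β _ =>
    sum_congr rfl fun i _ => sum_congr rfl fun j _ => ?_
  simp only [hP, hη]
  ring

section contDiffAlgebra
variable {V : Type*} [NormedAddCommGroup V] [NormedSpace ℝ V] {f g : V → ℝ}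

theorem contDiff_mul_fun (hf : ContDiff ℝ ∞ f) (hg : ContDiff ℝ ∞ g) : ContDiff ℝ ∞ (f * g) :=
  hf.mul hg

theorem contDiff_sub_fun (hf : ContDiff ℝ ∞ f) (hg : ContDiff ℝ ∞ g) : ContDiff ℝ ∞ (f - g) :=
  hf.sub hg

theorem contDiff_smul_fun (c : ℝ) (hf : ContDiff ℝ ∞ f) : ContDiff ℝ ∞ (c • f) :=
  contDiff_const.smul hf

theorem contDiff_zero_real : ContDiff ℝ ∞ (0 : V → ℝ) := contDiff_const

end contDiffAlgebra

/-- Differential operators of order `< k` with smooth coefficients supported in `S`. -/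
def IsLow (k : ℕ) (S : Set E) (T : (E → ℝ) → E → ℝ) : Prop :=
  ∃ c : (Fin d → ℕ) → E → ℝ, (∀ q, ContDiff ℝ ∞ (c q)) ∧ (∀ q, tsupport (c q) ⊆ S) ∧
    ∀ h, ContDiff ℝ ∞ h → T h = ∑ q ∈ MIdxLt d k, c q * DD q h

variable {k : ℕ} {S : Set (EuclideanSpace ℝ (Fin d))}
  {T U : (EuclideanSpace ℝ (Fin d) → ℝ) → EuclideanSpace ℝ (Fin d) → ℝ}

theorem IsLow.congr (hT : IsLow k S T) (h : ∀ f, ContDiff ℝ ∞ f → U f = T f) : IsLow k S U := by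
  obtain ⟨c, h1, h2, h3⟩ := hT
  exact ⟨c, h1, h2, fun f hf => by rw [h f hf, h3 f hf]⟩

theorem IsLow.add (hT : IsLow k S T) (hU : IsLow k S U) : IsLow k S fun h => T h + U h := by
  obtain ⟨c, h1, h2, h3⟩ := hT
  obtain ⟨c', h1', h2', h3'⟩ := hU
  refine ⟨fun q => c q + c' q, fun q => (h1 q).add (h1' q), fun q => ?_, fun h hh => ?_⟩
  · exact (tsupport_add (c q) (c' q)).trans (union_subset (h2 q) (h2' q))
  · simp only
    rw [h3 h hh, h3' h hh, ← sum_add_distrib]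
    exact sum_congr rfl fun q _ => by ring

theorem IsLow.zero : IsLow k S fun _ => 0 :=
  ⟨fun _ => 0, fun _ => contDiff_const, fun q => by simp [tsupport], fun h _ => by simp⟩

theorem IsLow.sum {ι : Type*} (s : Finset ι) {T : ι → (E → ℝ) → E → ℝ}
    (hT : ∀ i ∈ s, IsLow k S (T i)) : IsLow k S fun h => ∑ i ∈ s, T i h := by
  classical
  induction s using Finset.induction_on with
  | empty => simpa using IsLow.zero
  | insert a s ha ih =>
    simp only [sum_insert ha]
    exact (hT a (Finset.mem_insert_self a s)).add
      (ih fun i hi => hT i (Finset.mem_insert_of_mem hi))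

theorem IsLow.single {c : E → ℝ} (hc : ContDiff ℝ ∞ c) (hS : tsupport c ⊆ S) {q : Fin d → ℕ}
    (hq : ∑ i, q i < k) : IsLow k S fun h => c * DD q h := by
  classical
  refine ⟨fun p => if p = q then c else 0, fun p => ?_, fun p => ?_, fun h _ => ?_⟩
  · by_cases hp : p = q
    · simpa [hp] using hc
    · simpa [hp] using contDiff_zero_real (V := E)
  · by_cases hp : p = q
    · simpa [hp] using hS
    · simp [hp, tsupport]
  · simp only [ite_mul, zero_mul]
    rw [Finset.sum_ite_eq' (MIdxLt d k) q, if_pos (mem_MIdxLt.2 hq)]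

theorem contDiff_sum_mul_DD {s : Finset (Fin d → ℕ)} {c : (Fin d → ℕ) → E → ℝ}
    (hc : ∀ q, ContDiff ℝ ∞ (c q)) {h : E → ℝ} (hh : ContDiff ℝ ∞ h) :
    ContDiff ℝ ∞ (∑ q ∈ s, c q * DD q h) := by
  have := ContDiff.sum (𝕜 := ℝ) (n := ∞) (s := s) (f := fun q => c q * DD q h)
    fun q _ => (hc q).mul (contDiff_DD hh q)
  convert this using 1
  ext x; simp

theorem IsLow.pd (hT : IsLow k S T) (e : Fin d) : IsLow (k + 1) S fun h => pd e (T h) := by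
  obtain ⟨c, h1, h2, h3⟩ := hT
  refine IsLow.congr (T := fun h => ∑ q ∈ MIdxLt d k,
    (_root_.pd e (c q) * DD q h + c q * DD (q + Pi.single e 1) h)) ?_ ?_
  · refine IsLow.sum _ fun q hq => IsLow.add ?_ ?_
    · refine IsLow.single (contDiff_pd (h1 q) e) ?_ ?_
      · rw [← DD_single (h1 q)]
        exact (tsupport_DD_subset _ _).trans (h2 q)
      · exact (mem_MIdxLt.1 hq).trans (Nat.lt_succ_self _)
    · refine IsLow.single (h1 q) (h2 q) ?_
      have := mem_MIdxLt.1 hq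
      simp only [Pi.add_apply, sum_add_distrib]
      simp
      omega
  · intro f hf
    rw [h3 f hf, ← DD_single (contDiff_sum_mul_DD h1 hf), DD_sum]
    · refine sum_congr rfl fun q _ => ?_
      rw [DD_single (contDiff_mul_fun (h1 q) (contDiff_DD hf q)), pd_mul (h1 q) (contDiff_DD hf q),
        DD_add_single hf]
    · intro q _
      exact (h1 q).mul (contDiff_DD hf q)

theorem isLow_commutator {ψ : E → ℝ} (hψ : ContDiff ℝ ∞ ψ) (α : Fin d → ℕ) :
    IsLow (∑ i, α i) (tsupport ψ) fun h => DD α (ψ * h) - ψ * DD α h := by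
  induction α using multiIndex_induction with
  | h0 => exact IsLow.zero.congr fun f _ => by simp [DD_zero]
  | hs α e ih =>
    have hs : ∑ i, (α + Pi.single e 1 : Fin d → ℕ) i = ∑ i, α i + 1 := by
      simp [sum_add_distrib]
    rw [hs]
    refine ((ih.pd e).add (IsLow.single (c := pd e ψ) (q := α) (contDiff_pd hψ e) ?_
      (Nat.lt_succ_self _))).congr fun f hf => ?_
    · rw [← DD_single hψ]
      exact tsupport_DD_subset _ _
    · rw [DD_add_single (contDiff_mul_fun hψ hf), DD_add_single hf]
      have e1 : DD α (ψ * f) - ψ * DD α f = DD α (ψ * f) + (-1 : ℝ) • (ψ * DD α f) := by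
        ext x; simp [sub_eq_add_neg]
      have c2 := contDiff_mul_fun hψ (contDiff_DD hf α)
      rw [e1, pd_add (contDiff_DD (contDiff_mul_fun hψ hf) α) (contDiff_smul_fun (-1) c2),
        pd_const_smul c2, pd_mul hψ (contDiff_DD hf α)]
      ext x; simp; ring

theorem IsLow.contDiff (hT : IsLow k S T) {h : E → ℝ} (hh : ContDiff ℝ ∞ h) :
    ContDiff ℝ ∞ (T h) := by
  obtain ⟨c, h1, -, h3⟩ := hT
  rw [h3 h hh]
  exact contDiff_sum_mul_DD h1 hh

theorem IsLow.mono {k k' : ℕ} {S : Set E} {T : (E → ℝ) → E → ℝ} (hT : IsLow k S T) (hk : k ≤ k') :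
    IsLow k' S T := by
  obtain ⟨c, h1, h2, h3⟩ := hT
  refine (IsLow.sum (MIdxLt d k) (T := fun q h => c q * DD q h) fun q hq =>
    IsLow.single (h1 q) (h2 q) ((mem_MIdxLt.1 hq).trans_le hk)).congr h3

theorem isLow_DD_mul {φ : E → ℝ} (hφ : ContDiff ℝ ∞ φ) {q : Fin d → ℕ} {k : ℕ}
    (hq : ∑ i, q i < k) : IsLow k (tsupport φ) fun h => DD q (φ * h) :=
  (((isLow_commutator hφ q).mono hq.le).add (IsLow.single hφ subset_rfl hq)).congr
    fun f _ => by simp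

theorem integrableOn_halfSp_inter {S : Set E} (hS : IsCompact S) {f : E → ℝ} (hf : Continuous f) :
    IntegrableOn f (HalfSp N ∩ S) :=
  (hf.continuousOn.integrableOn_compact hS).mono_set inter_subset_right

/-- Sum of squared `L²` norms of the derivatives of order `< m` over the half space part of `S`. -/
def lowEn (N : Fin d) (m : ℕ) (S : Set E) (f : E → ℝ) : ℝ :=
  ∑ q ∈ MIdxLt d m, ∫ x in HalfSp N ∩ S, DD q f x ^ 2

theorem lowEn_nonneg {S : Set E} {f : E → ℝ} : 0 ≤ lowEn N m S f :=
  sum_nonneg fun _ _ => integral_nonneg fun _ => sq_nonneg _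

theorem IsLow.bound {k : ℕ} {S : Set E} {T : (E → ℝ) → E → ℝ} (hT : IsLow k S T)
    (hS : IsCompact S) : ∃ C, 0 ≤ C ∧ ∀ h, ContDiff ℝ ∞ h →
      HasCompactSupport (T h) ∧ ∫ x in HalfSp N, T h x ^ 2 ≤ C * lowEn N k S h := by
  obtain ⟨c, h1, h2, h3⟩ := id hT
  have hM : ∀ q, ∃ M, ∀ x, |c q x| ≤ M := fun q =>
    (h1 q).continuous.bounded_above_of_compact_support
      (hS.of_isClosed_subset (isClosed_tsupport _) (h2 q))
  choose M hM using hM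
  have hM0 : ∀ q, 0 ≤ M q := fun q => (abs_nonneg _).trans (hM q 0)
  refine ⟨(MIdxLt d k).card * ∑ q ∈ MIdxLt d k, M q ^ 2, by positivity, fun h hh => ?_⟩
  have hz : ∀ x, x ∉ S → T h x = 0 := by
    intro x hx
    rw [h3 h hh, Finset.sum_apply]
    refine sum_eq_zero fun q _ => ?_
    have : c q x = 0 := image_eq_zero_of_notMem_tsupport fun hc => hx (h2 q hc)
    simp [this]
  have hsup : HasCompactSupport (T h) := HasCompactSupport.intro hS hz
  refine ⟨hsup, ?_⟩
  have e : ∫ x in HalfSp N, T h x ^ 2 = ∫ x in HalfSp N ∩ S, T h x ^ 2 := by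
    rw [← setIntegral_indicator hS.measurableSet]
    congr 1; funext x
    by_cases hx : x ∈ S
    · simp [hx]
    · simp [hx, hz x hx]
  rw [e, lowEn, mul_sum]
  have hi : ∀ q ∈ MIdxLt d k, IntegrableOn (fun x => DD q h x ^ 2) (HalfSp N ∩ S) := fun q _ =>
    integrableOn_halfSp_inter hS ((contDiff_DD hh q).continuous.pow 2)
  simp only [← integral_const_mul]
  rw [← integral_finsetSum _ fun q hq => (hi q hq).const_mul _]
  refine integral_mono (integrableOn_halfSp_inter hS ((hT.contDiff hh).continuous.pow 2))
    (integrable_finsetSum _ fun q hq => (hi q hq).const_mul _) fun x => ?_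
  simp only
  rw [h3 h hh, Finset.sum_apply, ← mul_sum, mul_assoc]
  refine (sq_sum_le_card_mul_sum_sq).trans (mul_le_mul_of_nonneg_left ?_ (cast_nonneg _))
  rw [mul_sum]
  refine sum_le_sum fun q hq => ?_
  rw [Pi.mul_apply, mul_pow]
  refine mul_le_mul_of_nonneg_right ?_ (sq_nonneg _)
  calc c q x ^ 2 ≤ M q ^ 2 := sq_le_sq' (by linarith [neg_le_of_abs_le (hM q x)])
        (le_of_abs_le (hM q x))
    _ ≤ _ := single_le_sum (f := fun q => M q ^ 2) (fun _ _ => sq_nonneg _) hq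

theorem integral_halfSp_mul_DD {f g : E → ℝ} (hf : ContDiff ℝ ∞ f) (hg : ContDiff ℝ ∞ g)
    (hc : HasCompactSupport g) (α : Fin d → ℕ) : VanishOn N (α N) univ g →
    ∫ x in HalfSp N, g x * DD α f x = (-1) ^ (∑ i, α i) * ∫ x in HalfSp N, DD α g x * f x := by
  induction α using multiIndex_induction generalizing g with
  | h0 => intro _; simp [DD_zero]
  | hs α e ih =>
    intro hv
    have hs : ∑ i, (α + Pi.single e 1 : Fin d → ℕ) i = ∑ i, α i + 1 := by
      simp [sum_add_distrib]
    rw [hs, DD_add_single hf, DD_add_single hg, pd_DD hg]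
    have h1 := integral_halfSp_pd_mul (N := N) hg (contDiff_DD hf α) hc e ?_
    · have h2 := ih (contDiff_pd hg e) (hasCompactSupport_pd hg hc e) ?_
      · rw [h2] at h1
        rw [pow_succ]; linarith
      · rw [← DD_single hg]
        exact hv.DD hg _ le_rfl
    · rintro rfl x hx
      have := hv 0 (by simp) x trivial hx
      rwa [DD_zero] at this

theorem abs_integral_mul_le {μ : Measure E} {a b : E → ℝ} (ha : Integrable (fun x => a x ^ 2) μ)
    (hb : Integrable (fun x => b x ^ 2) μ) {ε : ℝ} (hε : 0 < ε) :
    |∫ x, a x * b x ∂μ| ≤ ε * ∫ x, a x ^ 2 ∂μ + ε⁻¹ * ∫ x, b x ^ 2 ∂μ := by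
  rw [← integral_const_mul, ← integral_const_mul, ← integral_add (ha.const_mul _) (hb.const_mul _),
    ← norm_eq_abs]
  refine norm_integral_le_of_norm_le ((ha.const_mul _).add (hb.const_mul _)) ?_
  refine of_forall fun x => ?_
  rw [norm_eq_abs, abs_mul]
  have h1 : 0 ≤ (ε * |a x| - |b x|) ^ 2 := sq_nonneg _
  have h2 : |a x| * |b x| * 2 ≤ ε * a x ^ 2 + ε⁻¹ * b x ^ 2 := by
    rw [← sq_abs (a x), ← sq_abs (b x)]
    have : ε * |a x| ^ 2 + ε⁻¹ * |b x| ^ 2 - |a x| * |b x| * 2 = ε⁻¹ * (ε * |a x| - |b x|) ^ 2 := by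
      field_simp; ring
    have h3 : 0 ≤ ε⁻¹ * (ε * |a x| - |b x|) ^ 2 := by positivity
    linarith
  nlinarith [mul_nonneg (abs_nonneg (a x)) (abs_nonneg (b x))]

/-- Sum of squared `L²` norms of the derivatives of order `m` over the half space. -/
def topEn (N : Fin d) (m : ℕ) (f : E → ℝ) : ℝ := ∑ α ∈ MIdx d m, ∫ x in HalfSp N, DD α f x ^ 2

theorem topEn_nonneg {f : E → ℝ} : 0 ≤ topEn N m f :=
  sum_nonneg fun _ _ => integral_nonneg fun _ => sq_nonneg _

theorem integrable_sq_of_compact {f : E → ℝ} (hf : Continuous f) (hc : HasCompactSupport f) :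
    Integrable fun x => f x ^ 2 := by
  have h : HasCompactSupport fun x => f x ^ 2 := by
    have h2 : HasCompactSupport (f * f) := hc.mul_right
    convert h2 using 1
    funext x; simp [pow_two]
  exact Continuous.integrable_of_hasCompactSupport (hf.pow 2) h

theorem integral_halfSp_inter_sq_le {f : E → ℝ} (hf : Continuous f) (hc : HasCompactSupport f)
    (S : Set E) : ∫ x in HalfSp N ∩ S, f x ^ 2 ≤ ∫ x in HalfSp N, f x ^ 2 := by
  have hi : IntegrableOn (fun x => f x ^ 2) (HalfSp N) :=
    (integrable_sq_of_compact hf hc).integrableOn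
  exact setIntegral_mono_set hi (of_forall fun _ => sq_nonneg _)
    inter_subset_left.eventuallyLE

theorem lowEn_mul_bound {φ : E → ℝ} (hφ : ContDiff ℝ ∞ φ) (hφc : HasCompactSupport φ) :
    ∃ C, 0 ≤ C ∧ ∀ f, ContDiff ℝ ∞ f → lowEn N m (tsupport φ) (φ * f)
      ≤ C * lowEn N m (tsupport φ) f := by
  have h : ∀ q ∈ MIdxLt d m, ∃ C, 0 ≤ C ∧ ∀ h, ContDiff ℝ ∞ h →
      HasCompactSupport (DD q (φ * h)) ∧
      ∫ x in HalfSp N, DD q (φ * h) x ^ 2 ≤ C * lowEn N m (tsupport φ) h := fun q hq =>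
    (isLow_DD_mul hφ (mem_MIdxLt.1 hq)).bound hφc
  choose! C hC0 hC using h
  refine ⟨∑ q ∈ MIdxLt d m, C q, sum_nonneg hC0, fun f hf => ?_⟩
  rw [sum_mul]
  refine sum_le_sum fun q hq => le_trans ?_ ((hC q hq f hf).2)
  exact integral_halfSp_inter_sq_le (contDiff_DD (contDiff_mul_fun hφ hf) q).continuous
    (hC q hq f hf).1 _

theorem lowEn_succ {S : Set E} {f : E → ℝ} (hf : ContDiff ℝ ∞ f) (hc : HasCompactSupport f) :
    lowEn N (m + 1) S f ≤ topEn N m f + lowEn N m S f := by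
  classical
  have hu : MIdxLt d (m + 1) = MIdx d m ∪ MIdxLt d m := by
    ext q; simp only [Finset.mem_union, mem_MIdx, mem_MIdxLt]; omega
  unfold lowEn topEn
  rw [hu]
  have hd : Disjoint (MIdx d m) (MIdxLt d m) := by
    rw [Finset.disjoint_left]; intro q; simp only [mem_MIdx, mem_MIdxLt]; omega
  rw [Finset.sum_union hd]
  refine add_le_add (sum_le_sum fun q _ => ?_) le_rfl
  exact integral_halfSp_inter_sq_le (contDiff_DD hf q).continuous (hasCompactSupport_DD hc q) _

theorem vanishOn_univ_mul {φ f : E → ℝ} (hφ : ContDiff ℝ ∞ φ) (hf : ContDiff ℝ ∞ f)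
    (hv : VanishOn N m (tsupport φ) f) : VanishOn N m univ (φ * f) := by
  intro γ hγ x _ hx
  by_cases hxs : x ∈ tsupport φ
  · exact vanishOn_mul hφ hf hv γ hγ x hxs hx
  · exact image_eq_zero_of_notMem_tsupport fun hc =>
      hxs ((tsupport_DD_subset _ _).trans (tsupport_mul_subset_left) hc)

theorem form_perturbation (hm : 1 ≤ m) {φ : E → ℝ} (hφ : ContDiff ℝ ∞ φ)
    (hφc : HasCompactSupport φ) {α β : Fin d → ℕ} (hα : α ∈ MIdx d m) (hβ : β ∈ MIdx d m)
    {ε : ℝ} (hε : 0 < ε) :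
    ∃ C, 0 ≤ C ∧ ∀ f g, ContDiff ℝ ∞ f → ContDiff ℝ ∞ g → VanishOn N m (tsupport φ) f →
      VanishOn N m (tsupport φ) g →
      |(-1) ^ m * (∫ x in HalfSp N, (φ * (φ * f)) x * DD (α + β) g x)
        - ∫ x in HalfSp N, DD α (φ * f) x * DD β (φ * g) x|
      ≤ ε * (topEn N m (φ * f)) +
        C * (lowEn N m (tsupport φ) f + lowEn N m (tsupport φ) g) := by
  rw [mem_MIdx] at hα hβ
  obtain ⟨e, he⟩ : ∃ e, β e ≠ 0 := by
    by_contra! h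
    simp [h] at hβ; omega
  obtain ⟨β', rfl⟩ : ∃ β' : Fin d → ℕ, β = β' + Pi.single e 1 := by
    refine ⟨β - Pi.single e 1, ?_⟩
    funext i
    by_cases hi : i = e
    · subst hi; simp; omega
    · simp [hi]
  have hβ' : ∑ i, β' i < m := by
    simp [sum_add_distrib] at hβ; omega
  have hSc : IsCompact (tsupport φ) := hφc
  have lowR := isLow_commutator hφ α
  have lowS := isLow_commutator hφ (β' + Pi.single e 1)
  rw [hα] at lowR
  rw [hβ] at lowS
  obtain ⟨C1, hC1, h1⟩ := lowS.bound (N := N) hSc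
  obtain ⟨C2, hC2, h2⟩ := (lowR.pd e).bound (N := N) hSc
  obtain ⟨C3, hC3, h3⟩ := lowEn_mul_bound (N := N) (m := m) hφ hφc
  obtain ⟨C4, hC4, h4⟩ := lowR.bound (N := N) hSc
  set ε' : ℝ := ε / (2 * (C2 + 1)) with hε'
  have hε'0 : 0 < ε' := by positivity
  refine ⟨(ε / 2)⁻¹ * C1 + ε' * C2 * C3 + ε'⁻¹, by positivity, ?_⟩
  intro f g hf hg hvf hvg
  set h := φ * f with hh
  have sh : ContDiff ℝ ∞ h := contDiff_mul_fun hφ hf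
  have ch : HasCompactSupport h := hφc.mul_right
  have vh : VanishOn N m univ h := vanishOn_univ_mul hφ hf hvf
  have shh : ContDiff ℝ ∞ (φ * h) := contDiff_mul_fun hφ sh
  have chh : HasCompactSupport (φ * h) := hφc.mul_right
  have hαN : α N ≤ m := hα ▸ single_le_sum (f := α) (fun _ _ => Nat.zero_le _)
    (Finset.mem_univ N)
  have vhh : VanishOn N m univ (φ * h) := vanishOn_mul hφ sh vh
  have step1 := integral_halfSp_mul_DD (N := N) (contDiff_DD hg (β' + Pi.single e 1)) shh chh α
    (fun γ hγ => vhh γ (hγ.trans_le hαN))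
  rw [DD_add_index hg, step1, hα, ← mul_assoc, ← mul_pow]
  simp only [mul_neg, mul_one, neg_neg, one_pow, one_mul]
  set R := DD α (φ * h) - φ * DD α h with hR
  have sR : ContDiff ℝ ∞ R := lowR.contDiff sh
  have cR : HasCompactSupport R := (h4 h sh).1
  set Sg := DD (β' + Pi.single e 1) (φ * g) - φ * DD (β' + Pi.single e 1) g with hSg
  have sSg : ContDiff ℝ ∞ Sg := lowS.contDiff hg
  have cSg : HasCompactSupport Sg := (h1 g hg).1
  have R0 : ∀ x, x N = 0 → R x = 0 := by
    intro x hx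
    obtain ⟨c, -, -, h3c⟩ := lowR
    have hc' := congrFun (h3c h sh) x
    simp only at hc'
    rw [hR, hc', Finset.sum_apply]
    refine sum_eq_zero fun q hq => ?_
    have hqN : q N < m := lt_of_le_of_lt (single_le_sum (f := q) (fun _ _ => Nat.zero_le _)
      (Finset.mem_univ N)) (mem_MIdxLt.1 hq)
    simp [vh q hqN x trivial hx]
  have step2 := integral_halfSp_pd_mul (N := N) sR (contDiff_DD hg β') cR e (fun _ => R0)
  rw [← DD_add_single hg] at step2
  have sDh := contDiff_DD sh α
  have cDh := hasCompactSupport_DD ch α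
  have i1 : Integrable fun x => DD α h x * DD (β' + Pi.single e 1) (φ * g) x :=
    (sDh.continuous.mul (contDiff_DD (contDiff_mul_fun hφ hg) _).continuous
      ).integrable_of_hasCompactSupport cDh.mul_right
  have i2 : Integrable fun x => DD α h x * Sg x :=
    (sDh.continuous.mul sSg.continuous).integrable_of_hasCompactSupport cDh.mul_right
  have i3 : Integrable fun x => R x * DD (β' + Pi.single e 1) g x :=
    (sR.continuous.mul (contDiff_DD hg _).continuous).integrable_of_hasCompactSupport cR.mul_right
  have step3 : ∫ x in HalfSp N, DD α (φ * h) x * DD (β' + Pi.single e 1) g x =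
      (∫ x in HalfSp N, DD α h x * DD (β' + Pi.single e 1) (φ * g) x)
      - (∫ x in HalfSp N, DD α h x * Sg x)
      + ∫ x in HalfSp N, R x * DD (β' + Pi.single e 1) g x := by
    have i4 : Integrable (fun x => DD α h x * DD (β' + Pi.single e 1) (φ * g) x - DD α h x * Sg x)
        (volume.restrict (HalfSp N)) := i1.restrict.sub i2.restrict
    rw [← integral_sub i1.restrict i2.restrict, ← integral_add i4 i3.restrict]
    congr 1; funext x
    simp only [hR, hSg, Pi.sub_apply, Pi.mul_apply]
    ring
  have step4 : ∫ x in HalfSp N, pd e R x * DD β' g x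
      = ∫ x in HalfSp N ∩ tsupport φ, pd e R x * DD β' g x := by
    rw [← setIntegral_indicator hSc.measurableSet]
    congr 1; funext x
    by_cases hx : x ∈ tsupport φ
    · simp [hx]
    · have : pd e R x = 0 := by
        obtain ⟨c, -, h2c, h3c⟩ := lowR.pd e
        have := congrFun (h3c h sh) x
        simp only at this
        rw [hR, this, Finset.sum_apply]
        refine sum_eq_zero fun q _ => ?_
        have : c q x = 0 := image_eq_zero_of_notMem_tsupport fun hc => hx (h2c q hc)
        simp [this]
      simp [hx, this]
  rw [step3]
  have b1 := abs_integral_mul_le (μ := volume.restrict (HalfSp N)) (a := DD α h) (b := Sg)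
    (integrable_sq_of_compact sDh.continuous cDh).restrict
    (integrable_sq_of_compact sSg.continuous cSg).restrict (half_pos hε)
  have b2 := abs_integral_mul_le (μ := volume.restrict (HalfSp N ∩ tsupport φ)) (a := pd e R)
    (b := DD β' g)
    (integrable_sq_of_compact (contDiff_pd sR e).continuous (h2 h sh).1).restrict
    (integrableOn_halfSp_inter hSc ((contDiff_DD hg β').continuous.pow 2)) hε'0
  have b3 : ∫ x in HalfSp N, DD α h x ^ 2 ≤ topEn N m h :=
    single_le_sum (f := fun α => ∫ x in HalfSp N, DD α h x ^ 2)
      (fun _ _ => integral_nonneg fun _ => sq_nonneg _) (mem_MIdx.2 hα)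
  have b4 : ∫ x in HalfSp N, Sg x ^ 2 ≤ C1 * lowEn N m (tsupport φ) g := (h1 g hg).2
  have b5 : ∫ x in HalfSp N ∩ tsupport φ, pd e R x ^ 2 ≤
      C2 * (topEn N m h + C3 * lowEn N m (tsupport φ) f) := by
    refine le_trans (integral_halfSp_inter_sq_le (contDiff_pd sR e).continuous (h2 h sh).1 _) (((h2 h sh).2).trans ?_)
    refine mul_le_mul_of_nonneg_left ?_ hC2
    exact (lowEn_succ sh ch).trans (add_le_add le_rfl (h3 f hf))
  have b6 : ∫ x in HalfSp N ∩ tsupport φ, DD β' g x ^ 2 ≤ lowEn N m (tsupport φ) g :=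
    single_le_sum (f := fun q => ∫ x in HalfSp N ∩ tsupport φ, DD q g x ^ 2)
      (fun _ _ => integral_nonneg fun _ => sq_nonneg _) (mem_MIdxLt.2 hβ')
  rw [step4] at step2
  have hfin : ∀ a b c : ℝ, |a - b + c - a| ≤ |b| + |c| := fun a b c => by
    rw [show a - b + c - a = -b + c by ring]
    exact (abs_add_le _ _).trans (by rw [abs_neg])
  refine (hfin _ _ _).trans ?_
  have e3 : |∫ x in HalfSp N, R x * DD (β' + Pi.single e 1) g x|
      = |∫ x in HalfSp N ∩ tsupport φ, pd e R x * DD β' g x| := by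
    rw [step2, abs_neg]
  rw [e3]
  have hX : 0 ≤ topEn N m h := topEn_nonneg
  have hYf : 0 ≤ lowEn N m (tsupport φ) f := lowEn_nonneg
  have hYg : 0 ≤ lowEn N m (tsupport φ) g := lowEn_nonneg
  have m1 := mul_le_mul_of_nonneg_left b3 (half_pos hε).le
  have m2 := mul_le_mul_of_nonneg_left b4 (inv_pos.2 (half_pos hε)).le
  have m3 := mul_le_mul_of_nonneg_left b5 hε'0.le
  have m4 := mul_le_mul_of_nonneg_left b6 (inv_pos.2 hε'0).le
  have m5 : ε' * C2 ≤ ε / 2 := by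
    rw [hε']
    rw [div_mul_eq_mul_div, div_le_div_iff₀ (by positivity) (by norm_num)]
    nlinarith
  have m6 := mul_le_mul_of_nonneg_right m5 hX
  have p1 : 0 ≤ (ε / 2)⁻¹ * C1 * lowEn N m (tsupport φ) f := by positivity
  have p2 : 0 ≤ ε' * C2 * C3 * lowEn N m (tsupport φ) g := by positivity
  have p3 : 0 ≤ ε'⁻¹ * lowEn N m (tsupport φ) f := by positivity
  nlinarith

theorem MIdx_card_pos (hd : 1 ≤ d) : 0 < (MIdx d m).card := by
  classical
  refine Finset.card_pos.2 ⟨Pi.single ⟨0, hd⟩ m, mem_MIdx.2 ?_⟩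
  simp

theorem localized_garding (hd : 1 ≤ d) (hm : 1 ≤ m) {lam K : ℝ} (hlam : 0 < lam) (hK : 0 ≤ K)
    {φ : E → ℝ} (hφ : ContDiff ℝ ∞ φ) (hφc : HasCompactSupport φ) :
    ∃ C, 0 ≤ C ∧ ∀ B, LegHad d n m lam B → (∀ α β i j, |B α β i j| ≤ K) →
      ∀ v : Fin n → E → ℝ, (∀ i, ContDiff ℝ ∞ (v i)) → (∀ i, VanishOn N m (tsupport φ) (v i)) →
      lam / (2 * (MIdx d m).card) * ∑ i, topEn N m (φ * v i) ≤
        (-1) ^ m * (∑ α ∈ MIdx d m, ∑ β ∈ MIdx d m, ∑ i, ∑ j,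
          B α β i j * ∫ x in HalfSp N, (φ * (φ * v i)) x * DD (α + β) (v j) x)
        + C * ∑ i, lowEn N m (tsupport φ) (v i) := by
  have hM : (0 : ℝ) < (MIdx d m).card := by exact_mod_cast MIdx_card_pos hd
  set M : ℝ := ((MIdx d m).card : ℝ) with hMdef
  set ε : ℝ := lam / (2 * M * (K * M ^ 2 * n + 1)) with hε
  have hε0 : 0 < ε := by positivity
  have hP : ∀ α β, ∃ C, 0 ≤ C ∧ (α ∈ MIdx d m → β ∈ MIdx d m →
      ∀ f g, ContDiff ℝ ∞ f → ContDiff ℝ ∞ g → VanishOn N m (tsupport φ) f →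
      VanishOn N m (tsupport φ) g →
      |(-1) ^ m * (∫ x in HalfSp N, (φ * (φ * f)) x * DD (α + β) g x)
        - ∫ x in HalfSp N, DD α (φ * f) x * DD β (φ * g) x|
      ≤ ε * (topEn N m (φ * f)) +
        C * (lowEn N m (tsupport φ) f + lowEn N m (tsupport φ) g)) := by
    intro α β
    by_cases h : α ∈ MIdx d m ∧ β ∈ MIdx d m
    · obtain ⟨C, hC, h⟩ := form_perturbation (N := N) hm hφ hφc h.1 h.2 hε0
      exact ⟨C, hC, fun _ _ => h⟩
    · exact ⟨0, le_rfl, fun h1 h2 => absurd ⟨h1, h2⟩ h⟩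
  choose C hC0 hC using hP
  refine ⟨∑ α ∈ MIdx d m, ∑ β ∈ MIdx d m, K * C α β * (2 * n), by
    refine sum_nonneg fun α _ => sum_nonneg fun β _ => ?_
    have := hC0 α β
    positivity, fun B hB hBK v hv hvan => ?_⟩
  have g0 := garding (N := N) hlam.le hB (fun i => contDiff_mul_fun hφ (hv i))
    (fun i => hφc.mul_right) (fun i => vanishOn_univ_mul hφ (hv i) (hvan i))
  set L := ∑ i, lowEn N m (tsupport φ) (v i) with hL
  set X := ∑ i, topEn N m (φ * v i) with hX
  have hXt : ∑ α ∈ MIdx d m, ∑ i, ∫ x in HalfSp N, DD α (φ * v i) x ^ 2 = X := by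
    rw [sum_comm]; rfl
  rw [hXt] at g0
  have key : ∀ α ∈ MIdx d m, ∀ β ∈ MIdx d m,
      ∑ i, ∑ j, B α β i j * ∫ x in HalfSp N, DD α (φ * v i) x * DD β (φ * v j) x
      ≤ (-1) ^ m * (∑ i, ∑ j, B α β i j * ∫ x in HalfSp N, (φ * (φ * v i)) x * DD (α + β) (v j) x)
        + (K * n * ε * X + K * C α β * (2 * n) * L) := by
    intro α hα β hβ
    have hsum : ∑ i : Fin n, ∑ j : Fin n, K * (ε * topEn N m (φ * v i) + C α β *
        (lowEn N m (tsupport φ) (v i) + lowEn N m (tsupport φ) (v j)))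
        = K * n * ε * X + K * C α β * (2 * n) * L := by
      simp only [mul_add, sum_add_distrib, ← mul_sum, Finset.sum_const,
        Finset.card_univ, Fintype.card_fin, nsmul_eq_mul]
      rw [hX, hL]; ring
    rw [← hsum, mul_sum, ← sum_add_distrib]
    refine sum_le_sum fun i _ => ?_
    rw [mul_sum, ← sum_add_distrib]
    refine sum_le_sum fun j _ => ?_
    have h1 := hC α β hα hβ (v i) (v j) (hv i) (hv j) (hvan i) (hvan j)
    set I1 := ∫ x in HalfSp N, (φ * (φ * v i)) x * DD (α + β) (v j) x
    set I2 := ∫ x in HalfSp N, DD α (φ * v i) x * DD β (φ * v j) x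
    set D := ε * topEn N m (φ * v i) + C α β *
        (lowEn N m (tsupport φ) (v i) + lowEn N m (tsupport φ) (v j))
    have h2 : B α β i j * (I2 - (-1) ^ m * I1) ≤ K * D := by
      refine (le_abs_self _).trans ?_
      rw [abs_mul, abs_sub_comm]
      exact mul_le_mul (hBK α β i j) h1 (abs_nonneg _) hK
    linarith [h2, mul_sub (B α β i j) I2 ((-1) ^ m * I1)]
  have hs := sum_le_sum fun α hα => sum_le_sum fun β hβ => key α hα β hβ
  simp only [sum_add_distrib, ← mul_sum, ← sum_mul, Finset.sum_const,
    nsmul_eq_mul, ← hMdef] at hs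
  have hX0 : 0 ≤ X := sum_nonneg fun _ _ => topEn_nonneg
  set F1 := ∑ α ∈ MIdx d m, ∑ β ∈ MIdx d m, ∑ i, ∑ j,
        B α β i j * ∫ x in HalfSp N, DD α (φ * v i) x * DD β (φ * v j) x with hF1
  have e1 : M * (M * (K * n * ε * X)) ≤ lam / (2 * M) * X := by
    have : lam / (2 * M) = ε * (K * M ^ 2 * n + 1) := by rw [hε]; field_simp
    rw [this]
    nlinarith [mul_nonneg hε0.le hX0]
  have e2 : lam / M * X ≤ F1 := by
    rw [div_mul_eq_mul_div, div_le_iff₀ hM]; linarith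
  have e3 : lam / M * X = lam / (2 * M) * X + lam / (2 * M) * X := by field_simp; ring
  simp only [← sum_mul, ← mul_sum] at *
  linarith

theorem halfSp_inter_ae_eq (S : Set E) :
    (HalfSp N ∩ S : Set E) =ᵐ[volume] ({x : E | 0 ≤ x N} ∩ S : Set E) := by
  refine EventuallyEq.inter ?_ (ae_eq_refl _)
  have h : ∀ᵐ x : E, x N ≠ 0 := by
    have := volume_hyperplane (N := N)
    rw [ae_iff]; simpa using this
  filter_upwards [h] with x hx
  refine propext ⟨fun h => le_of_lt h, fun h => lt_of_le_of_ne h (Ne.symm hx)⟩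

theorem continuous_integral_slice {S : Set E} (hS : IsCompact S) {F : ℝ × E → ℝ}
    (hF : Continuous F) : Continuous fun t => ∫ x in HalfSp N ∩ S, F (t, x) := by
  have hc : IsCompact ({x : E | 0 ≤ x N} ∩ S) :=
    hS.inter_left (isClosed_le continuous_const (continuous_coord N))
  have := continuous_parametric_integral_of_continuous (μ := (volume : Measure E))
    (f := fun t x => F (t, x)) hF hc
  convert this using 2 with t
  exact setIntegral_congr_set (halfSp_inter_ae_eq S)

theorem hasDerivAt_integral_slice {S : Set E} (hS : IsCompact S) {F : ℝ × E → ℝ}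
    (hF : ContDiff ℝ ∞ F) (t : ℝ) :
    HasDerivAt (fun s => ∫ x in HalfSp N ∩ S, F (s, x)) (∫ x in HalfSp N ∩ S, tder F (t, x)) t := by
  have hT := (contDiff_tder hF).continuous
  obtain ⟨C, hC⟩ := ((isCompact_closedBall t 1).prod hS).exists_bound_of_continuousOn
    hT.continuousOn
  have hfin : volume (HalfSp N ∩ S) < ⊤ :=
    (measure_mono inter_subset_right).trans_lt hS.measure_lt_top
  refine (hasDerivAt_integral_of_dominated_loc_of_deriv_le (μ := volume.restrict (HalfSp N ∩ S))
    (F := fun s x => F (s, x)) (F' := fun s x => tder F (s, x)) (bound := fun _ => C)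
    (ball_mem_nhds t one_pos) ?_ ?_ ?_ ?_ ?_ ?_).2
  · refine of_forall fun s => ?_
    exact ((contDiff_slice hF s).continuous).aestronglyMeasurable
  · exact integrableOn_halfSp_inter hS (contDiff_slice hF t).continuous
  · exact ((contDiff_slice (contDiff_tder hF) t).continuous).aestronglyMeasurable
  · refine (ae_restrict_iff' (isOpen_halfSp.measurableSet.inter hS.measurableSet)).2 ?_
    exact of_forall fun x hx s hs => hC (s, x) ⟨ball_subset_closedBall hs, hx.2⟩
  · exact integrableOn_const hfin.ne
  · exact of_forall fun x s _ => hasDerivAt_tder hF s x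

/-- Smooth solutions of the homogeneous Dirichlet problem in the unit half cylinder. -/
structure IsSol (N : Fin d) (m : ℕ) (A : (Fin d → ℕ) → (Fin d → ℕ) → ℝ → Fin n → Fin n → ℝ)
    (w : Fin n → ℝ × E → ℝ) : Prop where
  smooth : ∀ i, ContDiff ℝ ∞ (w i)
  eqn : ∀ᵐ t ∂(volume.restrict (Ioo (-1 : ℝ) 0)), ∀ x ∈ ball (0 : E) 1,
    0 < x N → ∀ i, tder (w i) (t, x) + (-1) ^ m * ∑ α ∈ MIdx d m, ∑ β ∈ MIdx d m, ∑ j,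
      A α β t i j * Dmul (α + β) (w j) (t, x) = 0
  bdry : ∀ t ∈ Ioo (-1 : ℝ) 0, ∀ i, VanishOn N m (ball 0 1) fun x => w i (t, x)

/-- The coefficients are measurable, bounded and elliptic. -/
structure IsCoeff (d n m : ℕ) (lam K : ℝ)
    (A : (Fin d → ℕ) → (Fin d → ℕ) → ℝ → Fin n → Fin n → ℝ) : Prop where
  meas : ∀ α β i j, Measurable fun t => A α β t i j
  bound : ∀ α β t i j, |A α β t i j| ≤ K
  ellip : ∀ t : ℝ, LegHad d n m lam (fun α β => A α β t)

theorem continuous_lowEn_slice {S : Set E} (hS : IsCompact S) {k : ℕ} {w : ℝ × E → ℝ}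
    (hw : ContDiff ℝ ∞ w) : Continuous fun t => lowEn N k S fun x => w (t, x) := by
  unfold lowEn
  refine continuous_finsetSum _ fun q _ => ?_
  have := continuous_integral_slice (N := N) hS ((contDiff_Dmul hw q).continuous.pow 2)
  convert this using 4
  rw [Pi.pow_apply, Dmul_apply]

theorem continuous_topEn_slice {φ : E → ℝ} (hφ : ContDiff ℝ ∞ φ)
    (hφc : HasCompactSupport φ) {k : ℕ} {w : ℝ × E → ℝ}
    (hw : ContDiff ℝ ∞ w) : Continuous fun t => topEn N k (φ * fun x => w (t, x)) := by
  unfold topEn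
  refine continuous_finsetSum _ fun q _ => ?_
  have hF : ContDiff ℝ ∞ fun p : ℝ × E => φ p.2 * w p := (hφ.comp contDiff_snd).mul hw
  have h := continuous_integral_slice (N := N) hφc ((contDiff_Dmul hF q).continuous.pow 2)
  convert h using 2 with t
  rw [← setIntegral_indicator (isClosed_tsupport φ).measurableSet]
  congr 1; funext x
  simp only [Pi.pow_apply, Dmul_apply]
  change DD q (φ * fun x => w (t, x)) x ^ 2 =
    (tsupport φ).indicator (fun x => DD q (φ * fun x => w (t, x)) x ^ 2) x
  by_cases hx : x ∈ tsupport φ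
  · rw [indicator_of_mem hx]
  · have h1 : tsupport (DD q (φ * fun x => w (t, x))) ⊆ tsupport φ :=
      (tsupport_DD_subset _ _).trans tsupport_mul_subset_left
    have h2 : DD q (φ * fun x => w (t, x)) x = 0 :=
      image_eq_zero_of_notMem_tsupport fun hc => hx (h1 hc)
    rw [indicator_of_notMem hx, h2]
    simp

theorem energy_inequality (hd : 1 ≤ d) (hm : 1 ≤ m) {lam K : ℝ} (hlam : 0 < lam) (hK : 0 ≤ K)
    {φ : E → ℝ} (hφ : ContDiff ℝ ∞ φ) (hφc : HasCompactSupport φ) (hφ1 : tsupport φ ⊆ ball 0 1) :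
    ∃ C, 0 ≤ C ∧ ∀ A, IsCoeff d n m lam K A → ∀ w, IsSol N m A w →
      ∀ t₁ t₂, -1 ≤ t₁ → t₁ ≤ t₂ → t₂ ≤ 0 →
      (∑ i, ∫ x in HalfSp N ∩ tsupport φ, (φ x * w i (t₂, x)) ^ 2) +
        lam / (MIdx d m).card * (∫ t in t₁..t₂, ∑ i, topEn N m (φ * fun x => w i (t, x))) ≤
      (∑ i, ∫ x in HalfSp N ∩ tsupport φ, (φ x * w i (t₁, x)) ^ 2) +
        C * ∫ t in t₁..t₂, ∑ i, lowEn N m (tsupport φ) fun x => w i (t, x) := by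
  obtain ⟨C, hC0, hC⟩ := localized_garding (N := N) (n := n) hd hm hlam hK hφ hφc
  refine ⟨2 * C, by positivity, fun A hA w hw t₁ t₂ h1 h12 h2 => ?_⟩
  set G : Fin n → ℝ × E → ℝ := fun i p => (φ p.2 * w i p) ^ 2 with hG
  have sG : ∀ i, ContDiff ℝ ∞ (G i) := fun i => ((hφ.comp contDiff_snd).mul (hw.smooth i)).pow 2
  have tG : ∀ i t x, tder (G i) (t, x) = 2 * (φ x * (φ x * w i (t, x)) * tder (w i) (t, x)) := by
    intro i t x
    have h := (((hasDerivAt_tder (hw.smooth i) t x).const_mul (φ x)).pow 2)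
    refine h.deriv.trans ?_
    simp; ring
  set X : ℝ → ℝ := fun t => ∑ i, topEn N m (φ * fun x => w i (t, x)) with hX
  set Y : ℝ → ℝ := fun t => ∑ i, lowEn N m (tsupport φ) fun x => w i (t, x) with hY
  have cX : Continuous X := continuous_finsetSum _ fun i _ =>
    continuous_topEn_slice hφ hφc (hw.smooth i)
  have cY : Continuous Y := continuous_finsetSum _ fun i _ =>
    continuous_lowEn_slice hφc (hw.smooth i)
  set En : ℝ → ℝ := fun t => ∑ i, ∫ x in HalfSp N ∩ tsupport φ, G i (t, x) with hEn
  set En' : ℝ → ℝ := fun t => ∑ i, ∫ x in HalfSp N ∩ tsupport φ, tder (G i) (t, x) with hEn'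
  have dE : ∀ t, HasDerivAt En (En' t) t := fun t =>
    HasDerivAt.fun_sum fun i _ => hasDerivAt_integral_slice hφc (sG i) t
  have cE' : Continuous En' := continuous_finsetSum _ fun i _ =>
    continuous_integral_slice hφc (contDiff_tder (sG i)).continuous
  have hint : ∫ t in t₁..t₂, En' t = En t₂ - En t₁ :=
    integral_eq_sub_of_hasDerivAt (fun t _ => dE t)
      (cE'.intervalIntegrable _ _)
  have hae : ∀ᵐ t ∂(volume.restrict (Ioo (-1 : ℝ) 0)),
      En' t ≤ 2 * C * Y t - lam / (MIdx d m).card * X t := by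
    filter_upwards [hw.eqn, ae_restrict_mem measurableSet_Ioo] with t ht htI
    have g := hC (fun α β => A α β t) (hA.ellip t) (fun α β i j => hA.bound α β t i j)
      (fun i x => w i (t, x)) (fun i => contDiff_slice (hw.smooth i) t)
      (fun i => (hw.bdry t htI i).mono_set hφ1)
    have e : En' t = -2 * ((-1) ^ m * (∑ α ∈ MIdx d m, ∑ β ∈ MIdx d m, ∑ i, ∑ j,
          A α β t i j * ∫ x in HalfSp N, (φ * (φ * fun x => w i (t, x))) x *
            DD (α + β) (fun x => w j (t, x)) x)) := by
      have hin : ∀ (α β : Fin d → ℕ) i j, IntegrableOn (fun x => (φ * (φ * fun x => w i (t, x))) x *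
            DD (α + β) (fun x => w j (t, x)) x) (HalfSp N) := by
        intro α β i j
        refine Integrable.integrableOn (Continuous.integrable_of_hasCompactSupport ?_ ?_)
        · exact (contDiff_mul_fun hφ (contDiff_mul_fun hφ (contDiff_slice (hw.smooth i) t))
            ).continuous.mul (contDiff_DD (contDiff_slice (hw.smooth j) t) _).continuous
        · have : HasCompactSupport (φ * ((φ * fun x => w i (t, x)) *
            DD (α + β) (fun x => w j (t, x)))) := hφc.mul_right
          have h2 : (fun x => (φ * (φ * fun x => w i (t, x))) x * DD (α + β) (fun x => w j (t, x)) x)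
              = φ * ((φ * fun x => w i (t, x)) * DD (α + β) (fun x => w j (t, x))) := by
            funext x; simp; ring
          rw [h2]; exact this
      have e1 : ∀ i, ∫ x in HalfSp N ∩ tsupport φ, tder (G i) (t, x) =
          ∫ x in HalfSp N, -2 * ((-1) ^ m * ∑ α ∈ MIdx d m, ∑ β ∈ MIdx d m, ∑ j, A α β t i j *
            ((φ * (φ * fun x => w i (t, x))) x * DD (α + β) (fun x => w j (t, x)) x)) := by
        intro i
        rw [← setIntegral_indicator (isClosed_tsupport φ).measurableSet]
        refine setIntegral_congr_fun isOpen_halfSp.measurableSet fun x hx => ?_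
        by_cases hxs : x ∈ tsupport φ
        · have hq := ht x (hφ1 hxs) hx i
          simp only [indicator_of_mem hxs, tG]
          rw [eq_neg_of_add_eq_zero_left hq]
          simp only [Pi.mul_apply, Dmul_apply, mul_sum]
          rw [← sum_neg_distrib, mul_sum, mul_sum]
          refine sum_congr rfl fun α _ => ?_
          rw [← sum_neg_distrib, mul_sum, mul_sum]
          refine sum_congr rfl fun β _ => ?_
          rw [← sum_neg_distrib, mul_sum, mul_sum]
          refine sum_congr rfl fun j _ => ?_
          ring
        · have : φ x = 0 := image_eq_zero_of_notMem_tsupport hxs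
          simp [hxs, this]
      rw [hEn']
      simp only [e1]
      have e2 : ∀ i, ∫ x in HalfSp N, -2 * ((-1) ^ m * ∑ α ∈ MIdx d m, ∑ β ∈ MIdx d m, ∑ j,
          A α β t i j * ((φ * (φ * fun x => w i (t, x))) x * DD (α + β) (fun x => w j (t, x)) x))
          = -2 * ((-1) ^ m * ∑ α ∈ MIdx d m, ∑ β ∈ MIdx d m, ∑ j, A α β t i j *
          ∫ x in HalfSp N, (φ * (φ * fun x => w i (t, x))) x * DD (α + β) (fun x => w j (t, x)) x) := by
        intro i
        rw [integral_const_mul, integral_const_mul, integral_finsetSum]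
        · congr 2
          refine sum_congr rfl fun α _ => ?_
          rw [integral_finsetSum]
          · refine sum_congr rfl fun β _ => ?_
            rw [integral_finsetSum]
            · exact sum_congr rfl fun j _ => integral_const_mul _ _
            · exact fun j _ => (hin α β i j).const_mul _
          · exact fun β _ => integrable_finsetSum _ fun j _ => (hin α β i j).const_mul _
        · exact fun α _ => integrable_finsetSum _ fun β _ =>
            integrable_finsetSum _ fun j _ => (hin α β i j).const_mul _
      simp only [e2, ← mul_sum]
      congr 2
      rw [sum_comm]
      refine sum_congr rfl fun α _ => ?_
      rw [sum_comm]
    rw [e]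
    have e3 : lam / (MIdx d m).card * X t = 2 * (lam / (2 * (MIdx d m).card) * X t) := by
      field_simp
    rw [e3]
    linarith
  have hmono : ∫ t in t₁..t₂, En' t ≤ ∫ t in t₁..t₂, (2 * C * Y t - lam / (MIdx d m).card * X t) := by
    refine intervalIntegral.integral_mono_ae_restrict h12 (cE'.intervalIntegrable _ _)
      (((cY.const_mul _).sub (cX.const_mul _)).intervalIntegrable _ _) ?_
    rw [Measure.restrict_congr_set Ioo_ae_eq_Icc.symm]
    exact ae_restrict_of_ae_restrict_of_subset (Ioo_subset_Ioo h1 h2) hae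
  have cY2 : Continuous fun t => 2 * C * Y t := continuous_const.mul cY
  have cX2 : Continuous fun t => lam / (MIdx d m).card * X t := continuous_const.mul cX
  rw [intervalIntegral.integral_sub (cY2.intervalIntegrable _ _) (cX2.intervalIntegrable _ _), intervalIntegral.integral_const_mul,
    intervalIntegral.integral_const_mul, hint] at hmono
  linarith

theorem DD_linear_combination {ι : Type*} (s : Finset ι) (c : ι → ℝ) (h : ι → E → ℝ)
    (hh : ∀ i ∈ s, ContDiff ℝ ∞ (h i)) (γ : Fin d → ℕ) :
    DD γ (fun x => ∑ i ∈ s, c i * h i x) = fun x => ∑ i ∈ s, c i * DD γ (h i) x := by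
  have e : (fun x => ∑ i ∈ s, c i * h i x) = ∑ i ∈ s, c i • h i := by
    funext x; simp
  rw [e, DD_sum s _ fun i hi => contDiff_smul_fun (c i) (hh i hi)]
  funext x
  rw [Finset.sum_apply]
  exact sum_congr rfl fun i hi => by rw [DD_const_smul (hh i hi)]; rfl

theorem IsSol.eqn_Dmul {A : (Fin d → ℕ) → (Fin d → ℕ) → ℝ → Fin n → Fin n → ℝ}
    {w : Fin n → ℝ × E → ℝ} (hw : IsSol N m A w) (δ : Fin d → ℕ) :
    ∀ᵐ t ∂(volume.restrict (Ioo (-1 : ℝ) 0)), ∀ x ∈ ball (0 : E) 1, 0 < x N → ∀ i,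
      tder (_root_.Dmul δ (w i)) (t, x) + (-1) ^ m * ∑ α ∈ MIdx d m, ∑ β ∈ MIdx d m, ∑ j,
        A α β t i j * _root_.Dmul (α + β) (_root_.Dmul δ (w j)) (t, x) = 0 := by
  filter_upwards [hw.eqn] with t ht x hx hxN i
  set T := (MIdx d m ×ˢ MIdx d m) ×ˢ (Finset.univ : Finset (Fin n)) with hT
  have e : (fun y => tder (w i) (t, y)) =ᶠ[𝓝 x] fun y => ∑ p ∈ T,
      (-((-1) ^ m * A p.1.1 p.1.2 t i p.2)) * _root_.Dmul (p.1.1 + p.1.2) (w p.2) (t, y) := by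
    filter_upwards [isOpen_ball.mem_nhds hx, isOpen_halfSp.mem_nhds hxN] with y hy hyN
    rw [eq_neg_of_add_eq_zero_left (ht y hy hyN i), hT, Finset.sum_product, Finset.sum_product,
      mul_sum, ← sum_neg_distrib]
    refine sum_congr rfl fun α _ => ?_
    rw [mul_sum, ← sum_neg_distrib]
    refine sum_congr rfl fun β _ => ?_
    rw [mul_sum, ← sum_neg_distrib]
    refine sum_congr rfl fun j _ => ?_
    ring
  have e2 := (DD_eventuallyEq e δ).eq_of_nhds
  rw [DD_linear_combination T _ (fun p y => _root_.Dmul (p.1.1 + p.1.2) (w p.2) (t, y))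
    fun p _ => contDiff_slice (contDiff_Dmul (hw.smooth p.2) _) t] at e2
  rw [tder_Dmul (hw.smooth i), Dmul_apply, e2]
  beta_reduce
  rw [hT, Finset.sum_product, Finset.sum_product, mul_sum, ← sum_add_distrib]
  refine sum_eq_zero fun α _ => ?_
  rw [mul_sum, ← sum_add_distrib]
  refine sum_eq_zero fun β _ => ?_
  rw [mul_sum, ← sum_add_distrib]
  refine sum_eq_zero fun j _ => ?_
  have e3 : DD δ (fun y => _root_.Dmul (α + β) (w j) (t, y)) x
      = _root_.Dmul (α + β) (_root_.Dmul δ (w j)) (t, x) := by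
    rw [← Dmul_apply, ← Dmul_add_index (hw.smooth j), ← Dmul_add_index (hw.smooth j), add_comm]
  simp only [e3]
  ring

/-- Tangential derivatives of solutions are solutions. -/
theorem IsSol.Dmul {A : (Fin d → ℕ) → (Fin d → ℕ) → ℝ → Fin n → Fin n → ℝ}
    {w : Fin n → ℝ × E → ℝ} (hw : IsSol N m A w) {δ : Fin d → ℕ} (hδ : δ N = 0) :
    IsSol N m A fun i => _root_.Dmul δ (w i) where
  smooth i := contDiff_Dmul (hw.smooth i) δ
  bdry t ht i := by
    rw [Dmul_slice]
    exact (hw.bdry t ht i).DD (contDiff_slice (hw.smooth i) t) δ (by simp [hδ])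
  eqn := hw.eqn_Dmul δ

/-- Space-time `L²` energy of the derivatives of order `< k` in the half cylinder of radius `r`. -/
def stEn (N : Fin d) (k : ℕ) (r : ℝ) (w : Fin n → ℝ × E → ℝ) : ℝ :=
  ∫ t in (-r)..0, ∑ i, lowEn N k (closedBall 0 r) fun x => w i (t, x)

theorem continuous_sum_lowEn {w : Fin n → ℝ × E → ℝ} (hw : ∀ i, ContDiff ℝ ∞ (w i)) (k : ℕ)
    {S : Set E} (hS : IsCompact S) : Continuous fun t => ∑ i, lowEn N k S fun x => w i (t, x) :=
  continuous_finsetSum _ fun i _ => continuous_lowEn_slice hS (hw i)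

theorem lowEn_mono_set {k : ℕ} {S T : Set E} (hT : IsCompact T) (hST : S ⊆ T) {f : E → ℝ}
    (hf : ContDiff ℝ ∞ f) : lowEn N k S f ≤ lowEn N k T f :=
  sum_le_sum fun q _ => setIntegral_mono_set
    (integrableOn_halfSp_inter hT ((contDiff_DD hf q).continuous.pow 2))
    (of_forall fun _ => sq_nonneg _)
    (inter_subset_inter_right _ hST).eventuallyLE

theorem integral_le_of_subinterval {f g : ℝ → ℝ} (hf : Continuous f) (hg : Continuous g)
    (hfg : ∀ t, f t ≤ g t) (h0 : ∀ t, 0 ≤ g t) {a b c e : ℝ} (hca : c ≤ a) (hab : a ≤ b)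
    (hbe : b ≤ e) : ∫ t in a..b, f t ≤ ∫ t in c..e, g t :=
  (integral_mono_on hab (hf.intervalIntegrable _ _) (hg.intervalIntegrable _ _)
    fun t _ => hfg t).trans (integral_mono_interval hca hab hbe
      (of_forall h0) (hg.intervalIntegrable _ _))

theorem stEn_nonneg {k : ℕ} {r : ℝ} (hr : 0 ≤ r) {w : Fin n → ℝ × E → ℝ} : 0 ≤ stEn N k r w :=
  intervalIntegral.integral_nonneg (by linarith) fun _ _ =>
    sum_nonneg fun _ _ => lowEn_nonneg

theorem lowEn_succ_cutoff {φ f : E → ℝ} (hφ : ContDiff ℝ ∞ φ) (hφc : HasCompactSupport φ)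
    (hf : ContDiff ℝ ∞ f) {S : Set E} (hS : IsCompact S) (h1 : ∀ x ∈ S, φ =ᶠ[𝓝 x] 1) :
    lowEn N (m + 1) S f ≤ topEn N m (φ * f) + lowEn N m S f := by
  have e (k : ℕ) : lowEn N k S f = lowEn N k S (φ * f) := by
    refine sum_congr rfl fun q _ => setIntegral_congr_fun
      (isOpen_halfSp.measurableSet.inter hS.measurableSet) fun x hx => ?_
    have : φ * f =ᶠ[𝓝 x] f := by
      filter_upwards [h1 x hx.2] with y hy
      simp [hy]
    rw [(DD_eventuallyEq this q).eq_of_nhds]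
  rw [e, e m]
  exact lowEn_succ (contDiff_mul_fun hφ hf) hφc.mul_right

theorem exists_cutoff {r' r : ℝ} (hr' : 0 < r') (hrr : r' < r) :
    ∃ φ : E → ℝ, ContDiff ℝ ∞ φ ∧ HasCompactSupport φ ∧ tsupport φ ⊆ ball 0 r ∧
      (∀ x ∈ closedBall (0 : E) r', φ =ᶠ[𝓝 x] 1) ∧ (∀ x, |φ x| ≤ 1) := by
  set b : ContDiffBump (0 : E) := ⟨(2 * r' + r) / 3, (r' + 2 * r) / 3, by linarith, by linarith⟩
  refine ⟨b, b.contDiff, b.hasCompactSupport, ?_, fun x hx => ?_, fun x => ?_⟩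
  · rw [b.tsupport_eq]
    refine closedBall_subset_ball ?_
    change (r' + 2 * r) / 3 < r
    linarith
  · refine b.eventuallyEq_one_of_mem_ball ?_
    refine closedBall_subset_ball ?_ hx
    change r' < (2 * r' + r) / 3
    linarith
  · rw [abs_of_nonneg b.nonneg]; exact b.le_one

theorem caccioppoli (hd : 1 ≤ d) (hm : 1 ≤ m) {lam K : ℝ} (hlam : 0 < lam) (hK : 0 ≤ K)
    {r' r : ℝ} (hr' : 0 < r') (hrr : r' < r) (hr : r ≤ 1) :
    ∃ C, 0 ≤ C ∧ ∀ A, IsCoeff d n m lam K A → ∀ w, IsSol N m A w →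
      (∀ t ∈ Icc (-r') 0, ∑ i, ∫ x in HalfSp N ∩ closedBall 0 r', w i (t, x) ^ 2
        ≤ C * stEn N m r w) ∧ stEn N (m + 1) r' w ≤ C * stEn N m r w := by
  obtain ⟨φ, hφ, hφc, hφr, hφ1, hφb⟩ := exists_cutoff (d := d) hr' hrr
  obtain ⟨C, hC0, hC⟩ := energy_inequality (N := N) (n := n) hd hm hlam hK hφ hφc
    (hφr.trans (ball_subset_ball hr))
  have hM : (0 : ℝ) < (MIdx d m).card := by exact_mod_cast MIdx_card_pos hd
  set c : ℝ := lam / (MIdx d m).card with hc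
  have hc0 : 0 < c := by positivity
  set C1 : ℝ := (r - r')⁻¹ + C with hC1
  have hC10 : 0 ≤ C1 := by have := sub_pos.2 hrr; positivity
  refine ⟨C1 + (c⁻¹ * C1 + 1), by positivity, fun A hA w hw => ?_⟩
  set X : ℝ → ℝ := fun t => ∑ i, topEn N m (φ * fun x => w i (t, x)) with hX
  set Y : ℝ → ℝ := fun t => ∑ i, lowEn N m (tsupport φ) fun x => w i (t, x) with hY
  set En : ℝ → ℝ := fun t => ∑ i, ∫ x in HalfSp N ∩ tsupport φ, (φ x * w i (t, x)) ^ 2 with hEn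
  have cX : Continuous X := continuous_finsetSum _ fun i _ =>
    continuous_topEn_slice hφ hφc (hw.smooth i)
  have cY : Continuous Y := continuous_sum_lowEn hw.smooth m hφc
  have X0 : ∀ t, 0 ≤ X t := fun t => sum_nonneg fun i _ => topEn_nonneg
  have cEn : Continuous En := continuous_finsetSum _ fun i _ => continuous_integral_slice hφc
    (((hφ.continuous.comp continuous_snd).mul (hw.smooth i).continuous).pow 2)
  have Y0 : ∀ t, 0 ≤ Y t := fun t => sum_nonneg fun i _ => lowEn_nonneg
  have hφS : tsupport φ ⊆ closedBall 0 r := hφr.trans ball_subset_closedBall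
  have EY : ∀ t, En t ≤ Y t := by
    intro t
    refine sum_le_sum fun i _ => ?_
    have h1 : ∫ x in HalfSp N ∩ tsupport φ, (DD 0 (fun x => w i (t, x)) x) ^ 2
        ≤ lowEn N m (tsupport φ) fun x => w i (t, x) :=
      single_le_sum (f := fun q => ∫ x in HalfSp N ∩ tsupport φ,
        (DD q (fun x => w i (t, x)) x) ^ 2)
        (fun _ _ => integral_nonneg fun _ => sq_nonneg _) (mem_MIdxLt.2 (by simp; omega))
    refine le_trans ?_ h1
    rw [DD_zero]
    have cw := (contDiff_slice (hw.smooth i) t).continuous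
    refine setIntegral_mono_on (integrableOn_halfSp_inter hφc ((hφ.continuous.mul cw).pow 2))
      (integrableOn_halfSp_inter hφc (cw.pow 2))
      (isOpen_halfSp.measurableSet.inter hφc.isCompact.measurableSet) fun x _ => ?_
    rw [mul_pow]
    have : φ x ^ 2 ≤ 1 := by rw [← sq_abs]; exact pow_le_one₀ (abs_nonneg _) (hφb x)
    nlinarith [sq_nonneg (w i (t, x))]
  have hYs : ∫ t in (-r)..0, Y t ≤ stEn N m r w := by
    refine integral_le_of_subinterval cY
      (continuous_sum_lowEn hw.smooth m (isCompact_closedBall 0 r)) (fun t => ?_) (fun t => ?_)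
      le_rfl (by linarith) le_rfl
    · exact sum_le_sum fun i _ => lowEn_mono_set (isCompact_closedBall 0 r) hφS
        (contDiff_slice (hw.smooth i) t)
    · exact sum_nonneg fun i _ => lowEn_nonneg
  set D := ∫ t in (-r)..0, Y t with hD
  have hD0 : 0 ≤ D := intervalIntegral.integral_nonneg (by linarith) fun t _ => Y0 t
  have main : ∀ t ∈ Icc (-r') 0, En t + c * (∫ s in (-r')..t, X s) ≤ C1 * D := by
    intro t ht
    have h1 : ∀ s ∈ Icc (-r) (-r'), En t + c * (∫ s in (-r')..t, X s) - C * D ≤ En s := by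
      intro s hs
      have h := hC A hA w hw s t (by linarith [hs.1]) (by linarith [hs.2, ht.1]) ht.2
      have h2 : ∫ s in (-r')..t, X s ≤ ∫ s in s..t, X s :=
        integral_le_of_subinterval cX cX (fun _ => le_rfl) X0 hs.2 ht.1 le_rfl
      have h3 : ∫ s in s..t, Y s ≤ D :=
        integral_le_of_subinterval cY cY (fun _ => le_rfl) Y0 hs.1 (by linarith [hs.2, ht.1]) ht.2
      have h4 := mul_le_mul_of_nonneg_left h2 hc0.le
      have h5 := mul_le_mul_of_nonneg_left h3 hC0
      have h6 : En t + c * (∫ s in s..t, X s) ≤ En s + C * ∫ s in s..t, Y s := h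
      linarith
    have h2 : (∫ s in (-r)..(-r'), (En t + c * (∫ s in (-r')..t, X s) - C * D)) ≤
        ∫ s in (-r)..(-r'), En s :=
      integral_mono_on (by linarith) (by simp) (cEn.intervalIntegrable _ _) h1
    have h3 : ∫ s in (-r)..(-r'), En s ≤ D :=
      integral_le_of_subinterval cEn cY EY Y0 le_rfl (by linarith) (by linarith)
    rw [intervalIntegral.integral_const, smul_eq_mul] at h2
    have h4 : 0 < r - r' := sub_pos.2 hrr
    have h5 : En t + c * (∫ s in (-r')..t, X s) - C * D ≤ (r - r')⁻¹ * D := by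
      rw [inv_mul_eq_div, le_div_iff₀ h4]
      linarith
    rw [hC1]; linarith
  have hint : ∀ t, -r' ≤ t → 0 ≤ ∫ s in (-r')..t, X s := fun t ht =>
    intervalIntegral.integral_nonneg ht fun s _ => X0 s
  have S0 : 0 ≤ stEn N m r w := stEn_nonneg (by linarith)
  have hCD : C1 * D ≤ C1 * stEn N m r w := mul_le_mul_of_nonneg_left hYs hC10
  have hpos : 0 ≤ (c⁻¹ * C1 + 1) * stEn N m r w := by positivity
  constructor
  · intro t ht
    have h1 := main t ht
    have h2 := mul_nonneg hc0.le (hint t ht.1)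
    have h3 : ∑ i, ∫ x in HalfSp N ∩ closedBall 0 r', w i (t, x) ^ 2 ≤ En t := by
      refine sum_le_sum fun i _ => ?_
      have cw := (contDiff_slice (hw.smooth i) t).continuous
      have e : ∫ x in HalfSp N ∩ closedBall 0 r', w i (t, x) ^ 2
          = ∫ x in HalfSp N ∩ closedBall 0 r', (φ x * w i (t, x)) ^ 2 :=
        setIntegral_congr_fun (isOpen_halfSp.measurableSet.inter measurableSet_closedBall)
          fun x hx => by simp [(hφ1 x hx.2).eq_of_nhds]
      rw [e]
      refine setIntegral_mono_set
        (integrableOn_halfSp_inter hφc ((hφ.continuous.mul cw).pow 2))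
        (of_forall fun _ => sq_nonneg _)
        (inter_subset_inter_right _ fun x hx => subset_tsupport _ ?_).eventuallyLE
      simp [(hφ1 x hx).eq_of_nhds]
    linarith
  · have h1 := main 0 ⟨by linarith, le_rfl⟩
    have hE0 : 0 ≤ En 0 := sum_nonneg fun i _ => integral_nonneg fun x => sq_nonneg _
    have h2 : ∫ s in (-r')..0, X s ≤ c⁻¹ * (C1 * stEn N m r w) := by
      rw [inv_mul_eq_div, le_div_iff₀ hc0]; linarith
    have cZ := continuous_sum_lowEn (N := N) hw.smooth m (isCompact_closedBall (0 : E) r)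
    have h3 : stEn N (m + 1) r' w ≤ ∫ s in (-r')..0, (X s +
        ∑ i, lowEn N m (closedBall 0 r) fun x => w i (s, x)) := by
      refine integral_mono_on (by linarith)
        ((continuous_sum_lowEn hw.smooth _ (isCompact_closedBall _ _)).intervalIntegrable _ _)
        ((cX.add cZ).intervalIntegrable _ _) fun t _ => ?_
      rw [hX, ← sum_add_distrib]
      refine sum_le_sum fun i _ => ?_
      have sw := contDiff_slice (hw.smooth i) t
      refine (lowEn_succ_cutoff hφ hφc sw (isCompact_closedBall _ _) hφ1).trans ?_
      exact add_le_add le_rfl (lowEn_mono_set (isCompact_closedBall _ _)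
        (closedBall_subset_closedBall hrr.le) sw)
    rw [intervalIntegral.integral_add (cX.intervalIntegrable _ _) (cZ.intervalIntegrable _ _)] at h3
    have h4 : ∫ s in (-r')..0, (∑ i, lowEn N m (closedBall 0 r) fun x => w i (s, x))
        ≤ stEn N m r w :=
      integral_le_of_subinterval cZ cZ (fun _ => le_rfl)
        (fun t => sum_nonneg fun i _ => lowEn_nonneg) (by linarith) (by linarith) le_rfl
    have h5 : 0 ≤ C1 * stEn N m r w := by positivity
    linarith

theorem lowEn_pd_le {f : E → ℝ} (hf : ContDiff ℝ ∞ f) (S : Set E) (e : Fin d) :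
    lowEn N m S (pd e f) ≤ lowEn N (m + 1) S f := by
  classical
  have h1 : lowEn N m S (pd e f) = ∑ q ∈ (MIdxLt d m).image (fun q => (q + Pi.single e 1 : Fin d → ℕ)),
      ∫ x in HalfSp N ∩ S, DD q f x ^ 2 := by
    rw [Finset.sum_image fun a _ b _ h => add_right_cancel h]
    refine sum_congr rfl fun q _ => ?_
    rw [DD_add_single hf, pd_DD hf]
  rw [h1]
  refine Finset.sum_le_sum_of_subset_of_nonneg ?_
    fun _ _ _ => integral_nonneg fun _ => sq_nonneg _
  intro q hq
  obtain ⟨p, hp, rfl⟩ := Finset.mem_image.1 hq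
  rw [mem_MIdxLt] at hp ⊢
  simp [sum_add_distrib]; omega

/-- Interior-type estimates for tangential derivatives. -/
theorem tangential_estimate (hd : 1 ≤ d) (hm : 1 ≤ m) {lam K : ℝ} (hlam : 0 < lam) (hK : 0 ≤ K)
    (σ : Fin d → ℕ) : σ N = 0 → ∀ {r' r : ℝ}, 0 < r' → r' < r → r ≤ 1 →
    ∃ C, 0 ≤ C ∧ ∀ A, IsCoeff d n m lam K A → ∀ w : Fin n → ℝ × E → ℝ, IsSol N m A w →
      stEn N m r' (fun i => Dmul σ (w i)) ≤ C * stEn N m r w := by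
  induction σ using multiIndex_induction with
  | h0 =>
    intro _ r' r hr' hrr hr
    refine ⟨1, zero_le_one, fun A _ w hw => ?_⟩
    have e : (fun i => Dmul (0 : Fin d → ℕ) (w i)) = w := by
      funext i p
      rw [show p = (p.1, p.2) from rfl, Dmul_apply, DD_zero]
    rw [e, one_mul]
    refine integral_le_of_subinterval (continuous_sum_lowEn hw.smooth _ (isCompact_closedBall _ _))
      (continuous_sum_lowEn hw.smooth _ (isCompact_closedBall _ _)) (fun t => ?_) (fun t => ?_)
      (by linarith) (by linarith) le_rfl
    · exact sum_le_sum fun i _ => lowEn_mono_set (isCompact_closedBall _ _)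
        (closedBall_subset_closedBall hrr.le) (contDiff_slice (hw.smooth i) t)
    · exact sum_nonneg fun i _ => lowEn_nonneg
  | hs σ e ih =>
    intro hσ r' r hr' hrr hr
    have he : e ≠ N := by
      rintro rfl
      simp at hσ
    have hσ0 : σ N = 0 := by simpa [he, Pi.single_apply, he.symm] using hσ
    obtain ⟨C1, hC1, h1⟩ := ih hσ0 (r' := (r' + r) / 2) (r := r) (by linarith) (by linarith) hr
    obtain ⟨C2, hC2, h2⟩ := caccioppoli (N := N) (n := n) hd hm hlam hK hr'
      (show r' < (r' + r) / 2 by linarith) (by linarith)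
    refine ⟨C2 * C1, by positivity, fun A hA w hw => ?_⟩
    have hsol := hw.Dmul hσ0
    have h3 : stEn N m r' (fun i => Dmul (σ + Pi.single e 1 : Fin d → ℕ) (w i)) ≤
        stEn N (m + 1) r' (fun i => Dmul σ (w i)) := by
      refine integral_mono_on (by linarith)
        ((continuous_sum_lowEn (fun i => contDiff_Dmul (hw.smooth i) _) _
          (isCompact_closedBall _ _)).intervalIntegrable _ _)
        ((continuous_sum_lowEn (fun i => contDiff_Dmul (hw.smooth i) _) _
          (isCompact_closedBall _ _)).intervalIntegrable _ _) fun t _ => ?_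
      refine sum_le_sum fun i _ => ?_
      have sw := contDiff_slice (hw.smooth i) t
      rw [Dmul_slice, Dmul_slice, DD_add_single sw]
      exact lowEn_pd_le (contDiff_DD sw σ) _ e
    calc _ ≤ _ := h3
      _ ≤ C2 * stEn N m ((r' + r) / 2) (fun i => Dmul σ (w i)) := (h2 A hA _ hsol).2
      _ ≤ C2 * (C1 * stEn N m r w) := mul_le_mul_of_nonneg_left (h1 A hA w hw) hC2
      _ = _ := by ring

theorem tangential_sup_estimate (hd : 1 ≤ d) (hm : 1 ≤ m) {lam K : ℝ} (hlam : 0 < lam) (hK : 0 ≤ K)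
    {σ : Fin d → ℕ} (hσ : σ N = 0) {r' r : ℝ} (hr' : 0 < r') (hrr : r' < r) (hr : r ≤ 1) :
    ∃ C, 0 ≤ C ∧ ∀ A, IsCoeff d n m lam K A → ∀ w : Fin n → ℝ × E → ℝ, IsSol N m A w →
      ∀ t ∈ Icc (-r') 0, ∑ i, ∫ x in HalfSp N ∩ closedBall 0 r', Dmul σ (w i) (t, x) ^ 2
        ≤ C * stEn N m r w := by
  obtain ⟨C1, hC1, h1⟩ := tangential_estimate (N := N) (n := n) hd hm hlam hK σ hσ
    (r' := (r' + r) / 2) (r := r) (by linarith) (by linarith) hr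
  obtain ⟨C2, hC2, h2⟩ := caccioppoli (N := N) (n := n) hd hm hlam hK hr'
    (show r' < (r' + r) / 2 by linarith) (by linarith)
  refine ⟨C2 * C1, by positivity, fun A hA w hw t ht => ?_⟩
  refine ((h2 A hA _ (hw.Dmul hσ)).1 t ht).trans ?_
  rw [mul_assoc]
  exact mul_le_mul_of_nonneg_left (h1 A hA w hw) hC2

end garding

section spectral
open scoped InnerProductSpace unitInterval

/-- The space `L²(0,1)`. -/
abbrev LI : Type := Lp ℝ 2 (volume : Measure I)

def indLI (s : Set I) (hs : MeasurableSet s) : LI := indicatorConstLp 2 hs (measure_ne_top _ s) (1 : ℝ)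

theorem inner_indLI {s : Set I} (hs : MeasurableSet s) (f : LI) :
    ⟪indLI s hs, f⟫_ℝ = ∫ x in s, f x := L2.inner_indicatorConstLp_one hs (measure_ne_top _ s) f

theorem norm_indLI_Ioc (y z : I) : ‖indLI (Ioc y z) measurableSet_Ioc‖ ≤ sqrt |(z : ℝ) - y| := by
  rw [indLI, norm_indicatorConstLp (by norm_num) (by norm_num)]
  simp only [norm_one, one_mul, ENNReal.toReal_ofNat]
  rw [← Real.sqrt_eq_rpow]
  apply Real.sqrt_le_sqrt
  simp only [Measure.real, unitInterval.volume_Ioc]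
  rcases le_total (y : ℝ) z with h | h
  · rw [ENNReal.toReal_ofReal (by linarith)]; exact le_abs_self _
  · rw [ENNReal.ofReal_of_nonpos (by linarith)]; simp

/-- The primitive vanishing at `0`. -/
def primFun (f : LI) (y : I) : ℝ := ∫ x in Iic y, f x

theorem integrable_LI (f : LI) : Integrable f := (Lp.memLp f).integrable (by norm_num)

theorem primFun_sub (f : LI) {y z : I} (h : y ≤ z) :
    |primFun f z - primFun f y| ≤ sqrt |(z : ℝ) - y| * ‖f‖ := by
  have e : primFun f z - primFun f y = ⟪indLI (Ioc y z) measurableSet_Ioc, f⟫_ℝ := by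
    rw [inner_indLI, primFun, primFun, ← Iic_union_Ioc_eq_Iic h, setIntegral_union
      (by rw [Set.disjoint_left]; rintro x hx hx'; exact not_lt.2 hx hx'.1) measurableSet_Ioc
      (integrable_LI f).integrableOn (integrable_LI f).integrableOn]
    ring
  rw [e]
  exact (abs_real_inner_le_norm _ _).trans
    (mul_le_mul_of_nonneg_right (norm_indLI_Ioc y z) (norm_nonneg _))

theorem primFun_sub' (f : LI) (y z : I) :
    |primFun f z - primFun f y| ≤ sqrt |(z : ℝ) - y| * ‖f‖ := by
  rcases le_total y z with h | h
  · exact primFun_sub f h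
  · rw [abs_sub_comm, abs_sub_comm (z : ℝ)]
    exact primFun_sub f h

theorem primFun_zero (f : LI) : primFun f 0 = 0 := by
  have : (volume : Measure I).restrict (Iic 0) = 0 := by
    rw [Measure.restrict_eq_zero]
    have : Iic (0 : I) = Icc 0 0 := by ext x; simp
    rw [this]; simp
  simp [primFun, this]

theorem primFun_continuous (f : LI) : Continuous (primFun f) := by
  rw [continuous_iff_continuousAt]
  intro y
  have : Tendsto (fun z : I => sqrt |(z : ℝ) - y| * ‖f‖) (𝓝 y) (𝓝 0) := by
    have h : Continuous fun z : I => sqrt |(z : ℝ) - y| * ‖f‖ := by fun_prop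
    simpa using h.tendsto y
  rw [ContinuousAt, tendsto_iff_dist_tendsto_zero]
  exact squeeze_zero (fun _ => dist_nonneg) (fun z => primFun_sub' f y z) this

theorem primFun_add (f g : LI) (y : I) : primFun (f + g) y = primFun f y + primFun g y := by
  simp only [primFun, ← inner_indLI measurableSet_Iic, inner_add_right]

theorem primFun_smul (c : ℝ) (f : LI) (y : I) : primFun (c • f) y = c * primFun f y := by
  simp only [primFun, ← inner_indLI measurableSet_Iic, inner_smul_right]

def primBCF : LI →ₗ[ℝ] BoundedContinuousFunction I ℝ where
  toFun f := BoundedContinuousFunction.mkOfCompact ⟨primFun f, primFun_continuous f⟩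
  map_add' f g := by ext y; exact primFun_add f g y
  map_smul' c f := by ext y; exact primFun_smul c f y

theorem primBCF_apply (f : LI) (y : I) : primBCF f y = primFun f y := rfl

theorem primFun_bound (f : LI) (y : I) : |primFun f y| ≤ ‖f‖ := by
  have := primFun_sub' f 0 y
  rw [primFun_zero, sub_zero] at this
  refine this.trans (mul_le_of_le_one_left (norm_nonneg _) ?_)
  rw [Real.sqrt_le_one]
  simpa [abs_le] using ⟨by linarith [y.2.1], y.2.2⟩

theorem isCompactOperator_primBCF : IsCompactOperator primBCF := by
  rw [isCompactOperator_iff_isCompact_closure_image_ball (𝕜₁ := ℝ) primBCF zero_lt_one]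
  refine BoundedContinuousFunction.arzela_ascoli (Icc (-1) 1) isCompact_Icc _ ?_ ?_
  · rintro _ x ⟨f, hf, rfl⟩
    rw [mem_Icc, ← abs_le, primBCF_apply]
    exact (primFun_bound f x).trans (by simpa using hf.out.le)
  · intro y
    rw [Metric.equicontinuousAt_iff_right]
    intro ε hε
    have h : Continuous fun z : I => sqrt |(z : ℝ) - y| := by fun_prop
    have h2 := h.tendsto y
    simp only [sub_self, abs_zero, sqrt_zero] at h2
    filter_upwards [h2.eventually (gt_mem_nhds hε)] with z hz
    rintro ⟨_, f, hf, rfl⟩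
    rw [dist_comm]
    refine lt_of_le_of_lt (primFun_sub' f y z) (lt_of_le_of_lt (mul_le_of_le_one_right (sqrt_nonneg _) ?_) hz)
    simpa using hf.out.le

/-- The Volterra operator on `L²(0,1)`. -/
def volterra : LI →L[ℝ] LI :=
  (BoundedContinuousFunction.toLp (E := ℝ) 2 (volume : Measure I) ℝ).comp
    ⟨primBCF, isCompactOperator_primBCF.continuous⟩

theorem isCompactOperator_volterra : IsCompactOperator volterra :=
  isCompactOperator_primBCF.clm_comp
    (BoundedContinuousFunction.toLp (E := ℝ) 2 (volume : Measure I) ℝ)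

theorem volterra_ae (f : LI) : volterra f =ᵐ[volume] primFun f :=
  BoundedContinuousFunction.coeFn_toLp (E := ℝ) 2 (volume : Measure I) ℝ _

theorem integral_I (G : ℝ → ℝ) : ∫ x : I, G x = ∫ x in (0 : ℝ)..1, G x := by
  rw [integral_of_le zero_le_one, ← integral_Icc_eq_integral_Ioc]
  exact integral_subtype_comap measurableSet_Icc G

theorem integral_Iic_I (G : ℝ → ℝ) (y : I) : ∫ x in Iic y, G x = ∫ x in (0 : ℝ)..y, G x := by
  have h : ∀ x : I, (Iic y).indicator (fun x : I => G x) x = (Iic (y : ℝ)).indicator G x := by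
    intro x
    by_cases hx : x ≤ y
    · rw [indicator_of_mem (by exact hx), indicator_of_mem (by exact hx)]
    · rw [indicator_of_notMem (by exact hx), indicator_of_notMem (by exact hx)]
  rw [← integral_indicator measurableSet_Iic, integral_congr_ae (of_forall h)]
  refine (integral_subtype_comap measurableSet_Icc ((Iic (y : ℝ)).indicator G)).trans ?_
  rw [setIntegral_indicator measurableSet_Iic, integral_of_le y.2.1,
    ← integral_Icc_eq_integral_Ioc]
  congr 2
  ext x
  simp only [mem_inter_iff, mem_Icc, mem_Iic]
  exact ⟨fun h => ⟨h.1.1, h.2⟩, fun h => ⟨⟨h.1, h.2.trans y.2.2⟩, h.2⟩⟩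

/-- The element of `L²(0,1)` represented by a continuous function. -/
def ofC (F : C(ℝ, ℝ)) : LI :=
  ContinuousMap.toLp (E := ℝ) 2 (volume : Measure I) ℝ ⟨fun x => F x, by fun_prop⟩

theorem ofC_ae (F : C(ℝ, ℝ)) : ofC F =ᵐ[volume] fun x : I => F x :=
  ContinuousMap.coeFn_toLp (E := ℝ) (μ := (volume : Measure I)) (p := 2) (𝕜 := ℝ) _

theorem ofC_add (F G : C(ℝ, ℝ)) : ofC (F + G) = ofC F + ofC G := by
  simp only [ofC, ← map_add]; rfl

theorem ofC_smul (c : ℝ) (F : C(ℝ, ℝ)) : ofC (c • F) = c • ofC F := by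
  simp only [ofC, ← map_smul]; rfl

theorem ofC_sub (F G : C(ℝ, ℝ)) : ofC (F - G) = ofC F - ofC G := by
  simp only [ofC, ← map_sub]; rfl

theorem inner_ofC (F G : C(ℝ, ℝ)) : ⟪ofC F, ofC G⟫_ℝ = ∫ x in (0 : ℝ)..1, F x * G x := by
  rw [L2.inner_def, ← integral_I fun x => F x * G x]
  refine integral_congr_ae ?_
  filter_upwards [ofC_ae F, ofC_ae G] with x h1 h2
  rw [h1, h2]; simp [mul_comm]

theorem ofC_eq {f : LI} {F : C(ℝ, ℝ)} (h : f =ᵐ[volume] fun x : I => F x) : f = ofC F :=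
  Lp.ext (h.trans (ofC_ae F).symm)

theorem eqOn_of_ofC_eq {F G : C(ℝ, ℝ)} (h : ofC F = ofC G) : ∀ x ∈ Icc (0 : ℝ) 1, F x = G x := by
  have h1 : (fun x : I => F x) =ᵐ[volume] fun x : I => G x :=
    (ofC_ae F).symm.trans (h ▸ ofC_ae G)
  have h2 : F =ᵐ[volume.restrict (Icc (0 : ℝ) 1)] G :=
    (ae_restrict_iff_subtype measurableSet_Icc).2 h1
  exact Measure.eqOn_Icc_of_ae_eq volume zero_ne_one h2 F.continuous.continuousOn
    G.continuous.continuousOn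

theorem dense_ofC : DenseRange ofC := by
  have h := ContinuousMap.toLp_denseRange ℝ (volume : Measure I) ℝ (p := 2) (by norm_num)
  refine h.mono ?_
  rintro _ ⟨f, rfl⟩
  refine ⟨⟨IccExtend zero_le_one f, f.continuous.Icc_extend'⟩, ?_⟩
  rw [ofC]
  congr 1
  ext x
  simp

/-- Primitive vanishing at `0`, on continuous functions. -/
def primC (F : C(ℝ, ℝ)) : C(ℝ, ℝ) :=
  ⟨fun y => ∫ x in (0 : ℝ)..y, F x, intervalIntegral.continuous_primitive
    (fun a b => F.continuous.intervalIntegrable a b) 0⟩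

theorem hasDerivAt_primC (F : C(ℝ, ℝ)) (y : ℝ) : HasDerivAt (primC F) (F y) y :=
  intervalIntegral.integral_hasDerivAt_right (F.continuous.intervalIntegrable _ _)
    (F.continuous.stronglyMeasurableAtFilter _ _) F.continuous.continuousAt

theorem primC_zero (F : C(ℝ, ℝ)) : primC F 0 = 0 := by simp [primC]

/-- Primitive vanishing at `1`, with opposite sign. -/
def coprimC (F : C(ℝ, ℝ)) : C(ℝ, ℝ) := ContinuousMap.const ℝ (primC F 1) - primC F

theorem hasDerivAt_coprimC (F : C(ℝ, ℝ)) (y : ℝ) : HasDerivAt (coprimC F) (-F y) y :=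
  (hasDerivAt_primC F y).const_sub _

theorem volterra_eq_ofC (f : LI) : ∃ F : C(ℝ, ℝ), volterra f = ofC F ∧
    (∀ y : I, F y = primFun f y) := by
  refine ⟨⟨IccExtend zero_le_one (primFun f), (primFun_continuous f).Icc_extend'⟩, ?_, ?_⟩
  · exact ofC_eq ((volterra_ae f).trans (of_forall fun x => by simp))
  · intro y; simp

theorem volterra_ofC (F : C(ℝ, ℝ)) : volterra (ofC F) = ofC (primC F) := by
  refine ofC_eq ((volterra_ae _).trans (of_forall fun y => ?_))
  show ∫ x in Iic y, ofC F x = ∫ x in (0 : ℝ)..y, F x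
  rw [← integral_Iic_I]
  exact integral_congr_ae (ae_restrict_of_ae (ofC_ae F))

theorem inner_volterra_ofC (F G : C(ℝ, ℝ)) :
    ⟪volterra (ofC F), ofC G⟫_ℝ = ⟪ofC F, ofC (coprimC G)⟫_ℝ := by
  rw [volterra_ofC, inner_ofC, inner_ofC]
  have h := integral_mul_deriv_eq_deriv_mul (a := 0) (b := 1)
    (u := primC F) (v := coprimC G) (u' := F) (v' := fun y => -G y)
    (fun x _ => hasDerivAt_primC F x) (fun x _ => hasDerivAt_coprimC G x)
    (F.continuous.intervalIntegrable _ _) (G.continuous.neg.intervalIntegrable _ _)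
  simp only [mul_neg, intervalIntegral.integral_neg] at h
  have e : coprimC G 1 = 0 := by simp [coprimC]
  rw [e, primC_zero] at h
  linarith

/-- The constant function `1`. -/
def oneLI : LI := ofC (ContinuousMap.const ℝ 1)

theorem inner_one_ofC (F : C(ℝ, ℝ)) : ⟪oneLI, ofC F⟫_ℝ = primC F 1 := by
  rw [oneLI, inner_ofC]; simp [primC]

theorem inner_one (f : LI) : ⟪oneLI, f⟫_ℝ = primFun f 1 := by
  have h1 : oneLI = indLI (Iic 1) measurableSet_Iic := by
    refine Lp.ext ((ofC_ae _).trans ?_)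
    have h2 := indicatorConstLp_coeFn (p := 2) (μ := (volume : Measure I))
      (hs := (measurableSet_Iic : MeasurableSet (Iic (1 : I)))) (hμs := measure_ne_top _ _) (c := (1 : ℝ))
    refine EventuallyEq.trans ?_ h2.symm
    filter_upwards with x
    rw [indicator_of_mem (show x ∈ Iic (1 : I) from x.2.2)]
    rfl
  rw [h1, inner_indLI]; rfl

theorem coprim_ofC (F : C(ℝ, ℝ)) :
    ofC (coprimC F) = ⟪oneLI, ofC F⟫_ℝ • oneLI - volterra (ofC F) := by
  rw [coprimC, ofC_sub, volterra_ofC, inner_one_ofC, oneLI, ← ofC_smul]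
  congr 2
  ext x; simp

theorem adjoint_volterra (f : LI) :
    ContinuousLinearMap.adjoint volterra f = ⟪oneLI, f⟫_ℝ • oneLI - volterra f := by
  have hcont : Continuous fun f : LI => ⟪oneLI, f⟫_ℝ • oneLI - volterra f := by fun_prop
  refine congrFun (dense_ofC.equalizer (by fun_prop) hcont (funext fun F => ?_)) f
  refine ext_inner_left ℝ fun g => ?_
  rw [comp_apply, comp_apply, ContinuousLinearMap.adjoint_inner_right]
  have h1 : Continuous fun g => ⟪volterra g, ofC F⟫_ℝ := by fun_prop
  have h2 : Continuous fun g => ⟪g, ⟪oneLI, ofC F⟫_ℝ • oneLI - volterra (ofC F)⟫_ℝ := by fun_prop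
  refine congrFun (dense_ofC.equalizer h1 h2 (funext fun G => ?_)) g
  rw [comp_apply, comp_apply, inner_volterra_ofC, coprim_ofC]

/-- The adjoint Volterra operator. -/
def covolterra : LI →L[ℝ] LI := ContinuousLinearMap.adjoint volterra

theorem covolterra_ofC (F : C(ℝ, ℝ)) : covolterra (ofC F) = ofC (coprimC F) := by
  rw [covolterra, adjoint_volterra, coprim_ofC]

theorem covolterra_inj {c : ℝ} {f : LI} (h : c • oneLI + covolterra f = 0) : c = 0 ∧ f = 0 := by
  obtain ⟨F, hF, hF'⟩ := volterra_eq_ofC f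
  rw [covolterra, adjoint_volterra, hF] at h
  have h1 : ofC ((c + ⟪oneLI, f⟫_ℝ) • ContinuousMap.const ℝ 1) = ofC F := by
    rw [ofC_smul]
    rw [← sub_eq_zero, ← h, oneLI]
    module
  have h2 := eqOn_of_ofC_eq h1
  have h3 := h2 0 (by simp)
  have h4 := h2 1 (by simp)
  have h5 := hF' 0
  have h6 := hF' 1
  simp only [Icc.coe_zero, Icc.coe_one] at h5 h6
  rw [h5, primFun_zero] at h3
  rw [h6, ← inner_one] at h4
  simp at h3 h4
  have hc : c = 0 := h4
  have h10 : ⟪oneLI, f⟫_ℝ = 0 := by linarith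
  refine ⟨hc, ?_⟩
  have hcv : covolterra f = 0 := by
    rw [covolterra, adjoint_volterra, hF, h10, ← h, hc, h10]; simp
  have hpoly : ∀ p : Polynomial ℝ, ⟪ofC ⟨fun x => p.eval x, p.continuous⟩, f⟫_ℝ = 0 := by
    intro p
    have e : ofC ⟨fun x => p.eval x, p.continuous⟩ = p.eval 0 • oneLI
        + volterra (ofC ⟨fun x => p.derivative.eval x, p.derivative.continuous⟩) := by
      rw [volterra_ofC, oneLI, ← ofC_smul, ← ofC_add]
      congr 1
      ext x
      have := integral_eq_sub_of_hasDerivAt (a := 0) (b := x)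
        (fun y _ => p.hasDerivAt y) (p.derivative.continuous.intervalIntegrable _ _)
      simp [primC, this]
    rw [e, inner_add_left, inner_smul_left, h10, ← ContinuousLinearMap.adjoint_inner_right]
    rw [show ContinuousLinearMap.adjoint volterra f = 0 from hcv]
    simp
  have hall : ∀ g : C(I, ℝ), ⟪ContinuousMap.toLp (E := ℝ) 2 (volume : Measure I) ℝ g, f⟫_ℝ = 0 := by
    have hcl : IsClosed {g : C(I, ℝ) |
        ⟪ContinuousMap.toLp (E := ℝ) 2 (volume : Measure I) ℝ g, f⟫_ℝ = 0} :=
      isClosed_eq (by fun_prop) continuous_const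
    intro g
    have hg : g ∈ (polynomialFunctions I).topologicalClosure := by
      rw [polynomialFunctions_closure_eq_top']; trivial
    refine (closure_minimal ?_ hcl) hg
    rintro _ ⟨p, -, rfl⟩
    exact hpoly p
  have h0 : (fun g : LI => ⟪g, f⟫_ℝ) = fun _ => 0 :=
    (ContinuousMap.toLp_denseRange ℝ (volume : Measure I) ℝ (p := 2) (by norm_num)).equalizer
      (by fun_prop) continuous_const (funext hall)
  exact inner_self_eq_zero.1 (congrFun h0 f)

/-- Classical eigenfunctions of `(-1)^m D^{2m}` on `(0,1)` with Dirichlet conditions. -/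
structure IsEig (m : ℕ) (e : ℝ → ℝ) (μ : ℝ) : Prop where
  smooth : ContDiff ℝ (2 * m : ℕ) e
  eqn : ∀ y ∈ Icc (0 : ℝ) 1, iteratedDeriv (2 * m) e y = (-1) ^ m * (μ * e y)
  bc0 : ∀ j < m, iteratedDeriv j e 0 = 0
  bc1 : ∀ j < m, iteratedDeriv j e 1 = 0

theorem deriv_primC (F : C(ℝ, ℝ)) : deriv (primC F) = F :=
  funext fun y => (hasDerivAt_primC F y).deriv

theorem deriv_coprimC (F : C(ℝ, ℝ)) : deriv (coprimC F) = -F :=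
  funext fun y => (hasDerivAt_coprimC F y).deriv

theorem contDiff_primC {F : C(ℝ, ℝ)} {k : ℕ} (h : ContDiff ℝ k F) :
    ContDiff ℝ (k + 1 : ℕ) (primC F) := by
  push_cast
  rw [contDiff_succ_iff_deriv, deriv_primC]
  exact ⟨fun y => (hasDerivAt_primC F y).differentiableAt, by simp, h⟩

theorem contDiff_coprimC {F : C(ℝ, ℝ)} {k : ℕ} (h : ContDiff ℝ k F) :
    ContDiff ℝ (k + 1 : ℕ) (coprimC F) := by
  push_cast
  rw [contDiff_succ_iff_deriv, deriv_coprimC]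
  exact ⟨fun y => (hasDerivAt_coprimC F y).differentiableAt, by simp, h.neg⟩

theorem contDiff_iterate_primC {F : C(ℝ, ℝ)} {k : ℕ} (h : ContDiff ℝ k F) (j : ℕ) :
    ContDiff ℝ (k + j : ℕ) (primC^[j] F) := by
  induction j with
  | zero => exact h
  | succ j ih => rw [iterate_succ_apply']; exact contDiff_primC ih

theorem contDiff_iterate_coprimC {F : C(ℝ, ℝ)} {k : ℕ} (h : ContDiff ℝ k F) (j : ℕ) :
    ContDiff ℝ (k + j : ℕ) (coprimC^[j] F) := by
  induction j with
  | zero => exact h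
  | succ j ih => rw [iterate_succ_apply']; exact contDiff_coprimC ih

theorem iteratedDeriv_primC (F : C(ℝ, ℝ)) (i j : ℕ) :
    iteratedDeriv (i + j) (primC^[j] F) = iteratedDeriv i F := by
  induction j with
  | zero => rfl
  | succ j ih => rw [iterate_succ_apply', ← add_assoc, iteratedDeriv_succ', deriv_primC, ih]

theorem iteratedDeriv_coprimC (F : C(ℝ, ℝ)) (i j : ℕ) :
    iteratedDeriv (i + j) (coprimC^[j] F) = (-1 : ℝ) ^ j • iteratedDeriv i F := by
  induction j with
  | zero => simp
  | succ j ih =>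
    rw [iterate_succ_apply', ← add_assoc, iteratedDeriv_succ', deriv_coprimC]
    funext y
    rw [iteratedDeriv_neg, ih]
    simp [pow_succ]

theorem iterate_volterra_ofC (F : C(ℝ, ℝ)) (j : ℕ) : (volterra ^ j) (ofC F) = ofC (primC^[j] F) := by
  induction j with
  | zero => rfl
  | succ j ih =>
    rw [pow_succ', mul_apply_eq_comp, ih, volterra_ofC, iterate_succ_apply']

theorem iterate_covolterra_ofC (F : C(ℝ, ℝ)) (j : ℕ) :
    (covolterra ^ j) (ofC F) = ofC (coprimC^[j] F) := by
  induction j with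
  | zero => rfl
  | succ j ih =>
    rw [pow_succ', mul_apply_eq_comp, ih, covolterra_ofC, iterate_succ_apply']

theorem covolterra_pow_inj (m : ℕ) (c : ℕ → ℝ) (f : LI)
    (h : (covolterra ^ m) f = ∑ k ∈ Finset.range m, c k • (covolterra ^ k) oneLI) : f = 0 := by
  induction m generalizing c with
  | zero => simpa using h
  | succ m ih =>
    refine ih (fun k => c (k + 1)) ?_
    rw [Finset.sum_range_succ', pow_succ', mul_apply_eq_comp] at h
    have h2 : (-c 0) • oneLI + covolterra ((covolterra ^ m) f
        - ∑ k ∈ Finset.range m, c (k + 1) • (covolterra ^ k) oneLI) = 0 := by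
      rw [map_sub, h, map_sum]
      simp only [map_smul, pow_succ', mul_apply_eq_comp, pow_zero, one_apply_eq_self]
      module
    exact sub_eq_zero.1 (covolterra_inj h2).2

theorem inner_volterra_pow (j : ℕ) (f g : LI) :
    ⟪(volterra ^ j) f, g⟫_ℝ = ⟪f, (covolterra ^ j) g⟫_ℝ := by
  induction j generalizing f with
  | zero => rfl
  | succ j ih =>
    rw [pow_succ, mul_apply_eq_comp, ih, pow_succ', mul_apply_eq_comp,
      covolterra, ContinuousLinearMap.adjoint_inner_right]

def momentSpan (m : ℕ) : Submodule ℝ LI :=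
  Submodule.span ℝ (range fun k : Fin m => (covolterra ^ (k : ℕ)) oneLI)

instance (m : ℕ) : FiniteDimensional ℝ (momentSpan m) :=
  FiniteDimensional.span_of_finite ℝ (finite_range _)

theorem exists_coeff {m : ℕ} {f : LI} (h : f ∈ momentSpan m) :
    ∃ c : ℕ → ℝ, f = ∑ k ∈ Finset.range m, c k • (covolterra ^ k) oneLI := by
  obtain ⟨c, hc⟩ := (Submodule.mem_span_range_iff_exists_fun ℝ).1 h
  refine ⟨fun k => if h : k < m then c ⟨k, h⟩ else 0, ?_⟩
  rw [← hc, Finset.sum_range]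
  simp

/-- The solution operator of the Dirichlet problem for `(-1)^m D^{2m}`. -/
def dirOp (m : ℕ) : LI →L[ℝ] LI :=
  (volterra ^ m).comp ((momentSpan m)ᗮ.starProjection.comp (covolterra ^ m))

theorem dirOp_inner (m : ℕ) (f g : LI) :
    ⟪dirOp m f, g⟫_ℝ = ⟪(momentSpan m)ᗮ.starProjection ((covolterra ^ m) f),
      (momentSpan m)ᗮ.starProjection ((covolterra ^ m) g)⟫_ℝ := by
  rw [dirOp, ContinuousLinearMap.comp_apply, ContinuousLinearMap.comp_apply, inner_volterra_pow]
  rw [← Submodule.inner_starProjection_left_eq_right, Submodule.starProjection_eq_self_iff.2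
    (Submodule.starProjection_apply_mem _ _)]

theorem dirOp_symm (m : ℕ) : (dirOp m).IsSymmetric := by
  intro f g
  show ⟪dirOp m f, g⟫_ℝ = ⟪f, dirOp m g⟫_ℝ
  rw [dirOp_inner, real_inner_comm, ← dirOp_inner, real_inner_comm]

theorem isCompactOperator_dirOp {m : ℕ} (hm : 1 ≤ m) : IsCompactOperator (dirOp m) := by
  obtain ⟨m, rfl⟩ := Nat.exists_eq_add_of_le hm
  have : dirOp (1 + m) = volterra.comp ((volterra ^ m).comp
      ((momentSpan (1 + m))ᗮ.starProjection.comp (covolterra ^ (1 + m)))) := by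
    rw [dirOp, pow_add volterra, pow_one]; rfl
  rw [this]
  exact isCompactOperator_volterra.comp_clm _

theorem norm_volterra_le (f : LI) : ‖volterra f‖ ≤ ‖f‖ := by
  have h := Lp.norm_le_of_ae_bound (p := 2) (μ := (volume : Measure I)) (f := volterra f) 
    (norm_nonneg f) (by filter_upwards [volterra_ae f] with x hx; rw [hx]; exact primFun_bound f x)
  simpa [measureUnivNNReal] using h

theorem dirOp_eig {m : ℕ} (hm : 1 ≤ m) {f : LI} {ν : ℝ} (hν : ν ≠ 0) (h : dirOp m f = ν • f) :
    ∃ F : C(ℝ, ℝ), f = ofC F ∧ IsEig m F ν⁻¹ := by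
  set q := (momentSpan m)ᗮ.starProjection ((covolterra ^ m) f) with hq
  have hqK : q ∈ (momentSpan m)ᗮ := Submodule.starProjection_apply_mem _ _
  have hfq : f = ν⁻¹ • (volterra ^ m) q := by
    rw [hq, eq_inv_smul_iff₀ hν, ← h]; rfl
  obtain ⟨F, hF⟩ : ∃ F : C(ℝ, ℝ), f = ofC F := by
    obtain ⟨k, rfl⟩ := Nat.exists_eq_add_of_le hm
    rw [add_comm, pow_succ', mul_apply_eq_comp] at hfq
    obtain ⟨G, hG, -⟩ := volterra_eq_ofC ((volterra ^ k) q)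
    exact ⟨ν⁻¹ • G, by rw [hfq, hG, ofC_smul]⟩
  have hmem : (covolterra ^ m) f - q ∈ momentSpan m := by
    have := Submodule.sub_starProjection_mem_orthogonal (K := (momentSpan m)ᗮ) ((covolterra ^ m) f)
    rwa [Submodule.orthogonal_orthogonal] at this
  obtain ⟨c, hc⟩ := exists_coeff hmem
  set Q : C(ℝ, ℝ) := coprimC^[m] F
    - ∑ k ∈ Finset.range m, c k • coprimC^[k] (ContinuousMap.const ℝ 1) with hQ
  have hsum : ∀ s : Finset ℕ, ofC (∑ k ∈ s, c k • coprimC^[k] (ContinuousMap.const ℝ 1))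
      = ∑ k ∈ s, c k • (covolterra ^ k) oneLI := by
    intro s
    induction s using Finset.induction_on with
    | empty => simpa using ofC_smul 0 0
    | insert a s ha ih => rw [sum_insert ha, sum_insert ha, ofC_add, ofC_smul, ih,
        oneLI, iterate_covolterra_ofC]
  have hqQ : q = ofC Q := by
    rw [hQ, ofC_sub, hsum, ← hc, ← iterate_covolterra_ofC, hF]; abel
  set G : C(ℝ, ℝ) := ν⁻¹ • primC^[m] Q with hG
  have hfG : f = ofC G := by rw [hG, ofC_smul, ← iterate_volterra_ofC, ← hqQ]; exact hfq
  have hFG := eqOn_of_ofC_eq (hF.symm.trans hfG)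
  have h1 : ∀ k : ℕ, ContDiff ℝ m (coprimC^[k] (ContinuousMap.const ℝ 1)) := fun k =>
    (contDiff_iterate_coprimC (k := m) (F := ContinuousMap.const ℝ 1) contDiff_const k).of_le
      (by norm_cast; omega)
  have hFm : ContDiff ℝ m (coprimC^[m] F) := by
    simpa using contDiff_iterate_coprimC (k := 0) (F := F) (by simpa using F.continuous) m
  have hQe : (Q : ℝ → ℝ) = fun x => coprimC^[m] F x
      - ∑ k ∈ Finset.range m, c k * coprimC^[k] (ContinuousMap.const ℝ 1) x := by
    funext x; simp [hQ, ContinuousMap.sum_apply]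
  have hS : ContDiff ℝ m fun x => ∑ k ∈ Finset.range m,
      c k * coprimC^[k] (ContinuousMap.const ℝ 1) x :=
    ContDiff.sum fun k _ => contDiff_const.mul (h1 k)
  have hQs : ContDiff ℝ m Q := by
    rw [hQe]; exact hFm.sub hS
  have hQd : ∀ x, iteratedDeriv m Q x = (-1) ^ m * F x := by
    intro x
    rw [hQe, iteratedDeriv_fun_sub hFm.contDiffAt hS.contDiffAt,
      iteratedDeriv_fun_sum fun k _ => (contDiff_const.mul (h1 k)).contDiffAt]
    have e1 := congrFun (iteratedDeriv_coprimC F 0 m) x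
    rw [zero_add] at e1
    rw [e1, sum_eq_zero, sub_zero]
    · simp
    · intro k hk
      rw [iteratedDeriv_const_mul_field]
      have e2 := congrFun (iteratedDeriv_coprimC (ContinuousMap.const ℝ 1) (m - k) k) x
      have hk' := Finset.mem_range.1 hk
      rw [Nat.sub_add_cancel hk'.le] at e2
      have e3 : iteratedDeriv (m - k) (fun _ : ℝ => (1 : ℝ)) x = 0 := by
        simp [iteratedDeriv_const, show m - k ≠ 0 by omega]
      rw [e2, Pi.smul_apply, show (⇑(ContinuousMap.const ℝ (1 : ℝ)) : ℝ → ℝ) = fun _ => 1 from rfl,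
        e3]
      simp
  have hGd : ∀ j x, iteratedDeriv j G x = ν⁻¹ * iteratedDeriv j (primC^[m] Q) x := fun j x => by
    rw [hG, ContinuousMap.coe_smul]
    exact iteratedDeriv_const_mul_field _ _
  have hlow : ∀ j ≤ m, iteratedDeriv j (primC^[m] Q) = primC^[m - j] Q := by
    intro j hj
    have := iteratedDeriv_primC (primC^[m - j] Q) 0 j
    rwa [zero_add, ← Function.iterate_add_apply, Nat.add_sub_cancel' hj] at this
  refine ⟨G, hfG, ?_, ?_, ?_, ?_⟩
  · have := contDiff_iterate_primC hQs m
    rw [← two_mul] at this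
    exact contDiff_const.smul this
  · intro y hy
    rw [hGd, two_mul, iteratedDeriv_primC, hQd, hFG y hy]; ring
  · intro j hj
    rw [hGd, hlow j hj.le]
    obtain ⟨k, hk⟩ : ∃ k, m - j = k + 1 := ⟨m - j - 1, by omega⟩
    rw [hk, iterate_succ_apply', primC_zero, mul_zero]
  · intro j hj
    rw [hGd, hlow j hj.le]
    obtain ⟨k, hk⟩ : ∃ k, m - j = k + 1 := ⟨m - j - 1, by omega⟩
    rw [hk, iterate_succ_apply', ← inner_one_ofC, ← iterate_volterra_ofC, ← hqQ,
      real_inner_comm, inner_volterra_pow, real_inner_comm, hqK _ (Submodule.subset_span ⟨⟨k, by omega⟩, rfl⟩),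
      mul_zero]

theorem norm_covolterra_pow_le (m : ℕ) (f : LI) : ‖(covolterra ^ m) f‖ ≤ ‖f‖ := by
  induction m with
  | zero => exact le_rfl
  | succ m ih =>
    rw [pow_succ', mul_apply_eq_comp]
    refine le_trans ?_ ih
    have h1 : ‖covolterra‖ ≤ 1 := by
      rw [covolterra, LinearIsometryEquiv.norm_map]
      exact ContinuousLinearMap.opNorm_le_bound _ zero_le_one fun f => by
        rw [one_mul]; exact norm_volterra_le f
    exact (covolterra.le_opNorm _).trans (mul_le_of_le_one_left (norm_nonneg _) h1)

theorem dirOp_inj {m : ℕ} {f : LI} (h : dirOp m f = 0) : f = 0 := by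
  have h1 := dirOp_inner m f f
  rw [h, inner_zero_left, eq_comm, inner_self_eq_zero,
    Submodule.starProjection_apply_eq_zero_iff, Submodule.orthogonal_orthogonal] at h1
  obtain ⟨c, hc⟩ := exists_coeff h1
  exact covolterra_pow_inj m c f hc

theorem dirOp_eigenvalue {m : ℕ} {f : LI} {ν : ℝ} (hf : f ≠ 0) (h : dirOp m f = ν • f) :
    0 < ν ∧ ν ≤ 1 := by
  have h1 := dirOp_inner m f f
  rw [h, inner_smul_left, real_inner_self_eq_norm_sq, real_inner_self_eq_norm_sq] at h1
  have h0 : 0 < ‖f‖ ^ 2 := by positivity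
  have h2 : ‖(momentSpan m)ᗮ.starProjection ((covolterra ^ m) f)‖ ≤ ‖f‖ :=
    (Submodule.norm_starProjection_apply_le _ _).trans (norm_covolterra_pow_le m f)
  have h3 := pow_le_pow_left₀ (norm_nonneg _) h2 2
  simp only [conj_trivial] at h1
  refine ⟨lt_of_le_of_ne ?_ ?_, ?_⟩
  · by_contra! hlt
    nlinarith [sq_nonneg ‖(momentSpan m)ᗮ.starProjection ((covolterra ^ m) f)‖]
  · rintro rfl
    exact hf (dirOp_inj (h.trans (zero_smul _ _)))
  · nlinarith

/-- A compact symmetric operator with trivial kernel has an orthonormal basis of eigenvectors. -/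
theorem exists_hilbertBasis_eigenvectors {H : Type} [NormedAddCommGroup H] [InnerProductSpace ℝ H]
    [CompleteSpace H] {T : H →L[ℝ] H} (hT : IsCompactOperator T) (hsymm : T.IsSymmetric)
    (hinj : ∀ f, T f = 0 → f = 0) :
    ∃ (ι : Type) (b : HilbertBasis ι ℝ H) (ν : ι → ℝ), ∀ k, T (b k) = ν k • b k := by
  have hfin : ∀ ν, FiniteDimensional ℝ (Module.End.eigenspace (T : H →ₗ[ℝ] H) ν) := by
    intro ν
    by_cases h : ν = 0
    · have : Module.End.eigenspace (T : H →ₗ[ℝ] H) ν = ⊥ := by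
        rw [Submodule.eq_bot_iff]
        intro f hf
        rw [Module.End.mem_eigenspace_iff, h, zero_smul] at hf
        exact hinj f hf
      rw [this]; infer_instance
    · exact ContinuousLinearMap.finite_dimensional_eigenspace hT ν h
  set v : (Σ ν : ℝ, Fin (Module.finrank ℝ (Module.End.eigenspace (T : H →ₗ[ℝ] H) ν))) → H :=
    fun a => (stdOrthonormalBasis ℝ (Module.End.eigenspace (T : H →ₗ[ℝ] H) a.1) a.2 : H) with hv
  have hon : Orthonormal ℝ v :=
    hsymm.orthogonalFamily_eigenspaces.orthonormal_sigma_orthonormal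
      fun ν => (stdOrthonormalBasis ℝ (Module.End.eigenspace (T : H →ₗ[ℝ] H) ν)).orthonormal
  have hspan : (Submodule.span ℝ (range v))ᗮ = ⊥ := by
    rw [eq_bot_iff, ← ContinuousLinearMap.orthogonalComplement_iSup_eigenspaces_eq_bot hT hsymm]
    refine Submodule.orthogonal_le (iSup_le fun ν u hu => ?_)
    have h1 := (stdOrthonormalBasis ℝ (Module.End.eigenspace (T : H →ₗ[ℝ] H) ν)).sum_repr ⟨u, hu⟩
    have h2 := congrArg Subtype.val h1
    simp only [Submodule.coe_sum, Submodule.coe_smul] at h2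
    rw [← h2]
    exact Submodule.sum_mem _ fun i _ => Submodule.smul_mem _ _
      (Submodule.subset_span ⟨⟨ν, i⟩, rfl⟩)
  refine ⟨_, HilbertBasis.mkOfOrthogonalEqBot hon hspan, fun a => a.1, fun a => ?_⟩
  rw [HilbertBasis.coe_mkOfOrthogonalEqBot]
  exact Module.End.mem_eigenspace_iff.1 (stdOrthonormalBasis ℝ _ a.2).2

/-- Orthonormal basis of Dirichlet eigenfunctions of `(-1)^m D^{2m}`. -/
theorem exists_dirichlet_basis {m : ℕ} (hm : 1 ≤ m) :
    ∃ (ι : Type) (e : ι → ℝ → ℝ) (μ : ι → ℝ), (∀ k, IsEig m (e k) (μ k)) ∧ (∀ k, 1 ≤ μ k) ∧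
      (∀ k, ∫ y in (0 : ℝ)..1, e k y ^ 2 = 1) ∧
      (∀ k l, k ≠ l → ∫ y in (0 : ℝ)..1, e k y * e l y = 0) ∧
      ∀ f : ℝ → ℝ, Continuous f →
        HasSum (fun k => (∫ y in (0 : ℝ)..1, f y * e k y) ^ 2) (∫ y in (0 : ℝ)..1, f y ^ 2) := by
  obtain ⟨ι, b, ν, heig⟩ := exists_hilbertBasis_eigenvectors (isCompactOperator_dirOp hm)
    (dirOp_symm m) fun f h => dirOp_inj h
  have hon := b.orthonormal
  have hpos : ∀ a, 0 < ν a ∧ ν a ≤ 1 := fun a => dirOp_eigenvalue (hon.ne_zero a) (heig a)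
  have hF0 : ∀ a, ∃ F : C(ℝ, ℝ), b a = ofC F ∧ IsEig m F (ν a)⁻¹ :=
    fun a => dirOp_eig hm (hpos a).1.ne' (heig a)
  choose F hF hF' using hF0
  refine ⟨ι, fun a => F a, fun a => (ν a)⁻¹, hF', fun a => (one_le_inv₀ (hpos a).1).2 (hpos a).2,
    fun a => ?_, fun a c hac => ?_, fun f hf => ?_⟩
  · simp_rw [pow_two]
    rw [← inner_ofC, ← hF, real_inner_self_eq_norm_sq, hon.1 a, one_pow]
  · rw [← inner_ofC, ← hF, ← hF, hon.2 hac]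
  · have h := b.hasSum_inner_mul_inner (ofC ⟨f, hf⟩) (ofC ⟨f, hf⟩)
    have e1 : (∫ y in (0 : ℝ)..1, f y ^ 2) = ⟪ofC ⟨f, hf⟩, ofC ⟨f, hf⟩⟫_ℝ := by
      rw [inner_ofC]; simp [pow_two]
    have e2 : ∀ k, (∫ y in (0 : ℝ)..1, f y * F k y) ^ 2
        = ⟪ofC ⟨f, hf⟩, b k⟫_ℝ * ⟪b k, ofC ⟨f, hf⟩⟫_ℝ := by
      intro k
      rw [real_inner_comm, hF k, inner_ofC, pow_two]; simp [mul_comm]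
    simp only [e1, e2]
    exact h

end spectral

section onedim

/-- Squared `L²(0,1)` norm. -/
def en (f : ℝ → ℝ) : ℝ := ∫ y in (0 : ℝ)..1, f y ^ 2

theorem en_nonneg (f : ℝ → ℝ) : 0 ≤ en f :=
  intervalIntegral.integral_nonneg zero_le_one fun _ _ => sq_nonneg _

theorem integral_sq_le_en {f : ℝ → ℝ} (hf : Continuous f) {a b : ℝ} (ha : 0 ≤ a) (hab : a ≤ b)
    (hb : b ≤ 1) : ∫ y in a..b, f y ^ 2 ≤ en f :=
  integral_mono_interval ha hab hb
    (of_forall fun _ => sq_nonneg _) ((hf.pow 2).intervalIntegrable _ _)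

theorem sq_sub_le_integral {f f' : ℝ → ℝ} (hf' : Continuous f')
    (h : ∀ y, HasDerivAt f (f' y) y) {a b : ℝ} (hab : a ≤ b) :
    (f b - f a) ^ 2 ≤ (b - a) * ∫ y in a..b, f' y ^ 2 := by
  rcases hab.eq_or_lt with rfl | hlt
  · simp
  have h1 : ∫ y in a..b, f' y = f b - f a :=
    integral_eq_sub_of_hasDerivAt (fun y _ => h y) (hf'.intervalIntegrable _ _)
  set c := (f b - f a) / (b - a) with hc
  have h2 : 0 ≤ ∫ y in a..b, (f' y - c) ^ 2 :=
    intervalIntegral.integral_nonneg hab fun _ _ => sq_nonneg _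
  have h3 : ∫ y in a..b, (f' y - c) ^ 2
      = (∫ y in a..b, f' y ^ 2) - 2 * c * (f b - f a) + c ^ 2 * (b - a) := by
    have e : (fun y => (f' y - c) ^ 2) = fun y => (f' y ^ 2 - 2 * c * f' y) + c ^ 2 := by
      funext y; ring
    have i1 : Continuous fun y => f' y ^ 2 := hf'.pow 2
    have i2 : Continuous fun y => 2 * c * f' y := by fun_prop
    have i3 : Continuous fun y => f' y ^ 2 - 2 * c * f' y := by fun_prop
    rw [e, intervalIntegral.integral_add (i3.intervalIntegrable _ _)
      (continuous_const.intervalIntegrable _ _),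
      intervalIntegral.integral_sub (i1.intervalIntegrable _ _) (i2.intervalIntegrable _ _),
      intervalIntegral.integral_const_mul, h1, intervalIntegral.integral_const, smul_eq_mul]
    ring
  have hba : 0 < b - a := sub_pos.2 hlt
  have h4 : c * (b - a) = f b - f a := div_mul_cancel₀ _ hba.ne'
  rw [h3] at h2
  have h5 : (b - a) * (2 * c * (f b - f a)) = 2 * (f b - f a) ^ 2 := by rw [← h4]; ring
  have h6 : (b - a) * (c ^ 2 * (b - a)) = (f b - f a) ^ 2 := by rw [← h4]; ring
  nlinarith [mul_nonneg hba.le h2]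

/-- One-dimensional Sobolev inequality with scale. -/
theorem sq_le_en {f f' : ℝ → ℝ} (hf' : Continuous f') (h : ∀ y, HasDerivAt f (f' y) y) {s : ℝ}
    (hs : 0 < s) (hs1 : s ≤ 1) {y : ℝ} (hy : y ∈ Icc (0 : ℝ) 1) :
    f y ^ 2 ≤ 2 / s * en f + 2 * s * en f' := by
  obtain ⟨a, ha0, ha1, hay, hya⟩ : ∃ a, 0 ≤ a ∧ a + s ≤ 1 ∧ a ≤ y ∧ y ≤ a + s := by
    rcases le_total y s with h | h
    · exact ⟨0, le_rfl, by linarith, hy.1, by linarith⟩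
    · exact ⟨y - s, by linarith, by linarith [hy.2], by linarith, by linarith⟩
  have hf : Continuous f := continuous_iff_continuousAt.2 fun y => (h y).continuousAt
  have key : ∀ z ∈ Icc a (a + s), f y ^ 2 ≤ 2 * f z ^ 2 + 2 * (s * en f') := by
    intro z hz
    have h1 : (f y - f z) ^ 2 ≤ s * en f' := by
      rcases le_total y z with hyz | hyz
      · rw [← neg_sub, neg_sq]
        exact (sq_sub_le_integral hf' h hyz).trans (mul_le_mul (by linarith [hz.2])
          (integral_sq_le_en hf' hy.1 hyz (hz.2.trans ha1))
          (intervalIntegral.integral_nonneg hyz fun _ _ => sq_nonneg _) hs.le)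
      · exact (sq_sub_le_integral hf' h hyz).trans (mul_le_mul (by linarith [hz.1])
          (integral_sq_le_en hf' (ha0.trans hz.1) hyz hy.2)
          (intervalIntegral.integral_nonneg hyz fun _ _ => sq_nonneg _) hs.le)
    nlinarith [sq_nonneg (f y - 2 * f z)]
  have i1 : Continuous fun z => 2 * f z ^ 2 := by fun_prop
  have i2 : Continuous fun z => 2 * f z ^ 2 + 2 * (s * en f') := by fun_prop
  have h2 := integral_mono_on (μ := volume) (show a ≤ a + s by linarith)
    (intervalIntegrable_const (c := f y ^ 2)) (i2.intervalIntegrable _ _) key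
  rw [intervalIntegral.integral_add (i1.intervalIntegrable _ _)
    intervalIntegrable_const, intervalIntegral.integral_const_mul,
    intervalIntegral.integral_const, intervalIntegral.integral_const, smul_eq_mul, smul_eq_mul,
    add_sub_cancel_left] at h2
  have h3 := integral_sq_le_en hf ha0 (show a ≤ a + s by linarith) ha1
  have h4 : s * f y ^ 2 ≤ 2 * en f + s * (2 * (s * en f')) := by linarith
  rw [← mul_le_mul_iff_right₀ hs]
  calc s * f y ^ 2 ≤ _ := h4
    _ = _ := by field_simp

theorem abs_integral_mul_le_en {f g : ℝ → ℝ} (hf : Continuous f) (hg : Continuous g) :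
    (∫ y in (0 : ℝ)..1, f y * g y) ^ 2 ≤ en f * en g := by
  have h := real_inner_mul_inner_self_le (ofC ⟨f, hf⟩) (ofC ⟨g, hg⟩)
  simp only [inner_ofC, ContinuousMap.coe_mk] at h
  simpa only [en, pow_two] using h

/-- Interpolation of a first derivative. -/
theorem en_deriv_le {f f' f'' : ℝ → ℝ} (hf'' : Continuous f'') (h : ∀ y, HasDerivAt f (f' y) y)
    (h' : ∀ y, HasDerivAt f' (f'' y) y) {s : ℝ} (hs : 0 < s) (hs1 : s ≤ 1) :
    en f' ≤ 2050 / s ^ 2 * en f + s ^ 2 * en f'' := by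
  have hf' : Continuous f' := continuous_iff_continuousAt.2 fun y => (h' y).continuousAt
  have hf : Continuous f := continuous_iff_continuousAt.2 fun y => (h y).continuousAt
  have ibp := integral_mul_deriv_eq_deriv_mul (a := 0) (b := 1)
    (fun y _ => h' y) (fun y _ => h y) (hf''.intervalIntegrable _ _) (hf'.intervalIntegrable _ _)
  have e1 : (∫ y in (0 : ℝ)..1, f' y * f' y) = en f' := by simp [en, pow_two]
  rw [e1] at ibp
  have cs := abs_integral_mul_le_en hf'' hf
  set X := en f
  set Y := en f'
  set Z := en f''
  have hX : 0 ≤ X := en_nonneg _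
  have hY : 0 ≤ Y := en_nonneg _
  have hZ : 0 ≤ Z := en_nonneg _
  have bd : ∀ y ∈ Icc (0 : ℝ) 1, |f' y * f y| ≤ 512 * X / s ^ 2 + Y / 8 + Y / 8 + s ^ 2 * Z / 8 := by
    intro y hy
    have p := sq_le_en hf' h (s := s / 64) (by positivity) (by linarith) hy
    have q := sq_le_en hf'' h' hs hs1 hy
    have am : |f' y * f y| ≤ 4 / s * f y ^ 2 + s / 16 * f' y ^ 2 := by
      rw [abs_mul]
      have : 4 / s * f y ^ 2 + s / 16 * f' y ^ 2 - |f' y| * |f y|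
          = (4 / s) * (|f y| - s / 8 * |f' y|) ^ 2 := by
        rw [← sq_abs (f y), ← sq_abs (f' y)]
        field_simp; ring
      have h0 : 0 ≤ (4 / s) * (|f y| - s / 8 * |f' y|) ^ 2 := by positivity
      linarith
    have p2 := mul_le_mul_of_nonneg_left p (show 0 ≤ 4 / s by positivity)
    have q2 := mul_le_mul_of_nonneg_left q (show 0 ≤ s / 16 by positivity)
    have p3 : 4 / s * (2 / (s / 64) * X + 2 * (s / 64) * Y) = 512 * X / s ^ 2 + Y / 8 := by
      field_simp; ring
    have q3 : s / 16 * (2 / s * Y + 2 * s * Z) = Y / 8 + s ^ 2 * Z / 8 := by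
      field_simp; ring
    linarith
  have b1 := bd 1 (by simp)
  have b0 := bd 0 (by simp)
  have hI : |∫ y in (0 : ℝ)..1, f'' y * f y| ≤ X / s ^ 2 + s ^ 2 * Z / 4 := by
    apply abs_le_of_sq_le_sq _ (by positivity)
    have : (X / s ^ 2 + s ^ 2 * Z / 4) ^ 2 - Z * X = (X / s ^ 2 - s ^ 2 * Z / 4) ^ 2 := by
      field_simp; ring
    nlinarith [sq_nonneg (X / s ^ 2 - s ^ 2 * Z / 4)]
  have t1 := abs_le.1 b1
  have t0 := abs_le.1 b0
  have tI := abs_le.1 hI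
  have e5 : 2050 / s ^ 2 * X = 2 * (1025 * (X / s ^ 2)) := by ring
  have e6 : 512 * X / s ^ 2 = 512 * (X / s ^ 2) := by ring
  rw [e5]
  rw [e6] at t1 t0
  linarith [t1.2, t0.1, tI.1]

theorem hasDerivAt_iteratedDeriv {M : ℕ} {f : ℝ → ℝ} (hf : ContDiff ℝ M f) {j : ℕ} (hj : j < M)
    (y : ℝ) : HasDerivAt (iteratedDeriv j f) (iteratedDeriv (j + 1) f y) y := by
  rw [iteratedDeriv_succ]
  exact ((hf.differentiable_iteratedDeriv j (by exact_mod_cast hj)) y).hasDerivAt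

theorem continuous_iteratedDeriv' {M : ℕ} {f : ℝ → ℝ} (hf : ContDiff ℝ M f) {j : ℕ} (hj : j ≤ M) :
    Continuous (iteratedDeriv j f) :=
  hf.continuous_iteratedDeriv j (by exact_mod_cast hj)

/-- Abstract interpolation along a chain. -/
theorem chain_interp (M : ℕ) {D : ℝ → ℝ} (hD : ∀ δ, 0 < δ → 0 ≤ D δ) :
    ∀ δ, 0 < δ → ∃ C, 0 ≤ C ∧ ∀ a : ℕ → ℝ, (∀ j, 0 ≤ a j) →
      (∀ j < M, ∀ δ, 0 < δ → δ ≤ 1 → a (j + 1) ≤ δ * a (j + 2) + D δ * a j) →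
      a M ≤ δ * a (M + 1) + C * a 0 := by
  induction M with
  | zero => exact fun δ hδ => ⟨1, zero_le_one, fun a ha _ => by nlinarith [ha 1, ha 0]⟩
  | succ M ih =>
    intro δ hδ
    set ε := min (δ / 2) 1 with hε
    have hε0 : 0 < ε := lt_min (by positivity) one_pos
    obtain ⟨C, hC, h⟩ := ih (1 / (2 * (D ε + 1))) (by have := hD ε hε0; positivity)
    have hDε := hD ε hε0
    refine ⟨2 * D ε * C, by positivity, fun a ha hstep => ?_⟩
    have h1 := hstep M (Nat.lt_succ_self M) ε hε0 (min_le_right _ _)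
    have h2 := h a ha fun j hj => hstep j (hj.trans (Nat.lt_succ_self M))
    have h3 : D ε * a M ≤ 1 / 2 * a (M + 1) + D ε * C * a 0 := by
      have h4 := mul_le_mul_of_nonneg_left h2 hDε
      have h5 : D ε * (1 / (2 * (D ε + 1))) ≤ 1 / 2 := by
        rw [mul_one_div, div_le_div_iff₀ (by positivity) (by norm_num)]; linarith
      nlinarith [ha (M + 1)]
    have h6 : ε * a (M + 2) ≤ δ / 2 * a (M + 2) :=
      mul_le_mul_of_nonneg_right (min_le_left _ _) (ha _)
    show a (M + 1) ≤ δ * a (M + 2) + _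
    linarith

theorem chain_interp' (M : ℕ) {D : ℝ → ℝ} (hD : ∀ δ, 0 < δ → 0 ≤ D δ) :
    ∃ C, 0 ≤ C ∧ ∀ a : ℕ → ℝ, (∀ j, 0 ≤ a j) →
      (∀ j, j + 2 ≤ M → ∀ δ, 0 < δ → δ ≤ 1 → a (j + 1) ≤ δ * a (j + 2) + D δ * a j) →
      ∀ j ≤ M, a j ≤ C * (a M + a 0) := by
  induction M with
  | zero => exact ⟨1, zero_le_one, fun a ha _ j hj => by
      obtain rfl : j = 0 := by omega
      linarith [ha 0]⟩
  | succ M ih =>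
    obtain ⟨C, hC, h⟩ := ih
    obtain ⟨C', hC', h'⟩ := chain_interp M hD 1 one_pos
    refine ⟨C * (1 + C') + C + 1, by positivity, fun a ha hstep j hj => ?_⟩
    have h1 := h' a ha fun j hj => hstep j (by omega)
    rcases Nat.lt_or_ge j (M + 1) with hlt | hge
    · have h2 := h a ha (fun j hj => hstep j (by omega)) j (by omega)
      have h3 : a M + a 0 ≤ (1 + C') * (a (M + 1) + a 0) := by nlinarith [ha (M + 1), ha 0]
      have h4 := mul_le_mul_of_nonneg_left h3 hC
      nlinarith [ha (M + 1), ha 0]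
    · obtain rfl : j = M + 1 := by omega
      have : 0 ≤ C * (1 + C') + C := by positivity
      nlinarith [ha (M + 1), ha 0, mul_nonneg this (ha (M + 1)), mul_nonneg this (ha 0)]

/-- Interpolation of intermediate derivatives on the unit interval, at frequency `κ ≥ 1`. -/
theorem exists_interpolation (M : ℕ) : ∃ C, 0 ≤ C ∧ ∀ f : ℝ → ℝ, ContDiff ℝ M f → ∀ κ : ℝ, 1 ≤ κ →
    ∀ j ≤ M, en (iteratedDeriv j f) ≤
      C * κ ^ (2 * j) * (en (iteratedDeriv M f) / κ ^ (2 * M) + en f) := by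
  obtain ⟨C, hC, h⟩ := chain_interp' M (D := fun δ => 2050 / δ) fun δ hδ => by positivity
  refine ⟨C, hC, fun f hf κ hκ j hj => ?_⟩
  have hκ0 : 0 < κ := by linarith
  have h1 := h (fun j => en (iteratedDeriv j f) / κ ^ (2 * j))
    (fun j => div_nonneg (en_nonneg _) (by positivity)) ?_ j hj
  · simp only [mul_zero, pow_zero, div_one, iteratedDeriv_zero] at h1
    rw [div_le_iff₀ (by positivity)] at h1
    linarith
  · intro i hi δ hδ hδ1
    have h2 := en_deriv_le (continuous_iteratedDeriv' hf hi)
      (hasDerivAt_iteratedDeriv hf (show i < M by omega))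
      (hasDerivAt_iteratedDeriv hf (show i + 1 < M by omega)) (s := sqrt δ / κ)
      (by positivity) (by
        rw [div_le_one hκ0]
        exact (Real.sqrt_le_one.2 hδ1).trans hκ)
    rw [div_pow, sq_sqrt hδ.le] at h2
    rw [div_le_iff₀ (by positivity)]
    calc _ ≤ _ := h2
      _ = _ := by field_simp; ring

end onedim

section dirbasis

/-- The `L²(0,1)` pairing. -/
def ip (f h : ℝ → ℝ) : ℝ := ∫ y in (0 : ℝ)..1, f y * h y

theorem ip_self (f : ℝ → ℝ) : ip f f = en f := by simp [ip, en, pow_two]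

theorem ip_comm (f h : ℝ → ℝ) : ip f h = ip h f := by simp [ip, mul_comm]

theorem sq_ip_le {f h : ℝ → ℝ} (hf : Continuous f) (hh : Continuous h) :
    ip f h ^ 2 ≤ en f * en h := abs_integral_mul_le_en hf hh

theorem abs_ip_le {f h : ℝ → ℝ} (hf : Continuous f) (hh : Continuous h) {a b : ℝ} (ha : 0 ≤ a)
    (hb : 0 ≤ b) (h1 : en f ≤ a ^ 2) (h2 : en h ≤ b ^ 2) : |ip f h| ≤ a * b := by
  apply abs_le_of_sq_le_sq _ (by positivity)
  calc ip f h ^ 2 ≤ en f * en h := sq_ip_le hf hh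
    _ ≤ a ^ 2 * b ^ 2 := mul_le_mul h1 h2 (en_nonneg _) (by positivity)
    _ = (a * b) ^ 2 := by ring

theorem ip_congr {f f' h h' : ℝ → ℝ} (hf : ∀ y ∈ Icc (0 : ℝ) 1, f y = f' y)
    (hh : ∀ y ∈ Icc (0 : ℝ) 1, h y = h' y) : ip f h = ip f' h' := by
  apply intervalIntegral.integral_congr
  intro y hy
  rw [uIcc_of_le zero_le_one] at hy
  simp only [hf y hy, hh y hy]

theorem en_congr {f f' : ℝ → ℝ} (hf : ∀ y ∈ Icc (0 : ℝ) 1, f y = f' y) : en f = en f' := by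
  rw [← ip_self, ← ip_self]; exact ip_congr hf hf

theorem ip_sum_right {ι : Type*} {f : ℝ → ℝ} {h : ι → ℝ → ℝ} {S : Finset ι} (c : ι → ℝ)
    (hf : Continuous f) (hh : ∀ k ∈ S, Continuous (h k)) :
    ip f (fun y => ∑ k ∈ S, c k * h k y) = ∑ k ∈ S, c k * ip f (h k) := by
  have e : ∀ y, f y * ∑ k ∈ S, c k * h k y = ∑ k ∈ S, c k * (f y * h k y) := fun y => by
    rw [mul_sum]; exact sum_congr rfl fun k _ => by ring
  simp only [ip, e]
  rw [intervalIntegral.integral_finsetSum]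
  · simp only [intervalIntegral.integral_const_mul]
  · intro k hk
    exact (continuous_const.mul (hf.mul (hh k hk))).intervalIntegrable _ _

theorem ip_add_left {f g h : ℝ → ℝ} (hf : Continuous f) (hg : Continuous g) (hh : Continuous h) :
    ip (fun y => f y + g y) h = ip f h + ip g h := by
  have i1 : Continuous fun y => f y * h y := by fun_prop
  have i2 : Continuous fun y => g y * h y := by fun_prop
  simp only [ip, add_mul]
  exact intervalIntegral.integral_add (i1.intervalIntegrable _ _) (i2.intervalIntegrable _ _)

theorem ip_smul_left (c : ℝ) (f h : ℝ → ℝ) : ip (fun y => c * f y) h = c * ip f h := by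
  simp only [ip, mul_assoc, intervalIntegral.integral_const_mul]

theorem ip_sub_left {f g h : ℝ → ℝ} (hf : Continuous f) (hg : Continuous g) (hh : Continuous h) :
    ip (fun y => f y - g y) h = ip f h - ip g h := by
  have := ip_add_left hf (g := fun y => -1 * g y) (by fun_prop) hh
  rw [ip_smul_left] at this
  simpa [sub_eq_add_neg] using this

theorem en_sub {f g : ℝ → ℝ} (hf : Continuous f) (hg : Continuous g) :
    en (fun y => f y - g y) = en f - 2 * ip f g + en g := by
  have h : Continuous fun y => f y - g y := by fun_prop
  rw [← ip_self, ip_sub_left hf hg h, ip_comm f, ip_comm g, ip_sub_left hf hg hf,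
    ip_sub_left hf hg hg, ip_self, ip_self, ip_comm g f]
  ring

/-- Functions of class `C^{2m}` with Dirichlet data at `0` and `1`. -/
structure IsDir (m : ℕ) (f : ℝ → ℝ) : Prop where
  smooth : ContDiff ℝ (2 * m : ℕ) f
  bc0 : ∀ j < m, iteratedDeriv j f 0 = 0
  bc1 : ∀ j < m, iteratedDeriv j f 1 = 0

variable {m : ℕ}

theorem IsDir.continuous {f : ℝ → ℝ} (hf : IsDir m f) : Continuous f := hf.smooth.continuous

theorem IsDir.continuous_iter {f : ℝ → ℝ} (hf : IsDir m f) {j : ℕ} (hj : j ≤ 2 * m) :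
    Continuous (iteratedDeriv j f) := continuous_iteratedDeriv' hf.smooth hj

theorem ip_iteratedDeriv_succ {f h : ℝ → ℝ} (hf : IsDir m f) (hh : IsDir m h) {i j : ℕ}
    (hij : i + j < 2 * m) :
    ip (iteratedDeriv (i + 1) f) (iteratedDeriv j h) =
      -ip (iteratedDeriv i f) (iteratedDeriv (j + 1) h) := by
  have h1 := integral_mul_deriv_eq_deriv_mul (a := 0) (b := 1)
    (fun y _ => hasDerivAt_iteratedDeriv hf.smooth (show i < 2 * m by omega) y)
    (fun y _ => hasDerivAt_iteratedDeriv hh.smooth (show j < 2 * m by omega) y)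
    ((hf.continuous_iter (by omega)).intervalIntegrable _ _)
    ((hh.continuous_iter (by omega)).intervalIntegrable _ _)
  have b0 : iteratedDeriv i f 0 * iteratedDeriv j h 0 = 0 := by
    rcases Nat.lt_or_ge i m with hi | hi
    · rw [hf.bc0 i hi, zero_mul]
    · rw [hh.bc0 j (by omega), mul_zero]
  have b1 : iteratedDeriv i f 1 * iteratedDeriv j h 1 = 0 := by
    rcases Nat.lt_or_ge i m with hi | hi
    · rw [hf.bc1 i hi, zero_mul]
    · rw [hh.bc1 j (by omega), mul_zero]
  rw [b0, b1] at h1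
  simp only [ip]
  linarith

theorem ip_iteratedDeriv_shift {f h : ℝ → ℝ} (hf : IsDir m f) (hh : IsDir m h) (i : ℕ) :
    ∀ j, i + j ≤ 2 * m → ip (iteratedDeriv i f) (iteratedDeriv j h) =
      (-1) ^ i * ip f (iteratedDeriv (i + j) h) := by
  induction i with
  | zero => intro j _; simp
  | succ i ih =>
    intro j hij
    rw [ip_iteratedDeriv_succ hf hh (by omega), ih (j + 1) (by omega), pow_succ,
      show i + (j + 1) = i + 1 + j by omega]
    ring

theorem ip_iteratedDeriv_left {f h : ℝ → ℝ} (hf : IsDir m f) (hh : IsDir m h) {i : ℕ}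
    (hi : i ≤ 2 * m) :
    ip (iteratedDeriv i f) h = (-1) ^ i * ip f (iteratedDeriv i h) := by
  simpa using ip_iteratedDeriv_shift hf hh i 0 hi

/-- A Dirichlet eigenbasis of `(-1)^m D^{2m}` on the unit interval. -/
structure DirBasis (m : ℕ) where
  ι : Type
  e : ι → ℝ → ℝ
  μ : ι → ℝ
  eig : ∀ k, IsEig m (e k) (μ k)
  one_le : ∀ k, 1 ≤ μ k
  normed : ∀ k, ∫ y in (0 : ℝ)..1, e k y ^ 2 = 1
  orth : ∀ k l, k ≠ l → ∫ y in (0 : ℝ)..1, e k y * e l y = 0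
  parseval : ∀ f : ℝ → ℝ, Continuous f →
    HasSum (fun k => (∫ y in (0 : ℝ)..1, f y * e k y) ^ 2) (∫ y in (0 : ℝ)..1, f y ^ 2)

theorem exists_dirBasis (hm : 1 ≤ m) : Nonempty (DirBasis m) := by
  obtain ⟨ι, e, μ, h1, h2, h3, h4, h5⟩ := exists_dirichlet_basis hm
  exact ⟨⟨ι, e, μ, h1, h2, h3, h4, h5⟩⟩

namespace DirBasis

variable (B : DirBasis m)

theorem isDir (k : B.ι) : IsDir m (B.e k) := ⟨(B.eig k).smooth, (B.eig k).bc0, (B.eig k).bc1⟩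

/-- Finite combinations of eigenfunctions. -/
def comb (S : Finset B.ι) (c : B.ι → ℝ) (y : ℝ) : ℝ := ∑ k ∈ S, c k * B.e k y

variable (S : Finset B.ι) (c : B.ι → ℝ)

theorem contDiff_comb : ContDiff ℝ (2 * m : ℕ) (B.comb S c) :=
  ContDiff.sum fun k _ => contDiff_const.mul (B.eig k).smooth

theorem iteratedDeriv_comb (j : ℕ) (hj : j ≤ 2 * m) :
    iteratedDeriv j (B.comb S c) = fun y => ∑ k ∈ S, c k * iteratedDeriv j (B.e k) y := by
  induction j with
  | zero => simp only [iteratedDeriv_zero]; rfl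
  | succ j ih =>
    rw [iteratedDeriv_succ, ih (by omega)]
    funext y
    exact (HasDerivAt.fun_sum fun k _ =>
      (hasDerivAt_iteratedDeriv (B.eig k).smooth (by omega) y).const_mul (c k)).deriv

theorem isDir_comb : IsDir m (B.comb S c) where
  smooth := B.contDiff_comb S c
  bc0 j hj := by
    rw [B.iteratedDeriv_comb S c j (by omega)]
    exact sum_eq_zero fun k _ => by rw [(B.eig k).bc0 j hj, mul_zero]
  bc1 j hj := by
    rw [B.iteratedDeriv_comb S c j (by omega)]
    exact sum_eq_zero fun k _ => by rw [(B.eig k).bc1 j hj, mul_zero]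

theorem iteratedDeriv_comb_top {y : ℝ} (hy : y ∈ Icc (0 : ℝ) 1) :
    iteratedDeriv (2 * m) (B.comb S c) y = (-1) ^ m * B.comb S (fun k => B.μ k * c k) y := by
  rw [B.iteratedDeriv_comb S c _ le_rfl, comb, mul_sum]
  refine sum_congr rfl fun k _ => ?_
  rw [(B.eig k).eqn y hy]; ring

theorem ip_comb {f : ℝ → ℝ} (hf : Continuous f) :
    ip f (B.comb S c) = ∑ k ∈ S, c k * ip f (B.e k) :=
  ip_sum_right c hf fun k _ => (B.isDir k).continuous

open Classical in
theorem ip_comb_e (k : B.ι) : ip (B.comb S c) (B.e k) = if k ∈ S then c k else 0 := by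
  rw [ip_comm, B.ip_comb S c (B.isDir k).continuous]
  have h : ∀ l, ip (B.e k) (B.e l) = if k = l then 1 else 0 := fun l => by
    split_ifs with h
    · subst h; rw [ip_self]; exact B.normed k
    · exact B.orth k l h
  simp only [h, mul_ite, mul_one, mul_zero, Finset.sum_ite_eq]

theorem en_comb : en (B.comb S c) = ∑ k ∈ S, c k ^ 2 := by
  rw [← ip_self, B.ip_comb S c (B.isDir_comb S c).continuous]
  refine sum_congr rfl fun k hk => ?_
  rw [B.ip_comb_e, if_pos hk]; ring

/-- Eigenfunction coefficients. -/
def coef (f : ℝ → ℝ) (k : B.ι) : ℝ := ip f (B.e k)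

theorem en_sub_comb {f : ℝ → ℝ} (hf : Continuous f) :
    en (fun y => f y - B.comb S (B.coef f) y) = en f - ∑ k ∈ S, B.coef f k ^ 2 := by
  rw [en_sub hf (B.isDir_comb S _).continuous, B.ip_comb S _ hf, en_comb]
  have : ∑ k ∈ S, B.coef f k * ip f (B.e k) = ∑ k ∈ S, B.coef f k ^ 2 :=
    sum_congr rfl fun k _ => by rw [coef]; ring
  rw [this]; ring

theorem sum_coef_sq_le {f : ℝ → ℝ} (hf : Continuous f) : ∑ k ∈ S, B.coef f k ^ 2 ≤ en f := by
  have h1 := B.en_sub_comb S hf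
  have h2 := en_nonneg (fun y => f y - B.comb S (B.coef f) y)
  linarith

theorem coef_iteratedDeriv_top {f : ℝ → ℝ} (hf : IsDir m f) (k : B.ι) :
    B.coef (iteratedDeriv (2 * m) f) k = (-1) ^ m * (B.μ k * B.coef f k) := by
  rw [coef, ip_iteratedDeriv_left hf (B.isDir k) le_rfl]
  have : ip f (iteratedDeriv (2 * m) (B.e k)) = ip f (fun y => (-1) ^ m * B.μ k * B.e k y) :=
    ip_congr (fun _ _ => rfl) fun y hy => by rw [(B.eig k).eqn y hy]; ring
  rw [this, ip_comm, ip_smul_left, ip_comm, pow_mul]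
  simp [coef]; ring

/-- Convergence of eigenfunction expansions in all derivatives. -/
theorem tendsto_iteratedDeriv {f : ℝ → ℝ} (hf : IsDir m f) {s : ℕ → Finset B.ι}
    (hs : Tendsto s atTop atTop) {j : ℕ} (hj : j < 2 * m) {y : ℝ}
    (hy : y ∈ Icc (0 : ℝ) 1) :
    Tendsto (fun L => iteratedDeriv j (B.comb (s L) (B.coef f)) y) atTop
      (𝓝 (iteratedDeriv j f y)) := by
  obtain ⟨C, hC, hint⟩ := exists_interpolation (2 * m)
  have par : ∀ g : ℝ → ℝ, Continuous g → Tendsto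
      (fun L => en g - ∑ k ∈ s L, B.coef g k ^ 2) atTop (𝓝 0) := fun g hg => by
    have := (((B.parseval g hg).comp hs).const_sub (en g))
    simpa [en, coef, ip] using this
  set q : ℕ → ℝ → ℝ := fun L y => f y - B.comb (s L) (B.coef f) y with hq
  have hqs : ∀ L, ContDiff ℝ (2 * m : ℕ) (q L) := fun L => hf.smooth.sub (B.contDiff_comb _ _)
  have hqd : ∀ L, ∀ i ≤ 2 * m, ∀ y, iteratedDeriv i (q L) y
      = iteratedDeriv i f y - iteratedDeriv i (B.comb (s L) (B.coef f)) y := fun L i hi y =>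
    iteratedDeriv_fun_sub ((hf.smooth.of_le (by exact_mod_cast hi)).contDiffAt)
      (((B.contDiff_comb _ _).of_le (by exact_mod_cast hi)).contDiffAt)
  have e0 : Tendsto (fun L => en (q L)) atTop (𝓝 0) := by
    simpa only [hq, B.en_sub_comb _ hf.continuous] using par f hf.continuous
  have e1 : Tendsto (fun L => en (iteratedDeriv (2 * m) (q L))) atTop (𝓝 0) := by
    have hc := hf.continuous_iter le_rfl
    convert par _ hc using 2 with L
    rw [← B.en_sub_comb _ hc]
    apply en_congr
    intro y hy
    rw [hqd L _ le_rfl, B.iteratedDeriv_comb_top _ _ hy]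
    congr 1
    rw [comb, comb, mul_sum]
    refine sum_congr rfl fun k _ => ?_
    rw [B.coef_iteratedDeriv_top hf]; ring
  have e2 : Tendsto (fun L => 4 * C * (en (iteratedDeriv (2 * m) (q L)) + en (q L)))
      atTop (𝓝 0) := by simpa using (e1.add e0).const_mul (4 * C)
  have e3 : ∀ L, iteratedDeriv j (q L) y ^ 2
      ≤ 4 * C * (en (iteratedDeriv (2 * m) (q L)) + en (q L)) := fun L => by
    have h1 := sq_le_en (continuous_iteratedDeriv' (hqs L) (show j + 1 ≤ 2 * m by omega))
      (hasDerivAt_iteratedDeriv (hqs L) hj) one_pos le_rfl hy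
    have h2 := hint _ (hqs L) 1 le_rfl j (by omega)
    have h3 := hint _ (hqs L) 1 le_rfl (j + 1) (by omega)
    simp only [one_pow, div_one, mul_one] at h1 h2 h3
    linarith
  have e4 : Tendsto (fun L => iteratedDeriv j (q L) y ^ 2) atTop (𝓝 0) :=
    squeeze_zero (fun L => sq_nonneg _) e3 e2
  have e5 : Tendsto (fun L => iteratedDeriv j (q L) y) atTop (𝓝 0) := by
    have := e4.sqrt
    simp only [sqrt_sq_eq_abs, sqrt_zero] at this
    exact (tendsto_zero_iff_abs_tendsto_zero _).2 this
  have e6 := e5.const_sub (iteratedDeriv j f y)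
  simp only [sub_zero] at e6
  refine e6.congr fun L => ?_
  rw [hqd L j (by omega)]; ring

end DirBasis
end dirbasis

section blocks

/-- Dyadic powers with real exponents. -/
def dya (x : ℝ) : ℝ := (2 : ℝ) ^ x

theorem dya_pos (x : ℝ) : 0 < dya x := Real.rpow_pos_of_pos two_pos x

theorem dya_add (x y : ℝ) : dya (x + y) = dya x * dya y := Real.rpow_add two_pos x y

theorem dya_le {x y : ℝ} (h : x ≤ y) : dya x ≤ dya y :=
  Real.rpow_le_rpow_of_exponent_le one_le_two h

theorem cast_le_two_mul_sub_one {i m : ℕ} (hi : i < 2 * m) : (i : ℝ) ≤ 2 * m - 1 := by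
  have : (i + 1 : ℝ) ≤ 2 * m := by exact_mod_cast hi
  linarith

theorem dya_zero : dya 0 = 1 := Real.rpow_zero 2

theorem dya_nat_mul (l j : ℕ) : dya (j * l) = ((2 : ℝ) ^ l) ^ j := by
  rw [dya, ← Nat.cast_mul, rpow_natCast, mul_comm, pow_mul]

theorem dya_mul_pow (x : ℝ) (j : ℕ) : dya x ^ j = dya (j * x) := by
  rw [dya, dya, ← rpow_natCast, ← rpow_mul two_pos.le, mul_comm]

theorem dya_pow (b : ℝ) (j : ℕ) : dya b ^ j = dya (b * j) := by rw [dya_mul_pow, mul_comm]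

theorem sum_geom_dist_le {q : ℝ} (hq : 0 ≤ q) (hq1 : q < 1) (l L : ℕ) :
    ∑ j ∈ Finset.range L, q ^ ((l - j) + (j - l)) ≤ 2 / (1 - q) := by
  have geo : ∀ N, ∑ j ∈ Finset.range N, q ^ j ≤ 1 / (1 - q) := fun N => by
    rw [one_div, ← tsum_geometric_of_lt_one hq hq1]
    exact (summable_geometric_of_lt_one hq hq1).sum_le_tsum _ fun _ _ => pow_nonneg hq _
  calc ∑ j ∈ Finset.range L, q ^ ((l - j) + (j - l))
      ≤ ∑ j ∈ Finset.range (l + 1 + L), q ^ ((l - j) + (j - l)) :=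
        Finset.sum_le_sum_of_subset_of_nonneg (Finset.range_mono (by omega))
          fun _ _ _ => pow_nonneg hq _
    _ = ∑ j ∈ Finset.range (l + 1), q ^ j + ∑ j ∈ Finset.range L, q ^ (j + 1) := by
        rw [Finset.sum_range_add]
        congr 1
        · rw [← Finset.sum_range_reflect]
          refine sum_congr rfl fun j hj => ?_
          rw [Finset.mem_range] at hj
          congr 1; omega
        · exact sum_congr rfl fun j _ => by congr 1; omega
    _ ≤ 1 / (1 - q) + 1 / (1 - q) := by
        refine add_le_add (geo _) (le_trans (sum_le_sum fun j _ => ?_) (geo L))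
        exact pow_le_pow_of_le_one hq hq1.le (Nat.le_succ j)
    _ = 2 / (1 - q) := by ring

variable {m : ℕ}

namespace DirBasis

variable (B : DirBasis m)

theorem exists_lev (hm : 1 ≤ m) : ∃ lev : B.ι → ℕ, ∀ k,
    dya ((2 * m : ℕ) * lev k) ≤ B.μ k ∧ B.μ k ≤ dya ((2 * m : ℕ) * (lev k + 1 : ℕ)) := by
  have h : ∀ k, ∃ l : ℕ, dya ((2 * m : ℕ) * l) ≤ B.μ k ∧
      B.μ k ≤ dya ((2 * m : ℕ) * (l + 1 : ℕ)) := fun k => by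
    obtain ⟨l, h1, h2⟩ := exists_nat_pow_near (B.one_le k)
      (one_lt_pow₀ one_lt_two (show 2 * m ≠ 0 by omega))
    refine ⟨l, ?_, ?_⟩
    · rwa [dya_nat_mul, ← pow_mul, mul_comm, pow_mul]
    · rw [dya_nat_mul, ← pow_mul, mul_comm, pow_mul]; exact h2.le
  exact ⟨fun k => (h k).choose, fun k => (h k).choose_spec⟩

variable {B} {lev : B.ι → ℕ}
  (hlev : ∀ k, dya ((2 * m : ℕ) * lev k) ≤ B.μ k ∧ B.μ k ≤ dya ((2 * m : ℕ) * (lev k + 1 : ℕ)))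

include hlev

theorem sum_mu_sq_le {l : ℕ} {S : Finset B.ι} (hS : ∀ k ∈ S, lev k = l) (c : B.ι → ℝ) :
    ∑ k ∈ S, (B.μ k * c k) ^ 2 ≤
      (dya (2 * m : ℕ) * dya ((2 * m : ℕ) * l)) ^ 2 * ∑ k ∈ S, c k ^ 2 := by
  rw [mul_sum]
  refine sum_le_sum fun k hk => ?_
  have h := hlev k
  rw [hS k hk] at h
  have h2 : B.μ k ≤ dya (2 * m : ℕ) * dya ((2 * m : ℕ) * l) := by
    rw [← dya_add]; convert h.2 using 2; push_cast; ring
  rw [mul_pow]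
  have := B.one_le k
  gcongr

theorem exists_block_bounds (hm : 1 ≤ m) : ∃ C, 0 ≤ C ∧ ∀ (l : ℕ) (S : Finset B.ι) (c : B.ι → ℝ)
    (N : ℝ), (∀ k ∈ S, lev k = l) → 0 ≤ N → ∑ k ∈ S, c k ^ 2 ≤ N ^ 2 → ∀ j ≤ 2 * m,
      en (iteratedDeriv j (B.comb S c)) ≤ (C * dya (j * l) * N) ^ 2 ∧
      ∀ y ∈ Icc (0 : ℝ) 1, |iteratedDeriv j (B.comb S c) y| ≤ C * dya ((j + 1 / 2) * l) * N := by
  obtain ⟨C, hC, hint⟩ := exists_interpolation (2 * m)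
  set T := dya (2 * m : ℕ) with hT
  have hTp : 0 < T := dya_pos _
  have hen : ∀ (l : ℕ) (S : Finset B.ι) (c : B.ι → ℝ)
    (N : ℝ), (∀ k ∈ S, lev k = l) → 0 ≤ N → ∑ k ∈ S, c k ^ 2 ≤ N ^ 2 → ∀ j ≤ 2 * m,
      en (iteratedDeriv j (B.comb S c)) ≤ C * (T ^ 2 + 1) * (dya (j * l) * N) ^ 2 := by
    intro l S c N hS hN hc j hj
    have h1 := hint _ (B.contDiff_comb S c) (2 ^ l) (one_le_pow₀ one_le_two) j hj
    have h2 : en (iteratedDeriv (2 * m) (B.comb S c)) ≤ (T * dya ((2 * m : ℕ) * l)) ^ 2 * N ^ 2 := by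
      have e : en (iteratedDeriv (2 * m) (B.comb S c))
          = en (B.comb S fun k => B.μ k * c k) := by
        rw [← ip_self, ← ip_self]
        refine intervalIntegral.integral_congr fun y hy => ?_
        rw [uIcc_of_le zero_le_one] at hy
        simp only [B.iteratedDeriv_comb_top S c hy]
        rw [mul_mul_mul_comm, ← pow_add, ← two_mul, pow_mul]; simp
      rw [e, B.en_comb]
      exact (B.sum_mu_sq_le hlev hS c).trans (mul_le_mul_of_nonneg_left hc (sq_nonneg _))
    rw [B.en_comb] at h1
    rw [dya_nat_mul] at h2 ⊢
    calc _ ≤ _ := h1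
      _ ≤ C * (2 ^ l) ^ (2 * j) * ((T * (2 ^ l) ^ (2 * m)) ^ 2 * N ^ 2 / (2 ^ l) ^ (2 * (2 * m))
            + N ^ 2) := by gcongr
      _ = _ := by field_simp; ring
  set D := C * (T ^ 2 + 1) with hD
  have hD0 : 0 ≤ D := by positivity
  have hsup : ∀ (l : ℕ) (S : Finset B.ι) (c : B.ι → ℝ)
    (N : ℝ), (∀ k ∈ S, lev k = l) → 0 ≤ N → ∑ k ∈ S, c k ^ 2 ≤ N ^ 2 → ∀ j < 2 * m,
      ∀ y ∈ Icc (0 : ℝ) 1, iteratedDeriv j (B.comb S c) y ^ 2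
        ≤ 4 * D * (dya ((j + 1 / 2) * l) * N) ^ 2 := by
    intro l S c N hS hN hc j hj y hy
    have h1 := sq_le_en (continuous_iteratedDeriv' (B.contDiff_comb S c) (show j + 1 ≤ 2 * m by omega))
      (hasDerivAt_iteratedDeriv (B.contDiff_comb S c) hj) (s := 1 / 2 ^ l) (by positivity)
      (by rw [div_le_one (by positivity)]; exact one_le_pow₀ one_le_two) hy
    have h2 := hen l S c N hS hN hc j (by omega)
    have h3 := hen l S c N hS hN hc (j + 1) (by omega)
    have e : dya ((j + 1 / 2) * l) ^ 2 = 2 ^ l * dya (j * l) ^ 2 := by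
      rw [dya_mul_pow, show ((2 : ℕ) : ℝ) * ((j + 1 / 2) * l) = (1 : ℕ) * l + (2 : ℕ) * (j * l) by
        push_cast; ring, dya_add, dya_nat_mul, ← dya_mul_pow, pow_one]
    have e3 : dya ((j + 1 : ℕ) * l) = 2 ^ l * dya (j * l) := by
      rw [dya_nat_mul, dya_nat_mul, pow_succ]; ring
    rw [e3] at h3
    calc _ ≤ _ := h1
      _ ≤ 2 / (1 / 2 ^ l) * (D * (dya (j * l) * N) ^ 2)
          + 2 * (1 / 2 ^ l) * (D * (2 ^ l * dya (j * l) * N) ^ 2) := by gcongr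
      _ = _ := by rw [mul_pow (dya ((j + 1 / 2) * l)), e]; field_simp; ring
  refine ⟨sqrt (4 * D) * (1 + T), by positivity, fun l S c N hS hN hc j hj => ⟨?_, ?_⟩⟩
  · refine (hen l S c N hS hN hc j hj).trans ?_
    rw [mul_assoc _ (dya _) N, mul_pow _ (dya _ * N), mul_pow _ (1 + T), sq_sqrt (by positivity),
      ← mul_assoc]
    apply mul_le_mul_of_nonneg_right _ (sq_nonneg _)
    nlinarith [mul_nonneg hD0 hTp.le, mul_nonneg hD0 (sq_nonneg T)]
  · intro y hy
    have h1 : ∀ {a x}, 0 ≤ x → a ^ 2 ≤ 4 * D * x ^ 2 → |a| ≤ sqrt (4 * D) * x :=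
      fun {a x} hx h => by
        apply abs_le_of_sq_le_sq _ (by positivity)
        rwa [mul_pow, sq_sqrt (by positivity)]
    have hp := dya_pos ((j + 1 / 2) * l)
    rcases hj.lt_or_eq with hj | rfl
    · refine (h1 (by positivity) (hsup l S c N hS hN hc j hj y hy)).trans ?_
      rw [mul_assoc _ (dya _) N]
      apply mul_le_mul_of_nonneg_right _ (by positivity)
      nlinarith [sqrt_nonneg (4 * D)]
    · rw [B.iteratedDeriv_comb_top S c hy, abs_mul, abs_pow, abs_neg, abs_one, one_pow, one_mul]
      have hq := dya_pos ((2 * m : ℕ) * l)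
      have h2 := hsup l S (fun k => B.μ k * c k) (T * dya ((2 * m : ℕ) * l) * N) hS (by positivity)
        ((B.sum_mu_sq_le hlev hS c).trans (by
          rw [mul_pow _ N]; exact mul_le_mul_of_nonneg_left hc (sq_nonneg _))) 0 (by omega) y hy
      rw [iteratedDeriv_zero] at h2
      have hr := dya_pos (((0 : ℕ) + 1 / 2) * l)
      refine (h1 (by positivity) h2).trans ?_
      have e : dya (((2 * m : ℕ) + 1 / 2) * l)
          = dya (((0 : ℕ) + 1 / 2) * l) * dya ((2 * m : ℕ) * l) := by
        rw [← dya_add]; congr 1; push_cast; ring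
      rw [e]
      have h4 : 0 ≤ sqrt (4 * D) * (dya (((0 : ℕ) + 1 / 2) * l) * dya ((2 * m : ℕ) * l)) * N := by
        positivity
      linarith

theorem finite_block (hm : 1 ≤ m) (l : ℕ) : {k | lev k = l}.Finite := by
  obtain ⟨C, hC, hb⟩ := exists_block_bounds hlev hm
  set D := (C * dya ((0 + 1 / 2) * l)) ^ 2 with hD
  have key : ∀ S : Finset B.ι, (∀ k ∈ S, lev k = l) → (S.card : ℝ) ≤ D := by
    intro S hS
    have pt : ∀ y ∈ Icc (0 : ℝ) 1, ∑ k ∈ S, B.e k y ^ 2 ≤ D := by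
      intro y hy
      set s := ∑ k ∈ S, B.e k y ^ 2 with hs
      have hs0 : 0 ≤ s := sum_nonneg fun _ _ => sq_nonneg _
      have h := (hb l S (fun k => B.e k y) (sqrt s) hS (sqrt_nonneg _)
        (by rw [sq_sqrt hs0]) 0 (by omega)).2 y hy
      have e : B.comb S (fun k => B.e k y) y = s := sum_congr rfl fun k _ => by ring
      rw [iteratedDeriv_zero, e, abs_of_nonneg hs0, Nat.cast_zero] at h
      have h2 : sqrt s * sqrt s = s := mul_self_sqrt hs0
      rcases hs0.eq_or_lt with h0 | h0
      · rw [← h0]; positivity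
      · have h3 : 0 < sqrt s := Real.sqrt_pos.2 h0
        have h4 : sqrt s ≤ C * dya ((0 + 1 / 2) * l) := by
          by_contra! h5
          nlinarith
        rw [← h2, hD]; nlinarith
    have hi : ∫ y in (0 : ℝ)..1, ∑ k ∈ S, B.e k y ^ 2 = S.card := by
      have hk : ∀ k ∈ S, IntervalIntegrable (fun y => B.e k y ^ 2) volume 0 1 := fun k _ =>
        ((B.isDir k).continuous.pow 2).intervalIntegrable _ _
      rw [intervalIntegral.integral_finsetSum hk]
      simp [B.normed]
    have hcont : Continuous fun y => ∑ k ∈ S, B.e k y ^ 2 :=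
      continuous_finsetSum _ fun k _ => (B.isDir k).continuous.pow 2
    have := integral_mono_on (μ := volume) zero_le_one
      (hcont.intervalIntegrable _ _) (intervalIntegrable_const (c := D)) pt
    rw [hi] at this
    simpa using this
  by_contra hinf
  obtain ⟨S, hS, hcard⟩ := Set.Infinite.exists_subset_card_eq hinf (⌈D⌉₊ + 1)
  have h1 := key S fun k hk => hS hk
  rw [hcard] at h1
  push_cast at h1
  linarith [Nat.le_ceil D]

end DirBasis
end blocks

section levels

variable {m : ℕ}

/-- A Dirichlet eigenbasis together with its dyadic frequency blocks. -/
structure LevBasis (m : ℕ) extends DirBasis m where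
  lev : ι → ℕ
  lev_spec : ∀ k, dya ((2 * m : ℕ) * lev k) ≤ μ k ∧ μ k ≤ dya ((2 * m : ℕ) * (lev k + 1 : ℕ))
  blk : ℕ → Finset ι
  mem_blk : ∀ l k, k ∈ blk l ↔ lev k = l

theorem exists_levBasis (hm : 1 ≤ m) : Nonempty (LevBasis m) := by
  obtain ⟨B⟩ := exists_dirBasis hm
  obtain ⟨lev, hlev⟩ := B.exists_lev hm
  exact ⟨{ B with
    lev := lev
    lev_spec := hlev
    blk := fun l => (B.finite_block hlev hm l).toFinset
    mem_blk := fun l k => by simp }⟩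

namespace LevBasis

variable (B : LevBasis m)

/-- Functions with frequencies in the block `l`. -/
def bcomb (l : ℕ) (c : B.ι → ℝ) : ℝ → ℝ := B.comb (B.blk l) c

theorem isDir_bcomb (l : ℕ) (c : B.ι → ℝ) : IsDir m (B.bcomb l c) := B.isDir_comb _ _

theorem exists_bcomb_bounds (hm : 1 ≤ m) : ∃ C, 0 ≤ C ∧ ∀ (l : ℕ) (c : B.ι → ℝ) (N : ℝ), 0 ≤ N →
    ∑ k ∈ B.blk l, c k ^ 2 ≤ N ^ 2 → ∀ j ≤ 2 * m,
      en (iteratedDeriv j (B.bcomb l c)) ≤ (C * dya (j * l) * N) ^ 2 ∧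
      ∀ y ∈ Icc (0 : ℝ) 1, |iteratedDeriv j (B.bcomb l c) y| ≤ C * dya ((j + 1 / 2) * l) * N := by
  obtain ⟨C, hC, h⟩ := B.exists_block_bounds B.lev_spec hm
  exact ⟨C, hC, fun l c N hN hc => h l _ c N (fun k hk => (B.mem_blk l k).1 hk) hN hc⟩

/-- Almost orthogonality of derivatives of blocks. -/
theorem exists_interaction (hm : 1 ≤ m) : ∃ C, 0 ≤ C ∧ ∀ (l' l : ℕ) (c' c : B.ι → ℝ) (N' N : ℝ),
    0 ≤ N' → 0 ≤ N → ∑ k ∈ B.blk l', c' k ^ 2 ≤ N' ^ 2 → ∑ k ∈ B.blk l, c k ^ 2 ≤ N ^ 2 →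
    ∀ i < 2 * m, |ip (iteratedDeriv i (B.bcomb l' c')) (B.bcomb l c)| ≤
      C * N' * N * (if l ≤ l' then dya ((2 * m - 1) * l) else dya ((2 * m - 1 / 2) * l' - l / 2)) := by
  obtain ⟨C, hC, hb⟩ := B.exists_bcomb_bounds hm
  refine ⟨C + 3 * C ^ 2, by positivity, fun l' l c' c N' N hN' hN hc' hc i hi => ?_⟩
  have hD' := B.isDir_bcomb l' c'
  have hD := B.isDir_bcomb l c
  have him := cast_le_two_mul_sub_one hi
  split_ifs with hll
  · rw [ip_iteratedDeriv_left hD' hD hi.le, abs_mul, abs_pow, abs_neg, abs_one, one_pow, one_mul]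
    have h1 : en (B.bcomb l' c') ≤ N' ^ 2 := by rw [bcomb, B.en_comb]; exact hc'
    have h2 := (hb l c N hN hc i hi.le).1
    have hp := dya_pos (i * l)
    refine (abs_ip_le hD'.continuous (hD.continuous_iter hi.le) hN' (by positivity) h1 h2).trans ?_
    have h3 : dya (i * l) ≤ dya ((2 * m - 1) * l) :=
      dya_le (mul_le_mul_of_nonneg_right him (cast_nonneg l))
    have hp' := dya_pos ((2 * m - 1) * l)
    calc N' * (C * dya (i * l) * N) ≤ N' * (C * dya ((2 * m - 1) * l) * N) := by gcongr
      _ = C * N' * N * dya ((2 * m - 1) * l) := by ring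
      _ ≤ (C + 3 * C ^ 2) * N' * N * dya ((2 * m - 1) * l) := by gcongr; nlinarith
  · push Not at hll
    set b : B.ι → ℝ := fun k => c k / B.μ k with hbdef
    have hDb := B.isDir_bcomb l b
    set n := dya (-((2 * m : ℕ) * l)) * N with hn
    have hp0 := dya_pos (-((2 * m : ℕ) * l))
    have hn0 : 0 ≤ n := by positivity
    have hbn : ∑ k ∈ B.blk l, b k ^ 2 ≤ n ^ 2 := by
      rw [hn, mul_pow]
      refine le_trans ?_ (mul_le_mul_of_nonneg_left hc (sq_nonneg _))
      rw [mul_sum]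
      refine sum_le_sum fun k hk => ?_
      have h1 := (B.lev_spec k).1
      rw [(B.mem_blk l k).1 hk] at h1
      have h2 := dya_pos ((2 * m : ℕ) * l)
      have h3 : (B.μ k)⁻¹ ≤ dya (-((2 * m : ℕ) * l)) := by
        rw [dya, Real.rpow_neg two_pos.le]
        exact inv_anti₀ h2 h1
      have h4 := B.one_le k
      rw [hbdef]
      simp only [div_eq_inv_mul, mul_pow]
      gcongr
    have e1 : ip (iteratedDeriv i (B.bcomb l' c')) (B.bcomb l c)
        = (-1) ^ m * ip (iteratedDeriv i (B.bcomb l' c')) (iteratedDeriv (2 * m) (B.bcomb l b)) := by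
      rw [ip_comm, ip_comm _ (iteratedDeriv (2 * m) _), ← ip_smul_left]
      refine ip_congr (fun y hy => ?_) fun _ _ => rfl
      rw [bcomb, bcomb, B.iteratedDeriv_comb_top _ _ hy, ← mul_assoc, ← pow_add, ← two_mul, pow_mul]
      simp only [neg_one_sq, one_pow, one_mul]
      refine sum_congr rfl fun k _ => ?_
      have := B.one_le k
      rw [hbdef]; field_simp
    rw [e1, abs_mul, abs_pow, abs_neg, abs_one, one_pow, one_mul]
    have h1 := integral_mul_deriv_eq_deriv_mul (a := 0) (b := 1)
      (fun y _ => hasDerivAt_iteratedDeriv hD'.smooth hi y)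
      (fun y _ => hasDerivAt_iteratedDeriv hDb.smooth (show 2 * m - 1 < 2 * m by omega) y)
      ((hD'.continuous_iter (by omega)).intervalIntegrable _ _)
      ((hDb.continuous_iter (by omega)).intervalIntegrable _ _)
    rw [show 2 * m - 1 + 1 = 2 * m by omega] at h1
    have hA := hb l' c' N' hN' hc' i hi.le
    have hA1 := hb l' c' N' hN' hc' (i + 1) hi
    have hB := hb l b n hn0 hbn (2 * m - 1) (by omega)
    have hcast : ((2 * m - 1 : ℕ) : ℝ) = 2 * m - 1 := by
      rw [Nat.cast_sub (by omega)]; push_cast; ring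
    rw [hcast] at hB
    have hl : (l' : ℝ) ≤ l := by exact_mod_cast hll.le
    set D := dya ((2 * m - 1 / 2) * l' - l / 2) with hDdef
    have hDp : 0 < D := dya_pos _
    have hbd : ∀ y ∈ Icc (0 : ℝ) 1, |iteratedDeriv i (B.bcomb l' c') y *
        iteratedDeriv (2 * m - 1) (B.bcomb l b) y| ≤ C ^ 2 * N' * N * D := fun y hy => by
      rw [abs_mul]
      have hq1 := dya_pos ((i + 1 / 2) * l')
      refine (mul_le_mul (hA.2 y hy) (hB.2 y hy) (abs_nonneg _) (by positivity)).trans ?_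
      have e : dya ((i + 1 / 2) * l') * (dya ((2 * m - 1 + 1 / 2) * l) * dya (-((2 * m : ℕ) * l)))
          ≤ D := by
        rw [← dya_add, ← dya_add]
        apply dya_le
        push_cast
        nlinarith [mul_le_mul_of_nonneg_right him (cast_nonneg (α := ℝ) l')]
      calc _ = C ^ 2 * N' * N * (dya ((i + 1 / 2) * l') *
            (dya ((2 * m - 1 + 1 / 2) * l) * dya (-((2 * m : ℕ) * l)))) := by rw [hn]; ring
        _ ≤ _ := by gcongr
    have hI : |ip (iteratedDeriv (i + 1) (B.bcomb l' c')) (iteratedDeriv (2 * m - 1) (B.bcomb l b))|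
        ≤ C ^ 2 * N' * N * D := by
      have hq1 := dya_pos ((i + 1 : ℕ) * l')
      have hq2 := dya_pos ((2 * m - 1) * l)
      refine (abs_ip_le (hD'.continuous_iter hi) (hDb.continuous_iter (by omega)) (by positivity)
        (by positivity) hA1.1 hB.1).trans ?_
      have e : dya ((i + 1 : ℕ) * l') * (dya ((2 * m - 1) * l) * dya (-((2 * m : ℕ) * l)))
          ≤ D := by
        rw [← dya_add, ← dya_add]
        apply dya_le
        push_cast
        nlinarith [mul_le_mul_of_nonneg_right him (cast_nonneg (α := ℝ) l')]
      calc _ = C ^ 2 * N' * N * (dya ((i + 1 : ℕ) * l') *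
            (dya ((2 * m - 1) * l) * dya (-((2 * m : ℕ) * l)))) := by rw [hn]; ring
        _ ≤ _ := by gcongr
    have hx0 := abs_le.1 (hbd 0 (by simp))
    have hx1 := abs_le.1 (hbd 1 (by simp))
    have hx2 := abs_le.1 hI
    have h4 : |ip (iteratedDeriv i (B.bcomb l' c')) (iteratedDeriv (2 * m) (B.bcomb l b))|
        ≤ 3 * C ^ 2 * N' * N * D := by
      unfold ip at hx2 ⊢
      rw [h1, abs_le]
      constructor <;> linarith [hx0.1, hx0.2, hx1.1, hx1.2, hx2.1, hx2.2]
    refine h4.trans ?_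
    gcongr
    linarith

theorem ip_bcomb (l : ℕ) (c : B.ι → ℝ) {f : ℝ → ℝ} (hf : Continuous f) :
    ip f (B.bcomb l c) = ∑ k ∈ B.blk l, c k * B.coef f k := B.ip_comb _ _ hf

open Classical in
/-- Expansion into blocks, including derivatives. -/
theorem tendsto_sum_bcomb {f : ℝ → ℝ} (hf : IsDir m f) {j : ℕ} (hj : j < 2 * m) {y : ℝ}
    (hy : y ∈ Icc (0 : ℝ) 1) :
    Tendsto (fun L => ∑ l ∈ Finset.range L, iteratedDeriv j (B.bcomb l (B.coef f)) y)
      atTop (𝓝 (iteratedDeriv j f y)) ∧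
    ∀ h : ℝ → ℝ, Continuous h → Tendsto
      (fun L => ∑ l ∈ Finset.range L, ip (B.bcomb l (B.coef f)) h) atTop (𝓝 (ip f h)) := by
  set s : ℕ → Finset B.ι := fun L => (Finset.range L).biUnion B.blk with hs
  have hmem : ∀ L k, k ∈ s L ↔ B.lev k < L := fun L k => by
    simp [hs, B.mem_blk]
  have hst : Tendsto s atTop atTop := by
    refine Filter.tendsto_atTop_finset_of_monotone (fun L L' hL k hk => ?_) fun k => ?_
    · rw [hmem] at *; omega
    · exact ⟨B.lev k + 1, by rw [hmem]; omega⟩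
  have hdisj : ∀ L, (↑(Finset.range L) : Set ℕ).PairwiseDisjoint B.blk := fun L a _ b _ hab => by
    rw [Function.onFun, Finset.disjoint_left]
    intro k hk hk'
    rw [B.mem_blk] at hk hk'
    exact hab (hk.symm.trans hk')
  constructor
  · refine (B.tendsto_iteratedDeriv hf hst hj hy).congr fun L => ?_
    rw [B.iteratedDeriv_comb _ _ _ hj.le]
    simp only [hs]
    rw [Finset.sum_biUnion (hdisj L)]
    refine sum_congr rfl fun l _ => ?_
    rw [bcomb, B.iteratedDeriv_comb _ _ _ hj.le]
  · intro h hh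
    have e : ∀ L, ∑ l ∈ Finset.range L, ip (B.bcomb l (B.coef f)) h
        = ip (B.comb (s L) (B.coef f)) h := fun L => by
      rw [ip_comm, B.ip_comb _ _ hh]
      simp only [hs]
      rw [Finset.sum_biUnion (hdisj L)]
      refine sum_congr rfl fun l _ => ?_
      rw [ip_comm, bcomb, B.ip_comb _ _ hh]
    have hc : ∀ L, Continuous (B.comb (s L) (B.coef f)) := fun L => (B.isDir_comb _ _).continuous
    have h0 : Tendsto (fun L => en (fun y => f y - B.comb (s L) (B.coef f) y))
        atTop (𝓝 0) := by
      have h : Tendsto (fun L => en f - ∑ k ∈ s L, B.coef f k ^ 2) atTop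
          (𝓝 (en f - en f)) := ((B.parseval f hf.continuous).comp hst).const_sub (en f)
      rw [sub_self] at h
      simpa only [B.en_sub_comb _ hf.continuous] using h
    have h1 : Tendsto (fun L => (ip f h - ip (B.comb (s L) (B.coef f)) h) ^ 2)
        atTop (𝓝 0) := by
      refine squeeze_zero (fun _ => sq_nonneg _) (fun L => ?_) (by simpa using h0.mul_const (en h))
      rw [← ip_sub_left hf.continuous (hc L) hh]
      exact sq_ip_le (hf.continuous.sub (hc L)) hh
    have h2 := h1.sqrt
    simp only [sqrt_sq_eq_abs, sqrt_zero] at h2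
    have h3 := ((tendsto_zero_iff_abs_tendsto_zero _).2 h2).const_sub (ip f h)
    simp only [sub_zero] at h3
    refine h3.congr fun L => ?_
    rw [e]; ring

/-- Derivatives of order below `2m` tested against a block, from decay of all blocks. -/
theorem exists_lower_bound (hm : 1 ≤ m) {a : ℝ} (ha : 0 < a) (ha' : a < 2 * m - 1 / 2) :
    ∃ C, 0 ≤ C ∧ ∀ (g : ℝ → ℝ) (M : ℝ), IsDir m g → 0 ≤ M →
      (∀ l, ∑ k ∈ B.blk l, B.coef g k ^ 2 ≤ (M * dya (-a * l)) ^ 2) →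
      ∀ (l : ℕ) (c : B.ι → ℝ) (N : ℝ), 0 ≤ N → ∑ k ∈ B.blk l, c k ^ 2 ≤ N ^ 2 → ∀ i < 2 * m,
        |ip (iteratedDeriv i g) (B.bcomb l c)| ≤ C * M * dya ((2 * m - 1 - a) * l) * N := by
  obtain ⟨C, hC, hint⟩ := B.exists_interaction hm
  set b := min a (2 * m - 1 / 2 - a) with hb
  have hb0 : 0 < b := lt_min ha (by linarith)
  set q := dya (-b) with hq
  have hq0 : 0 < q := dya_pos _
  have hq1 : q < 1 := by
    rw [hq, ← dya_zero]; exact rpow_lt_rpow_of_exponent_lt one_lt_two (by linarith)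
  refine ⟨C * (2 / (1 - q)), mul_nonneg hC (div_nonneg zero_le_two (by linarith)),
    fun g M hg hM hdec l c N hN hc i hi => ?_⟩
  have hDc := B.isDir_bcomb l c
  set P := dya ((2 * m - 1 - a) * l) with hP
  have hP0 : 0 < P := dya_pos _
  have hterm : ∀ j, |ip (B.bcomb j (B.coef g)) (iteratedDeriv i (B.bcomb l c))|
      ≤ C * M * N * P * q ^ ((l - j) + (j - l)) := by
    intro j
    have h1 := hint j l _ c (M * dya (-a * j)) N (mul_nonneg hM (dya_pos _).le) hN (hdec j) hc i hi
    rw [ip_iteratedDeriv_left (B.isDir_bcomb _ _) hDc hi.le, abs_mul, abs_pow, abs_neg, abs_one,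
      one_pow, one_mul] at h1
    refine h1.trans ?_
    have key : dya (-a * j) *
        (if l ≤ j then dya ((2 * m - 1) * l) else dya ((2 * m - 1 / 2) * j - l / 2))
        ≤ P * q ^ ((l - j) + (j - l)) := by
      rw [hq, dya_pow, hP, ← dya_add]
      split_ifs with h
      · rw [← dya_add, Nat.sub_eq_zero_of_le h, zero_add]
        apply dya_le
        have hx : 0 ≤ ((j - l : ℕ) : ℝ) := cast_nonneg _
        rw [Nat.cast_sub h] at hx ⊢
        nlinarith [mul_le_mul_of_nonneg_right (min_le_left a (2 * m - 1 / 2 - a)) hx]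
      · push Not at h
        rw [← dya_add, Nat.sub_eq_zero_of_le h.le, add_zero]
        apply dya_le
        have hx : 0 ≤ ((l - j : ℕ) : ℝ) := cast_nonneg _
        rw [Nat.cast_sub h.le] at hx ⊢
        nlinarith [mul_le_mul_of_nonneg_right (min_le_right a (2 * m - 1 / 2 - a)) hx]
    calc _ = C * M * N * (dya (-a * j) *
          (if l ≤ j then dya ((2 * m - 1) * l) else dya ((2 * m - 1 / 2) * j - l / 2))) := by ring
      _ ≤ C * M * N * (P * q ^ ((l - j) + (j - l))) := by gcongr
      _ = _ := by ring
  rw [ip_iteratedDeriv_left hg hDc hi.le, abs_mul, abs_pow, abs_neg, abs_one, one_pow, one_mul]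
  have hlim := ((B.tendsto_sum_bcomb hg (show 0 < 2 * m by omega) (left_mem_Icc.2 zero_le_one)).2 _
    (hDc.continuous_iter hi.le)).abs
  refine le_of_tendsto' hlim fun L => ?_
  calc _ ≤ ∑ j ∈ Finset.range L, |ip (B.bcomb j (B.coef g)) (iteratedDeriv i (B.bcomb l c))| :=
        abs_sum_le_sum_abs _ _
    _ ≤ ∑ j ∈ Finset.range L, C * M * N * P * q ^ ((l - j) + (j - l)) :=
        sum_le_sum fun j _ => hterm j
    _ = C * M * N * P * ∑ j ∈ Finset.range L, q ^ ((l - j) + (j - l)) := by rw [mul_sum]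
    _ ≤ C * M * N * P * (2 / (1 - q)) :=
        mul_le_mul_of_nonneg_left (sum_geom_dist_le hq0.le hq1 l L) (by positivity)
    _ = _ := by ring

/-- The crude bound used to start the bootstrap. -/
theorem exists_lower_bound_zero (hm : 1 ≤ m) :
    ∃ C, 0 ≤ C ∧ ∀ (g : ℝ → ℝ) (M : ℝ), IsDir m g → 0 ≤ M → en g ≤ M ^ 2 →
      ∀ (l : ℕ) (c : B.ι → ℝ) (N : ℝ), 0 ≤ N → ∑ k ∈ B.blk l, c k ^ 2 ≤ N ^ 2 → ∀ i < 2 * m,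
        |ip (iteratedDeriv i g) (B.bcomb l c)| ≤ C * M * dya ((2 * m - 1 - 0) * l) * N := by
  obtain ⟨C, hC, hb⟩ := B.exists_bcomb_bounds hm
  refine ⟨C, hC, fun g M hg hM hen l c N hN hc i hi => ?_⟩
  have hDc := B.isDir_bcomb l c
  rw [ip_iteratedDeriv_left hg hDc hi.le, abs_mul, abs_pow, abs_neg, abs_one, one_pow, one_mul]
  have hp := dya_pos (i * l)
  refine (abs_ip_le hg.continuous (hDc.continuous_iter hi.le) hM (by positivity) hen
    (hb l c N hN hc i hi.le).1).trans ?_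
  have him : (i : ℝ) ≤ 2 * m - 1 - 0 := by
    have : ((i + 1 : ℕ) : ℝ) ≤ (2 * m : ℕ) := by exact_mod_cast hi
    push_cast at this; linarith
  have h3 : dya (i * l) ≤ dya ((2 * m - 1 - 0) * l) :=
    dya_le (mul_le_mul_of_nonneg_right him (cast_nonneg l))
  calc M * (C * dya (i * l) * N) ≤ M * (C * dya ((2 * m - 1 - 0) * l) * N) := by gcongr
    _ = _ := by ring

end LevBasis
end levels

section expansions

variable {m : ℕ}

theorem abs_le_of_geometric {x : ℕ → ℝ} {P ε s : ℝ} (hε : 0 < ε)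
    (hP : 0 ≤ P) (hx : ∀ l : ℕ, |x l| ≤ P * dya (-ε * l))
    (hs : Tendsto (fun L => ∑ l ∈ Finset.range L, x l) atTop (𝓝 s)) :
    |s| ≤ P * (2 / (1 - dya (-ε))) := by
  have hq1 : dya (-ε) < 1 := by
    rw [← dya_zero]; exact rpow_lt_rpow_of_exponent_lt one_lt_two (by linarith)
  refine le_of_tendsto' hs.abs fun L => ?_
  calc |∑ l ∈ Finset.range L, x l| ≤ ∑ l ∈ Finset.range L, |x l| := abs_sum_le_sum_abs _ _
    _ ≤ ∑ l ∈ Finset.range L, P * dya (-ε) ^ ((0 - l) + (l - 0)) :=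
        sum_le_sum fun l _ => by
          rw [Nat.zero_sub, zero_add, Nat.sub_zero, dya_pow]; exact hx l
    _ = P * ∑ l ∈ Finset.range L, dya (-ε) ^ ((0 - l) + (l - 0)) := by rw [mul_sum]
    _ ≤ _ := mul_le_mul_of_nonneg_left (sum_geom_dist_le (dya_pos _).le hq1 0 L) hP

theorem le_rpow_of_le_of_le {z A x θ : ℝ} (hA : 0 ≤ A) (hx : 0 ≤ x) (hθ : 0 ≤ θ) (hθ1 : θ ≤ 1)
    (h1 : z ≤ 2 * A) (h2 : z ≤ A * x) : z ≤ 2 * A * x ^ θ := by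
  rcases le_total x 1 with h | h
  · have h3 : x ≤ x ^ θ := by
      rcases hx.eq_or_lt with rfl | hx
      · exact rpow_nonneg le_rfl _
      · calc x = x ^ (1 : ℝ) := (Real.rpow_one x).symm
          _ ≤ x ^ θ := Real.rpow_le_rpow_of_exponent_ge hx h hθ1
    have h4 := rpow_nonneg hx θ
    nlinarith
  · have h3 := Real.one_le_rpow h hθ
    nlinarith

theorem dya_rpow (x θ : ℝ) : dya x ^ θ = dya (x * θ) := (rpow_mul two_pos.le x θ).symm

namespace LevBasis

variable (B : LevBasis m)

theorem iteratedDeriv_bcomb_sub (l : ℕ) (c c' : B.ι → ℝ) {j : ℕ} (hj : j ≤ 2 * m) (y : ℝ) :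
    iteratedDeriv j (B.bcomb l c) y - iteratedDeriv j (B.bcomb l c') y
      = iteratedDeriv j (B.bcomb l fun k => c k - c' k) y := by
  simp only [bcomb, B.iteratedDeriv_comb _ _ _ hj]
  rw [← sum_sub_distrib]
  exact sum_congr rfl fun k _ => by ring

/-- Pointwise bounds for functions whose blocks decay fast enough. -/
theorem exists_pointwise_bounds (hm : 1 ≤ m) {γ ε : ℝ} (hγ : 0 < γ) (hε : 0 < ε)
    (hγε : γ + 2 * ε = 1) : ∃ C, 0 ≤ C ∧ ∀ (g : ℝ → ℝ) (M : ℝ), IsDir m g → 0 ≤ M →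
      (∀ l, ∑ k ∈ B.blk l, B.coef g k ^ 2 ≤ (M * dya (-(2 * m + 1 / 2 - ε) * l)) ^ 2) →
      ∀ i < 2 * m, ∀ y ∈ Icc (0 : ℝ) 1, |iteratedDeriv i g y| ≤ C * M ∧
        (∀ y' ∈ Icc (0 : ℝ) 1, |iteratedDeriv i g y - iteratedDeriv i g y'| ≤ C * M * |y - y'| ^ γ) ∧
        ∀ (h : ℝ → ℝ) (δ : ℝ), IsDir m h → 0 ≤ δ →
          (∀ l, ∑ k ∈ B.blk l, B.coef h k ^ 2 ≤ (M * dya (-(2 * m + 1 / 2 - ε) * l)) ^ 2) →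
          (∀ l, ∑ k ∈ B.blk l, (B.coef g k - B.coef h k) ^ 2 ≤
            (M * δ * dya ((-1 / 2 + ε) * l)) ^ 2) →
          |iteratedDeriv i g y - iteratedDeriv i h y| ≤ C * M * δ ^ (γ / (2 * m)) := by
  obtain ⟨C, hC, hb⟩ := B.exists_bcomb_bounds hm
  have hm1 : (1 : ℝ) ≤ m := by exact_mod_cast hm
  have hcast : ((2 * m : ℕ) : ℝ) = 2 * m := by push_cast; ring
  set G := 2 / (1 - dya (-ε)) with hG
  have hq1 : dya (-ε) < 1 := by
    rw [← dya_zero]; exact rpow_lt_rpow_of_exponent_lt one_lt_two (by linarith)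
  have hG0 : 0 ≤ G := div_nonneg zero_le_two (by linarith)
  set a := 2 * m + 1 / 2 - ε with ha
  have hbb : ∀ (g : ℝ → ℝ) (M : ℝ), 0 ≤ M →
      (∀ l, ∑ k ∈ B.blk l, B.coef g k ^ 2 ≤ (M * dya (-a * l)) ^ 2) → ∀ i < 2 * m,
      ∀ y ∈ Icc (0 : ℝ) 1, ∀ l, |iteratedDeriv i (B.bcomb l (B.coef g)) y|
        ≤ C * M * dya ((-1 + ε) * l) := fun g M hM hdec i hi y hy l => by
    have him := cast_le_two_mul_sub_one hi
    have hp := dya_pos (-a * l)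
    refine ((hb l _ _ (by positivity) (hdec l) i hi.le).2 y hy).trans ?_
    have e : dya ((i + 1 / 2) * l) * dya (-a * l) ≤ dya ((-1 + ε) * l) := by
      rw [← dya_add]
      apply dya_le
      rw [← add_mul]
      apply mul_le_mul_of_nonneg_right _ (cast_nonneg l)
      rw [ha]; linarith
    calc _ = C * M * (dya ((i + 1 / 2) * l) * dya (-a * l)) := by ring
      _ ≤ _ := by gcongr
  refine ⟨2 * C * G, by positivity, fun g M hg hM hdec i hi y hy => ⟨?_, ?_, ?_⟩⟩
  · refine (abs_le_of_geometric hε (P := C * M) (by positivity) (fun l => ?_)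
      (B.tendsto_sum_bcomb hg hi hy).1).trans ?_
    · refine (hbb g M hM hdec i hi y hy l).trans ?_
      apply mul_le_mul_of_nonneg_left _ (by positivity)
      exact dya_le (mul_le_mul_of_nonneg_right (by linarith) (cast_nonneg l))
    · have : 0 ≤ C * M * G := by positivity
      linarith
  · intro y' hy'
    have hlim := (B.tendsto_sum_bcomb hg hi hy).1.sub (B.tendsto_sum_bcomb hg hi hy').1
    simp only [← sum_sub_distrib] at hlim
    have hr : 0 ≤ |y - y'| ^ γ := rpow_nonneg (abs_nonneg _) _
    refine (abs_le_of_geometric hε (P := 2 * (C * M) * |y - y'| ^ γ) (by positivity) (fun l => ?_)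
      hlim).trans (le_of_eq (by ring))
    have h1 : |iteratedDeriv i (B.bcomb l (B.coef g)) y - iteratedDeriv i (B.bcomb l (B.coef g)) y'|
        ≤ 2 * (C * M * dya ((-1 + ε) * l)) := by
      have h1 := abs_le.1 (hbb g M hM hdec i hi y hy l)
      have h2 := abs_le.1 (hbb g M hM hdec i hi y' hy' l)
      rw [abs_le]; constructor <;> linarith [h1.1, h1.2, h2.1, h2.2]
    have hp := dya_pos (-a * l)
    have h2 : |iteratedDeriv i (B.bcomb l (B.coef g)) y - iteratedDeriv i (B.bcomb l (B.coef g)) y'|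
        ≤ (C * M * dya ((-1 + ε) * l)) * (dya l * |y - y'|) := by
      have him := cast_le_two_mul_sub_one hi
      have hl := (hb l _ _ (by positivity) (hdec l) (i + 1) hi).2
      have hder : ∀ z ∈ Icc (0 : ℝ) 1, HasDerivWithinAt (iteratedDeriv i (B.bcomb l (B.coef g)))
          (iteratedDeriv (i + 1) (B.bcomb l (B.coef g)) z) (Icc 0 1) z := fun z _ =>
        (hasDerivAt_iteratedDeriv (B.isDir_bcomb l (B.coef g)).smooth hi z).hasDerivWithinAt
      have := (convex_Icc (0 : ℝ) 1).norm_image_sub_le_of_norm_hasDerivWithin_le hder hl hy' hy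
      simp only [norm_eq_abs] at this
      refine this.trans ?_
      have e : dya (((i + 1 : ℕ) + 1 / 2) * l) * dya (-a * l) ≤ dya ((-1 + ε) * l) * dya l := by
        rw [← dya_add, ← dya_add]
        apply dya_le
        rw [← add_mul, ha]; push_cast
        nlinarith [cast_nonneg (α := ℝ) l]
      calc _ = C * M * (dya (((i + 1 : ℕ) + 1 / 2) * l) * dya (-a * l)) * |y - y'| := by ring
        _ ≤ C * M * (dya ((-1 + ε) * l) * dya l) * |y - y'| := by gcongr
        _ = _ := by ring
    have hp1 := dya_pos ((-1 + ε) * l)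
    have hp2 := dya_pos l
    refine (le_rpow_of_le_of_le (by positivity) (by positivity) hγ.le (by linarith) h1 h2).trans
      (le_of_eq ?_)
    rw [Real.mul_rpow hp2.le (abs_nonneg _), dya_rpow]
    have e : dya ((-1 + ε) * l) * dya (l * γ) = dya (-ε * l) := by
      rw [← dya_add]; congr 1; rw [show γ = 1 - 2 * ε by linarith]; ring
    rw [← e]; ring
  · intro h δ hh hδ hdech hdiff
    have hlim := (B.tendsto_sum_bcomb hg hi hy).1.sub (B.tendsto_sum_bcomb hh hi hy).1
    simp only [← sum_sub_distrib] at hlim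
    have hr : 0 ≤ δ ^ (γ / (2 * m)) := rpow_nonneg hδ _
    refine (abs_le_of_geometric hε (P := 2 * (C * M) * δ ^ (γ / (2 * m))) (by positivity)
      (fun l => ?_) hlim).trans (le_of_eq (by ring))
    have h1 : |iteratedDeriv i (B.bcomb l (B.coef g)) y - iteratedDeriv i (B.bcomb l (B.coef h)) y|
        ≤ 2 * (C * M * dya ((-1 + ε) * l)) := by
      have h1 := abs_le.1 (hbb g M hM hdec i hi y hy l)
      have h2 := abs_le.1 (hbb h M hM hdech i hi y hy l)
      rw [abs_le]; constructor <;> linarith [h1.1, h1.2, h2.1, h2.2]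
    have hp := dya_pos ((-1 / 2 + ε) * l)
    have h2 : |iteratedDeriv i (B.bcomb l (B.coef g)) y - iteratedDeriv i (B.bcomb l (B.coef h)) y|
        ≤ (C * M * dya ((-1 + ε) * l)) * (dya ((2 * m) * l) * δ) := by
      have him := cast_le_two_mul_sub_one hi
      rw [B.iteratedDeriv_bcomb_sub l _ _ hi.le]
      refine ((hb l _ _ (by positivity) (hdiff l) i hi.le).2 y hy).trans ?_
      have e : dya ((i + 1 / 2) * l) * dya ((-1 / 2 + ε) * l)
          ≤ dya ((-1 + ε) * l) * dya ((2 * m) * l) := by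
        rw [← dya_add, ← dya_add]
        apply dya_le
        rw [← add_mul, ← add_mul]
        apply mul_le_mul_of_nonneg_right _ (cast_nonneg l)
        linarith
      calc _ = C * M * δ * (dya ((i + 1 / 2) * l) * dya ((-1 / 2 + ε) * l)) := by ring
        _ ≤ C * M * δ * (dya ((-1 + ε) * l) * dya ((2 * m) * l)) := by gcongr
        _ = _ := by ring
    have hp1 := dya_pos ((-1 + ε) * l)
    have hp2 := dya_pos ((2 * m) * l)
    refine (le_rpow_of_le_of_le (θ := γ / (2 * m)) (by positivity) (by positivity) (by positivity)
      (by rw [div_le_one (by positivity)]; linarith) h1 h2).trans (le_of_eq ?_)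
    rw [Real.mul_rpow hp2.le hδ, dya_rpow]
    have e : dya ((-1 + ε) * l) * dya (2 * m * l * (γ / (2 * m))) = dya (-ε * l) := by
      rw [← dya_add]; congr 1
      rw [show γ = 1 - 2 * ε by linarith]; field_simp; ring
    rw [← e]; ring

end LevBasis
end expansions

section timefam

theorem le_of_ae_le_Ioo {f g : ℝ → ℝ} (hf : Continuous f) (hg : Continuous g) {a b : ℝ}
    (h : ∀ᵐ t ∂(volume.restrict (Ioo a b)), f t ≤ g t) : ∀ t ∈ Ioo a b, f t ≤ g t := by
  have h2 : (fun t => max (f t) (g t)) =ᵐ[volume.restrict (Ioo a b)] g := by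
    filter_upwards [h] with t ht using max_eq_right ht
  intro t ht
  have := Measure.eqOn_open_of_ae_eq h2 isOpen_Ioo (hf.max hg).continuousOn hg.continuousOn ht
  exact max_eq_right_iff.1 this

/-- A smooth cutoff function vanishing beyond `3/8`. -/
def IsCut (χ : ℝ → ℝ) : Prop := ContDiff ℝ ∞ χ ∧ ∀ y > 3 / 8, χ y = 0

theorem IsCut.deriv {χ : ℝ → ℝ} (h : IsCut χ) : IsCut (deriv χ) := by
  refine ⟨(contDiff_infty_iff_deriv.1 h.1).2, fun y hy => ?_⟩
  have : χ =ᶠ[𝓝 y] fun _ => 0 := by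
    filter_upwards [lt_mem_nhds hy] with z hz using h.2 z hz
  rw [this.deriv_eq]; simp

theorem IsCut.iteratedDeriv {χ : ℝ → ℝ} (h : IsCut χ) (j : ℕ) : IsCut (iteratedDeriv j χ) := by
  induction j with
  | zero => simpa using h
  | succ j ih => rw [iteratedDeriv_succ]; exact ih.deriv

/-- Commuting a factor through a derivative. -/
theorem exists_leibniz_inverse (j : ℕ) : ∃ b : ℕ → ℝ, ∀ χ w : ℝ → ℝ, ContDiff ℝ ∞ χ →
    ContDiff ℝ ∞ w → ∀ y, χ y * iteratedDeriv j w y =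
      ∑ k ∈ Finset.range (j + 1), b k * iteratedDeriv (j - k)
        (fun y => iteratedDeriv k χ y * w y) y := by
  induction j with
  | zero => exact ⟨fun _ => 1, fun χ w _ _ y => by simp⟩
  | succ j ih =>
    obtain ⟨b, hb⟩ := ih
    refine ⟨fun k => (if k ≤ j then b k else 0) - (if 1 ≤ k then b (k - 1) else 0),
      fun χ w hχ hw y => ?_⟩
    have sχ : ∀ k, ContDiff ℝ ∞ (iteratedDeriv k χ) := fun k => by
      rw [iteratedDeriv_eq_iterate]; exact hχ.iterate_deriv k
    have sw : ∀ k, ContDiff ℝ ∞ (iteratedDeriv k w) := fun k => by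
      rw [iteratedDeriv_eq_iterate]; exact hw.iterate_deriv k
    have s2 : ∀ k l, ContDiff ℝ ∞ (iteratedDeriv l fun y => iteratedDeriv k χ y * w y) :=
      fun k l => by
        rw [iteratedDeriv_eq_iterate]; exact (contDiff_mul_fun (sχ k) hw).iterate_deriv l
    have dd : ∀ {f : ℝ → ℝ}, ContDiff ℝ ∞ f → Differentiable ℝ f := fun h => h.differentiable (by simp)
    have h1 : deriv (fun y => χ y * iteratedDeriv j w y) y
        = deriv χ y * iteratedDeriv j w y + χ y * iteratedDeriv (j + 1) w y := by
      rw [deriv_fun_mul (dd hχ y) (dd (sw j) y), iteratedDeriv_succ]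
    have h2 : deriv (fun y => χ y * iteratedDeriv j w y) y = ∑ k ∈ Finset.range (j + 1),
        b k * iteratedDeriv (j + 1 - k) (fun y => iteratedDeriv k χ y * w y) y := by
      rw [funext fun y => hb χ w hχ hw y, deriv_fun_sum fun k _ => (dd (s2 k _) y).const_mul _]
      refine sum_congr rfl fun k hk => ?_
      rw [deriv_const_mul _ (dd (s2 k _) y), Nat.succ_sub (by simpa [Nat.lt_succ_iff] using hk),
        iteratedDeriv_succ]
    have h3 := hb (deriv χ) w (contDiff_infty_iff_deriv.1 hχ).2 hw y
    simp only [← iteratedDeriv_succ'] at h3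
    have e1 : ∑ k ∈ Finset.range (j + 1 + 1), (if k ≤ j then b k else 0) * iteratedDeriv (j + 1 - k)
        (fun y => iteratedDeriv k χ y * w y) y = ∑ k ∈ Finset.range (j + 1),
        b k * iteratedDeriv (j + 1 - k) (fun y => iteratedDeriv k χ y * w y) y := by
      rw [Finset.sum_range_succ]
      simp only [show ¬ j + 1 ≤ j by omega, if_false, zero_mul, add_zero]
      refine sum_congr rfl fun k hk => ?_
      rw [if_pos (by simpa [Nat.lt_succ_iff] using hk)]
    have e2 : ∑ k ∈ Finset.range (j + 1 + 1), (if 1 ≤ k then b (k - 1) else 0) *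
        iteratedDeriv (j + 1 - k) (fun y => iteratedDeriv k χ y * w y) y
        = ∑ k ∈ Finset.range (j + 1),
        b k * iteratedDeriv (j - k) (fun y => iteratedDeriv (k + 1) χ y * w y) y := by
      rw [Finset.sum_range_succ']
      simp
    simp only [sub_mul, sum_sub_distrib]
    rw [e1, e2, ← h2, ← h3, h1]
    ring

theorem continuous_deriv_fst {f : ℝ × ℝ → ℝ} (hf : ContDiff ℝ ∞ f) :
    (∀ t y, HasDerivAt (fun s => f (s, y)) (fderiv ℝ f (t, y) (1, 0)) t) ∧
      Continuous fun p : ℝ × ℝ => fderiv ℝ f p (1, 0) := by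
  constructor
  · intro t y
    have h1 := (hf.differentiable (by simp) (t, y)).hasFDerivAt
    have h2 : HasDerivAt (fun s : ℝ => (s, y)) ((1 : ℝ), (0 : ℝ)) t :=
      (hasDerivAt_id t).prodMk (hasDerivAt_const t y)
    exact h1.comp_hasDerivAt t h2
  · exact (hf.continuous_fderiv (by simp)).clm_apply continuous_const

theorem hasDerivAt_ip_slice {f : ℝ × ℝ → ℝ} (hf : ContDiff ℝ ∞ f) {χ g : ℝ → ℝ}
    (hχ : Continuous χ) (hg : Continuous g) :
    (∀ t, HasDerivAt (fun s => ip (fun y => χ y * f (s, y)) g)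
      (ip (fun y => χ y * fderiv ℝ f (t, y) (1, 0)) g) t) ∧
      Continuous fun t => ip (fun y => χ y * fderiv ℝ f (t, y) (1, 0)) g := by
  obtain ⟨hd, hc⟩ := continuous_deriv_fst hf
  have hfc := hf.continuous
  constructor
  · intro t
    have hT : Continuous fun p : ℝ × ℝ => χ p.2 * fderiv ℝ f p (1, 0) * g p.2 := by fun_prop
    obtain ⟨C, hC⟩ := ((isCompact_closedBall t 1).prod (isCompact_Icc (a := (0 : ℝ)) (b := 1))
      ).exists_bound_of_continuousOn hT.continuousOn
    refine (intervalIntegral.hasDerivAt_integral_of_dominated_loc_of_deriv_le (μ := volume)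
      (F := fun s y => χ y * f (s, y) * g y)
      (F' := fun s y => χ y * fderiv ℝ f (s, y) (1, 0) * g y) (bound := fun _ => C)
      (ball_mem_nhds t one_pos) ?_ ?_ ?_ ?_ ?_ ?_).2
    · refine of_forall fun s => Continuous.aestronglyMeasurable ?_
      fun_prop
    · refine Continuous.intervalIntegrable ?_ _ _
      fun_prop
    · refine Continuous.aestronglyMeasurable ?_
      exact hT.comp (by fun_prop : Continuous fun y : ℝ => (t, y))
    · refine of_forall fun y hy s hs => hC (s, y) ⟨ball_subset_closedBall hs, ?_⟩
      rw [uIoc_of_le zero_le_one] at hy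
      exact Ioc_subset_Icc_self hy
    · exact intervalIntegrable_const
    · refine of_forall fun y _ s _ => ?_
      exact ((hd s y).const_mul _).mul_const _
  · refine intervalIntegral.continuous_parametric_intervalIntegral_of_continuous' ?_ _ _
    have := hc
    exact (by fun_prop : Continuous fun p : ℝ × ℝ => χ p.2 * fderiv ℝ f p (1, 0) * g p.2)

end timefam

section blockode

variable {κ : Type*} {S : Finset κ} {n : ℕ} {μ : κ → ℝ} {A0 : ℝ → Fin n → Fin n → ℝ}
  {z z' : Fin n → κ → ℝ → ℝ} {lam t0 t1 : ℝ}

theorem block_decay (hz : ∀ i k t, HasDerivAt (z i k) (z' i k t) t)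
    (hz' : ∀ i k, Continuous (z' i k)) (hlam : 0 < lam)
    (hA : ∀ t (ξ : Fin n → ℝ), lam * ∑ i, ξ i ^ 2 ≤ ∑ i, ∑ j, A0 t i j * ξ i * ξ j) {L Ψ : ℝ}
    (hL : 0 < L) (hμ : ∀ k ∈ S, L ≤ μ k)
    (hR : ∀ᵐ t ∂(volume.restrict (Ioo t0 t1)),
      ∑ i, ∑ k ∈ S, (z' i k t + μ k * ∑ j, A0 t i j * z j k t) ^ 2 ≤ Ψ) :
    ∀ t ∈ Ico t0 t1, ∑ i, ∑ k ∈ S, z i k t ^ 2 ≤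
      exp (-(lam * L) * (t - t0)) * (∑ i, ∑ k ∈ S, z i k t0 ^ 2) + Ψ / (lam * L) ^ 2 := by
  set E : ℝ → ℝ := fun t => ∑ i, ∑ k ∈ S, z i k t ^ 2 with hE
  set E' : ℝ → ℝ := fun t => ∑ i, ∑ k ∈ S, 2 * z i k t * z' i k t with hE'
  set Λ := lam * L with hΛ
  have hΛ0 : 0 < Λ := mul_pos hlam hL
  have zc : ∀ i k, Continuous (z i k) := fun i k =>
    continuous_iff_continuousAt.2 fun t => (hz i k t).continuousAt
  have hEd : ∀ t, HasDerivAt E (E' t) t := fun t => by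
    refine HasDerivAt.fun_sum fun i _ => HasDerivAt.fun_sum fun k _ => ?_
    simpa using (hz i k t).fun_pow 2
  have hEc : Continuous E := continuous_iff_continuousAt.2 fun t => (hEd t).continuousAt
  have hE'c : Continuous E' := continuous_finsetSum _ fun i _ => continuous_finsetSum _ fun k _ =>
    (continuous_const.mul (zc i k)).mul (hz' i k)
  have hae : ∀ᵐ t ∂(volume.restrict (Ioo t0 t1)), E' t ≤ -Λ * E t + Ψ / Λ := by
    filter_upwards [hR] with t ht
    set R : Fin n → κ → ℝ := fun i k => z' i k t + μ k * ∑ j, A0 t i j * z j k t with hRd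
    have h1 : ∀ i, ∀ k ∈ S, 2 * z i k t * z' i k t ≤
        Λ * z i k t ^ 2 + R i k ^ 2 / Λ - 2 * (μ k * ∑ j, A0 t i j * z i k t * z j k t) := by
      intro i k _
      have : z' i k t = R i k - μ k * ∑ j, A0 t i j * z j k t := by simp [hRd]
      have e : ∑ j, A0 t i j * z i k t * z j k t = z i k t * ∑ j, A0 t i j * z j k t := by
        rw [mul_sum]; exact sum_congr rfl fun j _ => by ring
      have h2 : 2 * z i k t * R i k ≤ Λ * z i k t ^ 2 + R i k ^ 2 / Λ := by
        have : 0 ≤ (Λ * z i k t - R i k) ^ 2 / Λ := by positivity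
        have e2 : (Λ * z i k t - R i k) ^ 2 / Λ
            = Λ * z i k t ^ 2 - 2 * z i k t * R i k + R i k ^ 2 / Λ := by
          field_simp; ring
        linarith
      rw [this, e]; linarith
    have h3 : Λ * E t ≤ ∑ i, ∑ k ∈ S, μ k * ∑ j, A0 t i j * z i k t * z j k t := by
      rw [sum_comm]
      simp only [hE, mul_sum (s := Finset.univ)]
      rw [sum_congr rfl fun i _ => mul_sum S _ Λ, sum_comm]
      refine sum_le_sum fun k hk => ?_
      have h4 := hA t fun i => z i k t
      have h5 : 0 ≤ lam * ∑ i, z i k t ^ 2 :=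
        mul_nonneg hlam.le (sum_nonneg fun i _ => sq_nonneg _)
      simp only [← mul_sum] at h4 ⊢
      calc Λ * ∑ i, z i k t ^ 2 = L * (lam * ∑ i, z i k t ^ 2) := by rw [hΛ]; ring
        _ ≤ μ k * (lam * ∑ i, z i k t ^ 2) := mul_le_mul_of_nonneg_right (hμ k hk) h5
        _ ≤ _ := mul_le_mul_of_nonneg_left h4 (hL.le.trans (hμ k hk))
    calc E' t ≤ ∑ i, ∑ k ∈ S, (Λ * z i k t ^ 2 + R i k ^ 2 / Λ
          - 2 * (μ k * ∑ j, A0 t i j * z i k t * z j k t)) :=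
          sum_le_sum fun i _ => sum_le_sum fun k hk => h1 i k hk
      _ = Λ * E t + (∑ i, ∑ k ∈ S, R i k ^ 2) / Λ
          - 2 * ∑ i, ∑ k ∈ S, μ k * ∑ j, A0 t i j * z i k t * z j k t := by
          simp only [sum_sub_distrib, sum_add_distrib, ← mul_sum,
            ← Finset.sum_div, hE]
      _ ≤ Λ * E t + Ψ / Λ - 2 * (Λ * E t) := by gcongr
      _ = _ := by ring
  have hall := le_of_ae_le_Ioo hE'c (by fun_prop) hae
  set G : ℝ → ℝ := fun t => exp (Λ * (t - t0)) * (E t - Ψ / Λ ^ 2) with hG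
  have hGd : ∀ t, HasDerivAt G (exp (Λ * (t - t0)) * (Λ * (E t - Ψ / Λ ^ 2) + E' t)) t := by
    intro t
    have h1 : HasDerivAt (fun t => exp (Λ * (t - t0))) (exp (Λ * (t - t0)) * Λ) t := by
      have := (((hasDerivAt_id t).sub_const t0).const_mul Λ).exp
      simpa using this
    have := h1.mul ((hEd t).sub_const (Ψ / Λ ^ 2))
    refine this.congr_deriv ?_
    ring
  have hanti : AntitoneOn G (Ico t0 t1) := by
    refine antitoneOn_of_deriv_nonpos (convex_Ico t0 t1)
      (fun t _ => (hGd t).continuousAt.continuousWithinAt)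
      (fun t _ => (hGd t).differentiableAt.differentiableWithinAt) fun t ht => ?_
    rw [interior_Ico] at ht
    rw [(hGd t).deriv]
    refine mul_nonpos_of_nonneg_of_nonpos (exp_pos _).le ?_
    have := hall t ht
    have e : Λ * (E t - Ψ / Λ ^ 2) = Λ * E t - Ψ / Λ := by field_simp
    rw [e]; linarith
  intro t ht
  have h := hanti ⟨le_rfl, ht.1.trans_lt ht.2⟩ ht ht.1
  simp only [hG, sub_self, mul_zero, exp_zero, one_mul] at h
  have hΨ : 0 ≤ Ψ / Λ ^ 2 := by
    have hne : (volume.restrict (Ioo t0 t1)) ≠ 0 := by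
      rw [Ne, Measure.restrict_eq_zero, Real.volume_Ioo]
      simpa using ht.1.trans_lt ht.2
    have : (ae (volume.restrict (Ioo t0 t1))).NeBot := ae_neBot.2 hne
    obtain ⟨s, hs⟩ := hR.exists
    have : 0 ≤ Ψ := le_trans (sum_nonneg fun i _ => sum_nonneg fun k _ =>
      sq_nonneg _) hs
    positivity
  have h6 : E t - Ψ / Λ ^ 2 ≤ exp (-Λ * (t - t0)) * (E t0 - Ψ / Λ ^ 2) := by
    have h7 := mul_le_mul_of_nonneg_left h (exp_pos (-Λ * (t - t0))).le
    rwa [← mul_assoc, ← Real.exp_add, show -Λ * (t - t0) + Λ * (t - t0) = 0 by ring, exp_zero,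
      one_mul] at h7
  have := mul_nonneg (exp_pos (-Λ * (t - t0))).le hΨ
  show E t ≤ exp (-Λ * (t - t0)) * E t0 + Ψ / Λ ^ 2
  linarith [mul_sub (exp (-Λ * (t - t0))) (E t0) (Ψ / Λ ^ 2)]

theorem block_deriv_bound (hz' : ∀ i k, Continuous (z' i k)) {K U Ψ D : ℝ} (hK : ∀ t i j, |A0 t i j| ≤ K)
    (hU : ∀ k ∈ S, |μ k| ≤ U) (hD : ∀ t ∈ Ioo t0 t1, ∑ i, ∑ k ∈ S, z i k t ^ 2 ≤ D)
    (hR : ∀ᵐ t ∂(volume.restrict (Ioo t0 t1)),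
      ∑ i, ∑ k ∈ S, (z' i k t + μ k * ∑ j, A0 t i j * z j k t) ^ 2 ≤ Ψ) (i : Fin n) :
    ∀ t ∈ Ioo t0 t1, ∑ k ∈ S, z' i k t ^ 2 ≤ 2 * Ψ + 2 * (n * K ^ 2 * U ^ 2 * D) := by
  refine le_of_ae_le_Ioo (continuous_finsetSum _ fun k _ => (hz' i k).pow 2) continuous_const ?_
  filter_upwards [hR, ae_restrict_mem measurableSet_Ioo] with t ht hmem
  have hn : (0 : ℝ) ≤ n := n.cast_nonneg
  have h1 : ∀ k ∈ S, z' i k t ^ 2 ≤ 2 * (z' i k t + μ k * ∑ j, A0 t i j * z j k t) ^ 2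
      + 2 * (n * K ^ 2 * U ^ 2 * ∑ j, z j k t ^ 2) := by
    intro k hk
    have hK0 : 0 ≤ K := (abs_nonneg _).trans (hK t i i)
    have h2 : (∑ j, A0 t i j * z j k t) ^ 2 ≤ n * K ^ 2 * ∑ j, z j k t ^ 2 := by
      calc (∑ j, A0 t i j * z j k t) ^ 2 ≤ n * ∑ j, (A0 t i j * z j k t) ^ 2 := by
            simpa using sq_sum_le_card_mul_sum_sq (s := Finset.univ)
              (f := fun j => A0 t i j * z j k t)
        _ ≤ n * ∑ j, K ^ 2 * z j k t ^ 2 := by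
            gcongr with j _
            rw [mul_pow]
            refine mul_le_mul_of_nonneg_right ?_ (sq_nonneg _)
            exact sq_le_sq' (abs_le.1 (hK t i j)).1 (abs_le.1 (hK t i j)).2
        _ = _ := by rw [← mul_sum]; ring
    have h3 : μ k ^ 2 ≤ U ^ 2 := sq_le_sq' (abs_le.1 (hU k hk)).1 (abs_le.1 (hU k hk)).2
    have h4 : (μ k * ∑ j, A0 t i j * z j k t) ^ 2 ≤ n * K ^ 2 * U ^ 2 * ∑ j, z j k t ^ 2 := by
      rw [mul_pow]
      calc _ ≤ U ^ 2 * (n * K ^ 2 * ∑ j, z j k t ^ 2) := by gcongr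
        _ = _ := by ring
    nlinarith [sq_nonneg (z' i k t + 2 * (μ k * ∑ j, A0 t i j * z j k t))]
  calc ∑ k ∈ S, z' i k t ^ 2 ≤ _ := sum_le_sum h1
    _ = 2 * ∑ k ∈ S, (z' i k t + μ k * ∑ j, A0 t i j * z j k t) ^ 2
        + 2 * (n * K ^ 2 * U ^ 2 * ∑ k ∈ S, ∑ j, z j k t ^ 2) := by
        simp only [sum_add_distrib, ← mul_sum]
    _ ≤ _ := by
        gcongr
        · exact le_trans (single_le_sum (f := fun i => ∑ k ∈ S,
            (z' i k t + μ k * ∑ j, A0 t i j * z j k t) ^ 2)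
            (fun i _ => sum_nonneg fun k _ => sq_nonneg _) (Finset.mem_univ i)) ht
        · rw [sum_comm]; exact hD t hmem

theorem block_lipschitz {f f' : κ → ℝ → ℝ} (hf : ∀ k t, HasDerivAt (f k) (f' k t) t) {B : ℝ}
    (hB : 0 ≤ B) (h : ∀ t ∈ Ioo t0 t1, ∑ k ∈ S, f' k t ^ 2 ≤ B ^ 2) {t s : ℝ} (ht : t ∈ Ioo t0 t1)
    (hs : s ∈ Ioo t0 t1) : ∑ k ∈ S, (f k t - f k s) ^ 2 ≤ (B * |t - s|) ^ 2 := by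
  set c : κ → ℝ := fun k => f k t - f k s with hc
  set Q := ∑ k ∈ S, c k ^ 2 with hQ
  have hQ0 : 0 ≤ Q := sum_nonneg fun k _ => sq_nonneg _
  have h1 : ∀ x ∈ Ioo t0 t1, ‖∑ k ∈ S, c k * f' k x‖ ≤ √Q * B := by
    intro x hx
    refine abs_le_of_sq_le_sq ?_ (by positivity)
    calc _ ≤ (∑ k ∈ S, c k ^ 2) * ∑ k ∈ S, f' k x ^ 2 := Finset.sum_mul_sq_le_sq_mul_sq _ _ _
      _ ≤ Q * B ^ 2 := mul_le_mul_of_nonneg_left (h x hx) hQ0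
      _ = _ := by rw [mul_pow, sq_sqrt hQ0]
  have h2 := (convex_Ioo t0 t1).norm_image_sub_le_of_norm_hasDerivWithin_le
    (f := fun x => ∑ k ∈ S, c k * f k x) (f' := fun x => ∑ k ∈ S, c k * f' k x)
    (fun x _ => (HasDerivAt.fun_sum fun k _ => (hf k x).const_mul (c k)).hasDerivWithinAt) h1 hs ht
  rw [← sum_sub_distrib] at h2
  have e : ∑ k ∈ S, (c k * f k t - c k * f k s) = √Q * √Q := by
    rw [mul_self_sqrt hQ0, hQ]; exact sum_congr rfl fun k _ => by simp only [hc]; ring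
  rw [e, norm_eq_abs, abs_of_nonneg (by positivity), norm_eq_abs] at h2
  rcases hQ0.eq_or_lt with h0 | h0
  · rw [← h0]; positivity
  · have h3 : √Q ≤ B * |t - s| := by
      have := Real.sqrt_pos.2 h0
      exact le_of_mul_le_mul_left (by linarith) this
    calc Q = √Q ^ 2 := (sq_sqrt hQ0).symm
      _ ≤ _ := by gcongr

end blockode

/-- Data common to a class of families of one-dimensional parabolic systems. -/
structure Spec where
  n : ℕ
  m : ℕ
  I : Type
  S : Type
  T : Finset S
  js : S → ℕ
  sh : S → I → I
  lam : ℝ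
  K : ℝ
  τ0 : ℝ
  C0 : I → ℝ
  hm : 1 ≤ m
  hlam : 0 < lam
  hK : 0 ≤ K
  hjs : ∀ s ∈ T, js s < 2 * m

/-- A family of smooth functions on `ℝ × ℝ` solving coupled systems with Dirichlet data at `0`. -/
structure Fam (P : Spec) where
  A0 : ℝ → Fin P.n → Fin P.n → ℝ
  Bs : P.S → ℝ → Fin P.n → Fin P.n → ℝ
  w : P.I → Fin P.n → ℝ × ℝ → ℝ
  N : ℝ
  N_nonneg : 0 ≤ N
  smooth : ∀ σ i, ContDiff ℝ ∞ (w σ i)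
  A0_le : ∀ t i j, |A0 t i j| ≤ P.K
  Bs_le : ∀ s ∈ P.T, ∀ t i j, |Bs s t i j| ≤ P.K
  ellip : ∀ t (ξ : Fin P.n → ℝ), P.lam * ∑ i, ξ i ^ 2 ≤ ∑ i, ∑ j, A0 t i j * ξ i * ξ j
  eqn : ∀ σ, ∀ᵐ t ∂(volume.restrict (Ioo (-P.τ0) 0)), ∀ y ∈ Ioo (0 : ℝ) (1 / 2), ∀ i,
    fderiv ℝ (w σ i) (t, y) (1, 0)
      + (-1) ^ P.m * ∑ j, A0 t i j * iteratedDeriv (2 * P.m) (fun y => w σ j (t, y)) y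
      + ∑ s ∈ P.T, ∑ j, Bs s t i j * iteratedDeriv (P.js s) (fun y => w (P.sh s σ) j (t, y)) y = 0
  bc : ∀ σ i, ∀ t ∈ Ioo (-P.τ0) 0, ∀ k < P.m, iteratedDeriv k (fun y => w σ i (t, y)) 0 = 0
  bound : ∀ σ, ∀ t ∈ Ioo (-P.τ0) 0, ∑ i, ∫ y in (0 : ℝ)..1 / 2, w σ i (t, y) ^ 2 ≤ P.C0 σ * N ^ 2

section fam

theorem nat_le_infty {k : ℕ} : ((k : ℕ) : WithTop ℕ∞) ≤ ∞ := by
  exact_mod_cast (le_top : (k : ℕ∞) ≤ ⊤)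

theorem sum_fin_le {n : ℕ} {f : Fin n → ℝ} {b : ℝ} (h : ∀ i, f i ≤ b) : ∑ i, f i ≤ n * b := by
  simpa using sum_le_card_nsmul Finset.univ f b fun i _ => h i

theorem sum_sq_le_of_duality {κ : Type*} {S : Finset κ} {x : κ → ℝ} {Φ : ℝ}
    (h : ∀ (c : κ → ℝ) (N : ℝ), 0 ≤ N → ∑ k ∈ S, c k ^ 2 ≤ N ^ 2 →
      |∑ k ∈ S, c k * x k| ≤ Φ * N) : ∑ k ∈ S, x k ^ 2 ≤ Φ ^ 2 := by
  set Q := ∑ k ∈ S, x k ^ 2 with hQ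
  have hQ0 : 0 ≤ Q := sum_nonneg fun k _ => sq_nonneg _
  have h1 := h x (√Q) (sqrt_nonneg _) (by rw [sq_sqrt hQ0])
  have e : ∑ k ∈ S, x k * x k = √Q * √Q := by
    rw [mul_self_sqrt hQ0, hQ]; exact sum_congr rfl fun k _ => by ring
  rw [e, abs_of_nonneg (by positivity)] at h1
  rcases (sqrt_nonneg Q).eq_or_lt with h0 | h0
  · rw [← sq_sqrt hQ0, ← h0]; nlinarith [sq_nonneg Φ]
  · have := le_of_mul_le_mul_right h1 h0
    rw [← sq_sqrt hQ0]; gcongr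

theorem ip_sum_left {ι : Type*} {h : ℝ → ℝ} {f : ι → ℝ → ℝ} {S : Finset ι} (c : ι → ℝ)
    (hh : Continuous h) (hf : ∀ k ∈ S, Continuous (f k)) :
    ip (fun y => ∑ k ∈ S, c k * f k y) h = ∑ k ∈ S, c k * ip (f k) h := by
  rw [ip_comm, ip_sum_right c hh hf]
  simp only [ip_comm]

variable {P : Spec}

namespace Fam

/-- A slice of the family, cut off. -/
def g (F : Fam P) (χ : ℝ → ℝ) (σ : P.I) (i : Fin P.n) (t y : ℝ) : ℝ := χ y * F.w σ i (t, y)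

variable (F : Fam P) {χ : ℝ → ℝ} (σ : P.I) (i : Fin P.n)

theorem contDiff_w_slice (t : ℝ) : ContDiff ℝ ∞ fun y => F.w σ i (t, y) :=
  (F.smooth σ i).comp (contDiff_const.prodMk contDiff_id)

theorem contDiff_g (hχ : IsCut χ) (t : ℝ) : ContDiff ℝ ∞ (F.g χ σ i t) :=
  contDiff_mul_fun hχ.1 (F.contDiff_w_slice σ i t)

theorem iteratedDeriv_g (hχ : IsCut χ) (t y : ℝ) (j : ℕ) : iteratedDeriv j (F.g χ σ i t) y =
    ∑ k ∈ Finset.range (j + 1), j.choose k * iteratedDeriv k χ y *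
      iteratedDeriv (j - k) (fun y => F.w σ i (t, y)) y :=
  iteratedDeriv_fun_mul ((hχ.1.of_le (nat_le_infty)).contDiffAt)
    (((F.contDiff_w_slice σ i t).of_le (nat_le_infty)).contDiffAt)

theorem isDir_g (hχ : IsCut χ) {t : ℝ} (ht : t ∈ Ioo (-P.τ0) 0) : IsDir P.m (F.g χ σ i t) where
  smooth := (F.contDiff_g σ i hχ t).of_le nat_le_infty
  bc0 := fun j hj => by
    rw [F.iteratedDeriv_g σ i hχ]
    refine sum_eq_zero fun k _ => ?_
    rw [F.bc σ i t ht _ (by omega), mul_zero]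
  bc1 := fun j _ => by
    rw [F.iteratedDeriv_g σ i hχ]
    refine sum_eq_zero fun k _ => ?_
    rw [(hχ.iteratedDeriv k).2 1 (by norm_num)]
    simp

end Fam

variable (P) (B : LevBasis P.m)

/-- Blocks of all cut off members of the family decay at rate `a`. -/
def Dec (a : ℝ) : Prop := ∀ τ, 0 < τ → τ < P.τ0 → ∀ σ χ, IsCut χ → ∃ C, 0 ≤ C ∧
  ∀ F : Fam P, ∀ t ∈ Ioo (-τ) 0, ∀ i l,
    ∑ k ∈ B.blk l, B.coef (F.g χ σ i t) k ^ 2 ≤ (C * F.N * dya (-a * l)) ^ 2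

/-- Lower order derivatives of all cut off members, tested against blocks, are bounded. -/
def LowB (a : ℝ) : Prop := ∀ τ, 0 < τ → τ < P.τ0 → ∀ σ χ, IsCut χ → ∃ C, 0 ≤ C ∧
  ∀ F : Fam P, ∀ t ∈ Ioo (-τ) 0, ∀ i l, ∀ c N, 0 ≤ N → ∑ k ∈ B.blk l, c k ^ 2 ≤ N ^ 2 →
    ∀ j < 2 * P.m, |ip (iteratedDeriv j (F.g χ σ i t)) (B.bcomb l c)| ≤
      C * F.N * dya ((2 * P.m - 1 - a) * l) * N

variable {P B}

theorem exists_energy_bound (σ : P.I) {χ : ℝ → ℝ} (hχ : IsCut χ) : ∃ C, 0 ≤ C ∧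
    ∀ F : Fam P, ∀ t ∈ Ioo (-P.τ0) 0, ∀ i, en (F.g χ σ i t) ≤ (C * F.N) ^ 2 := by
  obtain ⟨C, hC⟩ := (isCompact_Icc (a := (0 : ℝ)) (b := 1)).exists_bound_of_continuousOn
    hχ.1.continuous.continuousOn
  refine ⟨C * √|P.C0 σ|, ?_, fun F t ht i => ?_⟩
  · exact mul_nonneg ((norm_nonneg _).trans (hC 0 (by simp))) (sqrt_nonneg _)
  have hw := (F.contDiff_w_slice σ i t).continuous
  have hg := (F.contDiff_g σ i hχ t).continuous
  have h0 : ∫ y in (1 / 2 : ℝ)..1, F.g χ σ i t y ^ 2 = 0 := by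
    rw [intervalIntegral.integral_congr (g := fun _ => 0), intervalIntegral.integral_zero]
    intro y hy
    rw [uIcc_of_le (by norm_num)] at hy
    simp [Fam.g, hχ.2 y (by linarith [hy.1])]
  have hb : ∫ y in (0 : ℝ)..1 / 2, F.w σ i (t, y) ^ 2 ≤ P.C0 σ * F.N ^ 2 :=
    (single_le_sum (f := fun i => ∫ y in (0 : ℝ)..1 / 2, F.w σ i (t, y) ^ 2)
      (fun i _ => intervalIntegral.integral_nonneg (by norm_num) fun y _ => sq_nonneg _)
      (Finset.mem_univ i)).trans (F.bound σ t ht)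
  calc en (F.g χ σ i t) = ∫ y in (0 : ℝ)..1 / 2, F.g χ σ i t y ^ 2 := by
        have := intervalIntegral.integral_add_adjacent_intervals (μ := volume)
          ((hg.pow 2).intervalIntegrable (0 : ℝ) (1 / 2)) ((hg.pow 2).intervalIntegrable (1 / 2) 1)
        simp only [Pi.pow_apply] at this
        rw [en, ← this, h0, add_zero]
    _ ≤ ∫ y in (0 : ℝ)..1 / 2, C ^ 2 * F.w σ i (t, y) ^ 2 := by
        refine integral_mono_on (by norm_num) ((hg.pow 2).intervalIntegrable _ _)
          ((continuous_const.mul (hw.pow 2)).intervalIntegrable _ _) fun y hy => ?_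
        simp only [Fam.g, mul_pow]
        refine mul_le_mul_of_nonneg_right ?_ (sq_nonneg _)
        have := abs_le.1 (hC y ⟨hy.1, hy.2.trans (by norm_num)⟩)
        exact sq_le_sq' this.1 this.2
    _ = C ^ 2 * ∫ y in (0 : ℝ)..1 / 2, F.w σ i (t, y) ^ 2 := intervalIntegral.integral_const_mul _ _
    _ ≤ C ^ 2 * (|P.C0 σ| * F.N ^ 2) := by
        gcongr
        exact hb.trans (mul_le_mul_of_nonneg_right (le_abs_self _) (sq_nonneg _))
    _ = _ := by rw [mul_pow, mul_pow, sq_sqrt (abs_nonneg _)]; ring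

theorem lowB_zero : LowB P B 0 := by
  intro τ h0 hτ σ χ hχ
  obtain ⟨C, hC, h⟩ := B.exists_lower_bound_zero P.hm
  obtain ⟨C1, hC1, h1⟩ := exists_energy_bound σ hχ
  refine ⟨C * C1, by positivity, fun F t ht i l c N hN hc j hj => ?_⟩
  have ht' : t ∈ Ioo (-P.τ0) 0 := ⟨by linarith [ht.1], ht.2⟩
  have := h (F.g χ σ i t) (C1 * F.N) (F.isDir_g σ i hχ ht') (mul_nonneg hC1 F.N_nonneg)
    (h1 F t ht' i) l c N hN hc j hj
  exact this.trans_eq (by ring)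

theorem Dec.lowB {a : ℝ} (ha : 0 < a) (ha' : a < 2 * P.m - 1 / 2) (hd : Dec P B a) :
    LowB P B a := by
  intro τ h0 hτ σ χ hχ
  obtain ⟨C, hC, h⟩ := B.exists_lower_bound P.hm ha ha'
  obtain ⟨C1, hC1, h1⟩ := hd τ h0 hτ σ χ hχ
  refine ⟨C * C1, by positivity, fun F t ht i l c N hN hc j hj => ?_⟩
  have ht' : t ∈ Ioo (-P.τ0) 0 := ⟨by linarith [ht.1], ht.2⟩
  have := h (F.g χ σ i t) (C1 * F.N) (F.isDir_g σ i hχ ht') (mul_nonneg hC1 F.N_nonneg)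
    (h1 F t ht i) l c N hN hc j hj
  exact this.trans_eq (by ring)

theorem LowB.cut {a : ℝ} (hd : LowB P B a) {τ : ℝ} (h0 : 0 < τ) (hτ : τ < P.τ0) (σ : P.I)
    {χ : ℝ → ℝ} (hχ : IsCut χ) {j : ℕ} (hj : j < 2 * P.m) : ∃ C, 0 ≤ C ∧
    ∀ F : Fam P, ∀ t ∈ Ioo (-τ) 0, ∀ i l, ∀ c N, 0 ≤ N → ∑ k ∈ B.blk l, c k ^ 2 ≤ N ^ 2 →
      |ip (fun y => χ y * iteratedDeriv j (fun y => F.w σ i (t, y)) y) (B.bcomb l c)| ≤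
        C * F.N * dya ((2 * P.m - 1 - a) * l) * N := by
  obtain ⟨b, hb⟩ := exists_leibniz_inverse j
  choose C hC h using fun k => hd τ h0 hτ σ (iteratedDeriv k χ) (hχ.iteratedDeriv k)
  refine ⟨∑ k ∈ Finset.range (j + 1), |b k| * C k, sum_nonneg fun k _ =>
    mul_nonneg (abs_nonneg _) (hC k), fun F t ht i l c N hN hc => ?_⟩
  rw [funext fun y => hb χ _ hχ.1 (F.contDiff_w_slice σ i t) y, ip_sum_left _
    (B.isDir_bcomb l c).continuous]
  · simp only [sum_mul]
    refine (abs_sum_le_sum_abs _ _).trans (sum_le_sum fun k _ => ?_)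
    rw [abs_mul]
    calc _ ≤ |b k| * (C k * F.N * dya ((2 * P.m - 1 - a) * l) * N) :=
          mul_le_mul_of_nonneg_left (h k F t ht i l c N hN hc (j - k) (by omega)) (abs_nonneg _)
      _ = _ := by ring
  · intro k _
    exact (F.contDiff_g σ i (hχ.iteratedDeriv k) t).continuous_iteratedDeriv _
      nat_le_infty

end fam

section residual

variable {P : Spec} {B : LevBasis P.m}

namespace Fam

variable (F : Fam P) {χ : ℝ → ℝ} (σ : P.I) (i : Fin P.n)

/-- The time derivative of a slice of the family. -/
def dw (t y : ℝ) : ℝ := fderiv ℝ (F.w σ i) (t, y) (1, 0)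

theorem ip_dw (hχ : IsCut χ) {t : ℝ} {h : ℝ → ℝ} (hh : Continuous h)
    (heq : ∀ y ∈ Ioo (0 : ℝ) (1 / 2), F.dw σ i t y
      + (-1) ^ P.m * ∑ j, F.A0 t i j * iteratedDeriv (2 * P.m) (fun y => F.w σ j (t, y)) y
      + ∑ s ∈ P.T, ∑ j, F.Bs s t i j *
        iteratedDeriv (P.js s) (fun y => F.w (P.sh s σ) j (t, y)) y = 0) :
    ip (fun y => χ y * F.dw σ i t y) h =
      ∑ j, -((-1) ^ P.m * F.A0 t i j) * ip (iteratedDeriv (2 * P.m) (F.g χ σ j t)) h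
      + (∑ j, (-1) ^ P.m * F.A0 t i j * ∑ k ∈ Finset.range (2 * P.m), ((2 * P.m).choose (k + 1) : ℝ) *
        ip (fun y => iteratedDeriv (k + 1) χ y *
          iteratedDeriv (2 * P.m - (k + 1)) (fun y => F.w σ j (t, y)) y) h
      + ∑ s ∈ P.T, 1 * ∑ j, -F.Bs s t i j *
        ip (fun y => χ y * iteratedDeriv (P.js s) (fun y => F.w (P.sh s σ) j (t, y)) y) h) := by
  have c1 : ∀ j, Continuous (iteratedDeriv (2 * P.m) (F.g χ σ j t)) := fun j =>
    (F.contDiff_g σ j hχ t).continuous_iteratedDeriv _ nat_le_infty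
  have c2 : ∀ (k l : ℕ) σ j, Continuous fun y => iteratedDeriv k χ y *
      iteratedDeriv l (fun y => F.w σ j (t, y)) y := fun k l σ j =>
    ((hχ.iteratedDeriv k).1.continuous).mul
      ((F.contDiff_w_slice σ j t).continuous_iteratedDeriv _ nat_le_infty)
  have c3 : ∀ (l : ℕ) σ j, Continuous fun y => χ y *
      iteratedDeriv l (fun y => F.w σ j (t, y)) y := fun l σ j => by simpa using c2 0 l σ j
  have c4 : ∀ j, Continuous fun y => ∑ k ∈ Finset.range (2 * P.m), ((2 * P.m).choose (k + 1) : ℝ) *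
      (iteratedDeriv (k + 1) χ y *
        iteratedDeriv (2 * P.m - (k + 1)) (fun y => F.w σ j (t, y)) y) := fun j =>
    continuous_finsetSum _ fun k _ => continuous_const.mul (c2 _ _ σ j)
  have c5 : ∀ s, Continuous fun y => ∑ j, -F.Bs s t i j *
      (χ y * iteratedDeriv (P.js s) (fun y => F.w (P.sh s σ) j (t, y)) y) := fun s =>
    continuous_finsetSum _ fun j _ => continuous_const.mul (c3 _ _ j)
  rw [← ip_sum_left _ hh fun j _ => c1 j]
  simp only [← ip_sum_left _ hh fun k _ => c2 _ _ σ _, ← ip_sum_left _ hh fun j _ => c3 _ _ j]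
  rw [← ip_sum_left _ hh fun j _ => c4 j, ← ip_sum_left _ hh fun s _ => c5 s,
    ← ip_add_left ?_ ?_ hh, ← ip_add_left ?_ ?_ hh]
  rotate_left
  · exact continuous_finsetSum _ fun j _ => continuous_const.mul (c1 j)
  · exact (continuous_finsetSum _ fun j _ => continuous_const.mul (c4 j)).add
      (continuous_finsetSum _ fun s _ => continuous_const.mul (c5 s))
  · exact continuous_finsetSum _ fun j _ => continuous_const.mul (c4 j)
  · exact continuous_finsetSum _ fun s _ => continuous_const.mul (c5 s)
  refine intervalIntegral.integral_congr_ae (of_forall fun y hy => ?_)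
  rw [uIoc_of_le zero_le_one] at hy
  beta_reduce
  congr 1
  have e1 : ∀ j, iteratedDeriv (2 * P.m) (F.g χ σ j t) y =
      χ y * iteratedDeriv (2 * P.m) (fun y => F.w σ j (t, y)) y +
      ∑ k ∈ Finset.range (2 * P.m), ((2 * P.m).choose (k + 1) : ℝ) *
      (iteratedDeriv (k + 1) χ y *
        iteratedDeriv (2 * P.m - (k + 1)) (fun y => F.w σ j (t, y)) y) := by
    intro j
    rw [F.iteratedDeriv_g σ j hχ, Finset.sum_range_succ']
    simp [add_comm, mul_assoc]
  simp only [e1, mul_add, sum_add_distrib]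
  have e2 : ∀ f : Fin P.n → ℝ, ∑ j, -((-1) ^ P.m * F.A0 t i j) * f j
      = -∑ j, (-1) ^ P.m * F.A0 t i j * f j := fun f => by
    rw [← sum_neg_distrib]; exact sum_congr rfl fun j _ => by ring
  rw [e2, e2, add_assoc, neg_add_cancel_left]
  simp only [one_mul]
  rcases lt_or_ge y (1 / 2) with hy2 | hy2
  · have := heq y ⟨hy.1, hy2⟩
    have e3 : F.dw σ i t y
      = -((-1) ^ P.m * ∑ j, F.A0 t i j * iteratedDeriv (2 * P.m) (fun y => F.w σ j (t, y)) y)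
      - ∑ s ∈ P.T, ∑ j, F.Bs s t i j *
        iteratedDeriv (P.js s) (fun y => F.w (P.sh s σ) j (t, y)) y := by linarith
    rw [e3, mul_sub, mul_neg, sub_eq_add_neg]
    congr 1
    · simp only [mul_sum]
      congr 1
      exact sum_congr rfl fun j _ => by ring
    · simp only [mul_sum, ← sum_neg_distrib]
      exact sum_congr rfl fun s _ => sum_congr rfl fun j _ => by ring
  · simp [hχ.2 y (by linarith)]

theorem continuous_dw (t : ℝ) : Continuous (F.dw σ i t) :=
  (continuous_deriv_fst (F.smooth σ i)).2.comp (Continuous.prodMk_right t)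

end Fam

theorem LowB.residual {a : ℝ} (hd : LowB P B a) {τ : ℝ} (h0 : 0 < τ) (hτ : τ < P.τ0) (σ : P.I)
    {χ : ℝ → ℝ} (hχ : IsCut χ) : ∃ Φ, 0 ≤ Φ ∧ ∀ F : Fam P,
      ∀ᵐ t ∂(volume.restrict (Ioo (-τ) 0)), ∀ l, ∑ i, ∑ k ∈ B.blk l,
        (B.coef (fun y => χ y * F.dw σ i t y) k +
          B.μ k * ∑ j, F.A0 t i j * B.coef (F.g χ σ j t) k) ^ 2 ≤
        P.n * (Φ * F.N * dya ((2 * P.m - 1 - a) * l)) ^ 2 := by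
  have hm := P.hm
  have hK := P.hK
  choose C2 hC2 h2 using fun k : ℕ => hd.cut h0 hτ σ (hχ.iteratedDeriv (k + 1))
    (j := 2 * P.m - (k + 1)) (by omega)
  have : ∀ s, ∃ C, 0 ≤ C ∧ (s ∈ P.T → ∀ F : Fam P, ∀ t ∈ Ioo (-τ) 0, ∀ i l, ∀ c N, 0 ≤ N →
      ∑ k ∈ B.blk l, c k ^ 2 ≤ N ^ 2 →
      |ip (fun y => χ y * iteratedDeriv (P.js s) (fun y => F.w (P.sh s σ) i (t, y)) y)
        (B.bcomb l c)| ≤ C * F.N * dya ((2 * P.m - 1 - a) * l) * N) := by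
    intro s
    by_cases hs : s ∈ P.T
    · obtain ⟨C, hC, h⟩ := hd.cut h0 hτ (P.sh s σ) hχ (P.hjs s hs)
      exact ⟨C, hC, fun _ => h⟩
    · exact ⟨0, le_rfl, fun h => absurd h hs⟩
  choose C3 hC3 h3 using this
  set Φ := (∑ _j : Fin P.n, P.K * ∑ k ∈ Finset.range (2 * P.m), ((2 * P.m).choose (k + 1) : ℝ) * C2 k)
    + ∑ s ∈ P.T, ∑ _j : Fin P.n, P.K * C3 s with hΦ
  have hΦ0 : 0 ≤ Φ := add_nonneg
    (sum_nonneg fun j _ => mul_nonneg hK (sum_nonneg fun k _ =>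
      mul_nonneg (cast_nonneg _) (hC2 k)))
    (sum_nonneg fun s _ => sum_nonneg fun j _ => mul_nonneg hK (hC3 s))
  refine ⟨Φ, hΦ0, fun F => ?_⟩
  have hsub : Ioo (-τ) 0 ⊆ Ioo (-P.τ0) 0 := Ioo_subset_Ioo_left (by linarith)
  filter_upwards [ae_restrict_of_ae_restrict_of_subset hsub (F.eqn σ),
    ae_restrict_mem measurableSet_Ioo] with t ht hmem l
  refine sum_fin_le fun i => sum_sq_le_of_duality fun c N hN hc => ?_
  have hbc := (B.isDir_bcomb l c).continuous
  have key := F.ip_dw σ i hχ hbc (fun y hy => ht y hy i)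
  have e1 : ∀ j, ip (iteratedDeriv (2 * P.m) (F.g χ σ j t)) (B.bcomb l c) =
      (-1) ^ P.m * ∑ k ∈ B.blk l, c k * (B.μ k * B.coef (F.g χ σ j t) k) := by
    intro j
    have hg := F.isDir_g σ j hχ (hsub hmem)
    rw [B.ip_bcomb l c (hg.continuous_iter le_rfl), mul_sum]
    refine sum_congr rfl fun k _ => ?_
    rw [B.coef_iteratedDeriv_top hg k]; ring
  have e2 : ∑ k ∈ B.blk l, c k * (B.coef (fun y => χ y * F.dw σ i t y) k +
        B.μ k * ∑ j, F.A0 t i j * B.coef (F.g χ σ j t) k)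
      = ip (fun y => χ y * F.dw σ i t y) (B.bcomb l c)
        - ∑ j, -((-1) ^ P.m * F.A0 t i j) *
          ip (iteratedDeriv (2 * P.m) (F.g χ σ j t)) (B.bcomb l c) := by
    have hcont : Continuous fun y => χ y * F.dw σ i t y :=
      hχ.1.continuous.mul (F.continuous_dw σ i t)
    rw [B.ip_bcomb l c hcont]
    simp only [e1, mul_add, sum_add_distrib, mul_sum]
    rw [sub_eq_add_neg, ← sum_neg_distrib, sum_comm]
    congr 1
    refine sum_congr rfl fun j _ => ?_
    rw [← sum_neg_distrib]
    refine sum_congr rfl fun k _ => ?_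
    have : ((-1 : ℝ) ^ P.m) * (-1) ^ P.m = 1 := by rw [← mul_pow]; simp
    linear_combination (-(F.A0 t i j * (c k * (B.μ k * B.coef (F.g χ σ j t) k)))) * this
  rw [e2, key, add_sub_cancel_left]
  set W := F.N * dya ((2 * P.m - 1 - a) * l) * N with hW
  have b2 : ∀ j, |(-1) ^ P.m * F.A0 t i j * ∑ k ∈ Finset.range (2 * P.m),
      ((2 * P.m).choose (k + 1) : ℝ) * ip (fun y => iteratedDeriv (k + 1) χ y *
        iteratedDeriv (2 * P.m - (k + 1)) (fun y => F.w σ j (t, y)) y) (B.bcomb l c)| ≤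
      P.K * (∑ k ∈ Finset.range (2 * P.m), ((2 * P.m).choose (k + 1) : ℝ) * C2 k) * W := by
    intro j
    rw [abs_mul, abs_mul, abs_pow, abs_neg, abs_one, one_pow, one_mul, mul_assoc]
    refine mul_le_mul (F.A0_le t i j) ?_ (abs_nonneg _) hK
    rw [sum_mul]
    refine (abs_sum_le_sum_abs _ _).trans (sum_le_sum fun k _ => ?_)
    rw [abs_mul, Nat.abs_cast, mul_assoc]
    exact mul_le_mul_of_nonneg_left ((h2 k F t hmem j l c N hN hc).trans_eq (by rw [hW]; ring))
      (cast_nonneg _)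
  have b3 : ∀ s ∈ P.T, |1 * ∑ j, -F.Bs s t i j * ip (fun y => χ y *
      iteratedDeriv (P.js s) (fun y => F.w (P.sh s σ) j (t, y)) y) (B.bcomb l c)| ≤
      (∑ _j : Fin P.n, P.K * C3 s) * W := by
    intro s hs
    rw [one_mul, sum_mul]
    refine (abs_sum_le_sum_abs _ _).trans (sum_le_sum fun j _ => ?_)
    rw [abs_mul, abs_neg, mul_assoc]
    exact mul_le_mul (F.Bs_le s hs t i j) ((h3 s hs F t hmem j l c N hN hc).trans_eq
      (by rw [hW]; ring)) (abs_nonneg _) hK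
  calc _ ≤ _ := abs_add_le _ _
    _ ≤ (∑ j : Fin P.n, P.K * (∑ k ∈ Finset.range (2 * P.m), ((2 * P.m).choose (k + 1) : ℝ) * C2 k) * W)
        + ∑ s ∈ P.T, (∑ _j : Fin P.n, P.K * C3 s) * W :=
        add_le_add ((abs_sum_le_sum_abs _ _).trans (sum_le_sum fun j _ => b2 j))
          ((abs_sum_le_sum_abs _ _).trans (sum_le_sum b3))
    _ = Φ * W := by rw [hΦ, add_mul, sum_mul, sum_mul]
    _ = _ := by rw [hW]; ring

end residual

section bootstrap

variable {P : Spec} {B : LevBasis P.m}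

theorem Fam.hasDerivAt_coef (F : Fam P) {χ : ℝ → ℝ} (hχ : IsCut χ) (σ : P.I) (i : Fin P.n) (k : B.ι)
    (t : ℝ) : HasDerivAt (fun t => B.coef (F.g χ σ i t) k)
      (B.coef (fun y => χ y * F.dw σ i t y) k) t :=
  (hasDerivAt_ip_slice (F.smooth σ i) hχ.1.continuous (B.isDir k).continuous).1 t

theorem Fam.continuous_coef_dw (F : Fam P) {χ : ℝ → ℝ} (hχ : IsCut χ) (σ : P.I) (i : Fin P.n)
    (k : B.ι) : Continuous fun t => B.coef (fun y => χ y * F.dw σ i t y) k :=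
  (hasDerivAt_ip_slice (F.smooth σ i) hχ.1.continuous (B.isDir k).continuous).2

theorem LowB.dec {a : ℝ} (ha : a + 1 ≤ 3 * P.m) (hd : LowB P B a) : Dec P B (a + 1) := by
  intro τ h0 hτ σ χ hχ
  have hlam := P.hlam
  set τ' := (τ + P.τ0) / 2 with hτ'
  obtain ⟨Φ, hΦ, hres⟩ := hd.residual (τ := τ') (by linarith) (by linarith) σ hχ
  obtain ⟨C1, hC1, hen⟩ := exists_energy_bound σ hχ
  set δ := τ' - τ with hδ
  have hδ0 : 0 < δ := by linarith
  set Q := P.n * C1 ^ 2 * (6 / (P.lam * δ) ^ 3) + P.n * Φ ^ 2 / P.lam ^ 2 with hQ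
  have hn : (0 : ℝ) ≤ P.n := cast_nonneg _
  have hQ0 : 0 ≤ Q := by positivity
  refine ⟨√Q, sqrt_nonneg _, fun F t ht i l => ?_⟩
  set L := dya ((2 * P.m : ℕ) * l) with hL
  have hL0 : 0 < L := dya_pos _
  have hmain := block_decay (S := B.blk l) (μ := B.μ) (A0 := F.A0)
    (z := fun i k t => B.coef (F.g χ σ i t) k)
    (z' := fun i k t => B.coef (fun y => χ y * F.dw σ i t y) k) (lam := P.lam) (t0 := -τ') (t1 := 0)
    (fun i k t => F.hasDerivAt_coef hχ σ i k t) (fun i k => F.continuous_coef_dw hχ σ i k) hlam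
    F.ellip (L := L) hL0
    (fun k hk => by have := (B.lev_spec k).1; rwa [(B.mem_blk l k).1 hk] at this)
    ((hres F).mono fun t ht => ht l) t ⟨by linarith [ht.1], ht.2⟩
  have hE0 : ∑ i, ∑ k ∈ B.blk l, B.coef (F.g χ σ i (-τ')) k ^ 2 ≤ P.n * (C1 * F.N) ^ 2 := by
    refine sum_fin_le fun i => ?_
    exact (B.sum_coef_sq_le (S := B.blk l) (F.contDiff_g σ i hχ _).continuous).trans
      (hen F _ ⟨by linarith, by linarith⟩ i)
  have hexp : exp (-(P.lam * L) * (t - -τ')) ≤ 6 / (P.lam * δ) ^ 3 * dya (-(a + 1) * l) ^ 2 := by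
    have hx : 0 < P.lam * L * δ := by positivity
    have h1 : P.lam * L * δ ≤ P.lam * L * (t - -τ') :=
      mul_le_mul_of_nonneg_left (by linarith [ht.1]) (by positivity)
    have h2 : (P.lam * L * δ) ^ 3 / 6 ≤ exp (P.lam * L * δ) := by
      have := Real.pow_div_factorial_le_exp _ hx.le 3
      norm_num [Nat.factorial] at this
      exact this
    have h3 : exp (-(P.lam * L) * (t - -τ')) ≤ 6 / (P.lam * L * δ) ^ 3 := by
      rw [neg_mul, Real.exp_neg, ← one_div, div_le_div_iff₀ (exp_pos _) (by positivity)]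
      have := Real.exp_le_exp.2 h1
      linarith
    have h4 : (L⁻¹) ^ 3 ≤ dya (-(a + 1) * l) ^ 2 := by
      rw [hL, dya, ← Real.rpow_neg two_pos.le]
      change dya _ ^ 3 ≤ _
      rw [dya_mul_pow, dya_mul_pow]
      refine dya_le ?_
      have hl : (0 : ℝ) ≤ l := cast_nonneg _
      push_cast
      nlinarith
    refine h3.trans ?_
    calc 6 / (P.lam * L * δ) ^ 3 = 6 / (P.lam * δ) ^ 3 * L⁻¹ ^ 3 := by field_simp
      _ ≤ _ := mul_le_mul_of_nonneg_left h4 (by positivity)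
  have hlow : dya ((2 * P.m - 1 - a) * l) = L * dya (-(a + 1) * l) := by
    rw [hL, ← dya_add]; congr 1; push_cast; ring
  refine (single_le_sum (f := fun i => ∑ k ∈ B.blk l, B.coef (F.g χ σ i t) k ^ 2)
    (fun i _ => sum_nonneg fun k _ => sq_nonneg _) (Finset.mem_univ i)).trans ?_
  refine hmain.trans ?_
  rw [hlow, mul_pow (√Q * F.N), mul_pow (√Q), sq_sqrt hQ0]
  calc _ ≤ 6 / (P.lam * δ) ^ 3 * dya (-(a + 1) * l) ^ 2 * (P.n * (C1 * F.N) ^ 2)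
        + P.n * (Φ * F.N * (L * dya (-(a + 1) * l))) ^ 2 / (P.lam * L) ^ 2 := by
        gcongr
    _ = _ := by rw [hQ]; field_simp

theorem Dec.mono {a b : ℝ} (hab : b ≤ a) (hd : Dec P B a) : Dec P B b := by
  intro τ h0 hτ σ χ hχ
  obtain ⟨C, hC, h⟩ := hd τ h0 hτ σ χ hχ
  refine ⟨C, hC, fun F t ht i l => (h F t ht i l).trans ?_⟩
  have := F.N_nonneg
  have : dya (-a * l) ≤ dya (-b * l) :=
    dya_le (mul_le_mul_of_nonneg_right (by linarith) (cast_nonneg _))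
  have := (dya_pos (-a * l)).le
  gcongr

theorem dec_top {ε : ℝ} (hε : 0 < ε) (hε' : ε < 1 / 2) : Dec P B (2 * P.m + 1 / 2 - ε) := by
  have hm : (1 : ℝ) ≤ P.m := by exact_mod_cast P.hm
  have h : ∀ k : ℕ, k ≤ 2 * P.m → Dec P B (k + 1 / 2 - ε) := by
    intro k
    induction k with
    | zero =>
      intro _
      refine (LowB.dec (a := 0) (by linarith) lowB_zero).mono ?_
      push_cast; linarith
    | succ k ih =>
      intro hk
      have hk' : (k : ℝ) + 1 ≤ 2 * P.m := by exact_mod_cast hk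
      have h0 : (0 : ℝ) ≤ k := cast_nonneg _
      have := (Dec.lowB (by linarith) (by linarith) (ih (by omega))).dec (by linarith)
      convert this using 1
      push_cast; ring
  simpa using h (2 * P.m) le_rfl

theorem Fam.lipschitz {ε : ℝ} (hε : 0 < ε) (hε' : ε < 1 / 2) {τ : ℝ} (h0 : 0 < τ) (hτ : τ < P.τ0)
    (σ : P.I) {χ : ℝ → ℝ} (hχ : IsCut χ) : ∃ C, 0 ≤ C ∧ ∀ F : Fam P, ∀ t ∈ Ioo (-τ) 0,
      ∀ s ∈ Ioo (-τ) 0, ∀ i l,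
      ∑ k ∈ B.blk l, (B.coef (F.g χ σ i t) k - B.coef (F.g χ σ i s) k) ^ 2 ≤
        (C * F.N * |t - s| * dya ((-1 / 2 + ε) * l)) ^ 2 := by
  have hm : (1 : ℝ) ≤ P.m := by exact_mod_cast P.hm
  obtain ⟨C1, hC1, h1⟩ := dec_top (P := P) (B := B) hε hε' τ h0 hτ σ χ hχ
  have hlow : LowB P B (2 * P.m - 1 / 2 - ε) := by
    refine Dec.lowB (by linarith) (by linarith) ((dec_top hε hε').mono (by linarith))
  obtain ⟨Φ, hΦ, hres⟩ := hlow.residual h0 hτ σ hχ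
  set u := (2 : ℝ) ^ (2 * P.m) with hu
  set Q := 2 * (P.n * Φ ^ 2) + 2 * (P.n * P.K ^ 2 * u ^ 2 * (P.n * C1 ^ 2)) with hQ
  have hn : (0 : ℝ) ≤ P.n := cast_nonneg _
  have hQ0 : 0 ≤ Q := by positivity
  refine ⟨√Q, sqrt_nonneg _, fun F t ht s hs i l => ?_⟩
  have hN := F.N_nonneg
  set L := dya ((2 * P.m : ℕ) * l) with hL
  set D := C1 * F.N * dya (-(2 * P.m + 1 / 2 - ε) * l) with hD
  have hLD : L * dya (-(2 * P.m + 1 / 2 - ε) * l) = dya ((-1 / 2 + ε) * l) := by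
    rw [hL, ← dya_add]; congr 1; push_cast; ring
  have hU : ∀ k ∈ B.blk l, |B.μ k| ≤ u * L := by
    intro k hk
    have h2 := (B.lev_spec k).2
    rw [(B.mem_blk l k).1 hk] at h2
    rw [abs_of_nonneg (zero_le_one.trans (B.one_le k))]
    refine h2.trans_eq ?_
    rw [show ((2 * P.m : ℕ) : ℝ) * (l + 1 : ℕ) = (2 * P.m : ℕ) + (2 * P.m : ℕ) * l by push_cast; ring,
      dya_add, hL, hu]
    congr 1
    exact rpow_natCast 2 _
  have hb := block_deriv_bound (S := B.blk l) (μ := B.μ) (A0 := F.A0)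
    (z := fun i k t => B.coef (F.g χ σ i t) k)
    (z' := fun i k t => B.coef (fun y => χ y * F.dw σ i t y) k) (t0 := -τ) (t1 := 0)
    (fun i k => F.continuous_coef_dw hχ σ i k) F.A0_le hU (D := P.n * D ^ 2) (fun t ht => by
      exact sum_fin_le fun i => h1 F t ht i l)
    ((hres F).mono fun t ht => ht l) i
  have e : 2 * (P.n * (Φ * F.N * dya ((2 * P.m - 1 - (2 * P.m - 1 / 2 - ε)) * l)) ^ 2)
      + 2 * (P.n * P.K ^ 2 * (u * L) ^ 2 * (P.n * D ^ 2))
      = (√Q * F.N * dya ((-1 / 2 + ε) * l)) ^ 2 := by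
    rw [show (2 * P.m - 1 - (2 * P.m - 1 / 2 - ε)) * (l : ℝ) = (-1 / 2 + ε) * l by ring, ← hLD, mul_pow (√Q * F.N),
      mul_pow (√Q), sq_sqrt hQ0, hD, hQ]
    ring
  have := block_lipschitz (S := B.blk l) (fun k t => F.hasDerivAt_coef (B := B) hχ σ i k t)
    (B := √Q * F.N * dya ((-1 / 2 + ε) * l))
    (mul_nonneg (mul_nonneg (sqrt_nonneg _) hN) (dya_pos _).le)
    (fun t ht => (hb t ht).trans_eq e) ht hs
  refine this.trans_eq ?_
  ring

theorem exists_isCut : ∃ χ, IsCut χ ∧ ∀ y < (5 / 16 : ℝ), χ y = 1 := by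
  refine ⟨fun y => 1 - Real.smoothTransition (16 * (y - 5 / 16)), ⟨?_, fun y hy => ?_⟩, fun y hy => ?_⟩
  · exact contDiff_sub_fun contDiff_const (Real.smoothTransition.contDiff.comp (by fun_prop))
  · beta_reduce
    rw [Real.smoothTransition.one_of_one_le (by linarith), sub_self]
  · beta_reduce
    rw [Real.smoothTransition.zero_of_nonpos (by linarith), sub_zero]

/-- Interior-in-time, up-to-the-boundary regularity for one-dimensional systems. -/
theorem Fam.exists_bound (P : Spec) {γ : ℝ} (hγ : γ ∈ Ioo (0 : ℝ) 1) {τ : ℝ} (h0 : 0 < τ)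
    (hτ : τ < P.τ0) (σ : P.I) : ∃ C, 0 ≤ C ∧ ∀ F : Fam P, ∀ t ∈ Ioo (-τ) 0, ∀ i, ∀ j < 2 * P.m,
      ∀ y ∈ Icc (0 : ℝ) (1 / 4), |iteratedDeriv j (fun y => F.w σ i (t, y)) y| ≤ C * F.N ∧
      ∀ s ∈ Ioo (-τ) 0, ∀ y' ∈ Icc (0 : ℝ) (1 / 4),
        |iteratedDeriv j (fun y => F.w σ i (t, y)) y - iteratedDeriv j (fun y => F.w σ i (s, y)) y'| ≤
          C * F.N * (|t - s| ^ (γ / (2 * P.m)) + |y - y'| ^ γ) := by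
  obtain ⟨B⟩ := exists_levBasis P.hm
  obtain ⟨χ, hχ, hχ1⟩ := exists_isCut
  set ε := (1 - γ) / 2 with hε
  have hε0 : 0 < ε := by linarith [hγ.2]
  have hε' : ε < 1 / 2 := by linarith [hγ.1]
  obtain ⟨C, hC, hb⟩ := B.exists_pointwise_bounds P.hm hγ.1 hε0 (by linarith)
  obtain ⟨C1, hC1, h1⟩ := dec_top (P := P) (B := B) hε0 hε' τ h0 hτ σ χ hχ
  obtain ⟨C2, hC2, h2⟩ := Fam.lipschitz (B := B) hε0 hε' h0 hτ σ hχ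
  refine ⟨C * (C1 + C2), by positivity, fun F t ht i j hj y hy => ?_⟩
  have hN := F.N_nonneg
  have hM : 0 ≤ (C1 + C2) * F.N := by positivity
  have hsub : Ioo (-τ) 0 ⊆ Ioo (-P.τ0) 0 := Ioo_subset_Ioo_left (by linarith)
  have hdec : ∀ t ∈ Ioo (-τ) 0, ∀ l, ∑ k ∈ B.blk l, B.coef (F.g χ σ i t) k ^ 2 ≤
      ((C1 + C2) * F.N * dya (-(2 * P.m + 1 / 2 - ε) * l)) ^ 2 := fun t ht l => by
    refine (h1 F t ht i l).trans ?_
    have := (dya_pos (-(2 * P.m + 1 / 2 - ε) * l)).le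
    gcongr
    linarith
  have heq : ∀ t, ∀ y ∈ Icc (0 : ℝ) (1 / 4),
      iteratedDeriv j (F.g χ σ i t) y = iteratedDeriv j (fun y => F.w σ i (t, y)) y := by
    intro t y hy
    refine EventuallyEq.iteratedDeriv_eq j ?_
    filter_upwards [gt_mem_nhds (show y < 5 / 16 by linarith [hy.2])] with x hx
    simp [Fam.g, hχ1 x hx]
  have hy1 : ∀ y ∈ Icc (0 : ℝ) (1 / 4), y ∈ Icc (0 : ℝ) 1 := fun y hy => ⟨hy.1, by linarith [hy.2]⟩
  have hball := fun t ht => hb (F.g χ σ i t) _ (F.isDir_g σ i hχ (hsub ht)) hM (hdec t ht) j hj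
  rw [← heq t y hy]
  refine ⟨(hball t ht y (hy1 y hy)).1.trans_eq (by ring), fun s hs y' hy' => ?_⟩
  rw [← heq s y' hy']
  have a1 := (hball t ht y (hy1 y hy)).2.2 (F.g χ σ i s) |t - s| (F.isDir_g σ i hχ (hsub hs))
    (abs_nonneg _) (hdec s hs) (fun l => by
      refine (h2 F t ht s hs i l).trans ?_
      have := (dya_pos ((-1 / 2 + ε) * l)).le
      gcongr
      linarith)
  have a2 := (hball s hs y (hy1 y hy)).2.1 y' (hy1 y' hy')
  refine (abs_sub_le _ (iteratedDeriv j (F.g χ σ i s) y) _).trans ?_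
  refine (add_le_add a1 a2).trans_eq (by ring)

end bootstrap

section BoundaryDecay
variable {d n m : ℕ} {N : Fin d}
local notation "E" => EuclideanSpace ℝ (Fin d)

theorem lintegral_sobolev {ρ : ℝ} (hρ : 0 < ρ) {f f' : ℝ → ℝ} (hf' : Continuous f')
    (h : ∀ y, HasDerivAt f (f' y) y) {x : ℝ} (hx : x ∈ Icc (-ρ) ρ) :
    ofReal (f x ^ 2) ≤ ofReal (1 / ρ + 4 * ρ) *
      ∫⁻ y in Icc (-ρ) ρ, (ofReal (f y ^ 2) + ofReal (f' y ^ 2)) := by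
  have hf : Continuous f := continuous_iff_continuousAt.2 fun y => (h y).continuousAt
  have hF : ∀ y, HasDerivAt (fun y => f (2 * ρ * y - ρ)) (f' (2 * ρ * y - ρ) * (2 * ρ)) y := by
    intro y
    have h1 : HasDerivAt (fun y => 2 * ρ * y - ρ) (2 * ρ) y := by
      simpa using ((hasDerivAt_id y).const_mul (2 * ρ)).sub_const ρ
    exact (h _).comp y h1
  have key := sq_le_en (f := fun y => f (2 * ρ * y - ρ)) (by fun_prop) hF one_pos le_rfl
    (y := (x + ρ) / (2 * ρ)) ⟨by have := hx.1; apply div_nonneg <;> linarith, by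
      rw [div_le_one (by linarith)]; linarith [hx.2]⟩
  have e1 : 2 * ρ * ((x + ρ) / (2 * ρ)) - ρ = x := by field_simp; ring
  have e2 : ∀ k : ℝ → ℝ, ∫ y in (0 : ℝ)..1, k (2 * ρ * y - ρ) = (2 * ρ)⁻¹ * ∫ y in (-ρ)..ρ, k y := by
    intro k
    rw [intervalIntegral.integral_comp_mul_sub k (by positivity : 2 * ρ ≠ 0)]
    rw [smul_eq_mul]
    congr 2 <;> ring
  simp only [e1, en, mul_pow] at key
  rw [e2 fun z => f z ^ 2, e2 fun z => f' z ^ 2 * ((2 : ℝ) ^ 2 * ρ ^ 2),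
    intervalIntegral.integral_mul_const] at key
  rw [← ENNReal.ofReal_le_ofReal_iff (by
    have : 0 ≤ ∫ y in (-ρ)..ρ, f y ^ 2 := intervalIntegral.integral_nonneg (by linarith) fun _ _ => sq_nonneg _
    have : 0 ≤ ∫ y in (-ρ)..ρ, f' y ^ 2 := intervalIntegral.integral_nonneg (by linarith) fun _ _ => sq_nonneg _
    positivity)] at key
  refine key.trans ?_
  have hi : ∀ k : ℝ → ℝ, Continuous k → IntegrableOn (fun y => k y ^ 2) (Icc (-ρ) ρ) := fun k hk =>
    (hk.pow 2).continuousOn.integrableOn_Icc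
  have e3 : ∫⁻ y in Icc (-ρ) ρ, (ofReal (f y ^ 2) + ofReal (f' y ^ 2))
      = ofReal (∫ y in (-ρ)..ρ, (f y ^ 2 + f' y ^ 2)) := by
    rw [integral_of_le (by linarith), ← integral_Icc_eq_integral_Ioc,
      ofReal_integral_eq_lintegral_ofReal (μ := volume.restrict (Icc (-ρ) ρ))
        (f := fun y => f y ^ 2 + f' y ^ 2) (Integrable.add (hi f hf) (hi f' hf'))
        (of_forall fun y => add_nonneg (sq_nonneg _) (sq_nonneg _))]
    refine lintegral_congr fun y => (ofReal_add (sq_nonneg _) (sq_nonneg _)).symm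
  rw [e3, ← ofReal_mul (by positivity)]
  refine ofReal_le_ofReal ?_
  have i1 : Continuous fun y => f y ^ 2 := by fun_prop
  have i2 : Continuous fun y => f' y ^ 2 := by fun_prop
  rw [intervalIntegral.integral_add (i1.intervalIntegrable _ _) (i2.intervalIntegrable _ _)]
  have a1 : 0 ≤ ∫ y in (-ρ)..ρ, f y ^ 2 := intervalIntegral.integral_nonneg (by linarith) fun _ _ => sq_nonneg _
  have a2 : 0 ≤ ∫ y in (-ρ)..ρ, f' y ^ 2 := intervalIntegral.integral_nonneg (by linarith) fun _ _ => sq_nonneg _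
  set a := ∫ y in (-ρ)..ρ, f y ^ 2
  set b := ∫ y in (-ρ)..ρ, f' y ^ 2
  have : 2 / 1 * ((2 * ρ)⁻¹ * a) + 2 * 1 * ((2 * ρ)⁻¹ * (b * (2 ^ 2 * ρ ^ 2)))
      = (1 / ρ) * a + 4 * ρ * b := by field_simp; ring
  rw [this]
  have : 0 ≤ (1 / ρ) * b := by positivity
  have : 0 ≤ ρ * a := by positivity
  nlinarith

theorem hasDerivAt_toLp_update {g : E → ℝ} (hg : ContDiff ℝ ∞ g) (z : Fin d → ℝ) (i : Fin d) (y : ℝ) :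
    HasDerivAt (fun y => g (toLp 2 (update z i y)))
      (pd i g (toLp 2 (update z i y))) y := by
  have h1 : HasDerivAt (fun y => (toLp 2 (update z i y) : E))
      (single i 1) y := by
    have : (fun y => (toLp 2 (update z i y) : E))
        = fun y => toLp 2 (update z i 0) + y • single i (1 : ℝ) := by
      funext y; ext j
      by_cases hj : j = i
      · subst hj; simp
      · simp [hj]
    rw [this]
    simpa using ((hasDerivAt_id y).smul_const (single i (1 : ℝ))).const_add
      (toLp 2 (update z i 0) : E)
  exact ((hg.differentiable (by simp)) _).hasFDerivAt.comp_hasDerivAt y h1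

/-- The measures on the factors of a box, `(0, 1/2]` in the normal direction. -/
def boxMeasure (N : Fin d) (ρ : ℝ) (i : Fin d) : Measure ℝ :=
  volume.restrict (if i = N then Ioc 0 (1 / 2) else Icc (-ρ) ρ)

instance (N : Fin d) (ρ : ℝ) (i : Fin d) : SigmaFinite (boxMeasure N ρ i) := by
  unfold boxMeasure; infer_instance

theorem lmarginal_sobolev (N : Fin d) {ρ : ℝ} (hρ : 0 < ρ) (s : Finset (Fin d)) (hs : N ∉ s) :
    ∃ C : ℝ, 0 ≤ C ∧ ∃ M : Finset (Fin d → ℕ), (∀ q ∈ M, q N = 0) ∧ ∀ g : E → ℝ, ContDiff ℝ ∞ g →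
      ∀ z : Fin d → ℝ, (∀ i ∈ s, z i ∈ Icc (-ρ) ρ) →
        ofReal (g (toLp 2 z) ^ 2) ≤ ofReal C * ∑ q ∈ M,
          lmarginal (boxMeasure N ρ) s (fun z => ofReal (DD q g (toLp 2 z) ^ 2)) z := by
  induction s using Finset.induction_on with
  | empty =>
    refine ⟨1, zero_le_one, {0}, by simp, fun g hg z _ => ?_⟩
    simp [DD_zero]
  | insert i s his ih =>
    obtain ⟨C, hC, M, hM, h⟩ := ih (fun h => hs (Finset.mem_insert_of_mem h))
    have hiN : i ≠ N := fun h => hs (h ▸ Finset.mem_insert_self _ _)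
    have hpos : (0 : ℝ) ≤ 1 / ρ + 4 * ρ := by positivity
    refine ⟨(1 / ρ + 4 * ρ) * (C * 2), by positivity, M ∪ M.image (· + Pi.single i 1), ?_,
      fun g hg z hz => ?_⟩
    · intro q hq
      rcases Finset.mem_union.1 hq with hq | hq
      · exact hM q hq
      · obtain ⟨p, hp, rfl⟩ := Finset.mem_image.1 hq
        simp [hM p hp, hiN.symm]
    have hm : ∀ q, Measurable fun z : Fin d → ℝ =>
        ofReal (DD q g (toLp 2 z) ^ 2) := fun q =>
      (((contDiff_DD hg q).continuous.comp
        (PiLp.continuous_toLp 2 _)).pow 2).measurable.ennreal_ofReal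
    have hc : Continuous fun y => pd i g (toLp 2 (update z i y)) :=
      (contDiff_pd hg i).continuous.comp ((PiLp.continuous_toLp 2 _).comp
        (continuous_const.update i continuous_id))
    have h0 := lintegral_sobolev hρ hc (hasDerivAt_toLp_update hg z i)
      (hz i (Finset.mem_insert_self _ _))
    rw [Function.update_eq_self] at h0
    refine h0.trans ?_
    rw [ofReal_mul hpos, mul_assoc]
    gcongr
    have h1 : ∀ y, ofReal (g (toLp 2 (update z i y)) ^ 2)
        + ofReal (pd i g (toLp 2 (update z i y)) ^ 2)
        ≤ ofReal (C * 2) * ∑ q ∈ M ∪ M.image (· + Pi.single i 1),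
          lmarginal (boxMeasure N ρ) s (fun z => ofReal (DD q g (toLp 2 z) ^ 2))
            (update z i y) := by
      intro y
      have hz' : ∀ j ∈ s, update z i y j ∈ Icc (-ρ) ρ := by
        intro j hj
        rw [Function.update_of_ne (by rintro rfl; exact his hj)]
        exact hz j (Finset.mem_insert_of_mem hj)
      have e1 := h g hg _ hz'
      have e2 := h (pd i g) (contDiff_pd hg i) _ hz'
      have e3 : ∀ q, DD q (pd i g) = DD (q + Pi.single i 1 : Fin d → ℕ) g := by
        intro q; rw [DD_add_single hg q i, pd_DD hg]
      simp only [e3] at e2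
      rw [← Finset.sum_image (s := M) (g := fun q : Fin d → ℕ => (q + Pi.single i 1 : Fin d → ℕ))
        (f := fun q => lmarginal (boxMeasure N ρ) s
          (fun z => ofReal (DD q g (toLp 2 z) ^ 2)) (update z i y))
        (fun a _ b _ hab => add_right_cancel hab)] at e2
      refine (add_le_add e1 e2).trans ?_
      rw [ofReal_mul hC, ← mul_add, mul_assoc]
      gcongr
      rw [show ofReal 2 = 2 by simp, two_mul]
      gcongr
      · exact Finset.subset_union_left
      · exact Finset.subset_union_right
    have hmu : boxMeasure N ρ i = volume.restrict (Icc (-ρ) ρ) := by simp [boxMeasure, hiN]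
    rw [← hmu]
    refine (lintegral_mono h1).trans ?_
    have hmm : ∀ q, Measurable fun y => lmarginal (boxMeasure N ρ) s
        (fun z => ofReal (DD q g (toLp 2 z) ^ 2)) (update z i y) := fun q =>
      ((hm q).lmarginal _).comp (measurable_update z)
    rw [lintegral_const_mul _ (Finset.measurable_sum _ fun q _ => hmm q),
      lintegral_finsetSum _ fun q _ => hmm q]
    gcongr with q hq
    rw [lmarginal_insert _ (hm q) his]

/-- A trace estimate on vertical segments by tangential derivatives. -/
theorem exists_slice_bound (N : Fin d) {ρ : ℝ} (hρ : 0 < ρ) (hρd : d * ρ ≤ 1 / 4) :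
    ∃ C, 0 ≤ C ∧ ∃ M : Finset (Fin d → ℕ), (∀ q ∈ M, q N = 0) ∧ ∀ g : E → ℝ, ContDiff ℝ ∞ g →
      ∀ x : E, x N = 0 → (∀ i, |x i| ≤ ρ) →
        ∫ y in (0 : ℝ)..(1 / 2), g (x + y • single N 1) ^ 2
          ≤ C * ∑ q ∈ M, ∫ x in HalfSp N ∩ closedBall 0 (3 / 4), DD q g x ^ 2 := by
  obtain ⟨C, hC, M, hM, h⟩ := lmarginal_sobolev N hρ (Finset.univ.erase N) (by simp)
  refine ⟨C, hC, M, hM, fun g hg x hxN hx => ?_⟩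
  have hm : ∀ q, Measurable fun z : Fin d → ℝ =>
      ofReal (DD q g (toLp 2 z) ^ 2) := fun q =>
    (((contDiff_DD hg q).continuous.comp
      (PiLp.continuous_toLp 2 _)).pow 2).measurable.ennreal_ofReal
  have hx' : ∀ y, x + y • single N 1
      = toLp 2 (update (WithLp.ofLp x) N y) := by
    intro y; ext j
    by_cases hj : j = N
    · subst hj; simp [hxN]
    · simp [hj]
  have hmu : boxMeasure N ρ N = volume.restrict (Ioc 0 (1 / 2)) := by simp [boxMeasure]
  have hmm : ∀ q, Measurable fun y => lmarginal (boxMeasure N ρ) (Finset.univ.erase N)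
      (fun z => ofReal (DD q g (toLp 2 z) ^ 2))
      (update (WithLp.ofLp x) N y) := fun q =>
    ((hm q).lmarginal _).comp (measurable_update _)
  have hI : ∀ q, IntegrableOn (fun x => DD q g x ^ 2) (HalfSp N ∩ closedBall 0 (3 / 4)) := fun q =>
    integrableOn_halfSp_inter (isCompact_closedBall _ _) ((contDiff_DD hg q).continuous.pow 2)
  have key : ∀ q, lmarginal (boxMeasure N ρ) Finset.univ
      (fun z => ofReal (DD q g (toLp 2 z) ^ 2)) (WithLp.ofLp x)
      ≤ ofReal (∫ x in HalfSp N ∩ closedBall 0 (3 / 4), DD q g x ^ 2) := by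
    intro q
    rw [ofReal_integral_eq_lintegral_ofReal (hI q) (of_forall fun _ => sq_nonneg _),
      lmarginal_univ]
    have e1 : Measure.pi (boxMeasure N ρ) = (volume : Measure (Fin d → ℝ)).restrict
        (Set.univ.pi fun i => if i = N then Ioc 0 (1 / 2) else Icc (-ρ) ρ) := by
      rw [volume_pi, Measure.restrict_pi_pi]; rfl
    rw [e1, ← (PiLp.volume_preserving_toLp (Fin d)).setLIntegral_comp_preimage_emb
      (MeasurableEquiv.toLp 2 (Fin d → ℝ)).measurableEmbedding
      (fun x => ofReal (DD q g x ^ 2))]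
    refine lintegral_mono_set fun z hz => ?_
    have hzN := hz N trivial
    simp only [if_true] at hzN
    refine ⟨hzN.1, ?_⟩
    rw [mem_closedBall, dist_zero_right]
    have hd0 : (0 : ℝ) ≤ d * ρ := by positivity
    have hsq : ‖(toLp 2 z : E)‖ ^ 2 ≤ (3 / 4) ^ 2 := by
      rw [EuclideanSpace.real_norm_sq_eq, ← Finset.add_sum_erase _ _ (Finset.mem_univ N)]
      have h1 : ∀ i ∈ Finset.univ.erase N, (toLp 2 z : E) i ^ 2 ≤ ρ ^ 2 := by
        intro i hi
        have := hz i trivial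
        simp only [(Finset.ne_of_mem_erase hi), if_false] at this
        exact sq_le_sq' this.1 this.2
      have h2 := sum_le_card_nsmul _ _ _ h1
      rw [Finset.card_erase_of_mem (Finset.mem_univ _), Finset.card_univ, Fintype.card_fin,
        nsmul_eq_mul] at h2
      have h3 : ((d - 1 : ℕ) : ℝ) ≤ d := by exact_mod_cast Nat.sub_le _ _
      have h4 : ((d - 1 : ℕ) : ℝ) * ρ ^ 2 ≤ d * ρ ^ 2 := by gcongr
      have h5 : (d : ℝ) * ρ ^ 2 ≤ (d * ρ) * (d * ρ) := by
        have : (1 : ℝ) ≤ d := by exact_mod_cast N.pos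
        have : 0 ≤ ((d : ℝ) - 1) * (d * ρ ^ 2) := mul_nonneg (by linarith) (by positivity)
        nlinarith
      have h6 : (toLp 2 z : E) N ^ 2 ≤ (1 / 2) ^ 2 := pow_le_pow_left₀ hzN.1.le hzN.2 2
      nlinarith
    exact abs_le_of_sq_le_sq' hsq (by norm_num) |>.2
  rw [← ENNReal.ofReal_le_ofReal_iff (mul_nonneg hC (sum_nonneg fun q _ =>
    integral_nonneg fun _ => sq_nonneg _)), integral_of_le (by norm_num),
    ofReal_integral_eq_lintegral_ofReal _ (of_forall fun _ => sq_nonneg _),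
    ofReal_mul hC, ENNReal.ofReal_sum_of_nonneg fun q _ => integral_nonneg fun _ => sq_nonneg _]
  · have h1 : ∀ y, ofReal (g (x + y • single N 1) ^ 2)
        ≤ ofReal C * ∑ q ∈ M, lmarginal (boxMeasure N ρ) (Finset.univ.erase N)
          (fun z => ofReal (DD q g (toLp 2 z) ^ 2))
          (update (WithLp.ofLp x) N y) := by
      intro y
      rw [hx']
      refine h g hg _ fun i hi => ?_
      rw [Function.update_of_ne (Finset.ne_of_mem_erase hi)]
      exact abs_le.1 (hx i)
    refine (lintegral_mono h1).trans ?_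
    rw [← hmu, lintegral_const_mul _ (Finset.measurable_sum _ fun q _ => hmm q),
      lintegral_finsetSum _ fun q _ => hmm q]
    gcongr with q hq
    rw [← lmarginal_insert _ (hm q) (by simp), Finset.insert_erase (Finset.mem_univ N)]
    exact key q
  · have hc : Continuous fun y : ℝ => g (x + y • single N 1) ^ 2 :=
      (hg.continuous.comp (by fun_prop)).pow 2
    exact hc.integrableOn_Ioc

theorem iteratedDeriv_slice {f : E → ℝ} (hf : ContDiff ℝ ∞ f) (x : E) (j : ℕ) :
    iteratedDeriv j (fun y : ℝ => f (x + y • single N 1))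
      = fun y => DD (j • Pi.single N 1) f (x + y • single N 1) := by
  induction j with
  | zero => simp [DD_zero]
  | succ j ih =>
    rw [iteratedDeriv_succ, ih, succ_nsmul', DD_add_index hf,
      DD_single (contDiff_DD hf _)]
    funext y
    have h1 : HasDerivAt (fun y : ℝ => x + y • single N (1 : ℝ))
        (single N 1) y := by
      simpa using ((hasDerivAt_id y).smul_const (single N (1 : ℝ))).const_add x
    exact ((((contDiff_DD hf _).differentiable (by simp)) _).hasFDerivAt.comp_hasDerivAt y h1).deriv

theorem iteratedDeriv_Dmul_slice {f : ℝ × E → ℝ} (hf : ContDiff ℝ ∞ f) (x : E) (j : ℕ)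
    (γ : Fin d → ℕ) (t y : ℝ) :
    iteratedDeriv j (fun y : ℝ => Dmul γ f (t, x + y • single N 1)) y
      = Dmul (j • Pi.single N 1 + γ) f (t, x + y • single N 1) := by
  have := congrFun (iteratedDeriv_slice (N := N) (contDiff_slice (contDiff_Dmul hf γ) t) x j) y
  rw [this, Dmul_add_index hf, Dmul_apply _ (Dmul γ f)]

/-- The tangential part of a multi-index. -/
def tang (N : Fin d) (γ : Fin d → ℕ) : Fin d → ℕ := update γ N 0

@[simp] theorem tang_self (γ : Fin d → ℕ) : tang N γ N = 0 := by simp [tang]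

theorem smul_add_tang (γ : Fin d → ℕ) : γ N • (Pi.single N 1 : Fin d → ℕ) + tang N γ = γ := by
  funext i
  by_cases h : i = N
  · subst h; simp [tang]
  · simp [tang, h]

theorem tang_add (γ δ : Fin d → ℕ) : tang N (γ + δ) = tang N γ + tang N δ := by
  funext i
  by_cases h : i = N
  · subst h; simp [tang]
  · simp [tang, h]

theorem MIdx_eq_single {γ : Fin d → ℕ} (hγ : γ ∈ MIdx d m) (h : m ≤ γ N) :
    γ = m • (Pi.single N 1 : Fin d → ℕ) := by
  rw [mem_MIdx, ← Finset.add_sum_erase _ _ (Finset.mem_univ N)] at hγ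
  have h0 : ∑ i ∈ Finset.univ.erase N, γ i = 0 := by omega
  funext i
  by_cases hi : i = N
  · subst hi; simp; omega
  · have := (Finset.sum_eq_zero_iff.1 h0) i (Finset.mem_erase.2 ⟨hi, Finset.mem_univ _⟩)
    simp [hi, this]

theorem single_mem_MIdx (N : Fin d) (m : ℕ) : m • (Pi.single N 1 : Fin d → ℕ) ∈ MIdx d m := by
  rw [mem_MIdx]; simp [← mul_sum]

theorem ellip_normal {lam : ℝ} {B : (Fin d → ℕ) → (Fin d → ℕ) → Fin n → Fin n → ℝ}
    (h : LegHad d n m lam B) (ξ : Fin n → ℝ) :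
    lam * ∑ i, ξ i ^ 2 ≤ ∑ i, ∑ j,
      B (m • (Pi.single N 1)) (m • (Pi.single N 1)) i j * ξ i * ξ j := by
  have h0 := h ξ (Pi.single N 1)
  have e1 : ∑ k, (Pi.single N 1 : Fin d → ℝ) k ^ 2 = 1 := by
    simp [Pi.single_apply, ite_pow]
  have e2 : ∀ α ∈ MIdx d m, α ≠ m • (Pi.single N 1 : Fin d → ℕ) →
      ∏ k, (Pi.single N 1 : Fin d → ℝ) k ^ α k = 0 := by
    intro α hα hne
    by_contra hp
    refine hne (MIdx_eq_single hα ?_)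
    rw [mem_MIdx] at hα
    rw [Finset.prod_eq_zero_iff] at hp
    push Not at hp
    have h0 : ∀ i ∈ Finset.univ.erase N, α i = 0 := by
      intro i hi
      have := hp i (Finset.mem_univ _)
      rw [Pi.single_eq_of_ne (Finset.ne_of_mem_erase hi)] at this
      by_contra hi
      exact this (zero_pow hi)
    rw [← Finset.add_sum_erase _ _ (Finset.mem_univ N), sum_eq_zero h0] at hα
    omega
  have e3 : ∏ k, (Pi.single N 1 : Fin d → ℝ) k ^ (m • (Pi.single N 1 : Fin d → ℕ)) k = 1 := by
    refine Finset.prod_eq_one fun k _ => ?_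
    by_cases hk : k = N
    · subst hk; simp
    · simp [hk]
  rw [e1, one_pow, mul_one, Finset.sum_eq_single_of_mem _ (single_mem_MIdx N m),
    Finset.sum_eq_single_of_mem _ (single_mem_MIdx N m)] at h0
  · simpa only [e3, mul_one] using h0
  · intro β hβ hne; simp [e2 β hβ hne]
  · intro α hα hne; simp [e2 α hα hne]

/-- The reduction of the solutions to families of one-dimensional systems on vertical segments. -/
theorem exists_spec (hd : 1 ≤ d) (hm : 1 ≤ m) {lam K : ℝ} (hlam : 0 < lam) (hK : 0 ≤ K) {ρ : ℝ}
    (hρ : 0 < ρ) (hρd : d * ρ ≤ 1 / 4) :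
    ∃ P : Spec, P.m = m ∧ P.τ0 = 3 / 4 ∧ ∃ e : Fin n → Fin P.n, ∃ ι : (Fin d → ℕ) → P.I,
      ∀ A, IsCoeff d n m lam K A → ∀ w : Fin n → ℝ × E → ℝ, IsSol N m A w →
      ∀ x : E, x N = 0 → ‖x‖ ≤ ρ → ∃ F : Fam P, F.N = √(stEn N m 1 w) ∧
        ∀ σ i, F.w (ι σ) (e i) = fun p =>
          Dmul (tang N σ) (w i) (p.1, x + p.2 • single N 1) := by
  obtain ⟨C, hC, M, hM, hb⟩ := exists_slice_bound N hρ hρd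
  choose C' hC' hs using fun σ : {σ : Fin d → ℕ // σ N = 0} => tangential_sup_estimate (N := N) (n := n) hd hm hlam hK
    σ.2 (r' := 3 / 4) (r := 1) (by norm_num) (by norm_num) le_rfl
  have htM : ∀ σ : Fin d → ℕ, ∀ q ∈ M, (q + tang N σ : Fin d → ℕ) N = 0 := fun σ q hq => by simp [hM q hq]
  have hρ4 : ρ ≤ 1 / 4 := by
    have : (1 : ℝ) ≤ d := by exact_mod_cast hd
    nlinarith
  have hlt : ∀ s ∈ ((MIdx d m) ×ˢ (MIdx d m)).erase
      (m • (Pi.single N 1 : Fin d → ℕ), m • (Pi.single N 1 : Fin d → ℕ)),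
      (s.1 + s.2) N < 2 * m := by
    rintro ⟨α, β⟩ hs
    obtain ⟨hne, hs⟩ := Finset.mem_erase.1 hs
    obtain ⟨hα, hβ⟩ := Finset.mem_product.1 hs
    have hle : ∀ γ ∈ MIdx d m, γ N ≤ m := fun γ hγ => by
      rw [mem_MIdx] at hγ
      rw [← hγ]; exact single_le_sum (fun _ _ => Nat.zero_le _) (Finset.mem_univ N)
    have h1 := hle α hα
    have h2 := hle β hβ
    by_contra hc
    have h3 : 2 * m ≤ α N + β N := not_lt.1 hc
    have hα' : m ≤ α N := by omega
    have hβ' : m ≤ β N := by omega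
    exact hne (Prod.ext (MIdx_eq_single hα hα') (MIdx_eq_single hβ hβ'))
  refine ⟨⟨n, m, Fin d → ℕ, (Fin d → ℕ) × (Fin d → ℕ), _, fun s => (s.1 + s.2) N,
    fun s σ => s.1 + s.2 + σ, lam, K, 3 / 4,
    fun σ => C * ∑ q ∈ M.attach, C' ⟨q.1 + tang N σ, htM σ q.1 q.2⟩, hm, hlam, hK, hlt⟩, rfl, rfl, id, id,
    fun A hA w hw x hx hxρ => ?_⟩
  have hball : ∀ y ∈ Icc (0 : ℝ) (1 / 2), x + y • single N (1 : ℝ) ∈ ball (0 : E) 1 := by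
    intro y hy
    rw [mem_ball_zero_iff]
    refine (norm_add_le _ _).trans_lt ?_
    rw [norm_smul, PiLp.norm_single, norm_one, mul_one, Real.norm_of_nonneg hy.1]
    linarith [hy.2]
  have hsm : ∀ γ i, ContDiff ℝ ∞ fun p : ℝ × ℝ =>
      Dmul γ (w i) (p.1, x + p.2 • single N (1 : ℝ)) := fun γ i =>
    (contDiff_Dmul (hw.smooth i) γ).comp (contDiff_fst.prodMk
      (contDiff_const.add (contDiff_snd.smul contDiff_const)))
  have hst := stEn_nonneg (N := N) (k := m) (w := w) zero_le_one
  refine ⟨⟨fun t => A (m • (Pi.single N 1)) (m • (Pi.single N 1)) t,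
    fun s t i j => (-1) ^ m * A s.1 s.2 t i j,
    fun σ i p => Dmul (tang N σ) (w i) (p.1, x + p.2 • single N 1),
    √(stEn N m 1 w), sqrt_nonneg _, fun σ i => hsm _ i, fun t i j => hA.bound _ _ _ _ _,
    fun s _ t i j => ?_, fun t ξ => ellip_normal (hA.ellip t) ξ, fun σ => ?_, fun σ i t ht k hk => ?_,
    fun σ t ht => ?_⟩, rfl, fun σ i => rfl⟩
  · rw [abs_mul, abs_pow, abs_neg, abs_one, one_pow, one_mul]; exact hA.bound _ _ _ _ _
  · have h0 := (hw.Dmul (tang_self (N := N) σ)).eqn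
    have hsub : Ioo (-(3 / 4) : ℝ) 0 ⊆ Ioo (-1) 0 := Ioo_subset_Ioo_left (by norm_num)
    filter_upwards [ae_restrict_of_ae_restrict_of_subset hsub h0] with t ht y hy i
    have h1 := ht (x + y • single N (1 : ℝ)) (hball y ⟨hy.1.le, hy.2.le⟩)
      (by simpa [hx] using hy.1) i
    rw [← ((continuous_deriv_fst (hsm (tang N σ) i)).1 t y).deriv]
    have e2 : ∀ (δ : Fin d → ℕ) j, Dmul δ (Dmul (tang N σ) (w j))
        (t, x + y • single N (1 : ℝ))
        = iteratedDeriv (δ N) (fun y : ℝ => Dmul (tang N (δ + σ)) (w j)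
          (t, x + y • single N (1 : ℝ))) y := by
      intro δ j
      rw [iteratedDeriv_Dmul_slice (hw.smooth j), tang_add, ← add_assoc, smul_add_tang,
        Dmul_add_index (hw.smooth j)]
    simp only [e2] at h1
    rw [← Finset.sum_product', ← Finset.add_sum_erase _ _
      (Finset.mk_mem_product (single_mem_MIdx N m) (single_mem_MIdx N m))] at h1
    rw [mul_add, ← add_assoc, mul_sum (Finset.erase _ _)] at h1
    simp only [mul_sum] at h1 ⊢
    have e3 : tang N (m • (Pi.single N 1 : Fin d → ℕ) + m • (Pi.single N 1 : Fin d → ℕ) + σ)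
        = tang N σ := by
      funext i
      by_cases h : i = N
      · subst h; simp [tang]
      · simp [tang, h]
    have e4 : (m • (Pi.single N 1 : Fin d → ℕ) + m • (Pi.single N 1 : Fin d → ℕ)) N = 2 * m := by
      simp [two_mul]
    simp only [e3, e4] at h1
    simp only [mul_assoc]
    exact h1
  · have : tang N σ N + k < m := by simpa using hk
    rw [iteratedDeriv_Dmul_slice (hw.smooth i), Dmul_apply]
    refine hw.bdry t ⟨by have := ht.1; simp only at this; linarith, ht.2⟩ i _ (by simpa using hk) _
      (hball 0 (by norm_num)) (by simp [hx])
  · rw [sq_sqrt hst]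
    have h1 : ∀ i, ∫ y in (0 : ℝ)..1 / 2, Dmul (tang N σ) (w i)
        (t, x + y • single N (1 : ℝ)) ^ 2 ≤ C * ∑ q ∈ M.attach,
          ∫ z in HalfSp N ∩ closedBall 0 (3 / 4), Dmul (q.1 + tang N σ) (w i) (t, z) ^ 2 := by
      intro i
      refine (hb _ (contDiff_slice (contDiff_Dmul (hw.smooth i) (tang N σ)) t) x hx fun j =>
        ?_).trans (le_of_eq ?_)
      · exact ((norm_eq_abs _).symm.le.trans (norm_apply_le x j)).trans hxρ
      · rw [← Finset.sum_attach M]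
        simp only [Dmul_add_index (hw.smooth i), Dmul_apply _ (Dmul (tang N σ) (w i))]
    refine (sum_le_sum fun i _ => h1 i).trans ?_
    simp only
    rw [← mul_sum, sum_comm, mul_assoc, sum_mul]
    gcongr with q hq
    exact hs ⟨_, htM σ q.1 q.2⟩ A hA w hw t ⟨by have := ht.1; simp only at this; linarith, ht.2.le⟩

theorem slice_bound (hd : 1 ≤ d) (hm : 1 ≤ m) {lam K : ℝ} (hlam : 0 < lam) (hK : 0 ≤ K) {γ : ℝ}
    (hγ : γ ∈ Ioo (0 : ℝ) 1) {ρ : ℝ} (hρ : 0 < ρ) (hρd : d * ρ ≤ 1 / 4) (β : Fin d → ℕ)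
    (hβ : β N < 2 * m) :
    ∃ C, 0 ≤ C ∧ ∀ A, IsCoeff d n m lam K A → ∀ w : Fin n → ℝ × E → ℝ, IsSol N m A w →
      ∀ x : E, x N = 0 → ‖x‖ ≤ ρ → ∀ i, ∀ t ∈ Ioo (-(1 / 2) : ℝ) 0, ∀ y ∈ Icc (0 : ℝ) (1 / 4),
        |Dmul β (w i) (t, x + y • single N 1)| ≤ C * √(stEn N m 1 w) ∧
        ∀ s ∈ Ioo (-(1 / 2) : ℝ) 0, ∀ y' ∈ Icc (0 : ℝ) (1 / 4),
        |Dmul β (w i) (t, x + y • single N 1)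
          - Dmul β (w i) (s, x + y' • single N 1)| ≤
          C * √(stEn N m 1 w) * (|t - s| ^ (γ / (2 * m)) + |y - y'| ^ γ) := by
  obtain ⟨P, rfl, hτ, e, ι, hP⟩ := exists_spec (N := N) (n := n) hd hm hlam hK hρ hρd
  obtain ⟨C, hC, h⟩ := Fam.exists_bound P hγ (τ := 1 / 2) (by norm_num) (by rw [hτ]; norm_num) (ι β)
  refine ⟨C, hC, fun A hA w hw x hx hxρ i t ht y hy => ?_⟩
  obtain ⟨F, hF, hFw⟩ := hP A hA w hw x hx hxρ
  have := h F t ht (e i) (β N) hβ y hy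
  simpa only [hF, hFw, iteratedDeriv_Dmul_slice (hw.smooth i), smul_add_tang] using this

theorem fderiv_eq_sum_pd {F : Type*} [NormedAddCommGroup F] [NormedSpace ℝ F] (f : E → F) (x v : E) :
    fderiv ℝ f x v = ∑ i, v i • pd i f x := by
  conv_lhs => rw [← (EuclideanSpace.basisFun (Fin d) ℝ).sum_repr v]
  simp [map_sum, pd]

theorem abs_sub_le_of_tangential {f : E → ℝ} (hf : ContDiff ℝ ∞ f) {x v : E} (hv : v N = 0) {L : ℝ}
    (h : ∀ s ∈ Icc (0 : ℝ) 1, ∀ i ≠ N, |pd i f (x + s • v)| ≤ L) :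
    |f (x + v) - f x| ≤ d * L * ‖v‖ := by
  have hd : ∀ s : ℝ, HasDerivAt (fun s : ℝ => f (x + s • v)) (fderiv ℝ f (x + s • v) v) s := by
    intro s
    have h1 : HasDerivAt (fun s : ℝ => x + s • v) v s := by
      simpa using ((hasDerivAt_id s).smul_const v).const_add x
    exact ((hf.differentiable (by simp)) _).hasFDerivAt.comp_hasDerivAt s h1
  have h2 := norm_image_sub_le_of_norm_deriv_le_segment_01' (f := fun s : ℝ => f (x + s • v))
    (f' := fun s => fderiv ℝ f (x + s • v) v) (C := d * L * ‖v‖)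
    (fun s _ => (hd s).hasDerivWithinAt) fun s hs => ?_
  · simpa using h2
  · rw [fderiv_eq_sum_pd, norm_eq_abs]
    refine (abs_sum_le_sum_abs _ _).trans ?_
    have : ∀ i ∈ Finset.univ, |v i • pd i f (x + s • v)| ≤ ‖v‖ * L := by
      intro i _
      rw [smul_eq_mul, abs_mul]
      by_cases hi : i = N
      · subst hi
        by_cases hex : ∃ j, j ≠ i
        · obtain ⟨j, hj⟩ := hex
          have hL := (abs_nonneg _).trans (h s ⟨hs.1, hs.2.le⟩ j hj)
          rw [hv]; simp; positivity
        · push Not at hex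
          have : v = 0 := by ext j; rw [hex j, hv]; rfl
          simp [this]
      · exact mul_le_mul (norm_apply_le v i) (h s ⟨hs.1, hs.2.le⟩ i hi) (abs_nonneg _)
          (norm_nonneg _)
    refine (sum_le_card_nsmul _ _ _ this).trans (le_of_eq ?_)
    simp; ring

theorem norm_sub_normal_le (z : E) : ‖z - z N • single N (1 : ℝ)‖ ≤ ‖z‖ := by
  rw [EuclideanSpace.norm_eq, EuclideanSpace.norm_eq]
  refine Real.sqrt_le_sqrt (sum_le_sum fun i _ => ?_)
  by_cases h : i = N
  · subst h; simp [sq_nonneg]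
  · simp [h]

/-- Pointwise oscillation decay of the derivatives of order `2m - 1` up to the flat boundary. -/
theorem oscillation_le (hd : 1 ≤ d) (hm : 1 ≤ m) {lam K : ℝ} (hlam : 0 < lam) (hK : 0 ≤ K) {γ : ℝ}
    (hγ : γ ∈ Ioo (0 : ℝ) 1) {ρ : ℝ} (hρ : 0 < ρ) (hρd : d * ρ ≤ 1 / 4) (β : Fin d → ℕ)
    (hβ : β N < 2 * m) :
    ∃ C, 0 ≤ C ∧ ∀ A, IsCoeff d n m lam K A → ∀ w : Fin n → ℝ × E → ℝ, IsSol N m A w →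
      ∀ r, 0 < r → r ≤ ρ → ∀ p ∈ QCylP d m N r 0, ∀ q ∈ QCylP d m N r 0, ∀ i,
        |Dmul β (w i) p - Dmul β (w i) q| ≤ C * √(stEn N m 1 w) * r ^ γ := by
  obtain ⟨C, hC, h⟩ := slice_bound (N := N) (n := n) hd hm hlam hK hγ hρ hρd β hβ
  have hβ' : ∀ j : {j // j ≠ N}, (β + Pi.single j.1 1 : Fin d → ℕ) N < 2 * m := fun j => by
    simpa [j.2.symm] using hβ
  choose C' hC' h' using fun j => slice_bound (N := N) (n := n) hd hm hlam hK hγ hρ hρd _ (hβ' j)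
  refine ⟨C * 3 + d * (∑ j, C' j) * 2, by
    have := sum_nonneg fun j (_ : j ∈ Finset.univ) => hC' j
    positivity, fun A hA w hw r hr hrρ => ?_⟩
  rintro ⟨t, z⟩ ⟨⟨ht, hz⟩, hzN⟩ ⟨s, z'⟩ ⟨⟨hs, hz'⟩, hzN'⟩ i
  have hρ4 : ρ ≤ 1 / 4 := by
    have : (1 : ℝ) ≤ d := by exact_mod_cast hd
    nlinarith
  set M := √(stEn N m 1 w)
  have hM : 0 ≤ M := sqrt_nonneg _
  simp only [Prod.fst_zero, Prod.snd_zero, zero_sub, mem_ball_zero_iff] at ht hz hs hz' hzN hzN'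
  have hr4 : r ≤ 1 / 4 := hrρ.trans hρ4
  have hrm : r ^ (2 * m) ≤ 1 / 2 := by
    calc r ^ (2 * m) ≤ r ^ 1 := pow_le_pow_of_le_one hr.le (by linarith) (by omega)
      _ ≤ 1 / 2 := by linarith
  have hT : Ioo (-r ^ (2 * m)) 0 ⊆ Ioo (-(1 / 2) : ℝ) 0 := Ioo_subset_Ioo_left (by linarith)
  set e := single N (1 : ℝ) with he
  set x := z - z N • e with hx
  set x' := z' - z' N • e with hx'
  have hxN : x N = 0 := by simp [hx, he]
  have hxN' : x' N = 0 := by simp [hx', he]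
  have hxn : ‖x‖ ≤ r := (norm_sub_normal_le z).trans hz.le
  have hxn' : ‖x'‖ ≤ r := (norm_sub_normal_le z').trans hz'.le
  have ez : z = x + z N • e := by simp [hx]
  have ez' : z' = x' + z' N • e := by simp [hx']
  have hy : z N ∈ Icc (0 : ℝ) (1 / 4) :=
    ⟨hzN.le, ((le_abs_self _).trans (norm_apply_le z N)).trans (hz.le.trans hr4)⟩
  have hy' : z' N ∈ Icc (0 : ℝ) (1 / 4) :=
    ⟨hzN'.le, ((le_abs_self _).trans (norm_apply_le z' N)).trans (hz'.le.trans hr4)⟩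
  have hyr : |z N - z' N| ≤ r := abs_sub_le_iff.2
    ⟨by linarith [((le_abs_self _).trans (norm_apply_le z N)).trans hz.le],
     by linarith [((le_abs_self _).trans (norm_apply_le z' N)).trans hz'.le]⟩
  have h1 := (h A hA w hw x hxN (hxn.trans hrρ) i t (hT ht) _ hy).2 s (hT hs) _ hy'
  have h2 : |Dmul β (w i) (s, x + z' N • e) - Dmul β (w i) (s, x' + z' N • e)|
      ≤ d * ((∑ j, C' j) * M) * ‖x - x'‖ := by
    have := abs_sub_le_of_tangential (N := N) (contDiff_slice (contDiff_Dmul (hw.smooth i) β) s)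
      (x := x' + z' N • e) (v := x - x') (by simp [hxN, hxN']) (L := (∑ j, C' j) * M)
      fun τ hτ j hj => ?_
    · rwa [show x' + z' N • e + (x - x') = x + z' N • e by abel] at this
    · have h3 := (h' ⟨j, hj⟩ A hA w hw (x' + τ • (x - x')) (by simp [hxN, hxN']) (by
        have := (convex_closedBall (0 : E) r).add_smul_sub_mem (mem_closedBall_zero_iff.2 hxn')
          (mem_closedBall_zero_iff.2 hxn) hτ
        exact (mem_closedBall_zero_iff.1 this).trans hrρ) i s (hT hs) _ hy').1
      rw [Dmul_apply, add_comm β, DD_add_index (contDiff_slice (hw.smooth i) s),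
        DD_single (contDiff_DD (contDiff_slice (hw.smooth i) s) _), ← Dmul_slice] at h3
      rw [add_right_comm]
      refine h3.trans (mul_le_mul_of_nonneg_right ?_ hM)
      exact single_le_sum (f := C') (fun j _ => hC' j) (Finset.mem_univ (⟨j, hj⟩ : {j // j ≠ N}))
  rw [ez, ez']
  have hγ0 := hγ.1
  have e1 : |t - s| ^ (γ / (2 * m)) ≤ r ^ γ := by
    have : |t - s| ≤ r ^ (2 * m) := abs_sub_le_iff.2 ⟨by linarith [ht.2, hs.1], by linarith [hs.2, ht.1]⟩
    refine (rpow_le_rpow (abs_nonneg _) this (by positivity)).trans (le_of_eq ?_)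
    rw [← rpow_natCast, ← rpow_mul hr.le]
    congr 1
    have : (m : ℝ) ≠ 0 := by positivity
    push_cast; field_simp
  have e2 : |z N - z' N| ^ γ ≤ r ^ γ := rpow_le_rpow (abs_nonneg _) hyr hγ0.le
  have e3 : ‖x - x'‖ ≤ 2 * r ^ γ := by
    have : r ≤ r ^ γ := by
      conv_lhs => rw [← Real.rpow_one r]
      exact Real.rpow_le_rpow_of_exponent_ge hr (by linarith) hγ.2.le
    linarith [norm_sub_le x x']
  have hS := sum_nonneg fun j (_ : j ∈ Finset.univ) => hC' j
  have hrγ : 0 ≤ r ^ γ := rpow_nonneg hr.le _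
  have h1' := h1.trans (mul_le_mul_of_nonneg_left (add_le_add e1 e2) (by positivity))
  have h2' := h2.trans (mul_le_mul_of_nonneg_left e3 (by positivity))
  have h3 := abs_sub_le (Dmul β (w i) (t, x + z N • e)) (Dmul β (w i) (s, x + z' N • e))
    (Dmul β (w i) (s, x' + z' N • e))
  have : 0 ≤ C * M * r ^ γ := by positivity
  nlinarith

theorem sq_integral_mul_le {X : Type*} [MeasurableSpace X] {μ : Measure X} {a b : X → ℝ}
    (ha : Integrable (fun x => a x ^ 2) μ) (hb : Integrable (fun x => b x ^ 2) μ)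
    (hab : Integrable (fun x => a x * b x) μ) :
    (∫ x, a x * b x ∂μ) ^ 2 ≤ (∫ x, a x ^ 2 ∂μ) * ∫ x, b x ^ 2 ∂μ := by
  have key : ∀ s : ℝ, 0 ≤ (∫ x, a x ^ 2 ∂μ) * (s * s) + (2 * ∫ x, a x * b x ∂μ) * s
      + ∫ x, b x ^ 2 ∂μ := by
    intro s
    have h0 : 0 ≤ ∫ x, (s * a x + b x) ^ 2 ∂μ := integral_nonneg fun _ => sq_nonneg _
    have h1 : ∀ x, (s * a x + b x) ^ 2 = s * s * a x ^ 2 + 2 * s * (a x * b x) + b x ^ 2 :=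
      fun x => by ring
    simp only [h1] at h0
    have i1 : Integrable (fun x => s * s * a x ^ 2 + 2 * s * (a x * b x)) μ :=
      Integrable.add (ha.const_mul _) (hab.const_mul _)
    rw [integral_add i1 hb, integral_add (ha.const_mul _) (hab.const_mul _), integral_const_mul,
      integral_const_mul] at h0
    linarith
  have := discrim_le_zero key
  unfold discrim at this
  linarith

/-- The closed unit half ball without its flat boundary. -/
def hBall (N : Fin d) : Set (E) := HalfSp N ∩ closedBall 0 1

theorem measurableSet_hBall : MeasurableSet (hBall N) :=
  (isOpen_halfSp (N := N)).measurableSet.inter isClosed_closedBall.measurableSet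

theorem volume_hBall_lt_top : volume (hBall N) < ⊤ :=
  (measure_mono inter_subset_right).trans_lt (isCompact_closedBall (0 : E) 1).measure_lt_top

theorem convex_hBall : Convex ℝ (hBall N) := by
  refine Convex.inter ?_ (convex_closedBall _ _)
  intro x hx y hy a b ha hb hab
  change 0 < (a • x + b • y) N
  have hx' : 0 < x N := hx
  have hy' : 0 < y N := hy
  rw [PiLp.add_apply, PiLp.smul_apply, PiLp.smul_apply, smul_eq_mul, smul_eq_mul]
  rcases ha.eq_or_lt with rfl | h
  · have : b = 1 := by linarith
    subst this; linarith
  · have := mul_pos h hx'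
    have := mul_nonneg hb hy'.le
    linarith

theorem integrableOn_hBall {f : E → ℝ} (hf : Continuous f) : IntegrableOn f (hBall N) :=
  integrableOn_halfSp_inter (isCompact_closedBall _ _) hf

theorem lintegral_hBall_eq {f : E → ℝ} (hf : Continuous f) (h0 : ∀ x, 0 ≤ f x) :
    ∫⁻ x in hBall N, ofReal (f x) = ofReal (∫ x in hBall N, f x) :=
  (ofReal_integral_eq_lintegral_ofReal (integrableOn_hBall hf)
    (of_forall h0)).symm

theorem lintegral_comp_smul_add (G : E → ENNReal) (hG : Measurable G) {c : ℝ}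
    (hc : 1 / 2 ≤ c) (a : E) :
    ∫⁻ y, G (c • y + a) ≤ 2 ^ d * ∫⁻ y, G y := by
  have h1 : ∫⁻ y, G (c • y + a) = ∫⁻ y, G (y + a) ∂(Measure.map (c • ·) (volume : Measure E)) :=
    (lintegral_map (hG.comp (measurable_add_const a)) (measurable_const_smul c)).symm
  rw [h1, Measure.map_addHaar_smul volume (by linarith), lintegral_smul_measure,
    lintegral_add_right_eq_self (fun y => G y) a, smul_eq_mul]
  gcongr
  rw [finrank_euclideanSpace, Fintype.card_fin, abs_of_pos (by positivity),
    show (2 : ENNReal) ^ d = ofReal (2 ^ d) by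
      rw [ENNReal.ofReal_pow (by norm_num)]; simp]
  refine ofReal_le_ofReal ?_
  rw [inv_le_comm₀ (by positivity) (by positivity), ← inv_pow]
  exact pow_le_pow_left₀ (by norm_num) (by linarith) d

theorem fderiv_sq_le {f : E → ℝ} (x v : E) (hv : ‖v‖ ≤ 1) :
    fderiv ℝ f x v ^ 2 ≤ ∑ i, pd i f x ^ 2 := by
  rw [fderiv_eq_sum_pd]
  simp only [smul_eq_mul]
  refine (Finset.sum_mul_sq_le_sq_mul_sq _ _ _).trans ?_
  rw [← EuclideanSpace.real_norm_sq_eq]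
  have : ‖v‖ ^ 2 ≤ 1 := by nlinarith [norm_nonneg v]
  have h0 : 0 ≤ ∑ i, pd i f x ^ 2 := sum_nonneg fun _ _ => sq_nonneg _
  nlinarith

theorem hasDerivAt_comp_line {f : E → ℝ} (hf : ContDiff ℝ ∞ f) (x v : E) (s : ℝ) :
    HasDerivAt (fun s : ℝ => f (x + s • v)) (fderiv ℝ f (x + s • v) v) s := by
  have h1 : HasDerivAt (fun s : ℝ => x + s • v) v s := by
    simpa using ((hasDerivAt_id s).smul_const v).const_add x
  exact ((hf.differentiable (by simp)) _).hasFDerivAt.comp_hasDerivAt s h1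

theorem ofReal_sq_sub_le {f : E → ℝ} (hf : ContDiff ℝ ∞ f) (x v : E) {b : ℝ} (hb : 0 ≤ b)
    (hb1 : b ≤ 1) :
    ofReal ((f (x + b • v) - f x) ^ 2) ≤
      ∫⁻ s in Ioc 0 b, ofReal (fderiv ℝ f (x + s • v) v ^ 2) := by
  have hc : Continuous fun s : ℝ => fderiv ℝ f (x + s • v) v :=
    ((hf.continuous_fderiv (by simp)).clm_apply continuous_const).comp
      (continuous_const.add (continuous_id.smul continuous_const))
  have h1 := sq_sub_le_integral hc (hasDerivAt_comp_line hf x v) hb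
  have h2 : 0 ≤ ∫ s in (0 : ℝ)..b, fderiv ℝ f (x + s • v) v ^ 2 :=
    intervalIntegral.integral_nonneg hb fun _ _ => sq_nonneg _
  have hc2 : Continuous fun s : ℝ => fderiv ℝ f (x + s • v) v ^ 2 := by fun_prop
  rw [← ofReal_integral_eq_lintegral_ofReal (hc2.integrableOn_Ioc)
    (of_forall fun _ => sq_nonneg _), ← integral_of_le hb]
  refine ofReal_le_ofReal ?_
  simp only [zero_smul, add_zero, sub_zero] at h1
  nlinarith

theorem lintegral_midpoint_le {f : E → ℝ} (hf : ContDiff ℝ ∞ f) (x : E) (hx : x ∈ hBall N) :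
    ∫⁻ y in hBall N, ofReal ((f ((1 / 2 : ℝ) • (x + y)) - f y) ^ 2)
      ≤ 2 ^ d * ∫⁻ z in hBall N, ofReal (∑ i, pd i f z ^ 2) := by
  have hgc : Continuous fun z => ∑ i, pd i f z ^ 2 :=
    continuous_finsetSum _ fun i _ => (contDiff_pd hf i).continuous.pow 2
  obtain ⟨G, hG⟩ : ∃ G : E → ENNReal,
    G = (hBall N).indicator fun z => ofReal (∑ i, pd i f z ^ 2) := ⟨_, rfl⟩
  have hGm : Measurable G := by
    rw [hG]; exact (hgc.measurable.ennreal_ofReal).indicator measurableSet_hBall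
  have h3 : ∀ y ∈ hBall N, ofReal ((f ((1 / 2 : ℝ) • (x + y)) - f y) ^ 2) ≤
      ∫⁻ s in Ioc (0 : ℝ) 1, G ((1 - s / 2) • y + (s / 2) • x) := by
    intro y hy
    have h4 := ofReal_sq_sub_le hf y ((1 / 2 : ℝ) • (x - y)) (b := 1) zero_le_one le_rfl
    have e : y + (1 : ℝ) • (1 / 2 : ℝ) • (x - y) = (1 / 2 : ℝ) • (x + y) := by module
    rw [e] at h4
    refine h4.trans (setLIntegral_mono' measurableSet_Ioc fun s hs => ?_)
    have e2 : y + s • (1 / 2 : ℝ) • (x - y) = (1 - s / 2) • y + (s / 2) • x := by module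
    rw [e2]
    have hmem : (1 - s / 2) • y + (s / 2) • x ∈ hBall N :=
      convex_hBall hy hx (by linarith [hs.2]) (by linarith [hs.1]) (by ring)
    rw [hG, indicator_of_mem hmem]
    refine ofReal_le_ofReal (fderiv_sq_le _ _ ?_)
    rw [norm_smul]
    have := (norm_sub_le x y).trans (add_le_add (mem_closedBall_zero_iff.1 hx.2)
      (mem_closedBall_zero_iff.1 hy.2))
    norm_num; linarith
  refine (setLIntegral_mono' measurableSet_hBall h3).trans
    ((setLIntegral_le_lintegral _ _).trans ?_)
  have hm : Measurable (Function.uncurry fun (y : E) (s : ℝ) =>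
      G ((1 - s / 2) • y + (s / 2) • x)) := by
    refine hGm.comp (Continuous.measurable ?_)
    fun_prop
  rw [lintegral_lintegral_swap hm.aemeasurable, ← lintegral_indicator measurableSet_hBall, ← hG]
  have : ∀ s ∈ Ioc (0 : ℝ) 1, ∫⁻ y, G ((1 - s / 2) • y + (s / 2) • x) ≤ 2 ^ d * ∫⁻ z, G z :=
    fun s hs => lintegral_comp_smul_add G hGm (by linarith [hs.2]) _
  refine (setLIntegral_mono' measurableSet_Ioc this).trans ?_
  simp

theorem lintegral_sub_sq_le {f : E → ℝ} (hf : ContDiff ℝ ∞ f) :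
    ∫⁻ x in hBall N, ∫⁻ y in hBall N, ofReal ((f x - f y) ^ 2)
      ≤ 4 * volume (hBall N) * 2 ^ d *
        ∫⁻ z in hBall N, ofReal (∑ i, pd i f z ^ 2) := by
  have hcf := hf.continuous
  obtain ⟨H, hH⟩ : ∃ H : E → E → ENNReal,
    ∀ x y, H x y = ofReal ((f ((1 / 2 : ℝ) • (x + y)) - f y) ^ 2) := ⟨_, fun _ _ => rfl⟩
  have hHm : Measurable (Function.uncurry H) := by
    have : Continuous fun p : E × E => (f ((1 / 2 : ℝ) • (p.1 + p.2)) - f p.2) ^ 2 := by fun_prop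
    convert this.measurable.ennreal_ofReal using 2 with p
    exact hH p.1 p.2
  have hHx : ∀ x, Measurable (H x) := fun x => hHm.comp measurable_prodMk_left
  have h1 : ∀ x y, ofReal ((f x - f y) ^ 2) ≤ 2 * H y x + 2 * H x y := by
    intro x y
    have e2 : ∀ a : ℝ, 2 * ofReal a = ofReal (2 * a) := fun a => by
      rw [ofReal_mul (by norm_num)]; simp
    rw [hH, hH, e2, e2, ← ofReal_add (by positivity) (by positivity),
      add_comm y x]
    refine ofReal_le_ofReal ?_
    nlinarith [sq_nonneg (f ((1 / 2 : ℝ) • (x + y)) - f y + (f ((1 / 2 : ℝ) • (x + y)) - f x))]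
  obtain ⟨S, hS⟩ : ∃ S, S = ∫⁻ z in hBall N, ofReal (∑ i, pd i f z ^ 2) := ⟨_, rfl⟩
  have h5 : ∫⁻ x in hBall N, ∫⁻ y in hBall N, H x y ≤ volume (hBall N) * (2 ^ d * S) := by
    have h2 : ∀ x ∈ hBall N, ∫⁻ y in hBall N, H x y ≤ 2 ^ d * S := by
      intro x hx
      simp only [hH, hS]
      exact lintegral_midpoint_le hf x hx
    refine (setLIntegral_mono' measurableSet_hBall h2).trans ?_
    rw [setLIntegral_const, mul_comm]
  have hs : Measurable fun p : E × E => H p.2 p.1 := hHm.comp measurable_swap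
  have h6 : ∫⁻ x in hBall N, ∫⁻ y in hBall N, H y x = ∫⁻ x in hBall N, ∫⁻ y in hBall N, H x y :=
    lintegral_lintegral_swap (f := fun x y => H y x) hs.aemeasurable
  have h7 : ∀ x, ∫⁻ y in hBall N, ofReal ((f x - f y) ^ 2)
      ≤ 2 * (∫⁻ y in hBall N, H y x) + 2 * ∫⁻ y in hBall N, H x y := by
    intro x
    refine (lintegral_mono fun y => h1 x y).trans (le_of_eq ?_)
    have hmx : Measurable fun y => H y x := hHm.comp measurable_prodMk_right
    rw [lintegral_add_left (hmx.const_mul _), lintegral_const_mul _ hmx,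
      lintegral_const_mul _ (hHx x)]
  have hm1 : Measurable fun x => ∫⁻ y in hBall N, H y x := Measurable.lintegral_prod_right' hs
  have hm2 : Measurable fun x => ∫⁻ y in hBall N, H x y := Measurable.lintegral_prod_right' hHm
  refine (lintegral_mono h7).trans ?_
  rw [lintegral_add_left (hm1.const_mul _), lintegral_const_mul _ hm1, lintegral_const_mul _ hm2,
    h6, ← hS, ← two_mul, ← mul_assoc]
  refine (mul_le_mul_right h5 _).trans (le_of_eq ?_)
  rw [show (2 : ENNReal) * 2 = 4 by norm_num]; ring

/-- The Poincaré inequality in the half ball, relative to a weight. -/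
theorem exists_poincare {ψ : E → ℝ} (hψ : Continuous ψ) (h1 : ∫ x in hBall N, ψ x = 1) :
    ∃ C, 0 ≤ C ∧ ∀ f : E → ℝ, ContDiff ℝ ∞ f → ∫ x in hBall N, f x ^ 2 ≤
      C * ((∑ i, ∫ x in hBall N, pd i f x ^ 2) + (∫ x in hBall N, ψ x * f x) ^ 2) := by
  set Ψ := ∫ x in hBall N, ψ x ^ 2 with hΨ
  have hΨ0 : 0 ≤ Ψ := integral_nonneg fun _ => sq_nonneg _
  set V := (volume (hBall N)).toReal with hV
  have hV0 : 0 ≤ V := ENNReal.toReal_nonneg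
  have hVe : volume (hBall N) = ofReal V :=
    (ENNReal.ofReal_toReal volume_hBall_lt_top.ne).symm
  refine ⟨2 * Ψ * (4 * V * 2 ^ d) + 2 * V, by positivity, fun f hf => ?_⟩
  have hcf := hf.continuous
  set ℓ := ∫ x in hBall N, ψ x * f x with hℓ
  have hgc : Continuous fun z => ∑ i, pd i f z ^ 2 :=
    continuous_finsetSum _ fun i _ => (contDiff_pd hf i).continuous.pow 2
  have key : ∀ x, ofReal (f x ^ 2) ≤
      ofReal (2 * Ψ) * (∫⁻ y in hBall N, ofReal ((f x - f y) ^ 2))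
        + ofReal (2 * ℓ ^ 2) := by
    intro x
    have c1 : Continuous fun y => (f x - f y) ^ 2 := by fun_prop
    have c2 : Continuous fun y => (f x - f y) * ψ y := by fun_prop
    rw [lintegral_hBall_eq (N := N) c1 fun y => sq_nonneg _, ← ofReal_mul (by positivity),
      ← ofReal_add (mul_nonneg (by positivity) (integral_nonneg fun _ => sq_nonneg _))
        (by positivity)]
    refine ofReal_le_ofReal ?_
    have h2 := sq_integral_mul_le (μ := volume.restrict (hBall N)) (a := fun y => f x - f y) (b := ψ)
      (integrableOn_hBall c1) (integrableOn_hBall (hψ.pow 2)) (integrableOn_hBall c2)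
    have h3 : ∫ y in hBall N, (f x - f y) * ψ y = f x - ℓ := by
      simp only [sub_mul]
      rw [integral_sub (integrableOn_hBall (by fun_prop)) (integrableOn_hBall (by fun_prop)),
        integral_const_mul, h1, mul_one, hℓ]
      simp only [mul_comm]
    rw [h3] at h2
    nlinarith [sq_nonneg (f x - 2 * ℓ)]
  have c3 : Continuous fun x => f x ^ 2 := by fun_prop
  have hm : Measurable fun x => ∫⁻ y in hBall N, ofReal ((f x - f y) ^ 2) := by
    refine Measurable.lintegral_prod_right' (f := fun p : E × E => ofReal ((f p.1 - f p.2) ^ 2)) ?_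
    exact (Continuous.measurable (by fun_prop)).ennreal_ofReal
  have h4 := lintegral_mono (μ := volume.restrict (hBall N)) key
  rw [lintegral_hBall_eq c3 fun y => sq_nonneg _, lintegral_add_left (hm.const_mul _),
    lintegral_const_mul _ hm, setLIntegral_const] at h4
  replace h4 := h4.trans (add_le_add_left (mul_le_mul_right (lintegral_sub_sq_le hf) _) _)
  have hS : 0 ≤ ∑ i, ∫ x in hBall N, pd i f x ^ 2 :=
    sum_nonneg fun i _ => integral_nonneg fun _ => sq_nonneg _
  rw [lintegral_hBall_eq hgc fun y => sum_nonneg fun _ _ => sq_nonneg _,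
    integral_finsetSum _ fun i _ => (integrableOn_hBall ((contDiff_pd hf i).continuous.pow 2) :
      Integrable (fun x => pd i f x ^ 2) _), hVe,
    show (4 : ENNReal) = ofReal 4 by simp, show (2 : ENNReal) ^ d = ofReal (2 ^ d) by
      rw [ENNReal.ofReal_pow (by norm_num)]; simp, ← ofReal_mul (by norm_num),
    ← ofReal_mul (by positivity), ← ofReal_mul (by positivity),
    ← ofReal_mul (by positivity), ← ofReal_mul (by positivity),
    ← ofReal_add (by positivity) (by positivity),
    ENNReal.ofReal_le_ofReal_iff (by positivity)] at h4
  have : 0 ≤ V * ∑ i, ∫ x in hBall N, pd i f x ^ 2 := by positivity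
  have : 0 ≤ Ψ * (4 * V * 2 ^ d) * ℓ ^ 2 := by positivity
  linarith

theorem exists_poincare_iter {ψ : E → ℝ} (hψ : Continuous ψ) (h1 : ∫ x in hBall N, ψ x = 1)
    (k : ℕ) : ∃ C, 1 ≤ C ∧ ∀ f : E → ℝ, ContDiff ℝ ∞ f → ∀ M : ℝ,
      (∀ β : Fin d → ℕ, ∑ i, β i = k → ∫ x in hBall N, DD β f x ^ 2 ≤ M) →
      (∀ β : Fin d → ℕ, ∑ i, β i < k → (∫ x in hBall N, ψ x * DD β f x) ^ 2 ≤ M) →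
      ∀ β : Fin d → ℕ, ∑ i, β i ≤ k → ∫ x in hBall N, DD β f x ^ 2 ≤ C * M := by
  obtain ⟨C₁, hC₁, hp⟩ := exists_poincare hψ h1
  induction k with
  | zero => exact ⟨1, le_rfl, fun f hf M hM _ β hβ => by rw [one_mul]; exact hM β (by omega)⟩
  | succ k ih =>
    obtain ⟨C₂, hC₂, h⟩ := ih
    refine ⟨C₂ * (C₁ * (d + 1) + 1), by nlinarith [mul_nonneg hC₁ (by positivity : (0:ℝ) ≤ d + 1)],
      fun f hf M ht hl β hβ => ?_⟩
    have hM : 0 ≤ M := (sq_nonneg _).trans (hl 0 (by simp))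
    have hk : ∀ β : Fin d → ℕ, ∑ i, β i = k →
        ∫ x in hBall N, DD β f x ^ 2 ≤ (C₁ * (d + 1) + 1) * M := by
      intro β hβ
      have h2 : ∑ j, ∫ x in hBall N, pd j (DD β f) x ^ 2 ≤ d * M := by
        refine (sum_le_card_nsmul _ _ M fun j _ => ?_).trans (by simp)
        rw [← DD_add_single hf]
        exact ht _ (by simp [sum_add_distrib, hβ])
      have h3 := (hp _ (contDiff_DD hf β)).trans
        (mul_le_mul_of_nonneg_left (add_le_add h2 (hl β (by omega))) hC₁)
      linarith
    have h0 : 0 ≤ C₁ * (d + 1) * M := by positivity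
    rcases hβ.lt_or_eq with h4 | h4
    · rw [mul_assoc]
      exact h f hf _ hk (fun β hβ => (hl β (by omega)).trans (by linarith)) β (by omega)
    · refine (ht β h4).trans ?_
      nlinarith [mul_nonneg (sub_nonneg.2 hC₂) hM, mul_nonneg (sub_nonneg.2 hC₂) h0]

/-- The Poincaré inequality in the normal direction for functions vanishing on the flat boundary. -/
theorem integral_sq_le_normal {f : E → ℝ} (hf : ContDiff ℝ ∞ f)
    (h0 : ∀ x ∈ ball (0 : E) 1, x N = 0 → f x = 0) :
    ∫ x in hBall N, f x ^ 2 ≤ ∫ x in hBall N, pd N f x ^ 2 := by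
  have hc1 : Continuous fun x => f x ^ 2 := hf.continuous.pow 2
  have hc2 : Continuous fun x => pd N f x ^ 2 := (contDiff_pd hf N).continuous.pow 2
  obtain ⟨e, he⟩ : ∃ e : E, e = single N 1 := ⟨_, rfl⟩
  have heN : e N = 1 := by simp [he]
  obtain ⟨G, hG⟩ : ∃ G : E → ENNReal,
    G = (hBall N).indicator fun z => ofReal (pd N f z ^ 2) := ⟨_, rfl⟩
  have hGm : Measurable G := by
    rw [hG]; exact (hc2.measurable.ennreal_ofReal).indicator measurableSet_hBall
  have hsq : ∀ (x : E) (s : ℝ), ‖x + s • -e‖ ^ 2 = ‖x‖ ^ 2 - 2 * s * x N + s ^ 2 := by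
    intro x s
    rw [smul_neg, ← sub_eq_add_neg, norm_sub_sq_real, norm_smul, he, inner_smul_right,
      EuclideanSpace.inner_single_right, PiLp.norm_single]
    simp; ring
  have key : ∀ x ∈ hBall N, ofReal (f x ^ 2) ≤ ∫⁻ s in Ioc (0 : ℝ) 1, G (x + s • -e) := by
    intro x hx
    have hxN : 0 < x N := hx.1
    have hx1 : ‖x‖ ≤ 1 := mem_closedBall_zero_iff.1 hx.2
    have hxN1 : x N ≤ 1 := ((le_abs_self _).trans (norm_apply_le x N)).trans hx1
    have h4 := ofReal_sq_sub_le hf x (-e) hxN.le hxN1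
    have hb : ‖x + x N • -e‖ < 1 := by
      rw [← sq_lt_one_iff₀ (norm_nonneg _), hsq]
      nlinarith [norm_nonneg x]
    rw [h0 _ (mem_ball_zero_iff.2 hb) (by simp [heN]), zero_sub, neg_sq] at h4
    refine h4.trans ?_
    rw [← setLIntegral_congr Ioo_ae_eq_Ioc]
    refine (setLIntegral_mono' measurableSet_Ioo fun s hs => ?_).trans
      (lintegral_mono_set (Ioo_subset_Ioc_self.trans (Ioc_subset_Ioc_right hxN1)))
    have hmem : x + s • -e ∈ hBall N := by
      constructor
      · change 0 < (x + s • -e) N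
        simp [heN]; linarith [hs.2]
      · rw [mem_closedBall_zero_iff]
        rw [← sq_le_one_iff₀ (norm_nonneg _), hsq]
        nlinarith [hs.1, hs.2, mul_pos hs.1 (sub_pos.2 hs.2), norm_nonneg x]
    rw [hG, indicator_of_mem hmem, map_neg, neg_sq, he]
    rfl
  have h5 := setLIntegral_mono' (μ := volume) measurableSet_hBall key
  have hm : Measurable (Function.uncurry fun (x : E) (s : ℝ) => G (x + s • -e)) :=
    hGm.comp (Continuous.measurable (by fun_prop))
  replace h5 := h5.trans (setLIntegral_le_lintegral _ _)
  rw [lintegral_lintegral_swap hm.aemeasurable] at h5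
  simp only [lintegral_add_right_eq_self (fun y => G y)] at h5
  rw [hG, lintegral_indicator measurableSet_hBall, lintegral_hBall_eq hc1 fun y => sq_nonneg _,
    lintegral_hBall_eq hc2 fun y => sq_nonneg _, setLIntegral_const, Real.volume_Ioc] at h5
  simp only [sub_zero, ENNReal.ofReal_one, mul_one] at h5
  rwa [ENNReal.ofReal_le_ofReal_iff (integral_nonneg fun _ => sq_nonneg _)] at h5

theorem integral_sq_le_of_vanishOn {m : ℕ} {f : E → ℝ} (hf : ContDiff ℝ ∞ f)
    (h : VanishOn N m (ball 0 1) f) (γ : Fin d → ℕ) (hγ : γ N ≤ m) :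
    ∫ x in hBall N, DD γ f x ^ 2 ≤
      ∫ x in hBall N, DD (tang N γ) (DD (m • Pi.single N 1) f) x ^ 2 := by
  have key : ∀ k, γ N + k ≤ m → ∫ x in hBall N, DD γ f x ^ 2 ≤
      ∫ x in hBall N, DD (γ + k • Pi.single N 1) f x ^ 2 := by
    intro k
    induction k with
    | zero => simp
    | succ k ih =>
      intro hk
      refine (ih (by omega)).trans ?_
      rw [succ_nsmul, ← add_assoc, DD_add_single hf]
      exact integral_sq_le_normal (contDiff_DD hf _) fun x hx hx0 => h _ (by simp; omega) x hx hx0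
  have := key (m - γ N) (by omega)
  rw [← DD_add_index hf]
  have e : γ + (m - γ N) • (Pi.single N 1 : Fin d → ℕ) = tang N γ + m • Pi.single N 1 := by
    conv_lhs => rw [← smul_add_tang (N := N) γ]
    rw [add_right_comm, ← add_smul, add_comm]
    congr 2
    simp [tang]; omega
  rwa [e] at this

/-- The normalized monomial `x ^ γ / γ!`. -/
def monom (γ : Fin d → ℕ) (x : E) : ℝ :=
  ∏ i, x i ^ γ i / (γ i).factorial

theorem contDiff_monom (γ : Fin d → ℕ) : ContDiff ℝ ∞ (monom γ) := by
  unfold monom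
  refine contDiff_prod fun i _ => ContDiff.div_const (ContDiff.pow ?_ _) _
  exact (proj (𝕜 := ℝ) i).contDiff

theorem monom_add_line (γ : Fin d → ℕ) (j : Fin d) (x : E) (s : ℝ) :
    monom γ (x + s • single j 1) =
      (∏ i ∈ Finset.univ.erase j, x i ^ γ i / (γ i).factorial) *
        ((x j + s) ^ γ j / (γ j).factorial) := by
  unfold monom
  rw [← Finset.prod_erase_mul _ _ (Finset.mem_univ j)]
  congr 1
  · refine Finset.prod_congr rfl fun i hi => ?_
    simp [(Finset.mem_erase.1 hi).1]
  · simp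

theorem pd_monom_add (γ : Fin d → ℕ) (j : Fin d) :
    pd j (monom (γ + Pi.single j 1 : Fin d → ℕ)) = monom γ := by
  funext x
  have h := hasDerivAt_comp_line (contDiff_monom (γ + Pi.single j 1 : Fin d → ℕ)) x
    (single j 1) 0
  have e := monom_add_line γ j x 0
  simp only [monom_add_line, zero_smul, add_zero, Pi.add_apply, Pi.single_eq_same] at h e
  have h2 : HasDerivAt (fun s : ℝ => (x j + s) ^ (γ j + 1) / ((γ j + 1).factorial : ℝ))
      (x j ^ γ j / (γ j).factorial) 0 := by
    have := (((hasDerivAt_id (0 : ℝ)).const_add (x j)).pow (γ j + 1)).div_const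
      ((γ j + 1).factorial : ℝ)
    refine this.congr_deriv ?_
    rw [Nat.factorial_succ]
    have : ((γ j).factorial : ℝ) ≠ 0 := by positivity
    push_cast
    field_simp
    simp
  refine (h.unique (h2.const_mul _)).trans ?_
  rw [e]
  congr 1
  refine Finset.prod_congr rfl fun i hi => ?_
  simp [(Finset.mem_erase.1 hi).1]

theorem pd_monom_of_eq_zero (γ : Fin d → ℕ) (j : Fin d) (hj : γ j = 0) : pd j (monom γ) = 0 := by
  funext x
  have h := hasDerivAt_comp_line (contDiff_monom γ) x (single j 1) 0
  simp only [monom_add_line, zero_smul, add_zero, hj, pow_zero] at h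
  exact h.unique (hasDerivAt_const _ _)

theorem DD_monom_add (γ δ : Fin d → ℕ) : DD δ (monom (γ + δ)) = monom γ := by
  induction δ using multiIndex_induction generalizing γ with
  | h0 => rw [add_zero, DD_zero]
  | hs δ j ih =>
    rw [DD_add_single (contDiff_monom _), ← add_assoc, add_right_comm, ih, pd_monom_add]

theorem DD_monom_of_lt {γ δ : Fin d → ℕ} {j : Fin d} (hj : γ j < δ j) : DD δ (monom γ) = 0 := by
  obtain ⟨δ', h⟩ : ∃ δ' : Fin d → ℕ, δ = δ' + (Pi.single j 1 + γ j • Pi.single j 1) := by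
    refine ⟨δ - (Pi.single j 1 + γ j • Pi.single j 1), (tsub_add_cancel_of_le fun i => ?_).symm⟩
    by_cases hi : i = j
    · subst hi; simp; omega
    · simp [hi]
  rw [h, DD_add_index (contDiff_monom _), DD_add_index (contDiff_monom _)]
  conv_lhs => rw [← smul_add_tang (N := j) γ, add_comm (γ j • _)]
  have : (tang j γ + γ j • Pi.single j 1 : Fin d → ℕ) j = γ j := by simp
  rw [this, DD_monom_add, DD_single (contDiff_monom _), pd_monom_of_eq_zero _ _ (tang_self γ)]
  exact DD_zero_fun _

theorem DD_monom_of_ne {γ δ : Fin d → ℕ} (h : ∑ i, γ i ≤ ∑ i, δ i) (hne : δ ≠ γ) :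
    DD δ (monom γ) = 0 := by
  by_contra h0
  have hle : ∀ j ∈ Finset.univ, δ j ≤ γ j := fun j _ => by
    by_contra hj
    exact h0 (DD_monom_of_lt (not_le.1 hj))
  have := (Finset.sum_eq_sum_iff_of_le hle).1 (le_antisymm (sum_le_sum hle) h)
  exact hne (funext fun j => this j (Finset.mem_univ j))

theorem vanishOn_monom (γ : Fin d → ℕ) : VanishOn N (γ N) univ (monom γ) := by
  intro δ hδ x _ hx
  by_cases h : δ ≤ γ
  · have e : DD δ (monom γ) = monom (γ - δ) := by
      conv_lhs => rw [← tsub_add_cancel_of_le h]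
      exact DD_monom_add _ _
    rw [e]
    refine Finset.prod_eq_zero (Finset.mem_univ N) ?_
    rw [hx, Pi.sub_apply, zero_pow (by omega), zero_div]
  · obtain ⟨j, hj⟩ := not_forall.1 h
    rw [DD_monom_of_lt (not_le.1 hj)]; rfl

theorem eq_of_pd_eq_zero {f : E → ℝ} (hf : ContDiff ℝ ∞ f) (h : ∀ j, pd j f = 0) (x y : E) :
    f x = f y := by
  refine is_const_of_fderiv_eq_zero (𝕜 := ℝ) (hf.differentiable (by simp)) (fun z => ?_) x y
  ext v
  rw [fderiv_eq_sum_pd]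
  simp [h]

/-- Polynomials vanishing to order `m` on the hyperplane with prescribed weighted averages. -/
theorem exists_polynomial {m : ℕ} {ψ : E → ℝ} (hψ : Continuous ψ)
    (h1 : ∫ x in hBall N, ψ x = 1) (y : (Fin d → ℕ) → ℝ) :
    ∃ P : E → ℝ, ContDiff ℝ ∞ P ∧ VanishOn N m univ P ∧
      (∀ δ : Fin d → ℕ, 2 * m ≤ ∑ i, δ i → DD δ P = 0) ∧
      ∀ β : Fin d → ℕ, ∑ i, β i < m →
        ∫ x in hBall N, ψ x * DD (β + m • Pi.single N 1 : Fin d → ℕ) P x = y β := by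
  suffices H : ∀ k, ∃ P : E → ℝ, ContDiff ℝ ∞ P ∧ VanishOn N m univ P ∧
      (∀ δ : Fin d → ℕ, 2 * m ≤ ∑ i, δ i → DD δ P = 0) ∧
      ∀ β : Fin d → ℕ, ∑ i, β i < m → m ≤ ∑ i, β i + k →
        ∫ x in hBall N, ψ x * DD (β + m • Pi.single N 1 : Fin d → ℕ) P x = y β by
    obtain ⟨P, hP, hv, hz, h⟩ := H m
    exact ⟨P, hP, hv, hz, fun β hβ => h β hβ (by omega)⟩
  intro k
  induction k with
  | zero =>
    exact ⟨0, contDiff_const, fun γ _ x _ _ => by rw [DD_zero_fun]; rfl,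
      fun δ _ => DD_zero_fun _, fun β h h' => by omega⟩
  | succ k ih =>
    obtain ⟨P, hP, hv, hz, h⟩ := ih
    by_cases hk : m ≤ k
    · exact ⟨P, hP, hv, hz, fun β hβ _ => h β hβ (by omega)⟩
    obtain ⟨c, hc⟩ : ∃ c : (Fin d → ℕ) → ℝ, ∀ β, c β = y β -
      ∫ x in hBall N, ψ x * DD (β + m • Pi.single N 1 : Fin d → ℕ) P x := ⟨_, fun _ => rfl⟩
    obtain ⟨M, hM⟩ : ∃ M : (Fin d → ℕ) → E → ℝ,
      ∀ β, M β = fun x => c β * monom (β + m • Pi.single N 1 : Fin d → ℕ) x := ⟨_, fun _ => rfl⟩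
    have hMc : ∀ β, ContDiff ℝ ∞ (M β) := fun β => by
      rw [hM]; exact contDiff_const.mul (contDiff_monom _)
    have hMD : ∀ β δ, DD δ (M β) = fun x => c β * DD δ (monom (β + m • Pi.single N 1 : Fin d → ℕ)) x :=
      fun β δ => by rw [hM]; exact DD_const_smul (contDiff_monom _) _ _
    have hs : ContDiff ℝ ∞ fun x => ∑ β ∈ MIdx d (m - (k + 1)), M β x :=
      ContDiff.sum fun β _ => hMc β
    have hD : ∀ δ x, DD δ (fun x => P x + ∑ β ∈ MIdx d (m - (k + 1)), M β x) x =
        DD δ P x + ∑ β ∈ MIdx d (m - (k + 1)), DD δ (M β) x := by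
      intro δ x
      have e : (fun x => P x + ∑ β ∈ MIdx d (m - (k + 1)), M β x) =
        P + ∑ β ∈ MIdx d (m - (k + 1)), M β := by funext x; simp
      rw [e, DD_add hP (by simpa only [Finset.sum_fn] using hs), DD_sum _ _ fun β _ => hMc β,
        Pi.add_apply, Finset.sum_apply]
    refine ⟨fun x => P x + ∑ β ∈ MIdx d (m - (k + 1)), M β x, hP.add hs, ?_, ?_, ?_⟩
    · intro γ hγ x hx hx0
      rw [hD, hv γ hγ x hx hx0, zero_add]
      refine sum_eq_zero fun β _ => ?_
      rw [hMD]
      dsimp only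
      rw [vanishOn_monom (N := N) _ γ (by simp; omega) x hx hx0, mul_zero]
    · intro δ hδ
      funext x
      rw [hD, hz δ hδ, Pi.zero_apply, zero_add]
      refine sum_eq_zero fun β hβ => ?_
      rw [mem_MIdx] at hβ
      have hs : ∑ i, (β + m • Pi.single N 1 : Fin d → ℕ) i = m - (k + 1) + m := by
        simp [sum_add_distrib, hβ, ← mul_sum]
      rw [hMD, DD_monom_of_ne (by omega) (by rintro rfl; omega)]
      simp
    · intro β hβ hβk
      have hterm : ∀ β' ∈ MIdx d (m - (k + 1)), DD (β + m • Pi.single N 1 : Fin d → ℕ) (M β') =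
          fun x => if β = β' then c β else 0 := by
        intro β' hβ'
        rw [hMD]
        rw [mem_MIdx] at hβ'
        split_ifs with hb
        · subst hb
          have := DD_monom_add (0 : Fin d → ℕ) (β + m • Pi.single N 1)
          rw [zero_add] at this
          rw [this]
          simp [monom]
        · rw [DD_monom_of_ne (by simp [sum_add_distrib]; omega) (by simpa using hb)]
          simp
      have e : ∀ x, ψ x * DD (β + m • Pi.single N 1 : Fin d → ℕ)
          (fun x => P x + ∑ β ∈ MIdx d (m - (k + 1)), M β x) x =
          ψ x * DD (β + m • Pi.single N 1 : Fin d → ℕ) P x +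
            ψ x * if β ∈ MIdx d (m - (k + 1)) then c β else 0 := by
        intro x
        rw [hD, mul_add, sum_congr rfl fun β' hβ' => congrFun (hterm β' hβ') x,
          Finset.sum_ite_eq]
      simp only [e]
      have i1 : Integrable (fun x => ψ x * DD (β + m • Pi.single N 1 : Fin d → ℕ) P x)
        (volume.restrict (hBall N)) := integrableOn_hBall (hψ.mul (contDiff_DD hP _).continuous)
      rw [integral_add i1 ((integrableOn_hBall hψ).mul_const _), integral_mul_const, h1, one_mul]
      split_ifs with hb
      · rw [hc]; ring
      · rw [mem_MIdx] at hb
        rw [add_zero]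
        exact h β hβ (by omega)

/-- Test functions of the open unit half ball. -/
structure IsTest (N : Fin d) (ψ : E → ℝ) : Prop where
  smooth : ContDiff ℝ ∞ ψ
  compact : HasCompactSupport ψ
  subset : tsupport ψ ⊆ HalfSp N ∩ ball 0 1

theorem exists_isTest (N : Fin d) : ∃ ψ, IsTest N ψ ∧ ∫ x in hBall N, ψ x = 1 := by
  let b : ContDiffBump (single N (1 / 2 : ℝ)) := ⟨1 / 8, 1 / 4, by norm_num, by norm_num⟩
  have hs : tsupport (b.normed volume) ⊆ HalfSp N ∩ ball 0 1 := by
    rw [b.tsupport_normed_eq]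
    intro x hx
    have hx' : ‖x - single N (1 / 2 : ℝ)‖ ≤ 1 / 4 := by
      rw [← dist_eq_norm]; exact hx
    have h1 := abs_le.1 ((norm_apply_le (x - single N (1 / 2 : ℝ)) N).trans hx')
    have h2 := norm_le_norm_add_norm_sub (single N (1 / 2 : ℝ)) x
    rw [norm_sub_rev, PiLp.norm_single] at h2
    refine ⟨?_, ?_⟩
    · change 0 < x N
      have := h1.1
      simp at this
      linarith
    · rw [mem_ball_zero_iff]
      have : ‖(1 / 2 : ℝ)‖ = 1 / 2 := by norm_num
      linarith
  refine ⟨b.normed volume, ⟨b.contDiff_normed, b.hasCompactSupport_normed, hs⟩, ?_⟩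
  rw [setIntegral_eq_integral_of_forall_compl_eq_zero, b.integral_normed]
  intro x hx
  by_contra h
  exact hx (inter_subset_inter_right _ ball_subset_closedBall (hs (subset_tsupport _ h)))

theorem IsTest.integral_mul_pd {ψ : E → ℝ} (h : IsTest N ψ) {g : E → ℝ} (hg : ContDiff ℝ ∞ g)
    (j : Fin d) : IsTest N (fun x => -pd j ψ x) ∧
      ∫ x in hBall N, ψ x * pd j g x = ∫ x in hBall N, -pd j ψ x * g x := by
  have h1 : IsTest N (fun x => -pd j ψ x) := by
    refine ⟨(contDiff_pd h.smooth j).neg, (hasCompactSupport_pd h.smooth h.compact j).neg, ?_⟩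
    refine (closure_minimal (fun x hx => ?_) (isClosed_tsupport _)).trans h.subset
    rw [← DD_single h.smooth] at hx
    exact tsupport_DD_subset ψ (Pi.single j 1) (subset_tsupport _ fun e => hx (by simp [e]))
  have h2 : ∀ φ : E → ℝ, IsTest N φ → ∀ q : E → ℝ,
      ∫ x in hBall N, φ x * q x = ∫ x in HalfSp N, φ x * q x := fun φ hφ q => by
    refine (setIntegral_eq_of_subset_of_forall_sdiff_eq_zero isOpen_halfSp.measurableSet
      inter_subset_left fun x hx => ?_).symm
    rw [image_eq_zero_of_notMem_tsupport fun hx' => hx.2 ⟨hx.1, ball_subset_closedBall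
      (hφ.subset hx').2⟩, zero_mul]
  refine ⟨h1, ?_⟩
  rw [h2 _ h, h2 _ h1]
  simp only [neg_mul, integral_neg]
  rw [integral_halfSp_pd_mul h.smooth hg h.compact j fun _ x hx => ?_, neg_neg]
  exact image_eq_zero_of_notMem_tsupport fun hx' => (ne_of_gt (h.subset hx').1) hx

theorem IsTest.exists_adjoint {ψ : E → ℝ} (h : IsTest N ψ) (δ : Fin d → ℕ) :
    ∃ φ, IsTest N φ ∧ ∀ g : E → ℝ, ContDiff ℝ ∞ g →
      ∫ x in hBall N, ψ x * DD δ g x = ∫ x in hBall N, φ x * g x := by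
  induction δ using multiIndex_induction generalizing ψ with
  | h0 => exact ⟨ψ, h, fun g _ => by rw [DD_zero]⟩
  | hs δ j ih =>
    obtain ⟨φ, hφ, e⟩ := ih (h.integral_mul_pd (contDiff_const (c := (0 : ℝ))) j).1
    refine ⟨φ, hφ, fun g hg => ?_⟩
    rw [DD_add_single hg, (h.integral_mul_pd (contDiff_DD hg δ) j).2, e g hg]

theorem exists_add_of_le (k : ℕ) (δ : Fin d → ℕ) (h : k ≤ ∑ i, δ i) :
    ∃ ρ μ : Fin d → ℕ, δ = ρ + μ ∧ ∑ i, μ i = k := by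
  induction k with
  | zero => exact ⟨δ, 0, by simp, by simp⟩
  | succ k ih =>
    obtain ⟨ρ, μ, rfl, hμ⟩ := ih (by omega)
    obtain ⟨j, hj⟩ : ∃ j, ρ j ≠ 0 := by
      by_contra! hj
      simp [hj, hμ] at h
    refine ⟨ρ - Pi.single j 1, Pi.single j 1 + μ, ?_, by simp [sum_add_distrib, hμ, add_comm]⟩
    rw [← add_assoc, tsub_add_cancel_of_le]
    intro i
    by_cases hi : i = j
    · subst hi; simp; omega
    · simp [hi]

theorem IsTest.exists_sq_bound {ψ : E → ℝ} (h : IsTest N ψ) (k : ℕ) (δ : Fin d → ℕ)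
    (hδ : k < ∑ i, δ i) : ∃ C, 0 ≤ C ∧ ∀ f : E → ℝ, ContDiff ℝ ∞ f → ∀ c : (Fin d → ℕ) → ℝ,
      (∫ x in hBall N, ψ x * DD δ f x) ^ 2 ≤
        C * ∑ μ ∈ MIdx d k, ∫ x in hBall N, (DD μ f x - c μ) ^ 2 := by
  obtain ⟨ρ, μ, rfl, hμ⟩ := exists_add_of_le k δ hδ.le
  obtain ⟨ν, θ, rfl, hθ⟩ := exists_add_of_le 1 ρ (by
    simp only [Pi.add_apply, sum_add_distrib] at hδ; omega)
  obtain ⟨j, hj⟩ : ∃ j, θ j ≠ 0 := by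
    by_contra! hj
    simp [hj] at hθ
  obtain rfl : θ = Pi.single j 1 := by
    simpa using MIdx_eq_single (N := j) (mem_MIdx.2 hθ) (Nat.one_le_iff_ne_zero.2 hj)
  obtain ⟨φ, hφ, e⟩ := h.exists_adjoint (ν + Pi.single j 1)
  obtain ⟨φ₁, hφ₁, e₁⟩ := h.exists_adjoint ν
  refine ⟨∫ x in hBall N, (-pd j φ₁ x) ^ 2, integral_nonneg fun _ => sq_nonneg _, fun f hf c => ?_⟩
  have hD := contDiff_DD hf μ
  have hg : ContDiff ℝ ∞ fun x => DD μ f x - c μ := hD.sub contDiff_const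
  have e2 : pd j (fun x => DD μ f x - c μ) = pd j (DD μ f) := by
    funext x; simp [pd, fderiv_sub_const]
  obtain ⟨h3, h4⟩ := hφ₁.integral_mul_pd hg j
  rw [add_assoc, DD_add_index hf, DD_add_index hf, DD_single hD, ← e2,
    e₁ _ (contDiff_pd hg j), h4]
  have c1 := h3.smooth.continuous
  refine (sq_integral_mul_le (integrableOn_hBall (c1.pow 2)) (integrableOn_hBall (hg.continuous.pow 2))
    (integrableOn_hBall (c1.mul hg.continuous))).trans
    (mul_le_mul_of_nonneg_left ?_ (integral_nonneg fun _ => sq_nonneg _))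
  exact single_le_sum (f := fun μ => ∫ x in hBall N, (DD μ f x - c μ) ^ 2)
    (fun _ _ => integral_nonneg fun _ => sq_nonneg _) (mem_MIdx.2 hμ)

/-- The squared deviation of the derivatives of order `2m-1` from constants. -/
def topDev (N : Fin d) (m : ℕ) (w : Fin n → ℝ × E → ℝ)
    (c : (Fin d → ℕ) → Fin n → ℝ) (t : ℝ) : ℝ :=
  ∑ i, ∑ μ ∈ MIdx d (2 * m - 1), ∫ x in hBall N, (Dmul μ (w i) (t, x) - c μ i) ^ 2

variable {A : (Fin d → ℕ) → (Fin d → ℕ) → ℝ → Fin n → Fin n → ℝ}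
  {w : Fin n → ℝ × EuclideanSpace ℝ (Fin d) → ℝ} {c : (Fin d → ℕ) → Fin n → ℝ}

theorem topDev_nonneg (t : ℝ) : 0 ≤ topDev N m w c t :=
  sum_nonneg fun _ _ => sum_nonneg fun _ _ => integral_nonneg fun _ => sq_nonneg _

theorem continuous_topDev (hw : ∀ i, ContDiff ℝ ∞ (w i)) : Continuous (topDev N m w c) := by
  refine continuous_finsetSum _ fun i _ => continuous_finsetSum _ fun μ _ => ?_
  exact continuous_integral_slice (F := fun p => (Dmul μ (w i) p - c μ i) ^ 2)
    (isCompact_closedBall _ _) (((contDiff_Dmul (hw i) μ).continuous.sub continuous_const).pow 2)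

theorem le_topDev (i : Fin n) (t : ℝ) :
    ∑ μ ∈ MIdx d (2 * m - 1), ∫ x in hBall N, (Dmul μ (w i) (t, x) - c μ i) ^ 2
      ≤ topDev N m w c t :=
  single_le_sum (f := fun i => ∑ μ ∈ MIdx d (2 * m - 1),
    ∫ x in hBall N, (Dmul μ (w i) (t, x) - c μ i) ^ 2) (fun _ _ => sum_nonneg fun _ _ =>
      integral_nonneg fun _ => sq_nonneg _) (Finset.mem_univ i)

theorem IsTest.time_variation (hm : 1 ≤ m) {lam K : ℝ} (hK : 0 ≤ K) {ψ : E → ℝ} (hψ : IsTest N ψ)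
    (θ : Fin d → ℕ) : ∃ C, 0 ≤ C ∧ ∀ A, IsCoeff d n m lam K A → ∀ w : Fin n → ℝ × E → ℝ,
      IsSol N m A w → ∀ c, ∀ t ∈ Ioo (-1 : ℝ) 0, ∀ i,
      ((∫ x in hBall N, ψ x * Dmul θ (w i) (t, x)) -
        ∫ x in hBall N, ψ x * Dmul θ (w i) (-1 / 2, x)) ^ 2 ≤
          C * ∫ s in (-1 : ℝ)..0, topDev N m w c s := by
  have h0 : ∀ δ : Fin d → ℕ, ∃ C, 0 ≤ C ∧ (2 * m - 1 < ∑ i, δ i → ∀ f : E → ℝ, ContDiff ℝ ∞ f →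
      ∀ c : (Fin d → ℕ) → ℝ, (∫ x in hBall N, ψ x * DD δ f x) ^ 2 ≤
        C * ∑ μ ∈ MIdx d (2 * m - 1), ∫ x in hBall N, (DD μ f x - c μ) ^ 2) := by
    intro δ
    by_cases hδ : 2 * m - 1 < ∑ i, δ i
    · obtain ⟨C, hC, h⟩ := hψ.exists_sq_bound _ δ hδ
      exact ⟨C, hC, fun _ => h⟩
    · exact ⟨0, le_rfl, fun h => absurd h hδ⟩
  choose B hB hBd using h0
  obtain ⟨L, hL⟩ : ∃ L, L = ∑ α ∈ MIdx d m, ∑ β ∈ MIdx d m, ∑ _j : Fin n, K * √(B (α + β + θ)) :=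
    ⟨_, rfl⟩
  have hL0 : 0 ≤ L := by rw [hL]; positivity
  refine ⟨L ^ 2, by positivity, fun A hA w hw c t ht i => ?_⟩
  have hFs : ContDiff ℝ ∞ fun p : ℝ × E => ψ p.2 * Dmul θ (w i) p :=
    (hψ.smooth.comp contDiff_snd).mul (contDiff_Dmul (hw.smooth i) θ)
  obtain ⟨g', hg'⟩ : ∃ g' : ℝ → ℝ, ∀ s, g' s =
    ∫ x in hBall N, ψ x * tder (Dmul θ (w i)) (s, x) := ⟨_, fun _ => rfl⟩
  have hder : ∀ s, HasDerivAt (fun s => ∫ x in hBall N, ψ x * Dmul θ (w i) (s, x)) (g' s) s := by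
    intro s
    rw [hg']
    convert hasDerivAt_integral_slice (N := N) (isCompact_closedBall (0 : E) 1) hFs s using 1
    · rfl
    refine setIntegral_congr_fun measurableSet_hBall fun x _ => ?_
    have h : HasDerivAt (fun s => ψ x * Dmul θ (w i) (s, x)) (ψ x * tder (Dmul θ (w i)) (s, x)) s :=
      (hasDerivAt_tder (contDiff_Dmul (hw.smooth i) θ) s x).const_mul (ψ x)
    exact h.deriv.symm
  have hgc : Continuous g' := by
    have : Continuous fun p : ℝ × E => ψ p.2 * tder (Dmul θ (w i)) p :=
      (hψ.smooth.continuous.comp continuous_snd).mul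
        (contDiff_tder (contDiff_Dmul (hw.smooth i) θ)).continuous
    rw [funext hg']
    exact continuous_integral_slice (isCompact_closedBall (0 : E) 1) this
  have hSc := continuous_topDev (N := N) (m := m) (c := c) hw.smooth
  have hae : ∀ᵐ s ∂(volume.restrict (Ioo (-1 : ℝ) 0)), g' s ^ 2 ≤ L ^ 2 * topDev N m w c s := by
    filter_upwards [hw.eqn_Dmul θ] with s hs
    have hc : ∀ α β j, Continuous fun x => ψ x * Dmul (α + β) (Dmul θ (w j)) (s, x) :=
      fun α β j => hψ.smooth.continuous.mul
        (contDiff_slice (contDiff_Dmul (contDiff_Dmul (hw.smooth j) θ) _) s).continuous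
    have e : g' s = -((-1) ^ m * ∑ α ∈ MIdx d m, ∑ β ∈ MIdx d m, ∑ j,
        A α β s i j * ∫ x in hBall N, ψ x * Dmul (α + β) (Dmul θ (w j)) (s, x)) := by
      simp only [← integral_const_mul]
      have i1 : ∀ α β j, Integrable (fun x => A α β s i j *
          (ψ x * Dmul (α + β) (Dmul θ (w j)) (s, x))) (volume.restrict (hBall N)) :=
        fun α β j => (integrableOn_hBall (hc α β j)).const_mul _
      have i2 := fun α β => integrable_finsetSum Finset.univ fun j _ => i1 α β j
      have i3 := fun α => integrable_finsetSum (MIdx d m) fun β _ => i2 α β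
      simp only [← integral_finsetSum _ fun j _ => i1 _ _ j]
      simp only [← integral_finsetSum _ fun β _ => i2 _ β]
      rw [← integral_finsetSum _ fun α _ => i3 α, ← integral_const_mul, ← integral_neg, hg']
      refine setIntegral_congr_fun measurableSet_hBall fun x hx => ?_
      by_cases hx1 : x ∈ ball (0 : E) 1
      · rw [eq_neg_of_add_eq_zero_left (hs x hx1 hx.1 i), mul_neg, mul_left_comm]
        simp only [mul_sum, mul_left_comm]
      · rw [image_eq_zero_of_notMem_tsupport fun hx' => hx1 (hψ.subset hx').2]
        simp
    have hterm : ∀ α ∈ MIdx d m, ∀ β ∈ MIdx d m, ∀ j,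
        |A α β s i j * ∫ x in hBall N, ψ x * Dmul (α + β) (Dmul θ (w j)) (s, x)| ≤
          K * √(B (α + β + θ)) * √(topDev N m w c s) := by
      intro α hα β hβ j
      rw [mem_MIdx] at hα hβ
      rw [abs_mul, mul_assoc, ← Real.sqrt_mul (hB _)]
      refine mul_le_mul (hA.bound α β s i j) (Real.abs_le_sqrt ?_) (abs_nonneg _) hK
      have := hBd (α + β + θ) (by simp [sum_add_distrib, hα, hβ]; omega) _
        (contDiff_slice (hw.smooth j) s) fun μ => c μ j
      simp only [← Dmul_apply] at this
      rw [← Dmul_add_index (hw.smooth j)]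
      exact this.trans (mul_le_mul_of_nonneg_left (le_topDev j s) (hB _))
    have habs : |g' s| ≤ L * √(topDev N m w c s) := by
      rw [e, abs_neg, abs_mul, abs_pow, abs_neg, abs_one, one_pow, one_mul, hL]
      simp only [sum_mul]
      refine (abs_sum_le_sum_abs _ _).trans (sum_le_sum fun α hα => ?_)
      refine (abs_sum_le_sum_abs _ _).trans (sum_le_sum fun β hβ => ?_)
      exact (abs_sum_le_sum_abs _ _).trans (sum_le_sum fun j _ => hterm α hα β hβ j)
    rw [← sq_abs, ← sq_sqrt (topDev_nonneg (N := N) (m := m) (w := w) (c := c) s), ← mul_pow]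
    exact pow_le_pow_left₀ (abs_nonneg _) habs 2
  have hle := le_of_ae_le_Ioo (hgc.pow 2) (hSc.const_mul (L ^ 2)) hae
  have hint : ∫ s in (-1 : ℝ)..0, g' s ^ 2 ≤ L ^ 2 * ∫ s in (-1 : ℝ)..0, topDev N m w c s := by
    rw [← intervalIntegral.integral_const_mul]
    exact integral_mono_on_of_le_Ioo (by norm_num)
      ((hgc.pow 2).intervalIntegrable _ _) ((hSc.const_mul _).intervalIntegrable _ _) hle
  refine le_trans ?_ hint
  have hab : ∀ a b : ℝ, -1 ≤ a → a ≤ b → b ≤ 0 →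
      ((∫ x in hBall N, ψ x * Dmul θ (w i) (b, x)) -
        ∫ x in hBall N, ψ x * Dmul θ (w i) (a, x)) ^ 2 ≤ ∫ s in (-1 : ℝ)..0, g' s ^ 2 := by
    intro a b ha h hb
    have h1 := sq_sub_le_integral hgc hder h
    have h2 := integral_le_of_subinterval (hgc.pow 2) (hgc.pow 2) (fun _ => le_rfl)
      (fun _ => sq_nonneg _) ha h hb
    have h3 : 0 ≤ ∫ s in a..b, g' s ^ 2 := intervalIntegral.integral_nonneg h fun _ _ => sq_nonneg _
    simp only [Pi.pow_apply] at h2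
    nlinarith
  rcases le_total (-1 / 2) t with h | h
  · exact hab _ _ (by norm_num) h ht.2.le
  · rw [← neg_sq, neg_sub]; exact hab _ _ ht.1.le h (by norm_num)

theorem Dmul_sub_snd {u : ℝ × E → ℝ} {P : E → ℝ} (hu : ContDiff ℝ ∞ u) (hP : ContDiff ℝ ∞ P)
    (γ : Fin d → ℕ) (t : ℝ) (x : E) :
    Dmul γ (fun p => u p - P p.2) (t, x) = Dmul γ u (t, x) - DD γ P x := by
  rw [Dmul_apply, Dmul_apply]
  exact congrFun (DD_sub (contDiff_slice hu t) hP γ) x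

theorem IsSol.sub_snd (hw : IsSol N m A w) {P : Fin n → E → ℝ} (hP : ∀ i, ContDiff ℝ ∞ (P i))
    (hv : ∀ i, VanishOn N m univ (P i))
    (hz : ∀ i, ∀ δ : Fin d → ℕ, 2 * m ≤ ∑ i, δ i → DD δ (P i) = 0) :
    IsSol N m A fun i p => w i p - P i p.2 where
  smooth i := (hw.smooth i).sub ((hP i).comp contDiff_snd)
  bdry t ht i γ hγ x hx hx0 := by
    have := Dmul_sub_snd (hw.smooth i) (hP i) γ t x
    rw [Dmul_apply, Dmul_apply, hw.bdry t ht i γ hγ x hx hx0, hv i γ hγ x trivial hx0, sub_zero] at this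
    exact this
  eqn := by
    filter_upwards [hw.eqn] with t ht x hx hxN i
    have e1 : tder (fun p => w i p - P i p.2) (t, x) = tder (w i) (t, x) :=
      ((hasDerivAt_tder (hw.smooth i) t x).sub_const (P i x)).deriv
    rw [e1, ← ht x hx hxN i]
    congr 2
    refine sum_congr rfl fun α hα => sum_congr rfl fun β hβ =>
      sum_congr rfl fun j _ => ?_
    rw [mem_MIdx] at hα hβ
    rw [Dmul_sub_snd (hw.smooth j) (hP j), hz j _ (by simp [sum_add_distrib, hα, hβ]; omega)]
    simp

theorem eq_of_DD_eq_zero {P : E → ℝ} (hP : ContDiff ℝ ∞ P) (hm : 1 ≤ m)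
    (hz : ∀ δ : Fin d → ℕ, 2 * m ≤ ∑ i, δ i → DD δ P = 0) {μ : Fin d → ℕ}
    (hμ : ∑ i, μ i = 2 * m - 1) (x y : E) : DD μ P x = DD μ P y := by
  refine eq_of_pd_eq_zero (contDiff_DD hP μ) (fun j => ?_) x y
  rw [← DD_add_single hP]
  exact hz _ (by simp [sum_add_distrib, hμ]; omega)

/-- Subtracting a polynomial controls the energy by the deviation of the top derivatives. -/
theorem exists_stEn_sub_le (hm : 1 ≤ m) {lam K : ℝ} (hK : 0 ≤ K) :
    ∃ C, 0 ≤ C ∧ ∀ A, IsCoeff d n m lam K A → ∀ w : Fin n → ℝ × E → ℝ, IsSol N m A w → ∀ c,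
      ∃ P : Fin n → E → ℝ, (∀ i, ContDiff ℝ ∞ (P i)) ∧ (∀ i, VanishOn N m univ (P i)) ∧
        (∀ i, ∀ δ : Fin d → ℕ, 2 * m ≤ ∑ i, δ i → DD δ (P i) = 0) ∧
        stEn N m 1 (fun i p => w i p - P i p.2) ≤ C * ∫ s in (-1 : ℝ)..0, topDev N m w c s := by
  obtain ⟨ψ, hψ, h1⟩ := exists_isTest N
  obtain ⟨e, he⟩ : ∃ e : Fin d → ℕ, e = m • Pi.single N 1 := ⟨_, rfl⟩
  have hse : ∑ i, e i = m := by simp [he, ← mul_sum]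
  choose CV hCV hV using fun β : Fin d → ℕ =>
    hψ.time_variation (n := n) (lam := lam) hm hK (β + e)
  obtain ⟨CP, hCP, hp⟩ := exists_poincare_iter hψ.smooth.continuous h1 (m - 1)
  obtain ⟨Cv, hCv⟩ : ∃ Cv, Cv = ∑ β ∈ MIdxLt d m, CV β := ⟨_, rfl⟩
  have hCv0 : 0 ≤ Cv := hCv ▸ sum_nonneg fun β _ => hCV β
  refine ⟨n * ((MIdxLt d m).card * (CP * (1 + Cv))), by positivity, fun A hA w hw c => ?_⟩
  choose P hP hPv hPz hPy using fun i => exists_polynomial (m := m) hψ.smooth.continuous h1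
    fun β => if ∑ i, β i + 1 = m then c (β + e) i else
      ∫ x in hBall N, ψ x * Dmul (β + e) (w i) (-1 / 2, x)
  refine ⟨P, hP, hPv, hPz, ?_⟩
  rw [← he] at hPy
  obtain ⟨S, hS⟩ : ∃ S, S = ∫ s in (-1 : ℝ)..0, topDev N m w c s := ⟨_, rfl⟩
  have hS0 : 0 ≤ S := by
    rw [hS]; exact intervalIntegral.integral_nonneg (by norm_num) fun t _ => topDev_nonneg t
  have hw' := hw.sub_snd hP hPv hPz
  have hTc := continuous_topDev (N := N) (m := m) (c := c) hw.smooth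
  have hslice : ∀ t ∈ Ioo (-1 : ℝ) 0,
      ∑ i, lowEn N m (closedBall 0 1) (fun x => w i (t, x) - P i x) ≤
        n * ((MIdxLt d m).card * (CP * (topDev N m w c t + Cv * S))) := by
    intro t ht
    have hi : ∀ i, lowEn N m (closedBall 0 1) (fun x => w i (t, x) - P i x) ≤
        (MIdxLt d m).card * (CP * (topDev N m w c t + Cv * S)) := by
      intro i
      have hf : ContDiff ℝ ∞ fun x => w i (t, x) - P i x := (contDiff_slice (hw.smooth i) t).sub (hP i)
      have hDf : ∀ γ x, DD γ (fun x => w i (t, x) - P i x) x = Dmul γ (w i) (t, x) - DD γ (P i) x :=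
        fun γ x => by rw [← Dmul_sub_snd (hw.smooth i) (hP i), Dmul_apply]
      have hV0 : 0 ≤ Cv * S := mul_nonneg hCv0 hS0
      have hg := hp (DD e fun x => w i (t, x) - P i x) (contDiff_DD hf e) (topDev N m w c t + Cv * S)
        (fun β hβ => ?_) fun β hβ => ?_
      · rw [← nsmul_eq_mul]
        refine sum_le_card_nsmul _ _ _ fun γ hγ => ?_
        rw [mem_MIdxLt] at hγ
        have hγs := congrArg (fun γ : Fin d → ℕ => ∑ i, γ i) (smul_add_tang (N := N) γ)
        simp only [Pi.add_apply, sum_add_distrib] at hγs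
        have hγN := single_le_sum (f := γ) (fun _ _ => Nat.zero_le _) (Finset.mem_univ N)
        have := integral_sq_le_of_vanishOn hf (hw'.bdry t ht i) γ (by omega)
        rw [← he] at this
        exact this.trans (hg _ (by omega))
      · refine le_trans ?_ ((le_topDev (c := c) i t).trans (le_add_of_nonneg_right hV0))
        have hs : ∑ i, (β + e) i = 2 * m - 1 := by
          simp only [Pi.add_apply, sum_add_distrib]; omega
        have hc : ∀ x, DD (β + e) (P i) x = c (β + e) i := fun x => by
          have := hPy i β (by omega)
          rw [if_pos (by omega)] at this
          rw [← this, integral_congr_ae (g := fun z => ψ z * DD (β + e) (P i) x)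
            (of_forall fun z => by
              simp only [eq_of_DD_eq_zero (hP i) hm (hPz i) hs z x]),
            integral_mul_const, h1, one_mul]
        simp only [← DD_add_index hf, hDf, hc]
        exact single_le_sum (f := fun μ => ∫ x in hBall N, (Dmul μ (w i) (t, x) - c μ i) ^ 2)
          (fun _ _ => integral_nonneg fun _ => sq_nonneg _) (mem_MIdx.2 hs)
      · refine le_trans ?_ (le_add_of_nonneg_left (topDev_nonneg t))
        have hy := hPy i β (by omega)
        rw [if_neg (by omega)] at hy
        have i1 : Integrable (fun x => ψ x * Dmul (β + e) (w i) (t, x)) (volume.restrict (hBall N)) :=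
          integrableOn_hBall (hψ.smooth.continuous.mul
            (contDiff_slice (contDiff_Dmul (hw.smooth i) _) t).continuous)
        have i2 : Integrable (fun x => ψ x * DD (β + e) (P i) x) (volume.restrict (hBall N)) :=
          integrableOn_hBall (hψ.smooth.continuous.mul (contDiff_DD (hP i) _).continuous)
        simp only [← DD_add_index hf, hDf, mul_sub]
        rw [integral_sub i1 i2, hy]
        refine (hV β A hA w hw c t ht i).trans ?_
        rw [← hS, hCv]
        exact mul_le_mul_of_nonneg_right (single_le_sum (fun β _ => hCV β)
          (mem_MIdxLt.2 (by omega))) hS0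
    refine (sum_le_card_nsmul _ _ _ fun i _ => hi i).trans (by simp)
  have hc2 : Continuous fun t =>
      (n : ℝ) * ((MIdxLt d m).card * (CP * (topDev N m w c t + Cv * S))) := by fun_prop
  refine (integral_mono_on_of_le_Ioo (by norm_num)
    ((continuous_sum_lowEn hw'.smooth m (isCompact_closedBall 0 1)).intervalIntegrable _ _)
    (hc2.intervalIntegrable _ _) hslice).trans_eq ?_
  rw [intervalIntegral.integral_const_mul, intervalIntegral.integral_const_mul,
    intervalIntegral.integral_const_mul, intervalIntegral.integral_add
      (hTc.intervalIntegrable _ _) (intervalIntegrable_const), ← hS]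
  simp
  ring

variable {R : ℝ} {X₀ : ℝ × EuclideanSpace ℝ (Fin d)}

/-- The parabolic scaling by `R` followed by the translation by `X₀`. -/
def parScale (m : ℕ) (X₀ : ℝ × E) (R : ℝ)
    (p : ℝ × E) : ℝ × E :=
  (X₀.1 + R ^ (2 * m) * p.1, X₀.2 + R • p.2)

theorem contDiff_parScale : ContDiff ℝ ∞ (parScale m X₀ R) :=
  (contDiff_const.add (contDiff_const.mul contDiff_fst)).prodMk
    (contDiff_const.add (contDiff_snd.const_smul R))

theorem map_parScale (hR : 0 < R) : MeasurableEmbedding (parScale m X₀ R) ∧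
    ∃ κ, 0 < κ ∧ Measure.map (parScale m X₀ R) volume = ofReal κ • volume := by
  obtain ⟨L, hL⟩ : ∃ L : (ℝ × E) ≃ₗ[ℝ] (ℝ × E), ∀ p, parScale m X₀ R p = X₀ + L p :=
    ⟨(LinearEquiv.smulOfNeZero ℝ ℝ (R ^ (2 * m)) (by positivity)).prodCongr
      (LinearEquiv.smulOfNeZero ℝ E R hR.ne'), fun p => rfl⟩
  have he : parScale m X₀ R = (fun p => X₀ + p) ∘ L := funext hL
  have hLm : MeasurableEmbedding L := L.toContinuousLinearEquiv.toHomeomorph.measurableEmbedding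
  have hdet : LinearMap.det (L : (ℝ × E) →ₗ[ℝ] (ℝ × E)) ≠ 0 := (LinearEquiv.isUnit_det' L).ne_zero
  rw [he]
  refine ⟨(measurableEmbedding_addLeft X₀).comp hLm, |(LinearMap.det (L : (ℝ × E) →ₗ[ℝ] (ℝ × E)))⁻¹|,
    by positivity, ?_⟩
  rw [← Measure.map_map (measurable_const_add X₀) hLm.measurable]
  have hvol : Measure.IsAddHaarMeasure (volume : Measure (ℝ × E)) :=
    inferInstanceAs (Measure.IsAddHaarMeasure ((volume : Measure ℝ).prod (volume : Measure E)))
  have : Measure.map L (volume : Measure (ℝ × E)) = _ :=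
    Measure.map_linearMap_addHaar_eq_smul_addHaar volume hdet
  rw [this, Measure.map_smul, (measurePreserving_add_left volume X₀).map_eq]

theorem parScale_preimage (hR : 0 < R) (r : ℝ) (hX : X₀.2 N = 0) :
    parScale m X₀ R ⁻¹' QCylP d m N (R * r) X₀ = QCylP d m N r 0 := by
  ext ⟨t, x⟩
  have h1 : dist (X₀.2 + R • x) X₀.2 = R * dist x 0 := by
    simp [dist_eq_norm, norm_smul, abs_of_pos hR]
  have h2 : X₀.1 - (R * r) ^ (2 * m) < X₀.1 + R ^ (2 * m) * t ↔ 0 - r ^ (2 * m) < t := by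
    rw [mul_pow, sub_lt_iff_lt_add, add_assoc, lt_add_iff_pos_right, ← mul_add,
      mul_pos_iff_of_pos_left (by positivity), sub_lt_iff_lt_add]
  have h3 : X₀.1 + R ^ (2 * m) * t < X₀.1 ↔ t < 0 := by
    rw [add_lt_iff_neg_left, ← mul_zero (R ^ (2 * m)), mul_lt_mul_iff_right₀ (by positivity), mul_zero]
  simp only [QCylP, QCyl, parScale, mem_preimage, mem_ofPred_eq, mem_prod, mem_Ioo, mem_ball, h1, h2,
    h3, mul_lt_mul_iff_right₀ hR]
  simp [hX, hR]

theorem Dmul_parScale {F : Type*} [NormedAddCommGroup F] [NormedSpace ℝ F] {u : ℝ × E → F}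
    (hu : ContDiff ℝ ∞ u) (L : F →L[ℝ] ℝ) (s : ℝ) (γ : Fin d → ℕ) (p : ℝ × E) :
    Dmul γ (fun p => s * L (u (parScale m X₀ R p))) p =
      s * R ^ (∑ i, γ i) * L (Dmul γ u (parScale m X₀ R p)) := by
  obtain ⟨t, x⟩ := p
  have h1 := L.contDiff.comp (contDiff_slice hu (X₀.1 + R ^ (2 * m) * t))
  have h2 := DD_comp_affine h1 X₀.2 R γ
  have h3 := DD_const_smul (f := fun x => L (u (X₀.1 + R ^ (2 * m) * t, X₀.2 + R • x)))
    (h1.comp (contDiff_const.add (contDiff_id.const_smul R))) s γ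
  have h4 := DD_clm_comp L (contDiff_slice hu (X₀.1 + R ^ (2 * m) * t)) γ
  rw [Dmul_apply]
  refine (congrFun h3 x).trans ?_
  have h5 := congrFun h2 x
  have h6 := congrFun h4 (X₀.2 + R • x)
  simp only [Function.comp_def, Pi.smul_apply, smul_eq_mul] at h5 ⊢
  rw [h5, h6, parScale, Dmul_apply, mul_assoc]

theorem measurableSet_QCylP (r : ℝ) : MeasurableSet (QCylP d m N r X₀) :=
  (isOpen_Ioo.prod isOpen_ball).measurableSet.inter
    (isOpen_lt continuous_const ((continuous_coord N).comp continuous_snd)).measurableSet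

theorem integrableOn_QCylP {F : Type*} [NormedAddCommGroup F] {f : ℝ × E → F} (hf : Continuous f)
    (r : ℝ) : IntegrableOn f (QCylP d m N r X₀) :=
  (hf.continuousOn.integrableOn_compact (isCompact_Icc.prod (isCompact_closedBall _ _))).mono_set
    fun _ hp => ⟨Ioo_subset_Icc_self hp.1.1, ball_subset_closedBall hp.1.2⟩

theorem isFiniteMeasure_QCylP (r : ℝ) : IsFiniteMeasure (volume.restrict (QCylP d m N r X₀)) := by
  simpa [IntegrableOn, integrable_const_iff] using
    integrableOn_QCylP (N := N) (m := m) (X₀ := X₀) (continuous_const (y := (1 : ℝ))) r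

theorem measureReal_QCylP_le {r : ℝ} (hr : 0 ≤ r) :
    volume.real (QCylP d m N r 0) ≤ r ^ (2 * m) * (r ^ d * volume.real (ball (0 : E) 1)) := by
  have : Nontrivial E := ⟨0, single N 1, fun h => by
    simpa using congrFun (congrArg WithLp.ofLp h) N⟩
  have h1 : QCylP d m N r (0 : ℝ × E) ⊆ Ioo (0 - r ^ (2 * m)) 0 ×ˢ ball 0 r := fun p hp => hp.1
  have h2 : volume.real (Ioo (0 - r ^ (2 * m)) 0 ×ˢ ball (0 : E) r) =
      r ^ (2 * m) * (r ^ d * volume.real (ball (0 : E) 1)) := by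
    rw [Measure.volume_eq_prod, measureReal_prod_prod, measureReal_def volume (ball 0 r),
      Measure.addHaar_ball _ _ hr]
    simp [ENNReal.toReal_mul, hr, measureReal_def]
  rw [← h2]
  refine measureReal_mono h1 ?_
  rw [Measure.volume_eq_prod, Measure.prod_prod]
  exact (ENNReal.mul_lt_top (by simp) measure_ball_lt_top).ne

theorem setIntegral_sub_average_le {f : ℝ × E → EuclideanSpace ℝ (Fin n)} (hf : Continuous f)
    (r : ℝ) (c : EuclideanSpace ℝ (Fin n)) :
    ∫ p in QCylP d m N r X₀, ‖f p - ⨍ q in QCylP d m N r X₀, f q‖ ^ 2 ≤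
      ∫ p in QCylP d m N r X₀, ‖f p - c‖ ^ 2 := by
  have hfin := isFiniteMeasure_QCylP (N := N) (m := m) (X₀ := X₀) r
  have h0 := integral_sub_average (volume.restrict (QCylP d m N r X₀)) f
  obtain ⟨a, ha⟩ : ∃ a, a = ⨍ q in QCylP d m N r X₀, f q := ⟨_, rfl⟩
  rw [← ha] at h0 ⊢
  have hc : Continuous fun p => f p - a := hf.sub continuous_const
  have i1 : Integrable (fun p => ‖f p - a‖ ^ 2) (volume.restrict (QCylP d m N r X₀)) :=
    integrableOn_QCylP (hc.norm.pow 2) r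
  have i2 : Integrable (fun p => 2 * inner ℝ (a - c) (f p - a))
      (volume.restrict (QCylP d m N r X₀)) :=
    integrableOn_QCylP (continuous_const.mul (continuous_const.inner hc)) r
  have h2 : ∫ p in QCylP d m N r X₀, 2 * inner ℝ (a - c) (f p - a) = 0 := by
    rw [integral_const_mul, integral_inner (integrableOn_QCylP hc r), h0, inner_zero_right, mul_zero]
  rw [← add_zero (∫ p in QCylP d m N r X₀, ‖f p - a‖ ^ 2), ← h2, ← integral_add i1 i2]
  refine integral_mono (i1.add i2)
    (integrableOn_QCylP ((hf.sub continuous_const).norm.pow 2) r) fun p => ?_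
  have h3 := norm_add_sq_real (f p - a) (a - c)
  rw [sub_add_sub_cancel, real_inner_comm] at h3
  simp only [h3]
  nlinarith [sq_nonneg ‖a - c‖]

theorem integral_topDev_eq {w : Fin n → ℝ × E → ℝ} (hw : ∀ i, ContDiff ℝ ∞ (w i))
    (c : (Fin d → ℕ) → Fin n → ℝ) : ∫ s in (-1 : ℝ)..0, topDev N m w c s =
      ∑ i, ∑ μ ∈ MIdx d (2 * m - 1), ∫ p in QCylP d m N 1 0, (Dmul μ (w i) p - c μ i) ^ 2 := by
  have : Nontrivial E := ⟨0, single N 1, fun h => by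
    simpa using congrFun (congrArg WithLp.ofLp h) N⟩
  have hc : ∀ i μ, Continuous fun p => (Dmul μ (w i) p - c μ i) ^ 2 := fun i μ =>
    ((contDiff_Dmul (hw i) μ).continuous.sub continuous_const).pow 2
  have hi : ∀ i μ, Continuous fun s => ∫ x in hBall N, (Dmul μ (w i) (s, x) - c μ i) ^ 2 :=
    fun i μ => continuous_integral_slice (isCompact_closedBall _ _) (hc i μ)
  have hQ : QCylP d m N 1 0 = Ioo (-1 : ℝ) 0 ×ˢ (HalfSp N ∩ ball (0 : E) 1) := by
    ext p
    simp only [QCylP, QCyl, HalfSp, mem_ofPred_eq, mem_prod, mem_inter_iff]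
    simp; tauto
  have hb : (HalfSp N ∩ ball (0 : E) 1 : Set E) =ᵐ[volume] hBall N := by
    refine (ae_eq_refl _).inter (ae_eq_of_subset_of_measure_ge ball_subset_closedBall ?_
      measurableSet_ball.nullMeasurableSet measure_closedBall_lt_top.ne)
    rw [Measure.addHaar_closedBall_eq_addHaar_ball]
  simp only [topDev]
  rw [intervalIntegral.integral_finsetSum fun i _ =>
    (continuous_finsetSum _ fun μ _ => hi i μ).intervalIntegrable _ _]
  refine sum_congr rfl fun i _ => ?_
  rw [intervalIntegral.integral_finsetSum fun μ _ => (hi i μ).intervalIntegrable _ _]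
  refine sum_congr rfl fun μ _ => ?_
  have := integrableOn_QCylP (N := N) (m := m) (X₀ := 0) (hc i μ) 1
  rw [hQ] at this ⊢
  rw [Measure.volume_eq_prod] at this ⊢
  rw [setIntegral_prod _ this, integral_of_le (by norm_num), integral_Ioc_eq_integral_Ioo]
  exact integral_congr_ae (of_forall fun t => (setIntegral_congr_set hb).symm)

theorem exists_oscillation_sq_le (hd : 1 ≤ d) (hm : 1 ≤ m) {lam K : ℝ} (hlam : 0 < lam) (hK : 0 ≤ K)
    {γ : ℝ} (hγ : γ ∈ Ioo (0 : ℝ) 1) {ρ : ℝ} (hρ : 0 < ρ) (hρd : d * ρ ≤ 1 / 4) :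
    ∃ C, 0 ≤ C ∧ ∀ A, IsCoeff d n m lam K A → ∀ w : Fin n → ℝ × E → ℝ, IsSol N m A w → ∀ c,
      ∀ μ ∈ MIdx d (2 * m - 1), ∀ r, 0 < r → r ≤ ρ → ∀ p ∈ QCylP d m N r 0,
      ∀ q ∈ QCylP d m N r 0, ∀ i, (Dmul μ (w i) p - Dmul μ (w i) q) ^ 2 ≤
        C * (∫ s in (-1 : ℝ)..0, topDev N m w c s) * r ^ (2 * γ) := by
  obtain ⟨C₁, hC₁, h₁⟩ := exists_stEn_sub_le (n := n) (N := N) (lam := lam) hm hK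
  have hN : ∀ μ : {μ // μ ∈ MIdx d (2 * m - 1)}, μ.1 N < 2 * m := fun μ => by
    have h1 := mem_MIdx.1 μ.2
    have := single_le_sum (f := μ.1) (fun _ _ => Nat.zero_le _) (Finset.mem_univ N)
    omega
  choose C hC h using fun μ => oscillation_le (n := n) hd hm hlam hK hγ hρ hρd μ.1 (hN μ)
  have hs : 0 ≤ ∑ μ, C μ ^ 2 := sum_nonneg fun μ _ => sq_nonneg _
  refine ⟨(∑ μ, C μ ^ 2) * C₁, by positivity, fun A hA w hw c μ hμ r hr hrρ p hp q hq i => ?_⟩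
  obtain ⟨P, hP, hPv, hPz, hle⟩ := h₁ A hA w hw c
  have h2 := h ⟨μ, hμ⟩ A hA _ (hw.sub_snd hP hPv hPz) r hr hrρ p hp q hq i
  rw [← Prod.mk.eta (p := p), ← Prod.mk.eta (p := q), Dmul_sub_snd (hw.smooth i) (hP i),
    Dmul_sub_snd (hw.smooth i) (hP i), eq_of_DD_eq_zero (hP i) hm (hPz i) (mem_MIdx.1 hμ) p.2 q.2,
    sub_sub_sub_cancel_right] at h2
  have h3 := stEn_nonneg (N := N) (k := m) zero_le_one (w := fun i p => w i p - P i p.2)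
  calc _ ≤ C ⟨μ, hμ⟩ ^ 2 * stEn N m 1 (fun i p => w i p - P i p.2) * r ^ (2 * γ) := by
        rw [← sq_abs]
        refine (pow_le_pow_left₀ (abs_nonneg _) h2 2).trans_eq ?_
        rw [mul_pow, mul_pow, sq_sqrt h3, ← rpow_natCast (r ^ γ), ← rpow_mul hr.le]
        norm_num [mul_comm]
    _ ≤ _ := by
        rw [mul_assoc (∑ μ, C μ ^ 2)]
        gcongr
        exact single_le_sum (f := fun μ => C μ ^ 2) (fun _ _ => sq_nonneg _)
          (Finset.mem_univ (⟨μ, hμ⟩ : {μ // μ ∈ MIdx d (2 * m - 1)}))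

theorem tder_parScale {F : Type*} [NormedAddCommGroup F] [NormedSpace ℝ F] {u : ℝ × E → F}
    (hu : ContDiff ℝ ∞ u) (L : F →L[ℝ] ℝ) (s : ℝ) (p : ℝ × E) :
    tder (fun p => s * L (u (parScale m X₀ R p))) p =
      s * R ^ (2 * m) * L (tder u (parScale m X₀ R p)) := by
  obtain ⟨t, x⟩ := p
  have h1 : HasDerivAt (fun t => X₀.1 + R ^ (2 * m) * t) (R ^ (2 * m)) t := by
    simpa using ((hasDerivAt_id t).const_mul (R ^ (2 * m))).const_add X₀.1
  have h2 := L.hasFDerivAt.comp_hasDerivAt t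
    ((hasDerivAt_tder hu (X₀.1 + R ^ (2 * m) * t) (X₀.2 + R • x)).scomp t h1)
  refine (h2.const_mul s).deriv.trans ?_
  simp [parScale, mul_assoc]

theorem isSol_parScale {A : (Fin d → ℕ) → (Fin d → ℕ) → ℝ → Fin n → Fin n → ℝ} (hR : 0 < R)
    (hX : X₀.2 N = 0) {u : ℝ × E → EuclideanSpace ℝ (Fin n)} (hu : ContDiff ℝ ∞ u)
    (heq : ∀ᵐ p ∂(volume.restrict (QCylP d m N (2 * R) X₀)), ∀ i,
        tder u p i + (-1 : ℝ) ^ m * ∑ α ∈ MIdx d m, ∑ β ∈ MIdx d m, ∑ j,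
          A α β p.1 i j * Dmul (α + β) u p j = 0)
    (hbd : ∀ q ∈ QCyl d m (2 * R) X₀, q.2 N = 0 → ∀ k < m, (pder N)^[k] u q = 0) (s : ℝ) :
    IsSol N m (fun α β t => A α β (X₀.1 + R ^ (2 * m) * t))
      fun i p => s * proj (𝕜 := ℝ) i (u (parScale m X₀ R p)) := by
  have hs : ∀ i : Fin n, ContDiff ℝ ∞ fun p : ℝ × E =>
      s * proj (𝕜 := ℝ) i (u (parScale m X₀ R p)) := fun i =>
    contDiff_const.mul ((proj (𝕜 := ℝ) i).contDiff.comp (hu.comp contDiff_parScale))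
  have hmem : ∀ t ∈ Ioo (-1 : ℝ) 0, ∀ x ∈ ball (0 : E) 1,
      parScale m X₀ R (t, x) ∈ QCyl d m (2 * R) X₀ := by
    intro t ht x hx
    have h1 : R ^ (2 * m) ≤ (2 * R) ^ (2 * m) := pow_le_pow_left₀ hR.le (by linarith) _
    have h2 : 0 < R ^ (2 * m) := by positivity
    refine ⟨⟨?_, ?_⟩, ?_⟩
    · simp only [parScale]; nlinarith [ht.1]
    · simp only [parScale]; nlinarith [ht.2]
    · rw [mem_ball_zero_iff] at hx
      simp only [parScale, mem_ball, dist_eq_norm, add_sub_cancel_left, norm_smul, norm_eq_abs,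
        abs_of_pos hR]
      nlinarith
  refine ⟨hs, ?_, fun t ht i => ?_⟩
  · obtain ⟨hΦ, κ, hκ, hmap⟩ := map_parScale (m := m) (X₀ := X₀) hR
    rw [ae_restrict_iff' (measurableSet_QCylP _)] at heq
    have h1 := ae_of_ae_map hΦ.measurable.aemeasurable
      (hmap ▸ Measure.ae_smul_measure heq (ofReal κ))
    rw [Measure.volume_eq_prod] at h1
    rw [ae_restrict_iff' measurableSet_Ioo]
    filter_upwards [Measure.ae_ae_of_ae_prod h1] with t ht htI x hx hxN i
    have hU : IsOpen (HalfSp N ∩ ball (0 : E) 1) := isOpen_halfSp.inter isOpen_ball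
    refine Measure.eqOn_open_of_ae_eq (μ := volume) (U := HalfSp N ∩ ball (0 : E) 1) (f := fun x =>
      tder (fun p => s * proj (𝕜 := ℝ) i (u (parScale m X₀ R p))) (t, x) + (-1) ^ m *
        ∑ α ∈ MIdx d m, ∑ β ∈ MIdx d m, ∑ j, A α β (X₀.1 + R ^ (2 * m) * t) i j * Dmul (α + β)
          (fun p => s * proj (𝕜 := ℝ) j (u (parScale m X₀ R p))) (t, x))
      (g := fun _ => 0) ?_ hU (Continuous.continuousOn ?_) continuousOn_const ⟨hxN, hx⟩
    · filter_upwards [ae_restrict_of_ae ht, ae_restrict_mem hU.measurableSet] with y hy hyU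
      have h2 := hy ⟨hmem t htI y hyU.2, by
        have : 0 < y N := hyU.1
        simpa [parScale, hX, hR] using this⟩ i
      rw [tder_parScale hu]
      have h3 : ∀ α ∈ MIdx d m, ∀ β ∈ MIdx d m, ∀ j, A α β (X₀.1 + R ^ (2 * m) * t) i j *
          Dmul (α + β) (fun p => s * proj (𝕜 := ℝ) j (u (parScale m X₀ R p))) (t, y) =
          s * R ^ (2 * m) * (A α β (parScale m X₀ R (t, y)).1 i j *
            Dmul (α + β) u (parScale m X₀ R (t, y)) j) := fun α hα β hβ j => by
        rw [Dmul_parScale hu, sum_congr rfl fun i _ => Pi.add_apply α β i,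
          sum_add_distrib, mem_MIdx.1 hα, mem_MIdx.1 hβ, ← two_mul]
        exact mul_left_comm _ _ _
      rw [sum_congr rfl fun α hα => sum_congr rfl fun β hβ =>
        sum_congr rfl fun j _ => h3 α hα β hβ j]
      simp only [← mul_sum]
      rw [mul_left_comm, ← mul_add]
      exact mul_eq_zero_of_right _ h2
    · exact (contDiff_slice (contDiff_tder (hs i)) t).continuous.add (continuous_const.mul
        (continuous_finsetSum _ fun α _ => continuous_finsetSum _ fun β _ =>
          continuous_finsetSum _ fun j _ => continuous_const.mul
            (contDiff_slice (contDiff_Dmul (hs j) _) t).continuous))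
  · refine vanishOn_of_normal isOpen_ball (contDiff_slice (hs i) t) fun k hk x hx hxN => ?_
    have h1 := hbd _ (hmem t ht x hx) (by simp [parScale, hX, hxN]) k hk
    rw [← DD_smul_single (contDiff_slice (hs i) t), ← Dmul_apply (k • Pi.single N 1) (fun p =>
      s * proj (𝕜 := ℝ) i (u (parScale m X₀ R p))), Dmul_parScale hu, parScale, Dmul_apply,
      DD_smul_single (contDiff_slice hu _), ← pder_iter_slice]
    exact mul_eq_zero_of_right _ ((congrArg _ h1).trans (map_zero _))

theorem setIntegral_parScale {R : ℝ} {X₀ : ℝ × E} (hR : 0 < R)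
    (hX : X₀.2 N = 0) : ∃ κ, 0 < κ ∧ ∀ r, ∀ f : ℝ × E → ℝ, ∫ p in QCylP d m N r X₀, f p =
      κ * ∫ p in QCylP d m N (r / R) 0, f (parScale m X₀ R p) := by
  obtain ⟨hΦ, κ, hκ, hmap⟩ := map_parScale (m := m) (X₀ := X₀) hR
  refine ⟨κ⁻¹, by positivity, fun r f => ?_⟩
  have := hΦ.setIntegral_map (μ := volume) f (QCylP d m N r X₀)
  rw [← parScale_preimage hR _ hX, mul_div_cancel₀ _ hR.ne', ← this, hmap, Measure.restrict_smul,
    integral_smul_measure, ENNReal.toReal_ofReal hκ.le, smul_eq_mul, inv_mul_cancel_left₀ hκ.ne']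

theorem setIntegral_sub_average_mono {R r : ℝ} {X₀ : ℝ × E} (hr : 0 ≤ r)
    (hrR : r ≤ R) {f : ℝ × E → EuclideanSpace ℝ (Fin n)} (hf : Continuous f) :
    ∫ p in QCylP d m N r X₀, ‖f p - ⨍ q in QCylP d m N r X₀, f q‖ ^ 2 ≤
      ∫ p in QCylP d m N R X₀, ‖f p - ⨍ q in QCylP d m N R X₀, f q‖ ^ 2 := by
  refine (setIntegral_sub_average_le hf r _).trans (setIntegral_mono_set
    (integrableOn_QCylP ((hf.sub continuous_const).norm.pow 2) R)
    (of_forall fun _ => sq_nonneg _) (LE.le.eventuallyLE ?_))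
  rintro p ⟨⟨h1, h2⟩, h3⟩
  have := pow_le_pow_left₀ hr hrR (2 * m)
  exact ⟨⟨⟨by linarith [h1.1], h1.2⟩, ball_subset_ball hrR h2⟩, h3⟩

theorem exists_small_radius_bound (hd : 1 ≤ d) (hm : 1 ≤ m) {lam K : ℝ} (hlam : 0 < lam)
    (hK : 0 ≤ K) {γ : ℝ} (hγ : γ ∈ Ioo (0 : ℝ) 1) {ρ : ℝ} (hρ : 0 < ρ) (hρd : d * ρ ≤ 1 / 4) :
    ∃ C, 0 ≤ C ∧ ∀ A, IsCoeff d n m lam K A → ∀ R : ℝ, 0 < R → ∀ X₀ : ℝ × E, X₀.2 N = 0 →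
      ∀ u : ℝ × E → EuclideanSpace ℝ (Fin n), ContDiff ℝ ∞ u →
      (∀ᵐ p ∂(volume.restrict (QCylP d m N (2 * R) X₀)), ∀ i,
        tder u p i + (-1 : ℝ) ^ m * ∑ α ∈ MIdx d m, ∑ β ∈ MIdx d m, ∑ j,
          A α β p.1 i j * Dmul (α + β) u p j = 0) →
      (∀ q ∈ QCyl d m (2 * R) X₀, q.2 N = 0 → ∀ k < m, (pder N)^[k] u q = 0) →
      ∀ r, 0 < r → r / R ≤ ρ → ∀ μ ∈ MIdx d (2 * m - 1),
        ∫ p in QCylP d m N r X₀, ‖Dmul μ u p - ⨍ q in QCylP d m N r X₀, Dmul μ u q‖ ^ 2 ≤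
          C * (r / R) ^ (2 * γ + d + 2 * m) * ∑ ν ∈ MIdx d (2 * m - 1),
            ∫ p in QCylP d m N R X₀, ‖Dmul ν u p - ⨍ q in QCylP d m N R X₀, Dmul ν u q‖ ^ 2 := by
  obtain ⟨C, hC, h⟩ := exists_oscillation_sq_le (n := n) (N := N) hd hm hlam hK hγ hρ hρd
  refine ⟨n * C * volume.real (ball (0 : E) 1), by positivity,
    fun A hA R hR X₀ hX u hu heq hbd r hr hrρ μ hμ => ?_⟩
  obtain ⟨κ, hκ, hint⟩ := setIntegral_parScale (m := m) hR hX
  obtain ⟨b, hb⟩ : ∃ b, b = volume.real (ball (0 : E) 1) := ⟨_, rfl⟩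
  obtain ⟨w, hw⟩ : ∃ w : Fin n → ℝ × E → ℝ, w = fun i p => (R ^ (2 * m - 1))⁻¹ *
    proj (𝕜 := ℝ) i (u (parScale m X₀ R p)) := ⟨_, rfl⟩
  have hsol := isSol_parScale hR hX hu heq hbd (R ^ (2 * m - 1))⁻¹
  rw [← hw] at hsol
  have hD : ∀ ν ∈ MIdx d (2 * m - 1), ∀ i p, Dmul ν (w i) p = Dmul ν u (parScale m X₀ R p) i := by
    intro ν hν i p
    rw [hw, Dmul_parScale hu, mem_MIdx.1 hν, inv_mul_cancel₀ (by positivity), one_mul]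
    rfl
  obtain ⟨c, hc⟩ : ∃ c : (Fin d → ℕ) → Fin n → ℝ,
    c = fun ν i => (⨍ q in QCylP d m N R X₀, Dmul ν u q) i := ⟨_, rfl⟩
  obtain ⟨S, hS⟩ : ∃ S, S = ∫ s in (-1 : ℝ)..0, topDev N m w c s := ⟨_, rfl⟩
  have hcont : ∀ ν, Continuous (Dmul ν u) := fun ν => (contDiff_Dmul hu ν).continuous
  have hcp : Continuous (parScale (d := d) m X₀ R) := contDiff_parScale.continuous
  have hSe : ∑ ν ∈ MIdx d (2 * m - 1), ∫ p in QCylP d m N R X₀,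
      ‖Dmul ν u p - ⨍ q in QCylP d m N R X₀, Dmul ν u q‖ ^ 2 = κ * S := by
    rw [hS, integral_topDev_eq hsol.smooth, sum_comm, mul_sum]
    refine sum_congr rfl fun ν hν => ?_
    rw [hint, div_self hR.ne']
    simp only [hD ν hν, hc, EuclideanSpace.real_norm_sq_eq, PiLp.sub_apply]
    rw [integral_finsetSum]
    intro i _
    exact integrableOn_QCylP ((((proj (𝕜 := ℝ) i).continuous.comp
      ((hcont ν).comp hcp)).sub continuous_const).pow 2) 1
  have hr' : 0 < r / R := by positivity
  have hS0 : 0 ≤ S := by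
    rw [hS]; exact intervalIntegral.integral_nonneg (by norm_num) fun t _ => topDev_nonneg t
  have hpt : ∀ p ∈ QCylP d m N (r / R) 0, ∀ q ∈ QCylP d m N (r / R) 0,
      ‖Dmul μ u (parScale m X₀ R p) - Dmul μ u (parScale m X₀ R q)‖ ^ 2 ≤
        n * (C * S * (r / R) ^ (2 * γ)) := by
    intro p hp q hq
    rw [EuclideanSpace.real_norm_sq_eq]
    refine (sum_le_card_nsmul _ _ (C * S * (r / R) ^ (2 * γ)) fun i _ => ?_).trans (by simp)
    have := h (fun α β t => A α β (X₀.1 + R ^ (2 * m) * t)) ⟨fun α β i j => (hA.meas α β i j).comp (by fun_prop), fun α β t => hA.bound α β _,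
      fun t => hA.ellip _⟩ w hsol c μ hμ _ hr' hrρ p hp q hq i
    rwa [hD μ hμ, hD μ hμ, ← hS] at this
  have hpow : (r / R) ^ (2 * γ + d + 2 * m) =
      (r / R) ^ (2 * γ) * ((r / R) ^ (2 * m) * (r / R) ^ d) := by
    rw [Real.rpow_add hr', Real.rpow_add hr', rpow_natCast, mul_assoc,
      mul_comm ((r / R) ^ d), ← rpow_natCast (r / R) (2 * m)]
    norm_num
  have hle : ∃ v, ∫ p in QCylP d m N (r / R) 0, ‖Dmul μ u (parScale m X₀ R p) - v‖ ^ 2 ≤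
      n * (C * S * (r / R) ^ (2 * γ)) * ((r / R) ^ (2 * m) * ((r / R) ^ d * b)) := by
    have hb0 : 0 ≤ b := hb ▸ measureReal_nonneg
    rcases (QCylP d m N (r / R) 0).eq_empty_or_nonempty with h0 | ⟨q, hq⟩
    · exact ⟨0, by rw [h0, setIntegral_empty]; positivity⟩
    · have hfin := isFiniteMeasure_QCylP (N := N) (m := m) (X₀ := 0) (r / R)
      refine ⟨Dmul μ u (parScale m X₀ R q), (setIntegral_mono_on (integrableOn_QCylP
        ((((hcont μ).comp hcp).sub continuous_const).norm.pow 2) _) (integrable_const _)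
        (measurableSet_QCylP _) fun p hp => hpt p hp q hq).trans ?_⟩
      rw [setIntegral_const, smul_eq_mul, mul_comm, hb]
      exact mul_le_mul_of_nonneg_left (measureReal_QCylP_le hr'.le) (by positivity)
  obtain ⟨v, hv⟩ := hle
  refine (setIntegral_sub_average_le (hcont μ) r v).trans ?_
  rw [hint, hSe, hpow, ← hb]
  exact (mul_le_mul_of_nonneg_left hv hκ.le).trans_eq (by ring)

end BoundaryDecay

end

/-- Boundary oscillation decay estimate (Lemma 6.2) for the `(2m-1)`-th
order derivatives of solutions of the homogeneous Dirichlet problem with simple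
coefficients in half cylinders. -/
theorem statement_16 (d n m : ℕ) (hd : 1 ≤ d) (hn : 1 ≤ n) (hm : 1 ≤ m)
    (iN : Fin d) (hiN : (iN : ℕ) = d - 1)
    (K lam g0 : ℝ) (hK : 0 ≤ K) (hlam : 0 < lam) (hg0 : g0 ∈ Set.Ioo (0 : ℝ) 1) :
    ∃ C : ℝ, 0 < C ∧
      ∀ A : (Fin d → ℕ) → (Fin d → ℕ) → ℝ → Fin n → Fin n → ℝ,
      (∀ α β i j, Measurable fun t => A α β t i j) →
      (∀ α β t i j, |A α β t i j| ≤ K) →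
      (∀ t : ℝ, LegHad d n m lam (fun α β => A α β t)) →
      ∀ R : ℝ, 0 < R →
      ∀ X₀ : ℝ × EuclideanSpace ℝ (Fin d), X₀.2 iN = 0 →
      ∀ u : ℝ × EuclideanSpace ℝ (Fin d) → EuclideanSpace ℝ (Fin n),
      ContDiff ℝ (⊤ : ℕ∞) u →
      (∀ᵐ p ∂(volume.restrict (QCylP d m iN (2 * R) X₀)), ∀ i,
        tder u p i + (-1 : ℝ) ^ m * ∑ α ∈ MIdx d m, ∑ β ∈ MIdx d m, ∑ j,
          A α β p.1 i j * Dmul (α + β) u p j = 0) →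
      (∀ q ∈ QCyl d m (2 * R) X₀, q.2 iN = 0 → ∀ k < m, (pder iN)^[k] u q = 0) →
      ∀ r : ℝ, 0 < r → r ≤ R →
        (∑ γ ∈ MIdx d (2 * m - 1), ∫ p in QCylP d m iN r X₀,
            ‖Dmul γ u p - ⨍ q in QCylP d m iN r X₀, Dmul γ u q‖ ^ 2) ≤
          C * (r / R) ^ (2 * g0 + (d : ℝ) + 2 * m) *
            (∑ γ ∈ MIdx d (2 * m - 1), ∫ p in QCylP d m iN R X₀,
              ‖Dmul γ u p - ⨍ q in QCylP d m iN R X₀, Dmul γ u q‖ ^ 2) := by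
  have hd0 : (0 : ℝ) < d := by exact_mod_cast hd
  obtain ⟨ρ, hρe⟩ : ∃ ρ : ℝ, ρ = 1 / (4 * d) := ⟨_, rfl⟩
  have hρ : 0 < ρ := by rw [hρe]; positivity
  have hρd : d * ρ ≤ 1 / 4 := by rw [hρe]; exact le_of_eq (by field_simp)
  obtain ⟨C, hC, h⟩ := exists_small_radius_bound (n := n) (N := iN) hd hm hlam hK hg0 hρ hρd
  obtain ⟨κ, hκ⟩ : ∃ κ : ℝ, κ = 2 * g0 + (d : ℝ) + 2 * m := ⟨_, rfl⟩
  have hκ0 : 0 ≤ κ := by rw [hκ]; have := hg0.1; positivity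
  refine ⟨(MIdx d (2 * m - 1)).card * C + (ρ ^ κ)⁻¹, by positivity,
    fun A hAm hAb hAe R hR X₀ hX u hu heq hbd r hr hrR => ?_⟩
  have hI : 0 ≤ ∑ γ ∈ MIdx d (2 * m - 1), ∫ p in QCylP d m iN R X₀,
      ‖Dmul γ u p - ⨍ q in QCylP d m iN R X₀, Dmul γ u q‖ ^ 2 :=
    Finset.sum_nonneg fun _ _ => integral_nonneg fun _ => sq_nonneg _
  rw [← hκ]
  have hk : 0 ≤ (r / R) ^ κ := by positivity
  by_cases hrρ : r / R ≤ ρ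
  · refine (Finset.sum_le_card_nsmul _ _ _
      (h A ⟨hAm, hAb, hAe⟩ R hR X₀ hX u hu heq hbd r hr hrρ)).trans ?_
    rw [nsmul_eq_mul, ← hκ, ← mul_assoc, ← mul_assoc]
    gcongr
    exact le_add_of_nonneg_right (by positivity)
  · refine (Finset.sum_le_sum fun γ _ => setIntegral_sub_average_mono hr.le hrR
      (contDiff_Dmul hu γ).continuous).trans (le_mul_of_one_le_left hI ?_)
    have h1 : ρ ^ κ ≤ (r / R) ^ κ := Real.rpow_le_rpow hρ.le (not_le.1 hrρ).le hκ0
    have h2 : (ρ ^ κ)⁻¹ * ρ ^ κ = 1 := inv_mul_cancel₀ (by positivity)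
    have h3 : 0 ≤ (MIdx d (2 * m - 1)).card * C * (r / R) ^ κ := by positivity
    have h4 := mul_le_mul_of_nonneg_left h1 (inv_nonneg.2 (by positivity : 0 ≤ ρ ^ κ))
    linarith [add_mul ((MIdx d (2 * m - 1)).card * C) (ρ ^ κ)⁻¹ ((r / R) ^ κ)]
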